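/- Let θ>0, α := 2/(2+θ), T>0, and let R_α, φ be as in the context. Let a<b and let m_T : ℝ → [0,∞) be a probability density supported in [a,b] such that m_T^θ is differentiable on (a,b) with σ-Hölder continuous derivative for some σ ∈ (0,1], and such that for some C₀>1: C₀^{−1} min(x−a, b−x)^{1/θ} ≤ m_T(x) ≤ C₀ min(x−a, b−x)^{1/θ} for all x ∈ [a,b]. Then there exists a solution (u,m) of the planning problem (in the sense of the definition in the context) such that the rescaled densities converge to the self-similar profile: for every g ∈ L¹(ℝ), lim_{t→0⁺} ∫_ℝ t^{α} m(t, t^{α} x) g(x) dx = ∫_ℝ φ(x) g(x) dx, i.e. x ↦ t^{α} m(t, t^{α} x) converges to φ in the L^∞ weak-* sense as t→0⁺. -/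

import Mathlib

open MeasureTheory Set Filter Topology

/-- A solution of the mean field planning problem with horizon `T`, terminal density
`mT`, initial condition the Dirac mass at `0`, coupling exponent `θ`. -/
def IsPlanningSolution (θ T : ℝ) (mT : ℝ → ℝ)
    (u : ℝ → ℝ → ℝ) (m : ℝ → ProbabilityMeasure ℝ) (md : ℝ → ℝ → ℝ) : Prop :=
  ContDiffOn ℝ 1 (fun p : ℝ × ℝ => u p.1 p.2) (Ioo 0 T ×ˢ univ) ∧
  ContinuousOn m (Icc 0 T) ∧
  ContinuousOn (fun p : ℝ × ℝ => md p.1 p.2) (Ioo 0 T ×ˢ univ) ∧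
  (∀ t ∈ Ioo 0 T, ∀ x : ℝ, 0 ≤ md t x) ∧
  (∀ t ∈ Ioo 0 T,
    (m t : Measure ℝ) = volume.withDensity (fun x => ENNReal.ofReal (md t x))) ∧
  (∀ t ∈ Ioo 0 T, ∀ x : ℝ,
    -(deriv (fun s => u s x) t) + (1/2) * (deriv (fun y => u t y) x)^2
      = (md t x) ^ θ) ∧
  (∀ ψ : ℝ × ℝ → ℝ, ContDiff ℝ (⊤ : ℕ∞) ψ → HasCompactSupport ψ →
    tsupport ψ ⊆ Ioo 0 T ×ˢ univ →
    (∫ t in Ioo 0 T, ∫ x : ℝ,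
      md t x * (deriv (fun s => ψ (s, x)) t
        - deriv (fun y => u t y) x * deriv (fun y => ψ (t, y)) x)) = 0) ∧
  (m 0 : Measure ℝ) = Measure.dirac 0 ∧
  (m T : Measure ℝ) = volume.withDensity (fun x => ENNReal.ofReal (mT x))

namespace MFPlanning

/-! ### Monotone systems of scalar equations -/

theorem exists_solution_of_monotone_system {ι : Type*} (lo hi : ι → ℝ) (hlh : lo ≤ hi)
    (Φ : ι → ℝ → (ι → ℝ) → ℝ)
    (hcont : ∀ x, ∀ w ∈ Icc lo hi, ContinuousOn (fun y => Φ x y w) (Icc (lo x) (hi x)))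
    (hanti : ∀ x y, ∀ w ∈ Icc lo hi, ∀ w' ∈ Icc lo hi, w ≤ w' → Φ x y w' ≤ Φ x y w)
    (hlo : ∀ x, Φ x (lo x) lo ≤ 0) (hhi : ∀ x, 0 ≤ Φ x (hi x) hi) :
    ∃ w ∈ Icc lo hi, ∀ x, Φ x (w x) w = 0 := by
  classical
  have hloI : lo ∈ Icc lo hi := ⟨le_rfl, hlh⟩
  have hhiI : hi ∈ Icc lo hi := ⟨hlh, le_rfl⟩
  set A : (ι → ℝ) → ι → Set ℝ := fun w x => {y | y ∈ Icc (lo x) (hi x) ∧ Φ x y w ≤ 0} with hA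
  set F : (ι → ℝ) → ι → ℝ := fun w x => sSup (A w x) with hF
  have hbdd : ∀ w x, BddAbove (A w x) := fun w x => ⟨hi x, fun y hy => hy.1.2⟩
  have hmem_lo : ∀ w ∈ Icc lo hi, ∀ x, lo x ∈ A w x := fun w hw x =>
    ⟨⟨le_rfl, hlh x⟩, (hanti x (lo x) lo hloI w hw hw.1).trans (hlo x)⟩
  have hFI : ∀ w ∈ Icc lo hi, F w ∈ Icc lo hi := by
    intro w hw
    refine ⟨fun x => le_csSup (hbdd w x) (hmem_lo w hw x), fun x => ?_⟩
    exact csSup_le ⟨_, hmem_lo w hw x⟩ fun y hy => hy.1.2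
  have hFmono : ∀ w ∈ Icc lo hi, ∀ w' ∈ Icc lo hi, w ≤ w' → F w ≤ F w' := by
    intro w hw w' hw' hww' x
    refine csSup_le_csSup (hbdd w' x) ⟨_, hmem_lo w hw x⟩ fun y hy => ⟨hy.1, ?_⟩
    exact (hanti x y w hw w' hw' hww').trans hy.2
  have hFzero : ∀ w ∈ Icc lo hi, ∀ x, Φ x (F w x) w = 0 := by
    intro w hw x
    have hclosed : IsClosed (A w x) := by
      have := (hcont x w hw).preimage_isClosed_of_isClosed isClosed_Icc (isClosed_Iic (a := (0 : ℝ)))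
      exact this
    have hmem : F w x ∈ A w x := hclosed.csSup_mem ⟨_, hmem_lo w hw x⟩ (hbdd w x)
    refine le_antisymm hmem.2 ?_
    by_contra! hneg
    have hhi' : 0 ≤ Φ x (hi x) w := (hhi x).trans (hanti x (hi x) w hw hi hhiI hw.2)
    have hsub : Icc (F w x) (hi x) ⊆ Icc (lo x) (hi x) := Icc_subset_Icc_left hmem.1.1
    have hivt := intermediate_value_Icc hmem.1.2 ((hcont x w hw).mono hsub)
    obtain ⟨y, hy, hy0⟩ := hivt ⟨hneg.le, hhi'⟩
    have hyA : y ∈ A w x := ⟨hsub hy, le_of_eq hy0⟩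
    have : y = F w x := le_antisymm (le_csSup (hbdd w x) hyA) hy.1
    rw [this] at hy0
    linarith
  set D : Set (ι → ℝ) := {w | w ∈ Icc lo hi ∧ w ≤ F w} with hD
  have hloD : lo ∈ D := ⟨hloI, (hFI lo hloI).1⟩
  set W : ι → ℝ := fun x => sSup ((fun w : ι → ℝ => w x) '' D) with hW
  have hbW : ∀ x, BddAbove ((fun w : ι → ℝ => w x) '' D) := by
    rintro x
    refine ⟨hi x, ?_⟩
    rintro _ ⟨w, hw, rfl⟩
    exact hw.1.2 x
  have hleW : ∀ w ∈ D, w ≤ W := fun w hw x => le_csSup (hbW x) ⟨w, hw, rfl⟩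
  have hWI : W ∈ Icc lo hi := by
    refine ⟨hleW lo hloD, fun x => csSup_le ⟨_, lo, hloD, rfl⟩ ?_⟩
    rintro _ ⟨w, hw, rfl⟩
    exact hw.1.2 x
  have hWF : W ≤ F W := by
    intro x
    refine csSup_le ⟨_, lo, hloD, rfl⟩ ?_
    rintro _ ⟨w, hw, rfl⟩
    exact (hw.2 x).trans (hFmono w hw.1 W hWI (hleW w hw) x)
  have hFW : F W ≤ W := hleW _ ⟨hFI W hWI, hFmono W hWI _ (hFI W hWI) hWF⟩
  have hfix : F W = W := le_antisymm hFW hWF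
  refine ⟨W, hWI, fun x => ?_⟩
  have := hFzero W hWI x
  rwa [hfix] at this

/-! ### Difference quotients of negative powers -/

/-- The opposite of the slope of `x ↦ x ^ (-e)`. -/
noncomputable def negSlope (e x y : ℝ) : ℝ :=
  if x = y then e * x ^ (-e - 1) else (y ^ (-e) - x ^ (-e)) / (x - y)

theorem negSlope_mul (e x y : ℝ) : negSlope e x y * (x - y) = y ^ (-e) - x ^ (-e) := by
  unfold negSlope
  split_ifs with h
  · simp [h]
  · rw [div_mul_cancel₀ _ (sub_ne_zero.mpr h)]

theorem exists_negSlope_eq {e x y : ℝ} (hx : 0 < x) (hy : 0 < y) :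
    ∃ z ∈ Icc (min x y) (max x y), negSlope e x y = e * z ^ (-e - 1) := by
  have key : ∀ {x y : ℝ}, 0 < x → x < y →
      ∃ z ∈ Icc x y, (y ^ (-e) - x ^ (-e)) / (x - y) = e * z ^ (-e - 1) := by
    intro x y hx hxy
    obtain ⟨z, hz, hz'⟩ := exists_hasDerivAt_eq_slope (fun s : ℝ => s ^ (-e))
      (fun s : ℝ => -e * s ^ (-e - 1)) hxy
      (fun s hs => (Real.continuousAt_rpow_const _ _ (Or.inl (hx.trans_le hs.1).ne')).continuousWithinAt)
      (fun s hs => Real.hasDerivAt_rpow_const (Or.inl (hx.trans hs.1).ne'))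
    refine ⟨z, ⟨hz.1.le, hz.2.le⟩, ?_⟩
    have h1 : x - y ≠ 0 := by linarith
    have h2 : y - x ≠ 0 := by linarith
    rw [eq_div_iff h2] at hz'
    rw [div_eq_iff h1]
    linarith
  unfold negSlope
  rcases lt_trichotomy x y with h | h | h
  · obtain ⟨z, hz, hz'⟩ := key hx h
    refine ⟨z, by rwa [min_eq_left h.le, max_eq_right h.le], ?_⟩
    rw [if_neg h.ne, hz']
  · exact ⟨x, by simp [h], by simp [h]⟩
  · obtain ⟨z, hz, hz'⟩ := key hy h
    refine ⟨z, by rwa [min_eq_right h.le, max_eq_left h.le], ?_⟩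
    rw [if_neg h.ne', ← hz', ← neg_div_neg_eq]
    congr 1 <;> ring

theorem negSlope_bounds {e x y lo hi : ℝ} (he : 0 < e) (hlo : 0 < lo) (hx : x ∈ Icc lo hi)
    (hy : y ∈ Icc lo hi) :
    e * hi ^ (-e - 1) ≤ negSlope e x y ∧ negSlope e x y ≤ e * lo ^ (-e - 1) := by
  obtain ⟨z, hz, hz'⟩ := exists_negSlope_eq (e := e) (hlo.trans_le hx.1) (hlo.trans_le hy.1)
  have h1 : lo ≤ z := (le_min hx.1 hy.1).trans hz.1
  have h2 : z ≤ hi := hz.2.trans (max_le hx.2 hy.2)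
  rw [hz']
  constructor
  · exact mul_le_mul_of_nonneg_left
      (Real.rpow_le_rpow_of_nonpos (hlo.trans_le h1) h2 (by linarith)) he.le
  · exact mul_le_mul_of_nonneg_left
      (Real.rpow_le_rpow_of_nonpos hlo h1 (by linarith)) he.le

theorem negSlope_pos {e x y : ℝ} (he : 0 < e) (hx : 0 < x) (hy : 0 < y) : 0 < negSlope e x y := by
  obtain ⟨z, hz, hz'⟩ := exists_negSlope_eq (e := e) hx hy
  rw [hz']
  have : 0 < z := (lt_min hx hy).trans_le hz.1
  positivity

/-! ### Discrete elliptic equations on rectangles -/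

/-- At each node strictly inside `[0, M₁] × [0, M₂]`, the value of `g` is an average with
positive weights of the values at the four neighbours. -/
def IsMeanOn (M₁ M₂ : ℕ) (g : ℕ → ℕ → ℝ) : Prop :=
  ∀ i j, i + 2 ≤ M₁ → j + 2 ≤ M₂ → ∃ w₁ w₂ w₃ w₄ : ℝ, 0 < w₁ ∧ 0 < w₂ ∧ 0 < w₃ ∧ 0 < w₄ ∧
    w₁ * (g (i + 2) (j + 1) - g (i + 1) (j + 1)) - w₂ * (g (i + 1) (j + 1) - g i (j + 1)) +
    (w₃ * (g (i + 1) (j + 2) - g (i + 1) (j + 1)) - w₄ * (g (i + 1) (j + 1) - g (i + 1) j)) = 0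

theorem IsMeanOn.neg {M₁ M₂ : ℕ} {g : ℕ → ℕ → ℝ} (hg : IsMeanOn M₁ M₂ g) :
    IsMeanOn M₁ M₂ (fun i j => - g i j) := by
  intro i j hi hj
  obtain ⟨w₁, w₂, w₃, w₄, h₁, h₂, h₃, h₄, h⟩ := hg i j hi hj
  exact ⟨w₁, w₂, w₃, w₄, h₁, h₂, h₃, h₄, by linarith⟩

theorem IsMeanOn.shift {M₁ M₂ : ℕ} {g : ℕ → ℕ → ℝ} (hg : IsMeanOn M₁ M₂ g) (x y N₁ N₂ : ℕ)
    (h₁ : x + N₁ ≤ M₁) (h₂ : y + N₂ ≤ M₂) :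
    IsMeanOn N₁ N₂ (fun i j => g (x + i) (y + j)) := by
  intro i j hi hj
  exact hg (x + i) (y + j) (by omega) (by omega)

theorem IsMeanOn.le_of_boundary {M₁ M₂ : ℕ} {g : ℕ → ℕ → ℝ} (hg : IsMeanOn M₁ M₂ g) {K : ℝ}
    (hK : ∀ i j, i ≤ M₁ → j ≤ M₂ → (i = 0 ∨ i = M₁ ∨ j = 0 ∨ j = M₂) → g i j ≤ K) :
    ∀ i j, i ≤ M₁ → j ≤ M₂ → g i j ≤ K := by
  classical
  set s : Finset (ℕ × ℕ) := Finset.range (M₁ + 1) ×ˢ Finset.range (M₂ + 1) with hs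
  have hsm : ∀ i j, (i, j) ∈ s ↔ i ≤ M₁ ∧ j ≤ M₂ := by
    intro i j; simp [hs]
  obtain ⟨q, hq, hqmax⟩ := s.exists_max_image (fun q => g q.1 q.2) ⟨(0, 0), (hsm 0 0).2 (by simp)⟩
  set G := g q.1 q.2 with hG
  have hex : ∃ i, ∃ j, i ≤ M₁ ∧ j ≤ M₂ ∧ g i j = G :=
    ⟨q.1, q.2, ((hsm _ _).1 hq).1, ((hsm _ _).1 hq).2, rfl⟩
  obtain ⟨j, hi, hj, hij⟩ := Nat.find_spec hex
  have hmin := fun i' h => Nat.find_min hex (m := i') h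
  set i := Nat.find hex
  have hle : ∀ i j, i ≤ M₁ → j ≤ M₂ → g i j ≤ G := fun i j h h' =>
    hqmax (i, j) ((hsm i j).2 ⟨h, h'⟩)
  have hGK : G ≤ K := by
    by_cases hb : i = 0 ∨ i = M₁ ∨ j = 0 ∨ j = M₂
    · rw [← hij]; exact hK i j hi hj hb
    · exfalso
      push Not at hb
      obtain ⟨i', rfl'⟩ : ∃ i', i = i' + 1 := ⟨i - 1, by omega⟩
      obtain ⟨j', rfl⟩ : ∃ j', j = j' + 1 := ⟨j - 1, by omega⟩
      rw [rfl'] at hij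
      obtain ⟨w₁, w₂, w₃, w₄, h₁, h₂, h₃, h₄, h⟩ := hg i' j' (by omega) (by omega)
      have e₁ := hle (i' + 2) (j' + 1) (by omega) (by omega)
      have e₂ := hle i' (j' + 1) (by omega) (by omega)
      have e₃ := hle (i' + 1) (j' + 2) (by omega) (by omega)
      have e₄ := hle (i' + 1) j' (by omega) (by omega)
      rw [hij] at h
      have k₁ := mul_nonneg h₁.le (sub_nonneg.2 e₁)
      have k₃ := mul_nonneg h₃.le (sub_nonneg.2 e₃)
      have k₄ := mul_nonneg h₄.le (sub_nonneg.2 e₄)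
      have : w₂ * (G - g i' (j' + 1)) ≤ 0 := by linarith
      have : G - g i' (j' + 1) ≤ 0 := by
        by_contra! hc
        exact absurd this (not_le.2 (mul_pos h₂ hc))
      exact hmin i' (by omega) ⟨j' + 1, by omega, by omega, le_antisymm e₂ (by linarith)⟩
  exact fun i j h h' => (hle i j h h').trans hGK

/-! ### Oscillation on squares and Dirichlet energy -/

/-- Dirichlet energy of `g` over the edges issued from `[0, n₁) × [0, n₂)`. -/
noncomputable def edgeEnergy (n₁ n₂ : ℕ) (g : ℕ → ℕ → ℝ) : ℝ :=
  ∑ i ∈ Finset.range n₁, ∑ j ∈ Finset.range n₂,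
    ((g (i + 1) j - g i j) ^ 2 + (g i (j + 1) - g i j) ^ 2)

theorem abs_sub_le_sum_range (f : ℕ → ℝ) {i n : ℕ} (hi : i ≤ n) :
    |f i - f 0| ≤ ∑ k ∈ Finset.range n, |f (k + 1) - f k| := by
  calc |f i - f 0| = |∑ k ∈ Finset.range i, (f (k + 1) - f k)| := by rw [Finset.sum_range_sub]
    _ ≤ ∑ k ∈ Finset.range i, |f (k + 1) - f k| := Finset.abs_sum_le_sum_abs _ _
    _ ≤ _ := Finset.sum_le_sum_of_subset_of_nonneg (by simpa using hi) (fun _ _ _ => abs_nonneg _)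

/-- Sum of the squares of the increments of `g` along the four sides of `[0, n]²`. -/
noncomputable def ringEnergy (n : ℕ) (g : ℕ → ℕ → ℝ) : ℝ :=
  ∑ k ∈ Finset.range n, ((g (k + 1) 0 - g k 0) ^ 2 + (g (k + 1) n - g k n) ^ 2 +
    ((g 0 (k + 1) - g 0 k) ^ 2 + (g n (k + 1) - g n k) ^ 2))

theorem IsMeanOn.sq_osc_le {n : ℕ} {g : ℕ → ℕ → ℝ} (hg : IsMeanOn n n g) {i j i' j' : ℕ}
    (hi : i ≤ n) (hj : j ≤ n) (hi' : i' ≤ n) (hj' : j' ≤ n) :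
    (g i j - g i' j') ^ 2 ≤ 16 * n * ringEnergy n g := by
  set t : ℕ → ℝ := fun k => |g (k + 1) 0 - g k 0| + |g (k + 1) n - g k n| +
    (|g 0 (k + 1) - g 0 k| + |g n (k + 1) - g n k|) with ht
  set V := ∑ k ∈ Finset.range n, t k with hV
  have hbd : ∀ i j, i ≤ n → j ≤ n → (i = 0 ∨ i = n ∨ j = 0 ∨ j = n) → |g i j - g 0 0| ≤ V := by
    intro i j hi hj hij
    have s₁ := fun i hi => abs_sub_le_sum_range (fun k => g k 0) (i := i) (n := n) hi
    have s₂ := fun i hi => abs_sub_le_sum_range (fun k => g k n) (i := i) (n := n) hi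
    have s₃ := fun i hi => abs_sub_le_sum_range (fun k => g 0 k) (i := i) (n := n) hi
    have s₄ := fun i hi => abs_sub_le_sum_range (fun k => g n k) (i := i) (n := n) hi
    have hVe : V = (∑ k ∈ Finset.range n, |g (k + 1) 0 - g k 0| +
        ∑ k ∈ Finset.range n, |g (k + 1) n - g k n|) +
        (∑ k ∈ Finset.range n, |g 0 (k + 1) - g 0 k| +
        ∑ k ∈ Finset.range n, |g n (k + 1) - g n k|) := by
      rw [hV, ← Finset.sum_add_distrib, ← Finset.sum_add_distrib, ← Finset.sum_add_distrib]
    have p₁ : 0 ≤ ∑ k ∈ Finset.range n, |g (k + 1) 0 - g k 0| :=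
      Finset.sum_nonneg fun _ _ => abs_nonneg _
    have p₂ : 0 ≤ ∑ k ∈ Finset.range n, |g (k + 1) n - g k n| :=
      Finset.sum_nonneg fun _ _ => abs_nonneg _
    have p₃ : 0 ≤ ∑ k ∈ Finset.range n, |g 0 (k + 1) - g 0 k| :=
      Finset.sum_nonneg fun _ _ => abs_nonneg _
    have p₄ : 0 ≤ ∑ k ∈ Finset.range n, |g n (k + 1) - g n k| :=
      Finset.sum_nonneg fun _ _ => abs_nonneg _
    rcases hij with rfl | rfl | rfl | rfl
    · linarith [s₃ j hj]
    · have := abs_sub_le (g i j) (g i 0) (g 0 0)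
      linarith [s₄ j hj, s₁ i le_rfl]
    · linarith [s₁ i hi]
    · have := abs_sub_le (g i j) (g 0 j) (g 0 0)
      linarith [s₂ i hi, s₃ j le_rfl]
  have hup : ∀ i j, i ≤ n → j ≤ n → g i j ≤ g 0 0 + V :=
    hg.le_of_boundary fun i j hi hj h => by linarith [(abs_le.1 (hbd i j hi hj h)).2]
  have hdn : ∀ i j, i ≤ n → j ≤ n → - g i j ≤ - g 0 0 + V :=
    hg.neg.le_of_boundary fun i j hi hj h => by linarith [(abs_le.1 (hbd i j hi hj h)).1]
  have hosc : |g i j - g i' j'| ≤ 2 * V := by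
    rw [abs_le]
    constructor <;> linarith [hup i j hi hj, hdn i j hi hj, hup i' j' hi' hj', hdn i' j' hi' hj']
  have hV2 : V ^ 2 ≤ n * ∑ k ∈ Finset.range n, t k ^ 2 := by
    have := sq_sum_le_card_mul_sum_sq (s := Finset.range n) (f := t)
    simpa using this
  have ht2 : ∑ k ∈ Finset.range n, t k ^ 2 ≤ 4 * ringEnergy n g := by
    rw [ringEnergy, Finset.mul_sum]
    refine Finset.sum_le_sum fun k _ => ?_
    simp only [ht]
    rw [← sq_abs (g (k + 1) 0 - g k 0), ← sq_abs (g (k + 1) n - g k n),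
      ← sq_abs (g 0 (k + 1) - g 0 k), ← sq_abs (g n (k + 1) - g n k)]
    generalize |g (k + 1) 0 - g k 0| = a
    generalize |g (k + 1) n - g k n| = b
    generalize |g 0 (k + 1) - g 0 k| = c
    generalize |g n (k + 1) - g n k| = d
    nlinarith [sq_nonneg (a - b), sq_nonneg (a - c), sq_nonneg (a - d), sq_nonneg (b - c),
      sq_nonneg (b - d), sq_nonneg (c - d)]
  calc (g i j - g i' j') ^ 2 = |g i j - g i' j'| ^ 2 := (sq_abs _).symm
    _ ≤ (2 * V) ^ 2 := by gcongr
    _ = 4 * V ^ 2 := by ring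
    _ ≤ 4 * (n * (4 * ringEnergy n g)) := by gcongr; exact hV2.trans (by gcongr)
    _ = _ := by ring

theorem sum_comp_le_sum_of_injOn {s t : Finset ℕ} {e : ℕ → ℕ} (he : Set.InjOn e (s : Set ℕ))
    (hst : ∀ x ∈ s, e x ∈ t) {f : ℕ → ℝ} (hf : ∀ i, 0 ≤ f i) :
    ∑ x ∈ s, f (e x) ≤ ∑ y ∈ t, f y := by
  classical
  rw [← Finset.sum_image (f := f) he]
  refine Finset.sum_le_sum_of_subset_of_nonneg ?_ (fun _ _ _ => hf _)
  intro x hx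
  obtain ⟨y, hy, rfl⟩ := Finset.mem_image.1 hx
  exact hst y hy

/-- Sum of the inverses of the integers in `(r, m]`. -/
noncomputable def harmSum (r m : ℕ) : ℝ := ∑ ρ ∈ Finset.Ioc r m, (1 / (ρ : ℝ))

theorem sum_ringEnergy_le (r m : ℕ) (g : ℕ → ℕ → ℝ) :
    ∑ ρ ∈ Finset.Ioc r m, ringEnergy (2 * ρ) (fun i j => g (m - ρ + i) (m - ρ + j)) ≤
      2 * edgeEnergy (2 * m + 1) (2 * m + 1) g := by
  set F : ℕ → ℕ → ℝ := fun i j => (g (i + 1) j - g i j) ^ 2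
  set G : ℕ → ℕ → ℝ := fun i j => (g i (j + 1) - g i j) ^ 2
  have hF : ∀ i j, 0 ≤ F i j := fun i j => sq_nonneg _
  have hG : ∀ i j, 0 ≤ G i j := fun i j => sq_nonneg _
  set n := 2 * m + 1
  have hring : ∀ ρ ∈ Finset.Ioc r m,
      ringEnergy (2 * ρ) (fun i j => g (m - ρ + i) (m - ρ + j)) ≤
      (∑ i ∈ Finset.range n, F i (m - ρ) + ∑ i ∈ Finset.range n, F i (m + ρ)) +
      (∑ i ∈ Finset.range n, G (m - ρ) i + ∑ i ∈ Finset.range n, G (m + ρ) i) := by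
    intro ρ hρ
    rw [Finset.mem_Ioc] at hρ
    have key : ∀ f : ℕ → ℝ, (∀ i, 0 ≤ f i) →
        ∑ k ∈ Finset.range (2 * ρ), f (m - ρ + k) ≤ ∑ i ∈ Finset.range n, f i := by
      intro f hf
      refine sum_comp_le_sum_of_injOn (fun x _ y _ h => Nat.add_left_cancel h) (fun x hx => ?_) hf
      simp only [Finset.mem_range] at hx ⊢
      omega
    have e : m - ρ + 2 * ρ = m + ρ := by omega
    rw [ringEnergy]
    simp only [Finset.sum_add_distrib]
    gcongr
    · exact key (fun i => F i (m - ρ)) (fun i => hF _ _)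
    · rw [e]; exact key (fun i => F i (m + ρ)) (fun i => hF _ _)
    · exact key (fun i => G (m - ρ) i) (fun i => hG _ _)
    · rw [e]; exact key (fun i => G (m + ρ) i) (fun i => hG _ _)
  have hlow : ∀ f : ℕ → ℝ, (∀ i, 0 ≤ f i) →
      ∑ ρ ∈ Finset.Ioc r m, f (m - ρ) ≤ ∑ j ∈ Finset.range n, f j := by
    intro f hf
    refine sum_comp_le_sum_of_injOn (e := fun ρ => m - ρ) (fun x hx y hy h => ?_)
      (fun x hx => ?_) hf
    · simp only [Finset.coe_Ioc, Set.mem_Ioc] at hx hy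
      simp only at h
      omega
    · simp only [Finset.mem_range]
      omega
  have hhigh : ∀ f : ℕ → ℝ, (∀ i, 0 ≤ f i) →
      ∑ ρ ∈ Finset.Ioc r m, f (m + ρ) ≤ ∑ j ∈ Finset.range n, f j := by
    intro f hf
    refine sum_comp_le_sum_of_injOn (fun x _ y _ h => Nat.add_left_cancel h) (fun x hx => ?_) hf
    simp only [Finset.mem_range, Finset.mem_Ioc] at hx ⊢
    omega
  refine (Finset.sum_le_sum hring).trans ?_
  simp only [Finset.sum_add_distrib]
  have hE : edgeEnergy n n g = ∑ j ∈ Finset.range n, ∑ i ∈ Finset.range n, F i j +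
      ∑ j ∈ Finset.range n, ∑ i ∈ Finset.range n, G j i := by
    rw [edgeEnergy]
    simp only [Finset.sum_add_distrib]
    congr 1
    exact Finset.sum_comm
  have a₁ := hlow (fun y => ∑ i ∈ Finset.range n, F i y) fun y => Finset.sum_nonneg fun _ _ => hF _ _
  have a₂ := hhigh (fun y => ∑ i ∈ Finset.range n, F i y) fun y => Finset.sum_nonneg fun _ _ => hF _ _
  have a₃ := hlow (fun y => ∑ i ∈ Finset.range n, G y i) fun y => Finset.sum_nonneg fun _ _ => hG _ _
  have a₄ := hhigh (fun y => ∑ i ∈ Finset.range n, G y i) fun y => Finset.sum_nonneg fun _ _ => hG _ _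
  linarith

/-- A discrete Courant–Lebesgue lemma. -/
theorem IsMeanOn.sq_osc_mul_harmSum_le {m r : ℕ} {g : ℕ → ℕ → ℝ}
    (hg : IsMeanOn (2 * m) (2 * m) g) {i j i' j' : ℕ} (hi : m ≤ i + r) (hi2 : i ≤ m + r)
    (hj : m ≤ j + r) (hj2 : j ≤ m + r) (hi' : m ≤ i' + r) (hi'2 : i' ≤ m + r)
    (hj' : m ≤ j' + r) (hj'2 : j' ≤ m + r) :
    (g i j - g i' j') ^ 2 * harmSum r m ≤ 64 * edgeEnergy (2 * m + 1) (2 * m + 1) g := by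
  rw [harmSum, Finset.mul_sum]
  calc _ ≤ ∑ ρ ∈ Finset.Ioc r m,
        32 * ringEnergy (2 * ρ) (fun i j => g (m - ρ + i) (m - ρ + j)) := ?_
    _ ≤ _ := by
        rw [← Finset.mul_sum]
        linarith [sum_ringEnergy_le r m g]
  refine Finset.sum_le_sum fun ρ hρ => ?_
  rw [Finset.mem_Ioc] at hρ
  have h := (hg.shift (m - ρ) (m - ρ) (2 * ρ) (2 * ρ) (by omega) (by omega)).sq_osc_le
    (i := i - (m - ρ)) (j := j - (m - ρ)) (i' := i' - (m - ρ)) (j' := j' - (m - ρ))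
    (by omega) (by omega) (by omega) (by omega)
  rw [show m - ρ + (i - (m - ρ)) = i by omega, show m - ρ + (j - (m - ρ)) = j by omega,
    show m - ρ + (i' - (m - ρ)) = i' by omega, show m - ρ + (j' - (m - ρ)) = j' by omega] at h
  have hρ0 : (0 : ℝ) < ρ := by exact_mod_cast (by omega : 0 < ρ)
  rw [mul_one_div, div_le_iff₀ hρ0]
  push_cast at h
  linarith

/-! ### Conjugate pairs of discrete elliptic equations -/

/-- A discrete elliptic system of Cauchy–Riemann type on `[0, M₁] × [0, M₂]`. -/
structure ConjPair (M₁ M₂ : ℕ) (a b p v : ℕ → ℕ → ℝ) : Prop where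
  fst : ∀ i j, i + 1 ≤ M₁ → j + 1 ≤ M₂ →
    v i (j + 1) - v i j = a i (j + 1) * (p (i + 1) (j + 1) - p i (j + 1))
  snd : ∀ i j, i + 1 ≤ M₁ → j + 1 ≤ M₂ →
    v (i + 1) j - v i j = - b (i + 1) j * (p (i + 1) (j + 1) - p (i + 1) j)

/-- Two-sided bounds for a weight on `[0, M₁] × [0, M₂]`. -/
def WeightBounds (M₁ M₂ : ℕ) (c₁ c₂ : ℝ) (a : ℕ → ℕ → ℝ) : Prop :=
  ∀ i j, i ≤ M₁ → j ≤ M₂ → c₁ ≤ a i j ∧ a i j ≤ c₂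

namespace ConjPair

variable {M₁ M₂ : ℕ} {a b p v : ℕ → ℕ → ℝ}

theorem shift (h : ConjPair M₁ M₂ a b p v) (x y N₁ N₂ : ℕ)
    (h₁ : x + N₁ ≤ M₁) (h₂ : y + N₂ ≤ M₂) :
    ConjPair N₁ N₂ (fun i j => a (x + i) (y + j)) (fun i j => b (x + i) (y + j))
      (fun i j => p (x + i) (y + j)) (fun i j => v (x + i) (y + j)) where
  fst i j hi hj := h.fst (x + i) (y + j) (by omega) (by omega)
  snd i j hi hj := h.snd (x + i) (y + j) (by omega) (by omega)

theorem eqn (h : ConjPair M₁ M₂ a b p v) (i j : ℕ) (hi : i + 2 ≤ M₁) (hj : j + 2 ≤ M₂) :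
    a (i + 1) (j + 1) * (p (i + 2) (j + 1) - p (i + 1) (j + 1)) -
      a i (j + 1) * (p (i + 1) (j + 1) - p i (j + 1)) +
    (b (i + 1) (j + 1) * (p (i + 1) (j + 2) - p (i + 1) (j + 1)) -
      b (i + 1) j * (p (i + 1) (j + 1) - p (i + 1) j)) = 0 := by
  have e₁ := h.fst (i + 1) j (by omega) (by omega)
  have e₂ := h.fst i j (by omega) (by omega)
  have e₃ := h.snd i (j + 1) (by omega) (by omega)
  have e₄ := h.snd i j (by omega) (by omega)
  linarith

theorem isMeanOn_fst (h : ConjPair M₁ M₂ a b p v) {c₁ c₂ : ℝ} (hc : 0 < c₁)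
    (ha : WeightBounds M₁ M₂ c₁ c₂ a) (hb : WeightBounds M₁ M₂ c₁ c₂ b) : IsMeanOn M₁ M₂ p := by
  intro i j hi hj
  exact ⟨_, _, _, _, hc.trans_le (ha (i + 1) (j + 1) (by omega) (by omega)).1,
    hc.trans_le (ha i (j + 1) (by omega) (by omega)).1,
    hc.trans_le (hb (i + 1) (j + 1) (by omega) (by omega)).1,
    hc.trans_le (hb (i + 1) j (by omega) (by omega)).1, h.eqn i j hi hj⟩

theorem isMeanOn_snd (h : ConjPair M₁ M₂ a b p v) {c₁ c₂ : ℝ} (hc : 0 < c₁)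
    (ha : WeightBounds M₁ M₂ c₁ c₂ a) (hb : WeightBounds M₁ M₂ c₁ c₂ b) : IsMeanOn M₁ M₂ v := by
  intro i j hi hj
  have e₁ := h.fst (i + 1) (j + 1) (by omega) (by omega)
  have e₂ := h.fst (i + 1) j (by omega) (by omega)
  have e₃ := h.snd (i + 1) (j + 1) (by omega) (by omega)
  have e₄ := h.snd i (j + 1) (by omega) (by omega)
  have a₁ : 0 < a (i + 1) (j + 2) := hc.trans_le (ha _ _ (by omega) (by omega)).1
  have a₂ : 0 < a (i + 1) (j + 1) := hc.trans_le (ha _ _ (by omega) (by omega)).1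
  have b₁ : 0 < b (i + 2) (j + 1) := hc.trans_le (hb _ _ (by omega) (by omega)).1
  have b₂ : 0 < b (i + 1) (j + 1) := hc.trans_le (hb _ _ (by omega) (by omega)).1
  refine ⟨_, _, _, _, inv_pos.2 b₁, inv_pos.2 b₂, inv_pos.2 a₁, inv_pos.2 a₂, ?_⟩
  rw [e₁, e₂, e₃, e₄]
  simp only [show i + 1 + 1 = i + 2 from rfl, show j + 1 + 1 = j + 2 from rfl, neg_mul, mul_neg]
  rw [inv_mul_cancel_left₀ a₁.ne', inv_mul_cancel_left₀ a₂.ne', inv_mul_cancel_left₀ b₁.ne',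
    inv_mul_cancel_left₀ b₂.ne']
  ring

end ConjPair

theorem sum_range_sub_mul_succ (F ψ : ℕ → ℝ) (L : ℕ) :
    ∑ i ∈ Finset.range L, (F (i + 1) - F i) * ψ (i + 1) =
      F L * ψ (L + 1) - F 0 * ψ 0 - ∑ i ∈ Finset.range (L + 1), F i * (ψ (i + 1) - ψ i) := by
  induction L with
  | zero => simp; ring
  | succ L ih =>
    rw [Finset.sum_range_succ, ih, Finset.sum_range_succ _ (L + 1)]
    ring

theorem ConjPair.caccioppoli {M₁ M₂ : ℕ} {a b p v η : ℕ → ℕ → ℝ} (h : ConjPair M₁ M₂ a b p v)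
    {c₁ c₂ K d : ℝ} (hM₁ : 1 ≤ M₁) (hM₂ : 1 ≤ M₂) (hc : 0 < c₁)
    (ha : WeightBounds M₁ M₂ c₁ c₂ a) (hb : WeightBounds M₁ M₂ c₁ c₂ b)
    (hp : ∀ i j, i ≤ M₁ → j ≤ M₂ → |p i j| ≤ K)
    (hη : ∀ i j, i ≤ M₁ → j ≤ M₂ → (i = 0 ∨ i = M₁ ∨ j = 0 ∨ j = M₂) → η i j = 0)
    (hd₁ : ∀ i j, |η (i + 1) j - η i j| ≤ d) (hd₂ : ∀ i j, |η i (j + 1) - η i j| ≤ d) :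
    edgeEnergy M₁ M₂ (fun i j => η i j * p i j) ≤ 2 * (c₂ / c₁) * K ^ 2 * d ^ 2 * M₁ * M₂ := by
  obtain ⟨L₁, rfl⟩ : ∃ L, M₁ = L + 1 := ⟨M₁ - 1, by omega⟩
  obtain ⟨L₂, rfl⟩ : ∃ L, M₂ = L + 1 := ⟨M₂ - 1, by omega⟩
  set ψ : ℕ → ℕ → ℝ := fun i j => η i j ^ 2 * p i j with hψ
  have hψ0 : ∀ i j, i ≤ L₁ + 1 → j ≤ L₂ + 1 → (i = 0 ∨ i = L₁ + 1 ∨ j = 0 ∨ j = L₂ + 1) →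
      ψ i j = 0 := by
    intro i j hi hj hij
    simp [hψ, hη i j hi hj hij]
  set Fx : ℕ → ℕ → ℝ := fun i j => a i j * (p (i + 1) j - p i j) with hFx
  set Fy : ℕ → ℕ → ℝ := fun i j => b i j * (p i (j + 1) - p i j) with hFy
  have hx : ∑ j ∈ Finset.range L₂, ∑ i ∈ Finset.range L₁,
      (Fx (i + 1) (j + 1) - Fx i (j + 1)) * ψ (i + 1) (j + 1) =
      - ∑ j ∈ Finset.range (L₂ + 1), ∑ i ∈ Finset.range (L₁ + 1),
        Fx i j * (ψ (i + 1) j - ψ i j) := by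
    rw [Finset.sum_range_succ' _ L₂, neg_add]
    have h0 : ∑ i ∈ Finset.range (L₁ + 1), Fx i 0 * (ψ (i + 1) 0 - ψ i 0) = 0 := by
      refine Finset.sum_eq_zero fun i hi => ?_
      rw [Finset.mem_range] at hi
      rw [hψ0 (i + 1) 0 (by omega) (by omega) (by simp), hψ0 i 0 (by omega) (by omega) (by simp)]
      simp
    rw [h0, neg_zero, add_zero, ← Finset.sum_neg_distrib]
    refine Finset.sum_congr rfl fun j hj => ?_
    rw [Finset.mem_range] at hj
    rw [sum_range_sub_mul_succ (fun i => Fx i (j + 1)) (fun i => ψ i (j + 1)),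
      hψ0 (L₁ + 1) (j + 1) (by omega) (by omega) (by simp),
      hψ0 0 (j + 1) (by omega) (by omega) (by simp)]
    simp
  have hy : ∑ i ∈ Finset.range L₁, ∑ j ∈ Finset.range L₂,
      (Fy (i + 1) (j + 1) - Fy (i + 1) j) * ψ (i + 1) (j + 1) =
      - ∑ i ∈ Finset.range (L₁ + 1), ∑ j ∈ Finset.range (L₂ + 1),
        Fy i j * (ψ i (j + 1) - ψ i j) := by
    rw [Finset.sum_range_succ' _ L₁, neg_add]
    have h0 : ∑ j ∈ Finset.range (L₂ + 1), Fy 0 j * (ψ 0 (j + 1) - ψ 0 j) = 0 := by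
      refine Finset.sum_eq_zero fun j hj => ?_
      rw [Finset.mem_range] at hj
      rw [hψ0 0 (j + 1) (by omega) (by omega) (by simp), hψ0 0 j (by omega) (by omega) (by simp)]
      simp
    rw [h0, neg_zero, add_zero, ← Finset.sum_neg_distrib]
    refine Finset.sum_congr rfl fun i hi => ?_
    rw [Finset.mem_range] at hi
    rw [sum_range_sub_mul_succ (fun j => Fy (i + 1) j) (fun j => ψ (i + 1) j),
      hψ0 (i + 1) (L₂ + 1) (by omega) (by omega) (by simp),
      hψ0 (i + 1) 0 (by omega) (by omega) (by simp)]
    simp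
  have hzero : ∑ i ∈ Finset.range (L₁ + 1), ∑ j ∈ Finset.range (L₂ + 1),
      (Fx i j * (ψ (i + 1) j - ψ i j) + Fy i j * (ψ i (j + 1) - ψ i j)) = 0 := by
    simp only [Finset.sum_add_distrib]
    rw [Finset.sum_comm, ← neg_eq_zero, neg_add, ← hx, ← hy, Finset.sum_comm,
      ← Finset.sum_add_distrib]
    refine Finset.sum_eq_zero fun i hi => ?_
    rw [← Finset.sum_add_distrib]
    refine Finset.sum_eq_zero fun j hj => ?_
    rw [Finset.mem_range] at hi hj
    have := h.eqn i j (by omega) (by omega)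
    rw [← add_mul, hFx, hFy]
    simp only
    rw [show i + 1 + 1 = i + 2 from rfl, show j + 1 + 1 = j + 2 from rfl, this, zero_mul]
  have hK : 0 ≤ K := (abs_nonneg _).trans (hp 0 0 (by omega) (by omega))
  have hcell : ∀ i ∈ Finset.range (L₁ + 1), ∀ j ∈ Finset.range (L₂ + 1),
      c₁ * ((η (i + 1) j * p (i + 1) j - η i j * p i j) ^ 2 +
        (η i (j + 1) * p i (j + 1) - η i j * p i j) ^ 2) ≤
      (Fx i j * (ψ (i + 1) j - ψ i j) + Fy i j * (ψ i (j + 1) - ψ i j)) +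
        2 * (c₂ * K ^ 2 * d ^ 2) := by
    intro i hi j hj
    rw [Finset.mem_range] at hi hj
    have key : ∀ {c x y s t : ℝ}, c₁ ≤ c → c ≤ c₂ → |x| ≤ K → |y| ≤ K → |s - t| ≤ d →
        c₁ * (s * x - t * y) ^ 2 ≤ c * (x - y) * (s ^ 2 * x - t ^ 2 * y) + c₂ * K ^ 2 * d ^ 2 := by
      intro c x y s t h₁ h₂ hx hy hst
      have e : c * (x - y) * (s ^ 2 * x - t ^ 2 * y) =
          c * (s * x - t * y) ^ 2 - c * (x * y) * (s - t) ^ 2 := by ring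
      have hxy : x * y ≤ K ^ 2 := by
        calc x * y ≤ |x * y| := le_abs_self _
          _ = |x| * |y| := abs_mul _ _
          _ ≤ K * K := by gcongr
          _ = K ^ 2 := by ring
      have hst2 : (s - t) ^ 2 ≤ d ^ 2 := by
        rw [← sq_abs]; gcongr
      have hc0 : 0 < c := hc.trans_le h₁
      have : c * (x * y) * (s - t) ^ 2 ≤ c₂ * K ^ 2 * d ^ 2 := by
        calc c * (x * y) * (s - t) ^ 2 ≤ c * K ^ 2 * (s - t) ^ 2 := by gcongr
          _ ≤ c₂ * K ^ 2 * d ^ 2 := by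
            have := hc0.trans_le h₂
            gcongr
      have : c₁ * (s * x - t * y) ^ 2 ≤ c * (s * x - t * y) ^ 2 := by gcongr
      linarith
    have k₁ := key (ha i j (by omega) (by omega)).1 (ha i j (by omega) (by omega)).2
      (hp (i + 1) j (by omega) (by omega)) (hp i j (by omega) (by omega)) (hd₁ i j)
    have k₂ := key (hb i j (by omega) (by omega)).1 (hb i j (by omega) (by omega)).2
      (hp i (j + 1) (by omega) (by omega)) (hp i j (by omega) (by omega)) (hd₂ i j)
    simp only [hFx, hFy, hψ]
    linarith
  have hsum := Finset.sum_le_sum fun i hi => Finset.sum_le_sum (hcell i hi)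
  simp only [Finset.sum_add_distrib (f := fun j => _ + _), Finset.sum_const, Finset.card_range,
    nsmul_eq_mul, ← Finset.mul_sum] at hsum
  have hE : edgeEnergy (L₁ + 1) (L₂ + 1) (fun i j => η i j * p i j) =
    ∑ i ∈ Finset.range (L₁ + 1), ∑ j ∈ Finset.range (L₂ + 1),
      ((η (i + 1) j * p (i + 1) j - η i j * p i j) ^ 2 +
        (η i (j + 1) * p i (j + 1) - η i j * p i j) ^ 2) := rfl
  rw [← hE] at hsum
  have hsum' : c₁ * edgeEnergy (L₁ + 1) (L₂ + 1) (fun i j => η i j * p i j) ≤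
      ((L₁ + 1 : ℕ) : ℝ) * (((L₂ + 1 : ℕ) : ℝ) * (2 * (c₂ * K ^ 2 * d ^ 2))) := by
    refine hsum.trans (le_of_eq ?_)
    rw [Finset.sum_add_distrib, hzero]
    simp
  rw [← le_div_iff₀' hc] at hsum'
  refine hsum'.trans (le_of_eq ?_)
  field_simp

/-- A cutoff function vanishing on the boundary of `[0, M₁] × [0, M₂]`. -/
noncomputable def cutoff (M₁ M₂ m : ℕ) (i j : ℕ) : ℝ :=
  min 1 ((min (min i (M₁ - i)) (min j (M₂ - j)) : ℕ) / (m : ℝ))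

theorem cutoff_sub_le {M₁ M₂ m : ℕ} (hm : 1 ≤ m) {i j i' j' : ℕ}
    (h₁ : min (min i (M₁ - i)) (min j (M₂ - j)) ≤ min (min i' (M₁ - i')) (min j' (M₂ - j')) + 1)
    (h₂ : min (min i' (M₁ - i')) (min j' (M₂ - j')) ≤ min (min i (M₁ - i)) (min j (M₂ - j)) + 1) :
    |cutoff M₁ M₂ m i' j' - cutoff M₁ M₂ m i j| ≤ 1 / m := by
  unfold cutoff
  generalize min (min i (M₁ - i)) (min j (M₂ - j)) = x at *
  generalize min (min i' (M₁ - i')) (min j' (M₂ - j')) = y at *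
  refine (abs_min_sub_min_le_max _ _ _ _).trans ?_
  rw [← sub_div, abs_div, Nat.abs_cast, sub_self, abs_zero]
  have h₁' : (x : ℝ) ≤ y + 1 := by exact_mod_cast h₁
  have h₂' : (y : ℝ) ≤ x + 1 := by exact_mod_cast h₂
  have : |(y : ℝ) - x| ≤ 1 := by rw [abs_le]; constructor <;> linarith
  refine max_le (by positivity) ?_
  gcongr

theorem ConjPair.edgeEnergy_fst_le {M₁ M₂ : ℕ} {a b p v : ℕ → ℕ → ℝ}
    (h : ConjPair M₁ M₂ a b p v) {c₁ c₂ K : ℝ} (hc : 0 < c₁)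
    (ha : WeightBounds M₁ M₂ c₁ c₂ a) (hb : WeightBounds M₁ M₂ c₁ c₂ b)
    (hp : ∀ i j, i ≤ M₁ → j ≤ M₂ → |p i j| ≤ K) {m n₁ n₂ : ℕ} (hm : 1 ≤ m)
    (h₁ : m + n₁ + m ≤ M₁) (h₂ : m + n₂ + m ≤ M₂) :
    edgeEnergy n₁ n₂ (fun i j => p (m + i) (m + j)) ≤
      2 * (c₂ / c₁) * K ^ 2 * (1 / m) ^ 2 * M₁ * M₂ := by
  have hm0 : (0 : ℝ) < m := by exact_mod_cast hm
  refine le_trans ?_ (h.caccioppoli (η := cutoff M₁ M₂ m) (by omega) (by omega) hc ha hb hp ?_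
    (fun i j => cutoff_sub_le hm (by omega) (by omega))
    (fun i j => cutoff_sub_le hm (by omega) (by omega)))
  · have hone : ∀ i j, m ≤ i → i + m ≤ M₁ → m ≤ j → j + m ≤ M₂ → cutoff M₁ M₂ m i j = 1 := by
      intro i j hi hi' hj hj'
      unfold cutoff
      refine min_eq_left ?_
      rw [one_le_div hm0, Nat.cast_le]
      omega
    set G : ℕ → ℕ → ℝ := fun i j => cutoff M₁ M₂ m i j * p i j
    set e : ℕ → ℕ → ℝ := fun i j => (G (i + 1) j - G i j) ^ 2 + (G i (j + 1) - G i j) ^ 2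
    have he : ∀ i j, 0 ≤ e i j := fun i j => by positivity
    calc edgeEnergy n₁ n₂ (fun i j => p (m + i) (m + j)) =
        ∑ i ∈ Finset.range n₁, ∑ j ∈ Finset.range n₂, e (m + i) (m + j) := by
          refine Finset.sum_congr rfl fun i hi => Finset.sum_congr rfl fun j hj => ?_
          rw [Finset.mem_range] at hi hj
          simp only [e, G]
          rw [hone (m + i) (m + j) (by omega) (by omega) (by omega) (by omega),
            hone (m + i + 1) (m + j) (by omega) (by omega) (by omega) (by omega),
            hone (m + i) (m + j + 1) (by omega) (by omega) (by omega) (by omega)]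
          simp [add_assoc]
      _ ≤ ∑ i ∈ Finset.range n₁, ∑ j ∈ Finset.range M₂, e (m + i) j := by
          refine Finset.sum_le_sum fun i _ => ?_
          refine sum_comp_le_sum_of_injOn (f := fun j => e (m + i) j)
            (fun x _ y _ h => Nat.add_left_cancel h) (fun x hx => ?_) (fun j => he _ _)
          rw [Finset.mem_range] at hx ⊢
          omega
      _ ≤ ∑ i ∈ Finset.range M₁, ∑ j ∈ Finset.range M₂, e i j := by
          refine sum_comp_le_sum_of_injOn (f := fun i => ∑ j ∈ Finset.range M₂, e i j)
            (fun x _ y _ h => Nat.add_left_cancel h) (fun x hx => ?_)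
            (fun i => Finset.sum_nonneg fun j _ => he _ _)
          rw [Finset.mem_range] at hx ⊢
          omega
  · intro i j hi hj hij
    unfold cutoff
    rw [show min (min i (M₁ - i)) (min j (M₂ - j)) = 0 by omega]
    simp

theorem ConjPair.edgeEnergy_snd_le {M₁ M₂ : ℕ} {a b p v : ℕ → ℕ → ℝ}
    (h : ConjPair M₁ M₂ a b p v) {c₁ c₂ : ℝ} (hc : 0 < c₁)
    (ha : WeightBounds M₁ M₂ c₁ c₂ a) (hb : WeightBounds M₁ M₂ c₁ c₂ b) {n₁ n₂ : ℕ}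
    (h₁ : n₁ ≤ M₁) (h₂ : n₂ ≤ M₂) :
    edgeEnergy n₁ n₂ v ≤ c₂ ^ 2 * edgeEnergy (n₁ + 1) (n₂ + 1) p := by
  set F : ℕ → ℕ → ℝ := fun i j => (p (i + 1) j - p i j) ^ 2
  set G : ℕ → ℕ → ℝ := fun i j => (p i (j + 1) - p i j) ^ 2
  have hF : ∀ i j, 0 ≤ F i j := fun i j => sq_nonneg _
  have hG : ∀ i j, 0 ≤ G i j := fun i j => sq_nonneg _
  have s₁ : ∑ i ∈ Finset.range n₁, ∑ j ∈ Finset.range n₂, F i (j + 1) ≤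
      ∑ i ∈ Finset.range (n₁ + 1), ∑ j ∈ Finset.range (n₂ + 1), F i j := by
    refine (Finset.sum_le_sum fun i _ => ?_).trans (Finset.sum_le_sum_of_subset_of_nonneg
      (Finset.range_subset_range.2 (by omega)) fun i _ _ => Finset.sum_nonneg fun j _ => hF i j)
    rw [Finset.sum_range_succ']
    linarith [hF i 0]
  have s₂ : ∑ i ∈ Finset.range n₁, ∑ j ∈ Finset.range n₂, G (i + 1) j ≤
      ∑ i ∈ Finset.range (n₁ + 1), ∑ j ∈ Finset.range (n₂ + 1), G i j := by
    rw [Finset.sum_range_succ']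
    have : ∑ i ∈ Finset.range n₁, ∑ j ∈ Finset.range n₂, G (i + 1) j ≤
        ∑ i ∈ Finset.range n₁, ∑ j ∈ Finset.range (n₂ + 1), G (i + 1) j :=
      Finset.sum_le_sum fun i _ => Finset.sum_le_sum_of_subset_of_nonneg
        (Finset.range_subset_range.2 (by omega)) fun j _ _ => hG _ j
    have : 0 ≤ ∑ j ∈ Finset.range (n₂ + 1), G 0 j := Finset.sum_nonneg fun j _ => hG 0 j
    linarith
  have hcell : ∀ i ∈ Finset.range n₁, ∀ j ∈ Finset.range n₂,
      ((v (i + 1) j - v i j) ^ 2 + (v i (j + 1) - v i j) ^ 2) ≤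
        c₂ ^ 2 * (F i (j + 1) + G (i + 1) j) := by
    intro i hi j hj
    rw [Finset.mem_range] at hi hj
    rw [h.fst i j (by omega) (by omega), h.snd i j (by omega) (by omega), mul_pow, mul_pow]
    have a₁ := ha i (j + 1) (by omega) (by omega)
    have b₁ := hb (i + 1) j (by omega) (by omega)
    have : a i (j + 1) ^ 2 ≤ c₂ ^ 2 := pow_le_pow_left₀ (hc.le.trans a₁.1) a₁.2 2
    have : (- b (i + 1) j) ^ 2 ≤ c₂ ^ 2 := by
      rw [neg_sq]; exact pow_le_pow_left₀ (hc.le.trans b₁.1) b₁.2 2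
    have k₁ : a i (j + 1) ^ 2 * F i (j + 1) ≤ c₂ ^ 2 * F i (j + 1) := by gcongr
    have k₂ : (- b (i + 1) j) ^ 2 * G (i + 1) j ≤ c₂ ^ 2 * G (i + 1) j := by gcongr
    rw [mul_add]
    exact (add_le_add k₂ k₁).trans (le_of_eq (add_comm _ _))
  have hE : edgeEnergy (n₁ + 1) (n₂ + 1) p =
      ∑ i ∈ Finset.range (n₁ + 1), ∑ j ∈ Finset.range (n₂ + 1), F i j +
      ∑ i ∈ Finset.range (n₁ + 1), ∑ j ∈ Finset.range (n₂ + 1), G i j := by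
    simp only [edgeEnergy, Finset.sum_add_distrib, F, G]
  have := Finset.sum_le_sum fun i hi => Finset.sum_le_sum (hcell i hi)
  simp only [← Finset.mul_sum, Finset.sum_add_distrib (g := fun j => G _ _)] at this
  rw [hE, edgeEnergy]
  refine this.trans (mul_le_mul_of_nonneg_left ?_ (sq_nonneg _))
  rw [Finset.sum_add_distrib]
  linarith

/-- Modulus of continuity for conjugate pairs, at the centre of a square. -/
theorem ConjPair.sq_osc_le {m r : ℕ} {a b p v : ℕ → ℕ → ℝ}
    (h : ConjPair (4 * m + 2) (4 * m + 2) a b p v) {c₁ c₂ K : ℝ} (hm : 1 ≤ m) (hc : 0 < c₁)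
    (hc' : c₁ ≤ c₂)
    (ha : WeightBounds (4 * m + 2) (4 * m + 2) c₁ c₂ a)
    (hb : WeightBounds (4 * m + 2) (4 * m + 2) c₁ c₂ b)
    (hp : ∀ i j, i ≤ 4 * m + 2 → j ≤ 4 * m + 2 → |p i j| ≤ K)
    {i j i' j' : ℕ} (hi : 2 * m ≤ i + r) (hi2 : i ≤ 2 * m + r)
    (hj : 2 * m ≤ j + r) (hj2 : j ≤ 2 * m + r) (hi' : 2 * m ≤ i' + r) (hi'2 : i' ≤ 2 * m + r)
    (hj' : 2 * m ≤ j' + r) (hj'2 : j' ≤ 2 * m + r) (hr : r ≤ m) :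
    (p i j - p i' j') ^ 2 * harmSum r m ≤ 4608 * (c₂ / c₁) * K ^ 2 ∧
    (v i j - v i' j') ^ 2 * harmSum r m ≤ 4608 * (c₂ / c₁) * c₂ ^ 2 * K ^ 2 := by
  have hm1 : (1 : ℝ) ≤ m := by exact_mod_cast hm
  have hE : edgeEnergy (2 * m + 2) (2 * m + 2) (fun i j => p (m + i) (m + j)) ≤
      72 * (c₂ / c₁) * K ^ 2 := by
    refine (h.edgeEnergy_fst_le hc ha hb hp hm (by omega) (by omega)).trans ?_
    have e : (1 / (m : ℝ)) * (4 * m + 2) ≤ 6 := by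
      rw [one_div_mul_eq_div, div_le_iff₀ (by linarith)]; linarith
    have e0 : 0 ≤ (1 / (m : ℝ)) * (4 * m + 2) := by positivity
    have e2 : ((1 / (m : ℝ)) * (4 * m + 2)) ^ 2 ≤ 36 := by nlinarith
    have hq : 0 ≤ 2 * (c₂ / c₁) * K ^ 2 := by
      have := hc.trans_le hc'
      positivity
    push_cast
    calc _ = 2 * (c₂ / c₁) * K ^ 2 * ((1 / (m : ℝ)) * (4 * m + 2)) ^ 2 := by ring
      _ ≤ 2 * (c₂ / c₁) * K ^ 2 * 36 := by gcongr
      _ = _ := by ring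
  have hs := h.shift m m (3 * m + 2) (3 * m + 2) (by omega) (by omega)
  have ha' : WeightBounds (3 * m + 2) (3 * m + 2) c₁ c₂ (fun i j => a (m + i) (m + j)) :=
    fun i j hi hj => ha _ _ (by omega) (by omega)
  have hb' : WeightBounds (3 * m + 2) (3 * m + 2) c₁ c₂ (fun i j => b (m + i) (m + j)) :=
    fun i j hi hj => hb _ _ (by omega) (by omega)
  have hmono : edgeEnergy (2 * m + 1) (2 * m + 1) (fun i j => p (m + i) (m + j)) ≤
      edgeEnergy (2 * m + 2) (2 * m + 2) (fun i j => p (m + i) (m + j)) := by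
    unfold edgeEnergy
    refine (Finset.sum_le_sum fun i _ => Finset.sum_le_sum_of_subset_of_nonneg
      (Finset.range_subset_range.2 (by omega : 2 * m + 1 ≤ 2 * m + 2)) fun j _ _ => by positivity).trans
      (Finset.sum_le_sum_of_subset_of_nonneg
      (Finset.range_subset_range.2 (by omega)) fun i _ _ =>
        Finset.sum_nonneg fun j _ => by positivity)
  have hEv := hs.edgeEnergy_snd_le hc ha' hb' (n₁ := 2 * m + 1) (n₂ := 2 * m + 1) (by omega)
    (by omega)
  have hsub : ∀ {i}, 2 * m ≤ i + r → m + (i - m) = i := fun h => by omega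
  have hpm := (((hs.isMeanOn_fst hc ha' hb').shift 0 0 (2 * m) (2 * m) (by omega) (by omega)))
  have hvm := (((hs.isMeanOn_snd hc ha' hb').shift 0 0 (2 * m) (2 * m) (by omega) (by omega)))
  simp only [zero_add] at hpm hvm
  have o₁ := hpm.sq_osc_mul_harmSum_le (r := r) (i := i - m) (j := j - m) (i' := i' - m)
    (j' := j' - m) (by omega) (by omega) (by omega) (by omega) (by omega) (by omega) (by omega)
    (by omega)
  have o₂ := hvm.sq_osc_mul_harmSum_le (r := r) (i := i - m) (j := j - m) (i' := i' - m)
    (j' := j' - m) (by omega) (by omega) (by omega) (by omega) (by omega) (by omega) (by omega)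
    (by omega)
  rw [hsub hi, hsub hj, hsub hi', hsub hj'] at o₁ o₂
  constructor
  · linarith
  · have : c₂ ^ 2 * edgeEnergy (2 * m + 2) (2 * m + 2) (fun i j => p (m + i) (m + j)) ≤
        c₂ ^ 2 * (72 * (c₂ / c₁) * K ^ 2) := by gcongr
    linarith

/-! ### Data of the Lagrangian problem -/

/-- Parameters of the Lagrangian boundary value problem: the terminal map `S` is bi-Lipschitz
on the label interval `[-R, R]`. -/
structure Data where
  /-- exponent of the coupling -/
  θ : ℝ
  /-- scaling exponent -/
  α : ℝ
  /-- radius of the self-similar profile -/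
  R : ℝ
  /-- horizon -/
  T : ℝ
  /-- bi-Lipschitz constant -/
  Λ : ℝ
  /-- terminal map -/
  S : ℝ → ℝ
  θ_pos : 0 < θ
  α_eq : α = 2 / (2 + θ)
  R_pos : 0 < R
  T_pos : 0 < T
  Λ_pos : 0 < Λ
  bilip : ∀ r r', -R ≤ r → r ≤ r' → r' ≤ R → Λ⁻¹ * (r' - r) ≤ S r' - S r ∧
    S r' - S r ≤ Λ * (r' - r)

namespace Data

variable (D : Data)

/-- The constant `α (1 - α)`. -/
noncomputable def κ : ℝ := D.α * (1 - D.α)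
/-- The exponent `1 + θ`. -/
noncomputable def e : ℝ := 1 + D.θ
/-- The exponent `1 / θ`. -/
noncomputable def γ : ℝ := 1 / D.θ
/-- The value `φ(0) ^ θ`. -/
noncomputable def a₀ : ℝ := 1 / 2 * D.κ * D.R ^ 2
/-- Slope of the lower barrier. -/
noncomputable def Am : ℝ := (1 - min (1 / 2) (D.Λ⁻¹ / D.T ^ D.α)) * D.T ^ (D.α - 1)
/-- Slope of the upper barrier. -/
noncomputable def Ap : ℝ := D.Λ / D.T
/-- Lower barrier for the Jacobian of the flow. -/
noncomputable def lower (t : ℝ) : ℝ := t ^ D.α - D.Am * t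
/-- Upper barrier for the Jacobian of the flow. -/
noncomputable def upper (t : ℝ) : ℝ := t ^ D.α + D.Ap * t

theorem α_pos : 0 < D.α := by
  rw [D.α_eq]; have := D.θ_pos; positivity

theorem α_lt_one : D.α < 1 := by
  have := D.θ_pos
  rw [D.α_eq, div_lt_one (by linarith)]; linarith

theorem κ_pos : 0 < D.κ := mul_pos D.α_pos (by linarith [D.α_lt_one])
theorem e_pos : 0 < D.e := by unfold e; linarith [D.θ_pos]
theorem γ_pos : 0 < D.γ := by unfold γ; have := D.θ_pos; positivity
theorem a₀_pos : 0 < D.a₀ := by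
  unfold a₀; have := D.κ_pos; have := D.R_pos; positivity

theorem α_mul_e : D.α * D.e = 2 - D.α := by
  have := D.θ_pos
  rw [D.α_eq, e]; field_simp; ring

theorem rpow_α_neg_e {t : ℝ} (ht : 0 ≤ t) : (t ^ D.α) ^ (-D.e) = t ^ (D.α - 2) := by
  rw [← Real.rpow_mul ht]
  congr 1
  linarith [D.α_mul_e]

theorem rpow_α_mul_div {t : ℝ} (ht : 0 < t) (h : ℝ) :
    t ^ D.α * (h / t) = h * t ^ (D.α - 2) * t := by
  rw [show D.α - 2 = D.α - 1 - 1 by ring, Real.rpow_sub_one ht.ne', Real.rpow_sub_one ht.ne']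
  field_simp

theorem Am_pos : 0 < D.Am := by
  unfold Am
  have := Real.rpow_pos_of_pos D.T_pos (D.α - 1)
  have := min_le_left (1 / 2) (D.Λ⁻¹ / D.T ^ D.α)
  have : 0 < 1 - min (1 / 2) (D.Λ⁻¹ / D.T ^ D.α) := by linarith
  positivity

theorem Ap_pos : 0 < D.Ap := div_pos D.Λ_pos D.T_pos

theorem rpow_α_eq {t : ℝ} (ht : 0 < t) : t ^ D.α = t ^ (D.α - 1) * t := by
  rw [Real.rpow_sub_one ht.ne']; field_simp

theorem mul_rpow_le_lower : ∃ η > 0, ∀ t, 0 ≤ t → t ≤ D.T → η * t ^ D.α ≤ D.lower t := by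
  have hη : 0 < min (1 / 2) (D.Λ⁻¹ / D.T ^ D.α) := by
    have := Real.rpow_pos_of_pos D.T_pos D.α
    have := inv_pos.2 D.Λ_pos
    positivity
  refine ⟨_, hη, fun t ht htT => ?_⟩
  rcases ht.eq_or_lt with rfl | ht
  · simp [lower, Real.zero_rpow D.α_pos.ne']
  have h : D.T ^ (D.α - 1) ≤ t ^ (D.α - 1) :=
    Real.rpow_le_rpow_of_nonpos ht htT (by linarith [D.α_lt_one])
  have hm := min_le_left (1 / 2) (D.Λ⁻¹ / D.T ^ D.α)
  have : D.Am ≤ (1 - min (1 / 2) (D.Λ⁻¹ / D.T ^ D.α)) * t ^ (D.α - 1) := by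
    unfold Am
    exact mul_le_mul_of_nonneg_left h (by linarith)
  have : D.Am * t ≤ (1 - min (1 / 2) (D.Λ⁻¹ / D.T ^ D.α)) * t ^ D.α := by
    rw [D.rpow_α_eq ht, ← mul_assoc]
    exact mul_le_mul_of_nonneg_right this ht.le
  unfold lower
  linarith

theorem lower_pos {t : ℝ} (ht : 0 < t) (htT : t ≤ D.T) : 0 < D.lower t := by
  obtain ⟨η, hη, h⟩ := D.mul_rpow_le_lower
  exact (mul_pos hη (Real.rpow_pos_of_pos ht _)).trans_le (h t ht.le htT)

theorem lower_le_upper {t : ℝ} (ht : 0 ≤ t) : D.lower t ≤ D.upper t := by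
  unfold lower upper
  have := mul_nonneg D.Am_pos.le ht
  have := mul_nonneg D.Ap_pos.le ht
  linarith

theorem upper_pos {t : ℝ} (ht : 0 < t) : 0 < D.upper t :=
  add_pos (Real.rpow_pos_of_pos ht _) (mul_pos D.Ap_pos ht)

theorem rpow_mem_barriers {t : ℝ} (ht : 0 ≤ t) : t ^ D.α ∈ Icc (D.lower t) (D.upper t) := by
  unfold lower upper
  have := mul_nonneg D.Am_pos.le ht
  have := mul_nonneg D.Ap_pos.le ht
  constructor <;> linarith

theorem lower_T_le : D.lower D.T ≤ D.Λ⁻¹ := by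
  have hT := D.T_pos
  have hTα := Real.rpow_pos_of_pos D.T_pos D.α
  have : D.lower D.T = min (1 / 2) (D.Λ⁻¹ / D.T ^ D.α) * D.T ^ D.α := by
    unfold lower Am
    rw [mul_assoc, ← D.rpow_α_eq hT]; ring
  rw [this, ← le_div_iff₀ hTα]
  exact min_le_right _ _

theorem le_upper_T : D.Λ ≤ D.upper D.T := by
  have hT := D.T_pos
  have hTα := Real.rpow_pos_of_pos D.T_pos D.α
  unfold upper Ap
  rw [div_mul_cancel₀ _ hT.ne']
  linarith

theorem continuous_lower : Continuous D.lower := by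
  have := D.α_pos
  unfold lower
  exact (Real.continuous_rpow_const this.le).sub (continuous_const.mul continuous_id)

theorem continuous_upper : Continuous D.upper := by
  have := D.α_pos
  unfold upper
  exact (Real.continuous_rpow_const this.le).add (continuous_const.mul continuous_id)

/-! ### Lattice quantities -/

/-- The angles of the lattice. -/
noncomputable def ang (_ : Data) (N j : ℕ) : ℝ := j * (Real.pi / (2 * N))
/-- The sines of the lattice. -/
noncomputable def sn (N j : ℕ) : ℝ := Real.sin (D.ang N j)
/-- The labels of the lattice. -/
noncomputable def lab (N j : ℕ) : ℝ := - D.R * Real.cos (D.ang N j + Real.pi / (2 * N) / 2)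
/-- The increments of the labels. -/
noncomputable def Δ (N j : ℕ) : ℝ := 2 * D.R * Real.sin (Real.pi / (2 * N) / 2) * D.sn N j
/-- The profile at the nodes. -/
noncomputable def ph (N j : ℕ) : ℝ := (D.a₀ * D.sn N j ^ 2) ^ D.γ
/-- The flux coefficients. -/
noncomputable def β (N j : ℕ) : ℝ := D.θ / (1 + D.θ) * (D.a₀ * D.sn N j ^ 2) ^ (1 + D.γ)
/-- The discrete masses. -/
noncomputable def μ (N j : ℕ) : ℝ := (D.β N j - D.β N (j + 1)) / (D.κ * D.lab N j)

variable {D} {N : ℕ}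

theorem ang_succ (j : ℕ) : D.ang N (j + 1) = D.ang N j + Real.pi / (2 * N) := by
  unfold ang; push_cast; ring

theorem ang_pos (hN : 1 ≤ N) {j : ℕ} (hj : 1 ≤ j) : 0 < D.ang N j := by
  unfold ang
  have : (0 : ℝ) < N := by exact_mod_cast hN
  have : (0 : ℝ) < j := by exact_mod_cast hj
  have := Real.pi_pos
  positivity

theorem step_pos (hN : 1 ≤ N) : 0 < Real.pi / (2 * N) := by
  have : (0 : ℝ) < N := by exact_mod_cast hN
  have := Real.pi_pos
  positivity

theorem step_le (hN : 1 ≤ N) : Real.pi / (2 * N) ≤ Real.pi / 2 := by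
  have : (1 : ℝ) ≤ N := by exact_mod_cast hN
  have := Real.pi_pos
  gcongr
  linarith

theorem ang_two_mul (hN : 1 ≤ N) : D.ang N (2 * N) = Real.pi := by
  unfold ang
  have : (0 : ℝ) < N := by exact_mod_cast hN
  push_cast
  field_simp

theorem ang_mono (hN : 1 ≤ N) {i j : ℕ} (h : i ≤ j) : D.ang N i ≤ D.ang N j := by
  unfold ang
  have := (step_pos hN).le
  gcongr

theorem ang_nonneg (hN : 1 ≤ N) (j : ℕ) : 0 ≤ D.ang N j := by
  unfold ang
  have := (step_pos hN).le
  positivity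

theorem mid_mem (hN : 1 ≤ N) {j : ℕ} (hj : j < 2 * N) :
    D.ang N j + Real.pi / (2 * N) / 2 ∈ Ioo 0 Real.pi := by
  have h := ang_mono (D := D) hN (show j + 1 ≤ 2 * N from hj)
  rw [ang_two_mul hN, ang_succ] at h
  have := step_pos hN
  constructor <;> linarith [ang_nonneg (D := D) hN j]

theorem ang_lt_pi (hN : 1 ≤ N) {j : ℕ} (hj : j < 2 * N) : D.ang N j < Real.pi := by
  linarith [(mid_mem (D := D) hN hj).2, step_pos hN]

theorem sn_pos (hN : 1 ≤ N) {j : ℕ} (hj : 1 ≤ j) (hj' : j < 2 * N) : 0 < D.sn N j :=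
  Real.sin_pos_of_pos_of_lt_pi (ang_pos hN hj) (ang_lt_pi hN hj')

theorem sn_zero : D.sn N 0 = 0 := by simp [sn, ang]

theorem sn_two_mul (hN : 1 ≤ N) : D.sn N (2 * N) = 0 := by
  rw [sn, ang_two_mul hN, Real.sin_pi]

theorem β_zero : D.β N 0 = 0 := by
  have := D.γ_pos
  rw [β, sn_zero]; simp [Real.zero_rpow (by linarith : 1 + D.γ ≠ 0)]

theorem β_two_mul (hN : 1 ≤ N) : D.β N (2 * N) = 0 := by
  have := D.γ_pos
  rw [β, sn_two_mul hN]; simp [Real.zero_rpow (by linarith : 1 + D.γ ≠ 0)]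

theorem β_nonneg (N j : ℕ) : 0 ≤ D.β N j := by
  unfold β
  have := D.θ_pos
  have := D.a₀_pos
  positivity

theorem half_step_sin_pos (hN : 1 ≤ N) : 0 < Real.sin (Real.pi / (2 * N) / 2) := by
  have := step_pos hN
  have := step_le hN
  have := Real.pi_pos
  exact Real.sin_pos_of_pos_of_lt_pi (by linarith) (by linarith)

theorem Δ_pos (hN : 1 ≤ N) {j : ℕ} (hj : 1 ≤ j) (hj' : j < 2 * N) : 0 < D.Δ N j := by
  unfold Δ
  have := D.R_pos
  have := half_step_sin_pos hN
  have := sn_pos (D := D) hN hj hj'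
  positivity

theorem lab_succ_sub (j : ℕ) : D.lab N (j + 1) - D.lab N j = D.Δ N (j + 1) := by
  unfold lab Δ sn
  rw [ang_succ]
  generalize D.ang N j = x
  generalize hk : Real.pi / (2 * N) / 2 = k
  have hk' : Real.pi / (2 * N) = 2 * k := by rw [← hk]; ring
  rw [hk', show x + 2 * k + k = (x + 2 * k) + k by ring, show x + k = (x + 2 * k) - k by ring,
    Real.cos_add, Real.cos_sub]
  ring

theorem neg_R_lt_lab (hN : 1 ≤ N) {j : ℕ} (hj : j < 2 * N) : -D.R < D.lab N j := by
  have h := mid_mem (D := D) hN hj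
  have : Real.cos (D.ang N j + Real.pi / (2 * N) / 2) < 1 := by
    rw [← Real.cos_zero]
    exact Real.cos_lt_cos_of_nonneg_of_le_pi le_rfl h.2.le h.1
  unfold lab
  nlinarith [D.R_pos]

theorem lab_lt_R (hN : 1 ≤ N) {j : ℕ} (hj : j < 2 * N) : D.lab N j < D.R := by
  have h := mid_mem (D := D) hN hj
  have : -1 < Real.cos (D.ang N j + Real.pi / (2 * N) / 2) := by
    rw [← Real.cos_pi]
    exact Real.cos_lt_cos_of_nonneg_of_le_pi h.1.le le_rfl h.2
  unfold lab
  nlinarith [D.R_pos]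

theorem lab_ne_zero (hN : 1 ≤ N) (j : ℕ) : D.lab N j ≠ 0 := by
  unfold lab
  refine mul_ne_zero (by linarith [D.R_pos]) ?_
  rw [Ne, Real.cos_eq_zero_iff]
  rintro ⟨n, hn⟩
  unfold ang at hn
  have : (0 : ℝ) < N := by exact_mod_cast hN
  have hpi := Real.pi_ne_zero
  field_simp at hn
  have h2 : ((j * 2 + 1 : ℕ) : ℝ) = ((2 * n + 1) * (2 * N) : ℤ) := by push_cast; linarith
  have h3 : ((j * 2 + 1 : ℕ) : ℤ) = (2 * n + 1) * (2 * N) := by exact_mod_cast h2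
  have h4 : (2 * n + 1) * (2 * (N : ℤ)) = 2 * ((2 * n + 1) * N) := by ring
  rw [h4] at h3
  push_cast at h3
  omega

theorem μ_mul_lab (hN : 1 ≤ N) (j : ℕ) :
    D.κ * D.lab N j * D.μ N j = D.β N j - D.β N (j + 1) := by
  unfold μ
  rw [mul_div_cancel₀]
  exact mul_ne_zero D.κ_pos.ne' (lab_ne_zero hN j)

theorem sq_sn_sub (N j : ℕ) : D.sn N j ^ 2 - D.sn N (j + 1) ^ 2 =
    2 * Real.sin (D.ang N j + Real.pi / (2 * N) / 2) * Real.sin (Real.pi / (2 * N)) *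
      (D.lab N j / D.R) := by
  unfold lab sn
  rw [ang_succ]
  generalize D.ang N j = x
  generalize hk : Real.pi / (2 * N) / 2 = k
  have hk' : Real.pi / (2 * N) = 2 * k := by rw [← hk]; ring
  have hR := D.R_pos.ne'
  rw [hk', show x + 2 * k = (x + k) + k by ring]
  nth_rw 1 [show x = (x + k) - k by ring]
  generalize x + k = y
  rw [Real.sin_sub, Real.sin_add, Real.sin_two_mul]
  field_simp
  ring

theorem sin_mid_pos (hN : 1 ≤ N) {j : ℕ} (hj : j < 2 * N) :
    0 < Real.sin (D.ang N j + Real.pi / (2 * N) / 2) :=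
  Real.sin_pos_of_pos_of_lt_pi (mid_mem hN hj).1 (mid_mem hN hj).2

theorem sin_step_pos (hN : 1 ≤ N) : 0 < Real.sin (Real.pi / (2 * N)) :=
  Real.sin_pos_of_pos_of_lt_pi (step_pos hN) (by linarith [step_le hN, Real.pi_pos])

theorem exists_μ_eq (hN : 1 ≤ N) {j : ℕ} (hj : j < 2 * N) :
    ∃ ξ, 0 < ξ ∧ min (D.sn N j ^ 2) (D.sn N (j + 1) ^ 2) ≤ ξ ∧
      ξ ≤ max (D.sn N j ^ 2) (D.sn N (j + 1) ^ 2) ∧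
      D.μ N j = D.R * Real.sin (Real.pi / (2 * N)) *
        Real.sin (D.ang N j + Real.pi / (2 * N) / 2) * (D.a₀ * ξ) ^ D.γ := by
  have hγ := D.γ_pos
  have hθ := D.θ_pos
  have hc : D.θ / (1 + D.θ) * (1 + D.γ) = 1 := by unfold γ; field_simp; ring
  have key : ∀ x y : ℝ, 0 ≤ x → x < y → ∃ ξ, 0 < ξ ∧ x ≤ ξ ∧ ξ ≤ y ∧
      D.θ / (1 + D.θ) * (D.a₀ * x) ^ (1 + D.γ) - D.θ / (1 + D.θ) * (D.a₀ * y) ^ (1 + D.γ) =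
      (D.a₀ * ξ) ^ D.γ * D.a₀ * (x - y) := by
    intro x y hx hxy
    obtain ⟨z, hz, hz'⟩ := exists_hasDerivAt_eq_slope
      (fun s : ℝ => D.θ / (1 + D.θ) * (D.a₀ * s) ^ (1 + D.γ))
      (fun s : ℝ => (D.a₀ * s) ^ D.γ * D.a₀) hxy
      (by
        refine Continuous.continuousOn (continuous_const.mul ?_)
        exact (Real.continuous_rpow_const (by linarith)).comp (continuous_const.mul continuous_id))
      (fun s hs => by
        have h := ((hasDerivAt_id s).const_mul D.a₀).rpow_const (p := 1 + D.γ)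
          (Or.inr (by linarith))
        refine (h.const_mul (D.θ / (1 + D.θ))).congr_deriv ?_
        simp only [id, mul_one, add_sub_cancel_left]
        linear_combination ((D.a₀ * s) ^ D.γ * D.a₀) * hc)
    refine ⟨z, hx.trans_lt hz.1, hz.1.le, hz.2.le, ?_⟩
    have h1 : y - x ≠ 0 := by linarith
    rw [eq_div_iff h1] at hz'
    linarith
  have hk : ∃ ξ, 0 < ξ ∧ min (D.sn N j ^ 2) (D.sn N (j + 1) ^ 2) ≤ ξ ∧
      ξ ≤ max (D.sn N j ^ 2) (D.sn N (j + 1) ^ 2) ∧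
      D.β N j - D.β N (j + 1) = (D.a₀ * ξ) ^ D.γ * D.a₀ * (D.sn N j ^ 2 - D.sn N (j + 1) ^ 2) := by
    rcases lt_trichotomy (D.sn N j ^ 2) (D.sn N (j + 1) ^ 2) with h | h | h
    · obtain ⟨ξ, h0, h1, h2, h3⟩ := key _ _ (sq_nonneg _) h
      exact ⟨ξ, h0, (min_le_left _ _).trans h1, h2.trans (le_max_right _ _), h3⟩
    · exfalso
      have h1 := sq_sn_sub (D := D) N j
      rw [h, sub_self] at h1
      have h2 := sin_mid_pos (D := D) hN hj
      have h3 := sin_step_pos hN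
      have h4 : D.lab N j / D.R ≠ 0 := div_ne_zero (lab_ne_zero hN j) D.R_pos.ne'
      exact mul_ne_zero (by positivity) h4 h1.symm
    · obtain ⟨ξ, h0, h1, h2, h3⟩ := key _ _ (sq_nonneg _) h
      refine ⟨ξ, h0, (min_le_right _ _).trans h1, h2.trans (le_max_left _ _), ?_⟩
      simp only [β]
      linarith
  obtain ⟨ξ, h0, h1, h2, h3⟩ := hk
  refine ⟨ξ, h0, h1, h2, ?_⟩
  unfold μ
  rw [h3, sq_sn_sub]
  have hl := lab_ne_zero (D := D) hN j
  have hκ := D.κ_pos.ne'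
  have hR := D.R_pos.ne'
  have : D.a₀ = 1 / 2 * D.κ * D.R ^ 2 := rfl
  rw [div_eq_iff (mul_ne_zero hκ hl)]
  generalize (D.a₀ * ξ) ^ D.γ = w
  rw [this]
  field_simp

theorem μ_pos (hN : 1 ≤ N) {j : ℕ} (hj : j < 2 * N) : 0 < D.μ N j := by
  obtain ⟨ξ, h0, -, -, h⟩ := exists_μ_eq (D := D) hN hj
  rw [h]
  have h2 := sin_mid_pos (D := D) hN hj
  have h3 := sin_step_pos hN
  have := D.R_pos
  have := D.a₀_pos
  positivity

theorem ph_pos (hN : 1 ≤ N) {j : ℕ} (hj : 1 ≤ j) (hj' : j < 2 * N) : 0 < D.ph N j := by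
  have := sn_pos (D := D) hN hj hj'
  have := D.a₀_pos
  unfold ph; positivity

theorem β_eq_ph (N j : ℕ) : D.β N j = D.θ / (1 + D.θ) * D.ph N j ^ D.e := by
  unfold β ph
  have := D.θ_pos
  have := D.a₀_pos
  rw [← Real.rpow_mul (by positivity)]
  congr 2
  unfold γ e
  field_simp
  ring

end Data

/-! ### Existence for the discrete Lagrangian system -/

theorem second_diff_le {f f' f'' : ℝ → ℝ} {x h M : ℝ} (hh : 0 < h)
    (hf : ∀ y ∈ Icc (x - h) (x + h), HasDerivAt f (f' y) y)
    (hf' : ∀ y ∈ Icc (x - h) (x + h), HasDerivAt f' (f'' y) y)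
    (hM : ∀ y ∈ Icc (x - h) (x + h), f'' y ≤ M) :
    f (x + h) - 2 * f x + f (x - h) ≤ M * h ^ 2 := by
  have hq : AntitoneOn (fun y => f' y - M * (y - x)) (Icc (x - h) (x + h)) := by
    have hd : ∀ y ∈ Icc (x - h) (x + h), HasDerivAt (fun y => f' y - M * (y - x)) (f'' y - M * 1) y :=
      fun y hy => (hf' y hy).sub (((hasDerivAt_id y).sub_const x).const_mul M)
    exact antitoneOn_of_hasDerivWithinAt_nonpos (convex_Icc _ _)
      (fun y hy => (hd y hy).continuousAt.continuousWithinAt)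
      (fun y hy => (hd y (interior_subset hy)).hasDerivWithinAt)
      fun y hy => by linarith [hM y (interior_subset hy)]
  have key : ∀ y ∈ Icc (x - h) (x + h), HasDerivAt (fun y => f y - M * (y - x) ^ 2 / 2)
      (f' y - M * (y - x)) y := by
    intro y hy
    have h1 := ((((hasDerivAt_id y).sub_const x).pow 2).const_mul M).div_const 2
    refine ((hf y hy).sub h1).congr_deriv ?_
    simp only [id]
    push_cast
    ring
  have hx : x ∈ Icc (x - h) (x + h) := ⟨by linarith, by linarith⟩
  obtain ⟨y, hy, hy'⟩ := exists_hasDerivAt_eq_slope (fun y => f y - M * (y - x) ^ 2 / 2)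
    (fun y => f' y - M * (y - x)) (show x < x + h by linarith)
    (fun y hy => (key y ⟨by linarith [hy.1], hy.2⟩).continuousAt.continuousWithinAt)
    (fun y hy => key y ⟨by linarith [hy.1], hy.2.le⟩)
  obtain ⟨z, hz, hz'⟩ := exists_hasDerivAt_eq_slope (fun y => f y - M * (y - x) ^ 2 / 2)
    (fun y => f' y - M * (y - x)) (show x - h < x by linarith)
    (fun y hy => (key y ⟨hy.1, by linarith [hy.2]⟩).continuousAt.continuousWithinAt)
    (fun y hy => key y ⟨hy.1.le, by linarith [hy.2]⟩)
  have := hq ⟨hz.1.le, by linarith [hz.2]⟩ ⟨by linarith [hy.1], hy.2.le⟩ (hz.2.trans hy.1).le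
  simp only [hy', hz'] at this
  rw [show x + h - x = h by ring, show x - (x - h) = h by ring, div_le_div_iff_of_pos_right hh]
    at this
  have e1 : (x - h - x) ^ 2 = h ^ 2 := by ring
  rw [e1] at this
  linarith

namespace Data

variable {D : Data}

theorem rpow_hasDerivAt {y : ℝ} (hy : 0 < y) :
    HasDerivAt (fun s : ℝ => s ^ D.α) (D.α * y ^ (D.α - 1)) y :=
  Real.hasDerivAt_rpow_const (Or.inl hy.ne')

theorem rpow_hasDerivAt' {y : ℝ} (hy : 0 < y) :
    HasDerivAt (fun s : ℝ => D.α * s ^ (D.α - 1)) (- D.κ * y ^ (D.α - 2)) y := by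
  refine ((Real.hasDerivAt_rpow_const (p := D.α - 1) (Or.inl hy.ne')).const_mul D.α).congr_deriv ?_
  rw [show D.α - 1 - 1 = D.α - 2 by ring, κ]; ring

theorem second_diff_rpow_le {t h : ℝ} (hh : 0 < h) (hht : h < t) :
    (t + h) ^ D.α - 2 * t ^ D.α + (t - h) ^ D.α ≤ - D.κ * (t + h) ^ (D.α - 2) * h ^ 2 := by
  refine second_diff_le (f := fun s => s ^ D.α) hh (fun y hy => rpow_hasDerivAt (by linarith [hy.1]))
    (fun y hy => rpow_hasDerivAt' (by linarith [hy.1])) fun y hy => ?_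
  have hy0 : 0 < y := by linarith [hy.1]
  have := mul_le_mul_of_nonneg_left (Real.rpow_le_rpow_of_nonpos hy0 hy.2
    (show D.α - 2 ≤ 0 by linarith [D.α_lt_one])) D.κ_pos.le
  linarith

theorem le_second_diff_rpow {t h : ℝ} (hh : 0 < h) (hht : h < t) :
    - D.κ * (t - h) ^ (D.α - 2) * h ^ 2 ≤ (t + h) ^ D.α - 2 * t ^ D.α + (t - h) ^ D.α := by
  have := second_diff_le (f := fun s => - s ^ D.α) (M := D.κ * (t - h) ^ (D.α - 2)) hh
    (fun y hy => (rpow_hasDerivAt (D := D) (by linarith [hy.1])).neg)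
    (fun y hy => (rpow_hasDerivAt' (D := D) (by linarith [hy.1])).neg) fun y hy => by
      have hy0 : 0 < y := by linarith [hy.1]
      have := mul_le_mul_of_nonneg_left (Real.rpow_le_rpow_of_nonpos (by linarith) hy.1
        (show D.α - 2 ≤ 0 by linarith [D.α_lt_one])) D.κ_pos.le
      linarith
  linarith

theorem upper_discrete {t h : ℝ} (hh : 0 < h) (hht : h < t) (hA : h * t ^ (D.α - 2) ≤ D.Ap) :
    D.upper (t + h) - 2 * D.upper t + D.upper (t - h) ≤ - D.κ * D.upper t ^ (-D.e) * h ^ 2 := by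
  have ht : 0 < t := hh.trans hht
  have hα := D.α_pos
  have hα1 := D.α_lt_one
  have h1 : (t + h) ^ D.α ≤ D.upper t := by
    have e1 : t + h = t * (1 + h / t) := by field_simp
    have hht0 : 0 ≤ h / t := by positivity
    rw [e1, Real.mul_rpow ht.le (by linarith), upper]
    have : (1 + h / t) ^ D.α ≤ 1 + D.α * (h / t) :=
      rpow_one_add_le_one_add_mul_self (by linarith) hα.le hα1.le
    have h2 : t ^ D.α * (1 + h / t) ^ D.α ≤ t ^ D.α * (1 + 1 * (h / t)) := by
      gcongr
      exact this.trans (by gcongr)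
    have h3 := D.rpow_α_mul_div ht h
    have := mul_le_mul_of_nonneg_right hA ht.le
    linarith
  have h2 : D.upper t ^ (-D.e) ≤ (t + h) ^ (D.α - 2) := by
    rw [← D.rpow_α_neg_e (by linarith)]
    exact Real.rpow_le_rpow_of_nonpos (by positivity) h1 (by linarith [D.e_pos])
  have h3 := second_diff_rpow_le (D := D) hh hht
  have h4 : D.κ * D.upper t ^ (-D.e) * h ^ 2 ≤ D.κ * (t + h) ^ (D.α - 2) * h ^ 2 := by
    have := D.κ_pos
    gcongr
  have h5 : D.upper (t + h) - 2 * D.upper t + D.upper (t - h) =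
      (t + h) ^ D.α - 2 * t ^ D.α + (t - h) ^ D.α := by unfold upper; ring
  linarith

theorem lower_discrete {t h : ℝ} (hh : 0 < h) (hht : h < t) (htT : t ≤ D.T)
    (hA : h * t ^ (D.α - 2) ≤ D.Am) :
    - D.κ * D.lower t ^ (-D.e) * h ^ 2 ≤ D.lower (t + h) - 2 * D.lower t + D.lower (t - h) := by
  have ht : 0 < t := hh.trans hht
  have hα := D.α_pos
  have hα1 := D.α_lt_one
  have h1 : D.lower t ≤ (t - h) ^ D.α := by
    have hht1 : h / t ≤ 1 := by rw [div_le_one ht]; exact hht.le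
    have e1 : t - h = t * (1 - h / t) := by field_simp
    rw [e1, Real.mul_rpow ht.le (by linarith), lower]
    have : 1 - h / t ≤ (1 - h / t) ^ D.α := by
      refine Real.self_le_rpow_of_le_one (by linarith) ?_ hα1.le
      have : 0 < h / t := by positivity
      linarith
    have h2 : t ^ D.α * (1 - h / t) ≤ t ^ D.α * (1 - h / t) ^ D.α := by gcongr
    have h3 := D.rpow_α_mul_div ht h
    have := mul_le_mul_of_nonneg_right hA ht.le
    linarith
  have h2 : (t - h) ^ (D.α - 2) ≤ D.lower t ^ (-D.e) := by
    rw [← D.rpow_α_neg_e (by linarith)]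
    exact Real.rpow_le_rpow_of_nonpos (D.lower_pos ht htT) h1 (by linarith [D.e_pos])
  have h3 := le_second_diff_rpow (D := D) hh hht
  have h4 : D.κ * (t - h) ^ (D.α - 2) * h ^ 2 ≤ D.κ * D.lower t ^ (-D.e) * h ^ 2 := by
    have := D.κ_pos
    gcongr
  have h5 : D.lower (t + h) - 2 * D.lower t + D.lower (t - h) =
      (t + h) ^ D.α - 2 * t ^ D.α + (t - h) ^ D.α := by unfold lower; ring
  linarith

/-- The time step of the lattice. -/
noncomputable def dt (D : Data) (N : ℕ) : ℝ := D.T / N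

theorem dt_pos {N : ℕ} (hN : 1 ≤ N) : 0 < D.dt N := by
  have : (0 : ℝ) < N := by exact_mod_cast hN
  exact div_pos D.T_pos this

theorem N_mul_dt {N : ℕ} (hN : 1 ≤ N) : N * D.dt N = D.T := by
  have : (0 : ℝ) < N := by exact_mod_cast hN
  unfold dt; field_simp

theorem mul_dt_le {N i : ℕ} (hN : 1 ≤ N) (hi : i ≤ N) : i * D.dt N ≤ D.T := by
  rw [← N_mul_dt (D := D) hN]
  have := (dt_pos (D := D) hN).le
  gcongr

/-- Existence for the discrete equation satisfied by the Jacobian of the flow. -/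
theorem exists_discrete_jacobian {N i₀ : ℕ} (hN : 1 ≤ N) (hi₀ : 1 ≤ i₀) (hi₀N : i₀ ≤ N)
    (hAm : D.dt N * (i₀ * D.dt N) ^ (D.α - 2) ≤ D.Am)
    (hAp : D.dt N * (i₀ * D.dt N) ^ (D.α - 2) ≤ D.Ap) :
    ∃ P : ℕ → ℕ → ℝ, (∀ i j, i₀ ≤ i → i ≤ N → P i j ∈ Icc (D.lower (i * D.dt N)) (D.upper (i * D.dt N))) ∧
      (∀ j, i₀ < N → P i₀ j = (i₀ * D.dt N) ^ D.α) ∧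
      (∀ j, j + 1 < 2 * N → P N (j + 1) =
        (D.S (D.lab N (j + 1)) - D.S (D.lab N j)) / D.Δ N (j + 1)) ∧
      (∀ i j, i₀ ≤ i → i + 2 ≤ N → j + 1 < 2 * N →
        D.Δ N (j + 1) * (P (i + 2) (j + 1) - 2 * P (i + 1) (j + 1) + P i (j + 1)) / D.dt N ^ 2 =
        (D.β N (j + 2) * P (i + 1) (j + 2) ^ (-D.e) - D.β N (j + 1) * P (i + 1) (j + 1) ^ (-D.e)) /
          D.μ N (j + 1) -
        (D.β N (j + 1) * P (i + 1) (j + 1) ^ (-D.e) - D.β N j * P (i + 1) j ^ (-D.e)) /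
          D.μ N j) := by
  classical
  have hh := dt_pos (D := D) hN
  set h := D.dt N with hhdef
  have he := D.e_pos
  let lo : ℕ × ℕ → ℝ := fun x => D.lower (x.1 * h)
  let hi : ℕ × ℕ → ℝ := fun x => D.upper (x.1 * h)
  have hlohi : lo ≤ hi := fun x => D.lower_le_upper (by positivity)
  let inn : ℕ × ℕ → Prop := fun x => i₀ < x.1 ∧ x.1 < N ∧ 1 ≤ x.2 ∧ x.2 < 2 * N
  let data : ℕ × ℕ → ℝ := fun x => if x.1 = N ∧ 1 ≤ x.2 ∧ x.2 < 2 * N then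
    (D.S (D.lab N x.2) - D.S (D.lab N (x.2 - 1))) / D.Δ N x.2 else (x.1 * h) ^ D.α
  let Φ : ℕ × ℕ → ℝ → (ℕ × ℕ → ℝ) → ℝ := fun x y w => if inn x then
    - (D.Δ N x.2 * (w (x.1 + 1, x.2) - 2 * y + w (x.1 - 1, x.2)) / h ^ 2) +
      ((D.β N (x.2 + 1) * w (x.1, x.2 + 1) ^ (-D.e) - D.β N x.2 * y ^ (-D.e)) / D.μ N x.2 -
       (D.β N x.2 * y ^ (-D.e) - D.β N (x.2 - 1) * w (x.1, x.2 - 1) ^ (-D.e)) / D.μ N (x.2 - 1))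
    else y - data x
  have hpos : ∀ i : ℕ, i₀ ≤ i → i ≤ N → 0 < D.lower (i * h) := by
    intro i hi hiN
    have : (0 : ℝ) < i := by exact_mod_cast (by omega : 0 < i)
    exact D.lower_pos (by positivity) (mul_dt_le hN hiN)
  have hdata : ∀ x, data x ∈ Icc (lo x) (hi x) := by
    rintro ⟨i, j⟩
    simp only [data, lo, hi]
    split_ifs with hx
    · obtain ⟨rfl, h1, h2⟩ := hx
      obtain ⟨j, rfl⟩ : ∃ j', j = j' + 1 := ⟨j - 1, by omega⟩
      simp only [Nat.add_sub_cancel]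
      rw [hhdef, N_mul_dt hN]
      have hΔ := Δ_pos (D := D) hN h1 h2
      have hb := D.bilip (D.lab i j) (D.lab i (j + 1)) (neg_R_lt_lab hN (by omega)).le
        (by linarith [lab_succ_sub (D := D) (N := i) j]) (lab_lt_R hN h2).le
      rw [lab_succ_sub] at hb
      constructor
      · rw [le_div_iff₀ hΔ]
        exact (mul_le_mul_of_nonneg_right D.lower_T_le hΔ.le).trans hb.1
      · rw [div_le_iff₀ hΔ]
        exact hb.2.trans (mul_le_mul_of_nonneg_right D.le_upper_T hΔ.le)
    · exact D.rpow_mem_barriers (by positivity)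
  have hbar : ∀ i j : ℕ, i₀ < i → i < N → 1 ≤ j → j < 2 * N → ∀ f : ℝ,
      (D.β N (j + 1) * f - D.β N j * f) / D.μ N j -
       (D.β N j * f - D.β N (j - 1) * f) / D.μ N (j - 1) = - D.κ * D.Δ N j * f := by
    intro i j _ _ hj hj' f
    obtain ⟨j, rfl⟩ : ∃ j', j = j' + 1 := ⟨j - 1, by omega⟩
    simp only [Nat.add_sub_cancel]
    have h1 := μ_mul_lab (D := D) hN (j + 1)
    have h2 := μ_mul_lab (D := D) hN j
    have m1 := (μ_pos (D := D) hN hj').ne'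
    have m2 := (μ_pos (D := D) hN (show j < 2 * N by omega)).ne'
    rw [← lab_succ_sub, show D.β N (j + 1 + 1) * f - D.β N (j + 1) * f =
      - (D.κ * D.lab N (j + 1) * f) * D.μ N (j + 1) by linear_combination f * h1,
      show D.β N (j + 1) * f - D.β N j * f =
      - (D.κ * D.lab N j * f) * D.μ N j by linear_combination f * h2,
      mul_div_cancel_right₀ _ m1, mul_div_cancel_right₀ _ m2]
    ring
  have hstep : ∀ i : ℕ, i₀ < i → h * (i * h) ^ (D.α - 2) ≤ h * (i₀ * h) ^ (D.α - 2) := by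
    intro i hi
    have : (0 : ℝ) < i₀ := by exact_mod_cast hi₀
    have h1 : (i₀ : ℝ) ≤ i := by exact_mod_cast hi.le
    refine mul_le_mul_of_nonneg_left ?_ hh.le
    exact Real.rpow_le_rpow_of_nonpos (by positivity) (by gcongr) (by linarith [D.α_lt_one])
  have htlt : ∀ i : ℕ, i₀ < i → h < i * h := by
    intro i hi
    have : (1 : ℝ) < i := by exact_mod_cast (by omega : 1 < i)
    nlinarith
  have hμ : ∀ j, j < 2 * N → 0 < D.μ N j := fun j hj => μ_pos hN hj
  obtain ⟨w, hw, hw'⟩ := exists_solution_of_monotone_system lo hi hlohi Φ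
    (by
      rintro ⟨i, j⟩ w hw
      simp only [Φ]
      split_ifs with hx
      · obtain ⟨h1, h2, h3, h4⟩ := hx
        have hc : ContinuousOn (fun y : ℝ => y ^ (-D.e)) (Icc (lo (i, j)) (hi (i, j))) :=
          fun y hy => (Real.continuousAt_rpow_const _ _
            (Or.inl ((hpos i h1.le h2.le).trans_le hy.1).ne')).continuousWithinAt
        fun_prop
      · fun_prop)
    (by
      rintro ⟨i, j⟩ y w hw w' hw' hww'
      simp only [Φ]
      split_ifs with hx
      · obtain ⟨h1, h2, h3, h4⟩ := hx
        simp only at h1 h2 h3 h4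
        have hΔ := Δ_pos (D := D) hN h3 h4
        have k1 : w' (i, j + 1) ^ (-D.e) ≤ w (i, j + 1) ^ (-D.e) :=
          Real.rpow_le_rpow_of_nonpos ((hpos i h1.le h2.le).trans_le (hw.1 (i, j + 1))) (hww' _)
            (by linarith)
        have k2 : w' (i, j - 1) ^ (-D.e) ≤ w (i, j - 1) ^ (-D.e) :=
          Real.rpow_le_rpow_of_nonpos ((hpos i h1.le h2.le).trans_le (hw.1 (i, j - 1))) (hww' _)
            (by linarith)
        have k3 := hww' (i + 1, j)
        have k4 := hww' (i - 1, j)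
        have m1 := hμ j h4
        have m2 := hμ (j - 1) (by omega)
        have b1 := β_nonneg (D := D) N (j + 1)
        have b2 := β_nonneg (D := D) N (j - 1)
        gcongr
      · exact le_rfl)
    (by
      rintro ⟨i, j⟩
      simp only [Φ]
      split_ifs with hx
      · obtain ⟨h1, h2, h3, h4⟩ := hx
        simp only at h1 h2 h3 h4
        simp only [lo]
        rw [hbar i j h1 h2 h3 h4]
        have hb := lower_discrete (D := D) hh (htlt i h1) (mul_dt_le hN h2.le)
          ((hstep i h1).trans hAm)
        have c1 : ((i + 1 : ℕ) : ℝ) * h = i * h + h := by push_cast; ring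
        have c2 : ((i - 1 : ℕ) : ℝ) * h = i * h - h := by
          rw [Nat.cast_sub (by omega)]; push_cast; ring
        rw [c1, c2]
        have hΔ := Δ_pos (D := D) hN h3 h4
        have := (le_div_iff₀ (by positivity : 0 < h ^ 2)).2 hb
        have := mul_le_mul_of_nonneg_left this hΔ.le
        rw [mul_div_assoc]
        linarith
      · linarith [(hdata (i, j)).1])
    (by
      rintro ⟨i, j⟩
      simp only [Φ]
      split_ifs with hx
      · obtain ⟨h1, h2, h3, h4⟩ := hx
        simp only at h1 h2 h3 h4
        simp only [hi]
        rw [hbar i j h1 h2 h3 h4]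
        have hb := upper_discrete (D := D) hh (htlt i h1) ((hstep i h1).trans hAp)
        have c1 : ((i + 1 : ℕ) : ℝ) * h = i * h + h := by push_cast; ring
        have c2 : ((i - 1 : ℕ) : ℝ) * h = i * h - h := by
          rw [Nat.cast_sub (by omega)]; push_cast; ring
        rw [c1, c2]
        have hΔ := Δ_pos (D := D) hN h3 h4
        have := (div_le_iff₀ (by positivity : 0 < h ^ 2)).2 hb
        have := mul_le_mul_of_nonneg_left this hΔ.le
        rw [mul_div_assoc]
        linarith
      · linarith [(hdata (i, j)).2])
  refine ⟨fun i j => w (i, j), fun i j hi hiN => ⟨hw.1 (i, j), hw.2 (i, j)⟩, ?_, ?_, ?_⟩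
  · intro j hlt
    have h1 := hw' (i₀, j)
    simp only [Φ, inn, data] at h1
    rw [if_neg (by omega), if_neg (by omega)] at h1
    linarith
  · intro j hj
    have h1 := hw' (N, j + 1)
    simp only [Φ, inn, data] at h1
    rw [if_neg (by omega), if_pos (by simp; omega)] at h1
    simp only [Nat.add_sub_cancel] at h1
    linarith
  · intro i j hi hiN hj
    have h1 := hw' (i + 1, j + 1)
    simp only [Φ, inn] at h1
    rw [if_pos (by omega)] at h1
    simp only [Nat.add_sub_cancel] at h1
    linarith

/-- Constant controlling the distance of the flow to the self-similar flow. -/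
noncomputable def C₀ (D : Data) : ℝ := 4 * D.R * (D.Am + D.Ap) + (|D.S 0| + D.Λ * D.R) / D.T

/-- A discrete Lagrangian flow `X`, with Jacobian `P`, on the time interval
`[i₀ T / N, T]`. -/
structure DiscreteFlow (D : Data) (N i₀ : ℕ) (P X : ℕ → ℕ → ℝ) : Prop where
  one_le : 1 ≤ i₀
  lt : i₀ < N
  rel : ∀ i j, i₀ ≤ i → i ≤ N → j + 1 < 2 * N →
    X i (j + 1) - X i j = D.Δ N (j + 1) * P i (j + 1)
  eqn : ∀ i j, i₀ ≤ i → i + 2 ≤ N → j < 2 * N →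
    D.μ N j * (X (i + 2) j - 2 * X (i + 1) j + X i j) / D.dt N ^ 2 =
      D.β N (j + 1) * P (i + 1) (j + 1) ^ (-D.e) - D.β N j * P (i + 1) j ^ (-D.e)
  bounds : ∀ i j, i₀ ≤ i → i ≤ N → P i j ∈ Icc (D.lower (i * D.dt N)) (D.upper (i * D.dt N))
  center : ∀ i j, i₀ ≤ i → i ≤ N → j < 2 * N →
    |X i j - (i * D.dt N) ^ D.α * D.lab N j| ≤ D.C₀ * (i * D.dt N)
  terminal : ∀ j, j < 2 * N → X N j = D.S (D.lab N j)

theorem abs_S_le {r : ℝ} (hr : r ∈ Icc (-D.R) D.R) : |D.S r| ≤ |D.S 0| + D.Λ * D.R := by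
  have hR := D.R_pos
  have hΛ := D.Λ_pos
  have hΛ' := inv_pos.2 hΛ
  have : |D.S r - D.S 0| ≤ D.Λ * D.R := by
    rcases le_total r 0 with h | h
    · have := D.bilip r 0 hr.1 h hR.le
      rw [abs_le]
      constructor <;> nlinarith [hr.1]
    · have := D.bilip 0 r (by linarith) h hr.2
      rw [abs_le]
      constructor <;> nlinarith [hr.2]
  have := abs_sub_abs_le_abs_sub (D.S r) (D.S 0)
  linarith

theorem sum_μ_mul_lab {N : ℕ} (hN : 1 ≤ N) :
    ∑ j ∈ Finset.range (2 * N), D.μ N j * D.lab N j = 0 := by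
  have h : D.κ * ∑ j ∈ Finset.range (2 * N), D.μ N j * D.lab N j = 0 := by
    rw [Finset.mul_sum]
    calc _ = ∑ j ∈ Finset.range (2 * N), (D.β N j - D.β N (j + 1)) :=
          Finset.sum_congr rfl fun j _ => by rw [← μ_mul_lab hN]; ring
      _ = 0 := by rw [Finset.sum_range_sub', β_zero, β_two_mul hN]; simp
  exact (mul_eq_zero.1 h).resolve_left D.κ_pos.ne'

theorem exists_discreteFlow {N i₀ : ℕ} (hi₀ : 1 ≤ i₀) (hi₀N : i₀ < N)
    (hAm : D.dt N * (i₀ * D.dt N) ^ (D.α - 2) ≤ D.Am)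
    (hAp : D.dt N * (i₀ * D.dt N) ^ (D.α - 2) ≤ D.Ap) :
    ∃ P X : ℕ → ℕ → ℝ, D.DiscreteFlow N i₀ P X := by
  have hN : 1 ≤ N := by omega
  obtain ⟨P, hb, hinit, hterm, heq⟩ := exists_discrete_jacobian hN hi₀ hi₀N.le hAm hAp
  have hh := dt_pos (D := D) hN
  set h := D.dt N with hhdef
  set w := D.μ N with hw
  have hwpos : ∀ j ∈ Finset.range (2 * N), 0 < w j := fun j hj => μ_pos hN (Finset.mem_range.1 hj)
  set M := ∑ j ∈ Finset.range (2 * N), w j with hM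
  have hMpos : 0 < M := Finset.sum_pos hwpos ⟨0, by simp; omega⟩
  set s : ℕ → ℕ → ℝ := fun i j => ∑ l ∈ Finset.range j, D.Δ N (l + 1) * P i (l + 1) with hs
  set avg : (ℕ → ℝ) → ℝ := fun f => (∑ j ∈ Finset.range (2 * N), w j * f j) / M with havg
  have avg_const_add : ∀ (f : ℕ → ℝ) (x : ℝ), avg (fun j => f j + x) = avg f + x := by
    intro f x
    simp only [havg, mul_add, Finset.sum_add_distrib, ← Finset.sum_mul]
    rw [add_div, ← hM]; field_simp
  have avg_le : ∀ (f : ℕ → ℝ) (x : ℝ), (∀ j, j < 2 * N → |f j| ≤ x) → |avg f| ≤ x := by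
    intro f x hf
    simp only [havg]
    rw [abs_div, abs_of_pos hMpos, div_le_iff₀ hMpos, hM, Finset.mul_sum]
    refine (Finset.abs_sum_le_sum_abs _ _).trans (Finset.sum_le_sum fun j hj => ?_)
    rw [abs_mul, abs_of_pos (hwpos j hj), mul_comm]
    exact mul_le_mul_of_nonneg_right (hf j (Finset.mem_range.1 hj)) (hwpos j hj).le
  set ℓN := avg (fun j => D.S (D.lab N j)) with hℓN
  set ℓ : ℕ → ℝ := fun i => ((i : ℝ) - i₀) / ((N : ℝ) - i₀) * ℓN with hℓ
  have hNi : (0 : ℝ) < (N : ℝ) - i₀ := by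
    have : (i₀ : ℝ) < N := by exact_mod_cast hi₀N
    linarith
  set X : ℕ → ℕ → ℝ := fun i j => s i j - avg (s i) + ℓ i with hX
  have hrel : ∀ i j, X i (j + 1) - X i j = D.Δ N (j + 1) * P i (j + 1) := by
    intro i j
    simp only [hX, hs, Finset.sum_range_succ]
    ring
  have havgX : ∀ i, avg (X i) = ℓ i := by
    intro i
    have : X i = fun j => s i j + (ℓ i - avg (s i)) := by funext j; simp only [hX]; ring
    rw [this, avg_const_add]; ring
  refine ⟨P, X, hi₀, hi₀N, fun i j _ _ _ => hrel i j, ?_, hb, ?_, ?_⟩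
  · intro i j hi hiN hj
    set E : ℕ → ℝ := fun j => w j * (X (i + 2) j - 2 * X (i + 1) j + X i j) / h ^ 2 -
      (D.β N (j + 1) * P (i + 1) (j + 1) ^ (-D.e) - D.β N j * P (i + 1) j ^ (-D.e)) with hE
    have hstep : ∀ j, j + 1 < 2 * N → E (j + 1) / w (j + 1) = E j / w j := by
      intro j hj
      have h1 : w (j + 1) ≠ 0 := (μ_pos (D := D) hN hj).ne'
      have h2 : w j ≠ 0 := (μ_pos (D := D) hN (show j < 2 * N by omega)).ne'
      have h3 := heq i j hi hiN hj
      have key : ∀ w Y : ℝ, w ≠ 0 → w * Y / h ^ 2 / w = Y / h ^ 2 := by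
        intro w Y hw
        field_simp
      have r1 := hrel (i + 2) j
      have r2 := hrel (i + 1) j
      have r3 := hrel i j
      simp only [hE]
      rw [sub_div (w (j + 1) * _ / _), sub_div (w j * _ / _), key _ _ h1, key _ _ h2]
      have e1 : (X (i + 2) (j + 1) - 2 * X (i + 1) (j + 1) + X i (j + 1)) =
        (X (i + 2) j - 2 * X (i + 1) j + X i j) +
        D.Δ N (j + 1) * (P (i + 2) (j + 1) - 2 * P (i + 1) (j + 1) + P i (j + 1)) := by linarith
      rw [e1, add_div]
      simp only [hw]
      linarith
    have hconst : ∀ j, j < 2 * N → E j / w j = E 0 / w 0 := by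
      intro j
      induction j with
      | zero => intro _; rfl
      | succ j ih => intro hj; rw [hstep j hj, ih (by omega)]
    have hEj : ∀ j, j < 2 * N → E j = w j * (E 0 / w 0) := by
      intro j hj
      have := (μ_pos (D := D) hN hj).ne'
      rw [← hconst j hj, mul_div_cancel₀]
      exact this
    have hsumE : ∑ j ∈ Finset.range (2 * N), E j = 0 := by
      simp only [hE, Finset.sum_sub_distrib]
      rw [← Finset.sum_sub_distrib (f := fun j => D.β N (j + 1) * P (i + 1) (j + 1) ^ (-D.e))
          (g := fun j => D.β N j * P (i + 1) j ^ (-D.e)),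
        Finset.sum_range_sub (fun j => D.β N j * P (i + 1) j ^ (-D.e)), β_zero, β_two_mul hN,
        ← Finset.sum_div]
      have a1 : ∀ i, ∑ j ∈ Finset.range (2 * N), w j * X i j = M * ℓ i := by
        intro i
        have := havgX i
        simp only [havg] at this
        rw [div_eq_iff hMpos.ne'] at this
        linarith
      have : ∑ j ∈ Finset.range (2 * N), w j * (X (i + 2) j - 2 * X (i + 1) j + X i j) = 0 := by
        calc _ = ∑ j ∈ Finset.range (2 * N), w j * X (i + 2) j -
              2 * ∑ j ∈ Finset.range (2 * N), w j * X (i + 1) j +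
              ∑ j ∈ Finset.range (2 * N), w j * X i j := by
              rw [Finset.mul_sum, ← Finset.sum_sub_distrib, ← Finset.sum_add_distrib]
              exact Finset.sum_congr rfl fun j _ => by ring
          _ = 0 := by
              rw [a1, a1, a1]
              simp only [hℓ]
              push_cast
              field_simp
              ring
      rw [this]; simp
    have hE0 : E 0 / w 0 = 0 := by
      rw [Finset.sum_congr rfl fun j hj => hEj j (Finset.mem_range.1 hj), ← Finset.sum_mul,
        ← hM] at hsumE
      exact (mul_eq_zero.1 hsumE).resolve_left hMpos.ne'
    have := hEj j hj
    rw [hE0, mul_zero] at this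
    simp only [hE] at this
    linarith
  · intro i j hi hiN hj
    have ht : 0 ≤ i * h := by positivity
    set t := (i : ℝ) * h with htdef
    set W : ℕ → ℝ := fun j => s i j - t ^ D.α * (D.lab N j - D.lab N 0) with hW
    have hsΔ : ∀ j, ∑ l ∈ Finset.range j, D.Δ N (l + 1) = D.lab N j - D.lab N 0 := by
      intro j
      rw [← Finset.sum_range_sub (D.lab N)]
      exact Finset.sum_congr rfl fun l _ => (lab_succ_sub l).symm
    have hWle : ∀ j, j < 2 * N → |W j| ≤ 2 * D.R * (D.Am + D.Ap) * t := by
      intro j hj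
      have e1 : W j = ∑ l ∈ Finset.range j, D.Δ N (l + 1) * (P i (l + 1) - t ^ D.α) := by
        simp only [hW, hs]
        rw [← hsΔ, Finset.mul_sum, ← Finset.sum_sub_distrib]
        exact Finset.sum_congr rfl fun l _ => by ring
      rw [e1]
      calc _ ≤ ∑ l ∈ Finset.range j, |D.Δ N (l + 1) * (P i (l + 1) - t ^ D.α)| :=
            Finset.abs_sum_le_sum_abs _ _
        _ ≤ ∑ l ∈ Finset.range j, D.Δ N (l + 1) * ((D.Am + D.Ap) * t) := by
            refine Finset.sum_le_sum fun l hl => ?_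
            have hl' := Finset.mem_range.1 hl
            have hΔ := Δ_pos (D := D) hN (show 1 ≤ l + 1 by omega) (by omega)
            rw [abs_mul, abs_of_pos hΔ]
            refine mul_le_mul_of_nonneg_left ?_ hΔ.le
            have hbb := hb i (l + 1) hi hiN
            have h1 : t ^ D.α - D.Am * t ≤ P i (l + 1) := hbb.1
            have h2 : P i (l + 1) ≤ t ^ D.α + D.Ap * t := hbb.2
            have := mul_nonneg D.Am_pos.le ht
            have := mul_nonneg D.Ap_pos.le ht
            rw [abs_le]
            constructor <;> linarith
        _ = (D.lab N j - D.lab N 0) * ((D.Am + D.Ap) * t) := by rw [← Finset.sum_mul, hsΔ]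
        _ ≤ (2 * D.R) * ((D.Am + D.Ap) * t) := by
            have := mul_nonneg (add_pos D.Am_pos D.Ap_pos).le ht
            refine mul_le_mul_of_nonneg_right ?_ this
            linarith [lab_lt_R (D := D) hN hj, neg_R_lt_lab (D := D) hN (show 0 < 2 * N by omega)]
        _ = _ := by ring
    have havgs : avg (s i) = avg W - t ^ D.α * D.lab N 0 := by
      have e1 : avg (fun j => t ^ D.α * D.lab N j) = 0 := by
        simp only [havg]
        rw [show ∑ j ∈ Finset.range (2 * N), w j * (t ^ D.α * D.lab N j) =
          t ^ D.α * ∑ j ∈ Finset.range (2 * N), w j * D.lab N j by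
            rw [Finset.mul_sum]; exact Finset.sum_congr rfl fun l _ => by ring,
          sum_μ_mul_lab hN]
        simp
      have e2 : avg (s i) = avg (fun j => W j - t ^ D.α * D.lab N 0) +
          avg (fun j => t ^ D.α * D.lab N j) := by
        simp only [havg]
        rw [← add_div, ← Finset.sum_add_distrib]
        congr 1
        refine Finset.sum_congr rfl fun l _ => ?_
        simp only [hW]; ring
      rw [e2, e1, add_zero]
      have := avg_const_add W (- (t ^ D.α * D.lab N 0))
      simpa [sub_eq_add_neg] using this
    have hℓle : |ℓ i| ≤ (|D.S 0| + D.Λ * D.R) / D.T * t := by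
      have h1 : |ℓN| ≤ |D.S 0| + D.Λ * D.R := avg_le _ _ fun j hj =>
        abs_S_le ⟨(neg_R_lt_lab hN hj).le, (lab_lt_R hN hj).le⟩
      have h2 : ((i : ℝ) - i₀) / ((N : ℝ) - i₀) ≤ t / D.T := by
        rw [htdef, ← N_mul_dt (D := D) hN, ← hhdef, mul_div_mul_right _ _ hh.ne']
        have hN0 : (0 : ℝ) < N := by exact_mod_cast hN
        rw [div_le_div_iff₀ hNi hN0]
        have : (i : ℝ) ≤ N := by exact_mod_cast hiN
        have := mul_le_mul_of_nonneg_right this (show (0 : ℝ) ≤ i₀ by positivity)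
        nlinarith
      have h3 : 0 ≤ ((i : ℝ) - i₀) / ((N : ℝ) - i₀) := by
        have : (i₀ : ℝ) ≤ i := by exact_mod_cast hi
        exact div_nonneg (by linarith) hNi.le
      simp only [hℓ]
      rw [abs_mul, abs_of_nonneg h3]
      calc _ ≤ t / D.T * (|D.S 0| + D.Λ * D.R) :=
            mul_le_mul h2 h1 (abs_nonneg _) (h3.trans h2)
        _ = _ := by ring
    have e3 : X i j - t ^ D.α * D.lab N j = W j - avg W + ℓ i := by
      simp only [hX, hW] at havgs ⊢
      rw [havgs]
      ring
    rw [e3]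
    have h1 := hWle j hj
    have h2 := avg_le W _ hWle
    calc _ ≤ |W j| + |avg W| + |ℓ i| := (abs_add_le _ _).trans (by gcongr; exact abs_sub _ _)
      _ ≤ _ := by unfold C₀; linarith
  · intro j hj
    have hsj : ∀ j, j < 2 * N → s N j = D.S (D.lab N j) + (- D.S (D.lab N 0)) := by
      intro j hj
      rw [← sub_eq_add_neg, ← Finset.sum_range_sub (fun j => D.S (D.lab N j))]
      refine Finset.sum_congr rfl fun l hl => ?_
      have hl' := Finset.mem_range.1 hl
      rw [hterm l (by omega), mul_div_cancel₀]
      exact (Δ_pos (D := D) hN (show 1 ≤ l + 1 by omega) (by omega)).ne'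
    have e1 : avg (s N) = ℓN - D.S (D.lab N 0) := by
      rw [hℓN, sub_eq_add_neg, ← avg_const_add]
      simp only [havg]
      congr 1
      refine Finset.sum_congr rfl fun l hl => ?_
      rw [hsj l (Finset.mem_range.1 hl)]
    have e2 : ℓ N = ℓN := by
      simp only [hℓ]
      rw [div_self hNi.ne', one_mul]
    simp only [hX]
    rw [e1, e2, hsj j hj]
    ring

end Data

namespace Data

/-- The inverse discrete density. -/
noncomputable def spec (D : Data) (N : ℕ) (P : ℕ → ℕ → ℝ) (i j : ℕ) : ℝ := P i j / D.ph N j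

/-- The discrete velocity. -/
noncomputable def vel (D : Data) (N : ℕ) (X : ℕ → ℕ → ℝ) (i j : ℕ) : ℝ :=
  (X (i + 1) j - X i j) / D.dt N

/-- The weight linking time increments of `spec` and space increments of `vel`. -/
noncomputable def wtA (D : Data) (N : ℕ) (_ j : ℕ) : ℝ := D.Δ N j * D.ph N j / D.dt N

/-- The weight linking space increments of `spec` and time increments of `vel`. -/
noncomputable def wtB (D : Data) (N : ℕ) (P : ℕ → ℕ → ℝ) (i j : ℕ) : ℝ :=
  D.dt N * (D.θ / (1 + D.θ)) / D.μ N j * negSlope D.e (D.spec N P i (j + 1)) (D.spec N P i j)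

variable {D : Data} {N i₀ : ℕ} {P X : ℕ → ℕ → ℝ}

namespace DiscreteFlow

theorem N_pos (h : D.DiscreteFlow N i₀ P X) : 1 ≤ N := h.one_le.trans h.lt.le

theorem lower_time_pos (h : D.DiscreteFlow N i₀ P X) {i : ℕ} (hi : i₀ ≤ i) (hiN : i ≤ N) :
    0 < D.lower (i * D.dt N) := by
  have hN := h.N_pos
  have := dt_pos (D := D) hN
  have hi' : (0 : ℝ) < i := by exact_mod_cast h.one_le.trans hi
  refine D.lower_pos (by positivity) ?_
  rw [← N_mul_dt (D := D) hN]
  gcongr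

theorem P_pos (h : D.DiscreteFlow N i₀ P X) {i : ℕ} (hi : i₀ ≤ i) (hiN : i ≤ N) (j : ℕ) :
    0 < P i j :=
  (h.lower_time_pos hi hiN).trans_le (h.bounds i j hi hiN).1

theorem β_mul_rpow (h : D.DiscreteFlow N i₀ P X) {i j : ℕ} (hi : i₀ ≤ i) (hiN : i ≤ N)
    (hj : 1 ≤ j) (hj' : j < 2 * N) :
    D.β N j * P i j ^ (-D.e) = D.θ / (1 + D.θ) * D.spec N P i j ^ (-D.e) := by
  have h1 := ph_pos (D := D) h.N_pos hj hj'
  have h2 := h.P_pos hi hiN j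
  rw [β_eq_ph, spec, Real.div_rpow h2.le h1.le, Real.rpow_neg h1.le D.e]
  have := Real.rpow_pos_of_pos h1 D.e
  field_simp

theorem vel_succ_fst (h : D.DiscreteFlow N i₀ P X) {i j : ℕ} (hi : i₀ ≤ i) (hiN : i + 1 ≤ N)
    (hj' : j + 1 < 2 * N) :
    D.vel N X i (j + 1) - D.vel N X i j =
      D.wtA N i (j + 1) * (D.spec N P (i + 1) (j + 1) - D.spec N P i (j + 1)) := by
  have h1 := ph_pos (D := D) h.N_pos (show 1 ≤ j + 1 by omega) hj'
  have h2 := dt_pos (D := D) h.N_pos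
  have e1 := h.rel (i + 1) j (by omega) hiN hj'
  have e2 := h.rel i j hi (by omega) hj'
  simp only [vel, wtA, spec]
  field_simp
  linarith

theorem vel_succ_snd (h : D.DiscreteFlow N i₀ P X) {i j : ℕ} (hi : i₀ ≤ i) (hiN : i + 2 ≤ N)
    (hj : 1 ≤ j) (hj' : j + 1 < 2 * N) :
    D.vel N X (i + 1) j - D.vel N X i j = D.dt N * (D.θ / (1 + D.θ)) / D.μ N j *
      (D.spec N P (i + 1) (j + 1) ^ (-D.e) - D.spec N P (i + 1) j ^ (-D.e)) := by
  have h1 := μ_pos (D := D) h.N_pos (show j < 2 * N by omega)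
  have h2 := dt_pos (D := D) h.N_pos
  have e1 := h.eqn i j hi hiN (by omega)
  rw [h.β_mul_rpow (by omega) (by omega) (by omega) hj',
    h.β_mul_rpow (by omega) (by omega) hj (by omega), ← mul_sub] at e1
  have e2 : D.vel N X (i + 1) j - D.vel N X i j = D.dt N / D.μ N j *
      (D.μ N j * (X (i + 2) j - 2 * X (i + 1) j + X i j) / D.dt N ^ 2) := by
    simp only [vel]
    field_simp
    ring
  rw [e2, e1]
  ring

theorem vel_succ_snd' (h : D.DiscreteFlow N i₀ P X) {i j : ℕ} (hi : i₀ ≤ i) (hiN : i + 2 ≤ N)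
    (hj : 1 ≤ j) (hj' : j + 1 < 2 * N) :
    D.vel N X (i + 1) j - D.vel N X i j =
      - D.wtB N P (i + 1) j * (D.spec N P (i + 1) (j + 1) - D.spec N P (i + 1) j) := by
  rw [h.vel_succ_snd hi hiN hj hj', wtB, neg_mul, mul_assoc, negSlope_mul]
  ring

theorem conjPair (h : D.DiscreteFlow N i₀ P X) {i₁ j₁ M₁ M₂ : ℕ} (hi : i₀ ≤ i₁)
    (hiN : i₁ + M₁ + 1 ≤ N) (hj : 1 ≤ j₁) (hj' : j₁ + M₂ + 1 < 2 * N) :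
    ConjPair M₁ M₂ (fun i j => D.wtA N (i₁ + i) (j₁ + j)) (fun i j => D.wtB N P (i₁ + i) (j₁ + j))
      (fun i j => D.spec N P (i₁ + i) (j₁ + j)) (fun i j => D.vel N X (i₁ + i) (j₁ + j)) := by
  constructor
  · intro i j hi' hj''
    exact h.vel_succ_fst (i := i₁ + i) (j := j₁ + j) (by omega) (by omega) (by omega)
  · intro i j hi' hj''
    exact h.vel_succ_snd' (i := i₁ + i) (j := j₁ + j) (by omega) (by omega) (by omega) (by omega)

end DiscreteFlow

theorem sn_add_sn (N j : ℕ) : D.sn N j + D.sn N (j + 1) =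
    2 * Real.sin (D.ang N j + Real.pi / (2 * N) / 2) * Real.cos (Real.pi / (2 * N) / 2) := by
  unfold sn
  rw [ang_succ]
  generalize D.ang N j = x
  generalize hk : Real.pi / (2 * N) / 2 = k
  have e1 : x = (x + k) - k := by ring
  have e2 : x + Real.pi / (2 * N) = (x + k) + k := by rw [← hk]; ring
  rw [e2]
  generalize x + k = y at e1 ⊢
  rw [e1, Real.sin_sub, Real.sin_add]
  ring

theorem sin_mid_bounds (hN : 1 ≤ N) {j : ℕ} {s t : ℝ} (hs : 0 ≤ s)
    (h1 : D.sn N j ∈ Icc s t) (h2 : D.sn N (j + 1) ∈ Icc s t) :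
    Real.sin (D.ang N j + Real.pi / (2 * N) / 2) ∈ Icc s (2 * t) := by
  have hk := step_pos hN
  have hk' := step_le hN
  have hpi := Real.pi_pos
  have h := sn_add_sn (D := D) N j
  set q := Real.sin (D.ang N j + Real.pi / (2 * N) / 2)
  have hc1 : Real.cos (Real.pi / (2 * N) / 2) ≤ 1 := Real.cos_le_one _
  have hc2 : 1 / 2 ≤ Real.cos (Real.pi / (2 * N) / 2) := by
    rw [← Real.cos_pi_div_three]
    exact Real.cos_le_cos_of_nonneg_of_le_pi (by linarith) (by linarith) (by linarith)
  have hq : 0 ≤ q := by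
    by_contra hq
    push Not at hq
    nlinarith [h1.1, h2.1]
  constructor
  · nlinarith [h1.1, h2.1]
  · nlinarith [h1.2, h2.2]

theorem step_div_dt (hN : 1 ≤ N) : Real.pi / (2 * N) = Real.pi / (2 * D.T) * D.dt N := by
  have := D.T_pos
  have : (0 : ℝ) < N := by exact_mod_cast hN
  unfold dt
  field_simp

theorem sin_step_bounds (hN : 1 ≤ N) :
    Real.sin (Real.pi / (2 * N)) ∈ Icc (D.dt N / D.T) (Real.pi / (2 * D.T) * D.dt N) ∧
    Real.sin (Real.pi / (2 * N) / 2) ∈ Icc (D.dt N / D.T / 2) (Real.pi / (4 * D.T) * D.dt N) := by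
  have hk := step_pos hN
  have hk' := step_le hN
  have hpi := Real.pi_pos
  have hT := D.T_pos
  have e := step_div_dt (D := D) hN
  refine ⟨⟨?_, ?_⟩, ?_, ?_⟩
  · refine le_trans (le_of_eq ?_) (Real.mul_le_sin hk.le hk')
    rw [e]; field_simp
  · rw [← e]; exact Real.sin_le hk.le
  · refine le_trans (le_of_eq ?_) (Real.mul_le_sin (by linarith) (by linarith))
    rw [e]; field_simp
  · refine (Real.sin_le (by linarith)).trans (le_of_eq ?_)
    rw [e]; field_simp; ring

/-- The size of the profile at nodes where the sine is of size `s`. -/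
noncomputable def prof (D : Data) (s : ℝ) : ℝ := (D.a₀ * s ^ 2) ^ D.γ

theorem prof_pos {s : ℝ} (hs : 0 < s) : 0 < D.prof s := by
  have := D.a₀_pos
  unfold prof; positivity

theorem prof_mono {s t : ℝ} (hs : 0 ≤ s) (h : s ≤ t) : D.prof s ≤ D.prof t := by
  have := D.a₀_pos
  have := D.γ_pos
  unfold prof
  gcongr

theorem prof_mul {s L : ℝ} : D.prof (L * s) = (L ^ 2) ^ D.γ * D.prof s := by
  have := D.a₀_pos
  unfold prof
  rw [← Real.mul_rpow (by positivity) (by positivity)]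
  congr 1
  ring

theorem prof_rpow_e {s : ℝ} (hs : 0 < s) :
    D.prof s ^ (D.e + 1) = D.a₀ * s ^ 2 * D.prof s ^ 2 := by
  have h := D.prof_pos hs
  have ha := D.a₀_pos
  have hθ := D.θ_pos
  have : D.e + 1 = D.θ + (2 : ℕ) := by unfold e; push_cast; ring
  rw [this, Real.rpow_add h, Real.rpow_natCast]
  congr 1
  unfold prof γ
  rw [← Real.rpow_mul (by positivity), one_div, inv_mul_cancel₀ hθ.ne', Real.rpow_one]

theorem ph_eq_prof (j : ℕ) : D.ph N j = D.prof (D.sn N j) := rfl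

/-- Natural size of the weights at nodes where the sine is of size `s`. -/
noncomputable def wsize (D : Data) (s : ℝ) : ℝ := s * D.prof s

theorem wsize_pos {s : ℝ} (hs : 0 < s) : 0 < D.wsize s := mul_pos hs (prof_pos hs)

/-- The factor comparing `prof (L * s)` and `prof s`. -/
noncomputable def Lf (D : Data) (L : ℝ) : ℝ := (L ^ 2) ^ D.γ

theorem ph_bounds {j : ℕ} {s L : ℝ} (hs : 0 < s) (h1 : D.sn N j ∈ Icc s (L * s)) :
    D.ph N j ∈ Icc (D.prof s) (D.Lf L * D.prof s) := by
  rw [ph_eq_prof, Lf, ← prof_mul]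
  exact ⟨prof_mono hs.le h1.1, prof_mono (hs.le.trans h1.1) h1.2⟩

theorem wtA_bounds (hN : 1 ≤ N) {i j : ℕ} {s L : ℝ} (hs : 0 < s)
    (h1 : D.sn N j ∈ Icc s (L * s)) :
    D.wtA N i j ∈ Icc (D.R / D.T * D.wsize s)
      (D.R * Real.pi * L * D.Lf L / (2 * D.T) * D.wsize s) := by
  have hR := D.R_pos
  have hT := D.T_pos
  have hh := dt_pos (D := D) hN
  have hpi := Real.pi_pos
  have hp := prof_pos (D := D) hs
  have h2 := ph_bounds hs h1
  have h3 := (sin_step_bounds (D := D) hN).2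
  have hq : 0 < D.dt N / D.T / 2 := by positivity
  have hq' := hq.trans_le h3.1
  have hph := hp.trans_le h2.1
  unfold wtA Δ wsize
  constructor
  · rw [le_div_iff₀ hh]
    calc _ = 2 * D.R * (D.dt N / D.T / 2) * s * D.prof s := by ring
      _ ≤ _ := by
        have a := h3.1; have b := h1.1; have c := h2.1
        have b' := hs.trans_le b
        gcongr
  · rw [div_le_iff₀ hh]
    calc _ ≤ 2 * D.R * (Real.pi / (4 * D.T) * D.dt N) * (L * s) * (D.Lf L * D.prof s) := by
          have a := h3.2; have b := h1.2; have c := h2.2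
          have b' := hs.trans_le h1.1
          have b'' := b'.trans_le b
          gcongr
      _ = _ := by field_simp; ring

theorem μ_bounds (hN : 1 ≤ N) {j : ℕ} (hj : j < 2 * N) {s L : ℝ} (hs : 0 < s)
    (h1 : D.sn N j ∈ Icc s (L * s)) (h2 : D.sn N (j + 1) ∈ Icc s (L * s)) :
    D.μ N j ∈ Icc (D.R / D.T * D.dt N * D.wsize s)
      (D.R * Real.pi * L * D.Lf L / D.T * D.dt N * D.wsize s) := by
  have hR := D.R_pos
  have hT := D.T_pos
  have hh := dt_pos (D := D) hN
  have hpi := Real.pi_pos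
  have hγ := D.γ_pos
  have ha := D.a₀_pos
  obtain ⟨ξ, h0, hξ1, hξ2, he⟩ := exists_μ_eq (D := D) hN hj
  have h3 := (sin_step_bounds (D := D) hN).1
  have h4 := sin_mid_bounds hN hs.le h1 h2
  have hs1 : s ^ 2 ≤ ξ := by
    refine le_trans (le_min ?_ ?_) hξ1
    · exact pow_le_pow_left₀ hs.le h1.1 2
    · exact pow_le_pow_left₀ hs.le h2.1 2
  have hs2 : ξ ≤ (L * s) ^ 2 := by
    refine hξ2.trans (max_le ?_ ?_)
    · exact pow_le_pow_left₀ (hs.le.trans h1.1) h1.2 2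
    · exact pow_le_pow_left₀ (hs.le.trans h2.1) h2.2 2
  have hp := prof_pos (D := D) hs
  have e1 : D.prof s ≤ (D.a₀ * ξ) ^ D.γ := by
    unfold prof
    gcongr
  have e2 : (D.a₀ * ξ) ^ D.γ ≤ D.Lf L * D.prof s := by
    rw [Lf, ← prof_mul]
    unfold prof
    gcongr
  have hq : 0 < D.dt N / D.T := by positivity
  have hq' := hq.trans_le h3.1
  have hm := hs.trans_le h4.1
  have hm' := hm.trans_le h4.2
  rw [he]
  unfold wsize
  constructor
  · calc _ = D.R * (D.dt N / D.T) * s * D.prof s := by ring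
      _ ≤ _ := by
        have a := h3.1; have b := h4.1
        gcongr
  · calc _ ≤ D.R * (Real.pi / (2 * D.T) * D.dt N) * (2 * (L * s)) * (D.Lf L * D.prof s) := by
          have a := h3.2; have b := h4.2
          gcongr
      _ = _ := by field_simp

theorem spec_bounds {i j : ℕ} {s L lo hi : ℝ} (hs : 0 < s) (hlo : 0 < lo)
    (hP : P i j ∈ Icc lo hi)
    (h1 : D.sn N j ∈ Icc s (L * s)) :
    D.spec N P i j ∈ Icc (lo / D.Lf L / D.prof s) (hi / D.prof s) := by
  have hp := prof_pos (D := D) hs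
  have h2 := ph_bounds hs h1
  have hph := hp.trans_le h2.1
  have hP' := hlo.trans_le hP.1
  have a := hP.1; have b := hP.2; have c := h2.1; have d := h2.2
  have hhi := hP'.trans_le b
  unfold spec
  constructor
  · rw [div_div]
    gcongr
  · gcongr

theorem wtB_bounds (hN : 1 ≤ N) {i j : ℕ} (hj : j < 2 * N) {s L lo hi : ℝ} (hs : 0 < s)
    (hL : 0 < L) (hlo : 0 < lo) (hP : P i j ∈ Icc lo hi) (hP2 : P i (j + 1) ∈ Icc lo hi)
    (h1 : D.sn N j ∈ Icc s (L * s)) (h2 : D.sn N (j + 1) ∈ Icc s (L * s)) :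
    D.wtB N P i j ∈ Icc ((D.θ / (1 + D.θ)) / (D.R * Real.pi * L * D.Lf L / D.T) *
        (D.e * hi ^ (-D.e - 1)) * D.a₀ * D.wsize s)
      ((D.θ / (1 + D.θ)) / (D.R / D.T) * (D.e * (lo / D.Lf L) ^ (-D.e - 1)) * D.a₀ *
        D.wsize s) := by
  have hR := D.R_pos
  have hT := D.T_pos
  have hh := dt_pos (D := D) hN
  have hpi := Real.pi_pos
  have ha := D.a₀_pos
  have hθ := D.θ_pos
  have he := D.e_pos
  have hp := prof_pos (D := D) hs
  have hw := wsize_pos (D := D) hs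
  have hμ := μ_bounds (D := D) hN hj hs h1 h2
  have hL' : 0 < D.Lf L := by unfold Lf; positivity
  have hhi : 0 < hi := hlo.trans_le (hP.1.trans hP.2)
  have hn := negSlope_bounds he (show 0 < lo / D.Lf L / D.prof s by positivity)
    (spec_bounds hs hlo hP2 h2) (spec_bounds hs hlo hP h1)
  have key : ∀ x : ℝ, 0 < x → (x / D.prof s) ^ (-D.e - 1) =
      x ^ (-D.e - 1) * (D.a₀ * s ^ 2 * D.prof s ^ 2) := by
    intro x hx
    rw [Real.div_rpow hx.le hp.le, ← prof_rpow_e hs, show -D.e - 1 = -(D.e + 1) by ring,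
      Real.rpow_neg hp.le]
    field_simp
  rw [key _ hhi, key _ (by positivity)] at hn
  have hx1 := Real.rpow_pos_of_pos hhi (-D.e - 1)
  have hx2 := Real.rpow_pos_of_pos (show 0 < lo / D.Lf L by positivity) (-D.e - 1)
  have hμ0 : 0 < D.μ N j := lt_of_lt_of_le (by positivity) hμ.1
  have hsq : D.a₀ * s ^ 2 * D.prof s ^ 2 = D.a₀ * D.wsize s * D.wsize s := by unfold wsize; ring
  rw [hsq] at hn
  unfold wtB
  constructor
  · calc _ = D.dt N * (D.θ / (1 + D.θ)) /
          (D.R * Real.pi * L * D.Lf L / D.T * D.dt N * D.wsize s) *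
          (D.e * (hi ^ (-D.e - 1) * (D.a₀ * D.wsize s * D.wsize s))) := by
          field_simp
      _ ≤ _ := by
          have a := hμ.2; have b := hn.1
          gcongr
  · calc _ ≤ D.dt N * (D.θ / (1 + D.θ)) / (D.R / D.T * D.dt N * D.wsize s) *
          (D.e * ((lo / D.Lf L) ^ (-D.e - 1) * (D.a₀ * D.wsize s * D.wsize s))) := by
          have a := hμ.1; have b := hn.2
          have : 0 < negSlope D.e (D.spec N P i (j + 1)) (D.spec N P i j) :=
            lt_of_lt_of_le (by positivity) hn.1
          gcongr
      _ = _ := by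
          field_simp

/-- On a box where the sine is comparable with `s` and the Jacobian is bounded above and below, the
weights are comparable with `wsize s` and `spec` with `1 / prof s`. -/
theorem exists_box_bounds (D : Data) {L lo hi : ℝ} (hL : 0 < L) (hlo : 0 < lo) (hhi : 0 < hi) :
    ∃ C : ℝ, 1 ≤ C ∧ ∀ (N i₁ j₁ M₁ M₂ : ℕ) (P : ℕ → ℕ → ℝ) (s : ℝ), 1 ≤ N → 0 < s →
      j₁ + M₂ + 1 < 2 * N →
      (∀ j, j₁ ≤ j → j ≤ j₁ + M₂ + 1 → D.sn N j ∈ Icc s (L * s)) →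
      (∀ i j, i₁ ≤ i → i ≤ i₁ + M₁ → P i j ∈ Icc lo hi) →
      WeightBounds M₁ M₂ (C⁻¹ * D.wsize s) (C * D.wsize s)
        (fun i j => D.wtA N (i₁ + i) (j₁ + j)) ∧
      WeightBounds M₁ M₂ (C⁻¹ * D.wsize s) (C * D.wsize s)
        (fun i j => D.wtB N P (i₁ + i) (j₁ + j)) ∧
      ∀ i j, i ≤ M₁ → j ≤ M₂ → |D.spec N P (i₁ + i) (j₁ + j)| ≤ C / D.prof s ∧
        C⁻¹ / D.prof s ≤ D.spec N P (i₁ + i) (j₁ + j) := by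
  have hR := D.R_pos
  have hT := D.T_pos
  have hpi := Real.pi_pos
  have ha := D.a₀_pos
  have hθ := D.θ_pos
  have he := D.e_pos
  have hL' : 0 < D.Lf L := by unfold Lf; positivity
  set A₁ := D.R / D.T
  set A₂ := D.R * Real.pi * L * D.Lf L / (2 * D.T)
  set B₁ := (D.θ / (1 + D.θ)) / (D.R * Real.pi * L * D.Lf L / D.T) *
        (D.e * hi ^ (-D.e - 1)) * D.a₀
  set B₂ := (D.θ / (1 + D.θ)) / (D.R / D.T) * (D.e * (lo / D.Lf L) ^ (-D.e - 1)) * D.a₀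
  have hA₁ : 0 < A₁ := by positivity
  have hA₂ : 0 < A₂ := by positivity
  have hB₁ : 0 < B₁ := by positivity
  have hB₂ : 0 < B₂ := by positivity
  have hl : 0 < lo / D.Lf L := by positivity
  set C := 1 + A₁⁻¹ + A₂ + B₁⁻¹ + B₂ + hi + (lo / D.Lf L)⁻¹ with hC
  have p1 := inv_pos.2 hA₁
  have p2 := inv_pos.2 hB₁
  have p3 := inv_pos.2 hl
  have hC1 : 1 ≤ C := by linarith
  have hC0 : 0 < C := by linarith
  have inv_le : ∀ x : ℝ, 0 < x → x⁻¹ ≤ C → C⁻¹ ≤ x := fun x hx h => by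
    rw [inv_le_comm₀ hC0 hx]; exact h
  refine ⟨C, hC1, fun N i₁ j₁ M₁ M₂ P s hN hs hj hsn hP => ?_⟩
  have hw := wsize_pos (D := D) hs
  have hp := prof_pos (D := D) hs
  refine ⟨fun i j hi hj' => ?_, fun i j hi hj' => ?_, fun i j hi hj' => ?_⟩
  · have := wtA_bounds (D := D) hN (i := i₁ + i) hs (hsn (j₁ + j) (by omega) (by omega))
    exact ⟨(mul_le_mul_of_nonneg_right (inv_le A₁ hA₁ (by linarith)) hw.le).trans this.1,
      this.2.trans (mul_le_mul_of_nonneg_right (show A₂ ≤ C by linarith) hw.le)⟩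
  · have := wtB_bounds (D := D) hN (i := i₁ + i) (j := j₁ + j) (by omega) hs hL hlo
      (hP _ _ (by omega) (by omega)) (hP _ _ (by omega) (by omega))
      (hsn (j₁ + j) (by omega) (by omega)) (hsn (j₁ + j + 1) (by omega) (by omega))
    exact ⟨(mul_le_mul_of_nonneg_right (inv_le B₁ hB₁ (by linarith)) hw.le).trans this.1,
      this.2.trans (mul_le_mul_of_nonneg_right (show B₂ ≤ C by linarith) hw.le)⟩
  · have := spec_bounds (D := D) hs hlo (hP (i₁ + i) (j₁ + j) (by omega) (by omega))
      (hsn (j₁ + j) (by omega) (by omega))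
    refine ⟨?_, le_trans ?_ this.1⟩
    · rw [abs_of_nonneg (le_trans (by positivity) this.1)]
      refine this.2.trans ?_
      gcongr
      linarith
    · gcongr
      exact inv_le _ hl (by linarith)

end Data

theorem harmSum_le_harmSum_two_mul {r m : ℕ} (hr : r ≤ m) (hm : 1 ≤ m) :
    harmSum r m + 1 / 2 ≤ harmSum r (2 * m) := by
  unfold harmSum
  rw [← Finset.sum_Ioc_consecutive _ hr (show m ≤ 2 * m by omega)]
  have hm' : (0 : ℝ) < m := by exact_mod_cast hm
  have : (1 : ℝ) / 2 ≤ ∑ ρ ∈ Finset.Ioc m (2 * m), (1 / (ρ : ℝ)) := by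
    calc (1 : ℝ) / 2 = ∑ ρ ∈ Finset.Ioc m (2 * m), (1 / (2 * m : ℝ)) := by
          rw [Finset.sum_const, Nat.card_Ioc, nsmul_eq_mul, show 2 * m - m = m by omega]
          field_simp
      _ ≤ _ := by
          refine Finset.sum_le_sum fun ρ hρ => ?_
          have h := Finset.mem_Ioc.1 hρ
          have h1 : (ρ : ℝ) ≤ 2 * m := by exact_mod_cast h.2
          have h2 : (0 : ℝ) < ρ := by exact_mod_cast (show 0 < ρ by omega)
          exact one_div_le_one_div_of_le h2 h1
  linarith

theorem half_le_harmSum_two_pow {r : ℕ} (hr : 1 ≤ r) (q : ℕ) :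
    (q : ℝ) / 2 ≤ harmSum r (2 ^ q * r) := by
  induction q with
  | zero => simp [harmSum]
  | succ q ih =>
    have h1 : 1 ≤ 2 ^ q := Nat.one_le_two_pow
    have h2 : r ≤ 2 ^ q * r := Nat.le_mul_of_pos_left r (by omega)
    have := harmSum_le_harmSum_two_mul (r := r) (m := 2 ^ q * r) h2 (by omega)
    rw [show 2 ^ (q + 1) * r = 2 * (2 ^ q * r) by ring]
    push_cast
    linarith

namespace Data

variable {D : Data}

/-- Uniform bounds for the barriers away from the initial time. -/
theorem exists_barrier_bounds (D : Data) {τ : ℝ} (hτ : 0 < τ) :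
    ∃ lo hi : ℝ, 0 < lo ∧ 0 < hi ∧ ∀ t, τ ≤ t → t ≤ D.T → lo ≤ D.lower t ∧ D.upper t ≤ hi := by
  obtain ⟨η, hη, h⟩ := D.mul_rpow_le_lower
  refine ⟨η * τ ^ D.α, D.upper D.T, by positivity, D.upper_pos D.T_pos, fun t h1 h2 => ⟨?_, ?_⟩⟩
  · refine le_trans ?_ (h t (hτ.le.trans h1) h2)
    have := D.α_pos
    gcongr
  · unfold upper
    have := D.α_pos
    have := D.Ap_pos
    have := hτ.le.trans h1
    gcongr

theorem exists_flow_box_bounds (D : Data) {τ L : ℝ} (hτ : 0 < τ) (hL : 0 < L) :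
    ∃ C : ℝ, 1 ≤ C ∧ ∀ (N i₀ : ℕ) (P X : ℕ → ℕ → ℝ) (i₁ j₁ M₁ M₂ : ℕ) (s : ℝ),
      D.DiscreteFlow N i₀ P X → 0 < s → i₀ ≤ i₁ → τ ≤ i₁ * D.dt N → i₁ + M₁ ≤ N →
      j₁ + M₂ + 1 < 2 * N →
      (∀ j, j₁ ≤ j → j ≤ j₁ + M₂ + 1 → D.sn N j ∈ Icc s (L * s)) →
      WeightBounds M₁ M₂ (C⁻¹ * D.wsize s) (C * D.wsize s)
        (fun i j => D.wtA N (i₁ + i) (j₁ + j)) ∧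
      WeightBounds M₁ M₂ (C⁻¹ * D.wsize s) (C * D.wsize s)
        (fun i j => D.wtB N P (i₁ + i) (j₁ + j)) ∧
      ∀ i j, i ≤ M₁ → j ≤ M₂ → |D.spec N P (i₁ + i) (j₁ + j)| ≤ C / D.prof s ∧
        C⁻¹ / D.prof s ≤ D.spec N P (i₁ + i) (j₁ + j) := by
  obtain ⟨lo, hi, hlo, hhi, hb⟩ := D.exists_barrier_bounds hτ
  obtain ⟨C, hC, h⟩ := D.exists_box_bounds hL hlo hhi
  refine ⟨C, hC, fun N i₀ P X i₁ j₁ M₁ M₂ s hF hs h1 h2 h3 h4 h5 =>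
    h N i₁ j₁ M₁ M₂ P s hF.N_pos hs h4 h5 fun i j hi1 hi2 => ?_⟩
  have hh := dt_pos (D := D) hF.N_pos
  have e1 : (i₁ : ℝ) ≤ i := by exact_mod_cast hi1
  have e2 : (i : ℝ) ≤ N := by exact_mod_cast hi2.trans h3
  have e3 := hF.bounds i j (by omega) (by omega)
  have e4 := hb (i * D.dt N) (h2.trans (by gcongr)) (by rw [← N_mul_dt (D := D) hF.N_pos]; gcongr)
  exact ⟨e4.1.trans e3.1, e3.2.trans e4.2⟩

theorem exists_sq_osc_le (D : Data) {τ L : ℝ} (hτ : 0 < τ) (hL : 0 < L) :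
    ∃ C : ℝ, 0 < C ∧ ∀ (N i₀ : ℕ) (P X : ℕ → ℕ → ℝ) (i₁ j₁ m r : ℕ) (s : ℝ),
      D.DiscreteFlow N i₀ P X → 0 < s → i₀ ≤ i₁ → τ ≤ i₁ * D.dt N → i₁ + (4 * m + 2) + 1 ≤ N →
      1 ≤ j₁ → j₁ + (4 * m + 2) + 1 < 2 * N →
      (∀ j, j₁ ≤ j → j ≤ j₁ + (4 * m + 2) + 1 → D.sn N j ∈ Icc s (L * s)) → 1 ≤ m → r ≤ m →
      ∀ i j i' j', i₁ + 2 * m ≤ i + r → i ≤ i₁ + 2 * m + r → j₁ + 2 * m ≤ j + r →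
        j ≤ j₁ + 2 * m + r → i₁ + 2 * m ≤ i' + r → i' ≤ i₁ + 2 * m + r → j₁ + 2 * m ≤ j' + r →
        j' ≤ j₁ + 2 * m + r →
        (D.spec N P i j - D.spec N P i' j') ^ 2 * harmSum r m ≤ C / D.prof s ^ 2 ∧
        (D.vel N X i j - D.vel N X i' j') ^ 2 * harmSum r m ≤ C * s ^ 2 := by
  obtain ⟨C, hC, h⟩ := D.exists_flow_box_bounds hτ hL
  have hC0 : 0 < C := by linarith
  refine ⟨4608 * C ^ 6, by positivity, ?_⟩
  intro N i₀ P X i₁ j₁ m r s hF hs h1 h2 h3 h4 h5 h6 hm hr i j i' j' a1 a2 a3 a4 a5 a6 a7 a8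
  obtain ⟨hA, hB, hS⟩ := h N i₀ P X i₁ j₁ (4 * m + 2) (4 * m + 2) s hF hs h1 h2 (by omega) h5 h6
  have hw := wsize_pos (D := D) hs
  have hp := prof_pos (D := D) hs
  have hcp := hF.conjPair h1 h3 h4 h5
  obtain ⟨x, rfl⟩ := Nat.exists_eq_add_of_le (show i₁ ≤ i by omega)
  obtain ⟨y, rfl⟩ := Nat.exists_eq_add_of_le (show j₁ ≤ j by omega)
  obtain ⟨x', rfl⟩ := Nat.exists_eq_add_of_le (show i₁ ≤ i' by omega)
  obtain ⟨y', rfl⟩ := Nat.exists_eq_add_of_le (show j₁ ≤ j' by omega)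
  have hCC : C⁻¹ ≤ C := (inv_le_one_of_one_le₀ hC).trans hC
  have := hcp.sq_osc_le (r := r) (c₁ := C⁻¹ * D.wsize s) (c₂ := C * D.wsize s) (K := C / D.prof s)
    (i := x) (j := y) (i' := x') (j' := y')
    hm (by positivity) (by gcongr) hA hB (fun i j hi hj => (hS i j hi hj).1) (by omega) (by omega)
    (by omega) (by omega) (by omega) (by omega) (by omega) (by omega) hr
  have e1 : C * D.wsize s / (C⁻¹ * D.wsize s) = C ^ 2 := by field_simp
  rw [e1] at this
  refine ⟨this.1.trans ?_, this.2.trans (le_of_eq ?_)⟩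
  · rw [div_pow, ← mul_div_assoc]
    refine div_le_div_of_nonneg_right ?_ (by positivity)
    have : C ^ 4 ≤ C ^ 6 := pow_le_pow_right₀ hC (by norm_num)
    nlinarith
  · unfold wsize
    field_simp

end Data

/-- Lower and upper bounds for the sine in terms of the distance to the ends of `[0, π]`. -/
theorem sin_mem_of_near {x ϑ ρ : ℝ} (hρ : 0 < ρ) (h1 : 2 * ρ ≤ ϑ) (h2 : 2 * ρ ≤ Real.pi - ϑ)
    (hx : |x - ϑ| ≤ ρ) :
    Real.sin x ∈ Icc (min ϑ (Real.pi - ϑ) / Real.pi) (5 * (min ϑ (Real.pi - ϑ) / Real.pi)) := by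
  have hpi := Real.pi_pos
  have hpi4 := Real.pi_le_four
  have hpi3 : Real.pi < 3.15 := Real.pi_lt_d2
  set y := min ϑ (Real.pi - ϑ) with hy
  have hyρ : 2 * ρ ≤ y := le_min h1 h2
  have hy1 : y ≤ ϑ := min_le_left _ _
  have hy2 : y ≤ Real.pi - ϑ := min_le_right _ _
  obtain ⟨hx1, hx2⟩ := abs_le.1 hx
  have low : ∀ z, y / 2 ≤ z → z ≤ Real.pi / 2 → y / Real.pi ≤ Real.sin z := by
    intro z hz hz'
    refine le_trans ?_ (Real.mul_le_sin (by linarith) hz')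
    rw [div_le_iff₀ hpi]
    field_simp
    linarith
  constructor
  · rcases le_total x (Real.pi / 2) with h | h
    · exact low x (by linarith) h
    · rw [← Real.sin_pi_sub]
      exact low _ (by linarith) (by linarith)
  · have : Real.sin x ≤ 3 / 2 * y := by
      rcases le_total ϑ (Real.pi - ϑ) with h | h
      · have : y = ϑ := min_eq_left h
        exact (Real.sin_le (by linarith)).trans (by linarith)
      · have : y = Real.pi - ϑ := min_eq_right h
        rw [← Real.sin_pi_sub]
        exact (Real.sin_le (by linarith)).trans (by linarith)
    refine this.trans ?_
    rw [← mul_div_assoc, le_div_iff₀ hpi]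
    nlinarith

namespace Data

variable {D : Data}

theorem exists_osc (D : Data) {τ : ℝ} (hτ : 0 < τ) :
    ∃ C : ℝ, 0 < C ∧ ∀ (t ϑ ρ : ℝ) (q N i₀ : ℕ) (P X : ℕ → ℕ → ℝ), 2 * τ ≤ t → t ≤ D.T - τ →
      0 < ρ → 2 * ρ ≤ ϑ → 2 * ρ ≤ Real.pi - ϑ → D.T * ρ ≤ τ / 2 →
      D.DiscreteFlow N i₀ P X → i₀ * D.dt N ≤ τ → Real.pi / (2 * N) ≤ ρ * (1 / 2) ^ q / 16 →
      ∀ i j i' j' : ℕ, |i * D.dt N - t| ≤ D.T * (ρ * (1 / 2) ^ q) / 16 →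
        |D.ang N j - ϑ| ≤ ρ * (1 / 2) ^ q / 8 →
        |i' * D.dt N - t| ≤ D.T * (ρ * (1 / 2) ^ q) / 16 →
        |D.ang N j' - ϑ| ≤ ρ * (1 / 2) ^ q / 8 →
        (D.spec N P i j - D.spec N P i' j') ^ 2 * q ≤
          C / D.prof (min ϑ (Real.pi - ϑ) / Real.pi) ^ 2 ∧
        (D.vel N X i j - D.vel N X i' j') ^ 2 * q ≤ C * min ϑ (Real.pi - ϑ) ^ 2 := by
  obtain ⟨C, hC, H⟩ := D.exists_sq_osc_le hτ (show (0 : ℝ) < 5 by norm_num)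
  refine ⟨2 * C, by positivity, ?_⟩
  intro t ϑ ρ q N i₀ P X ht htT hρ hϑ hϑ' hρτ hF hi₀ hk i j i' j' hi hj hi' hj'
  have hN := hF.N_pos
  have hT := D.T_pos
  have hh := dt_pos (D := D) hN
  have hk0 := step_pos hN
  have hpi := Real.pi_pos
  have hpi3 := Real.pi_gt_three
  have hpi4 := Real.pi_le_four
  have hstep := step_div_dt (D := D) hN
  set k := Real.pi / (2 * N) with hkdef
  set h := D.dt N with hhdef
  have hhk : h = 2 * D.T / Real.pi * k := by rw [hstep]; field_simp
  have hhk1 : h ≤ D.T * k := by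
    rw [hhk, div_mul_eq_mul_div, div_le_iff₀ hpi]
    have := mul_pos hT hk0
    nlinarith
  have hhk2 : D.T * k ≤ 2 * h := by
    have e : 2 * h = 4 * (D.T * k) / Real.pi := by rw [hhk]; ring
    rw [e, le_div_iff₀ hpi]
    have := mul_pos hT hk0
    nlinarith
  set Q : ℝ := (1 / 2) ^ q with hQ
  have hQ0 : 0 < Q := by positivity
  have hQ1 : Q ≤ 1 := pow_le_one₀ (by norm_num) (by norm_num)
  have hρQ : ρ * Q ≤ ρ := mul_le_of_le_one_right hρ.le hQ1
  have hρQ0 : 0 < ρ * Q := by positivity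
  set x := ρ * Q / (8 * k) with hx
  have hxk : 8 * (x * k) = ρ * Q := by rw [hx]; field_simp
  have hx2 : 2 ≤ x := by
    rw [hx, le_div_iff₀ (by positivity)]; linarith
  set r := ⌊2 * x⌋₊ with hr
  have hr1 : (r : ℝ) ≤ 2 * x := Nat.floor_le (by linarith)
  have hr2 : 2 * x < r + 1 := Nat.lt_floor_add_one _
  have hr3 : x + 1 ≤ r := by linarith
  have hr4 : 1 ≤ r := by
    have : (1 : ℝ) ≤ r := by linarith
    exact_mod_cast this
  set m := 2 ^ q * r with hm
  have hrm : r ≤ m := Nat.le_mul_of_pos_left r (by positivity)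
  have hmk : 4 * (m * k) ≤ ρ := by
    have : (m : ℝ) = 2 ^ q * r := by rw [hm]; push_cast; ring
    rw [this]
    have h1 : (2 : ℝ) ^ q * Q = 1 := by rw [hQ, ← mul_pow]; norm_num
    have h2 : (2 : ℝ) ^ q * r * k ≤ 2 ^ q * (2 * x) * k := by gcongr
    have h3 : 4 * ((2 : ℝ) ^ q * (2 * x) * k) = (2 ^ q * Q) * ρ := by
      calc _ = 2 ^ q * (8 * (x * k)) := by ring
        _ = _ := by rw [hxk]; ring
    rw [h1, one_mul] at h3
    linarith
  have hmh : 4 * (m * h) ≤ D.T * ρ := by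
    have h1 : (m : ℝ) * h ≤ m * (D.T * k) := by gcongr
    have h2 : D.T * (4 * (m * k)) ≤ D.T * ρ := by gcongr
    linarith
  have hkρ : 16 * k ≤ ρ := by linarith
  have hhτ : 16 * h ≤ τ / 2 := by
    have := mul_le_mul_of_nonneg_left hkρ hT.le
    linarith
  set ic := ⌊t / h⌋₊ with hic
  set jc := ⌊ϑ / k⌋₊ with hjc
  have ht0 : 0 < t := by linarith
  have hϑ0 : 0 < ϑ := by linarith
  have ic1 : (ic : ℝ) * h ≤ t := by
    rw [← le_div_iff₀ hh]; exact Nat.floor_le (by positivity)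
  have ic2 : t < (ic + 1) * h := by
    rw [← div_lt_iff₀ hh]; exact Nat.lt_floor_add_one _
  have jc1 : (jc : ℝ) * k ≤ ϑ := by
    rw [← le_div_iff₀ hk0]; exact Nat.floor_le (by positivity)
  have jc2 : ϑ < (jc + 1) * k := by
    rw [← div_lt_iff₀ hk0]; exact Nat.lt_floor_add_one _
  have hang : ∀ j : ℕ, D.ang N j = j * k := fun j => rfl
  -- the box
  have him : 2 * m ≤ ic := by
    have : ((2 * m : ℕ) : ℝ) * h ≤ ic * h := by
      push_cast
      linarith
    exact_mod_cast le_of_mul_le_mul_right this hh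
  have hjm : 2 * m + 1 ≤ jc := by
    have : ((2 * m + 1 : ℕ) : ℝ) * k ≤ jc * k := by
      push_cast
      linarith
    exact_mod_cast le_of_mul_le_mul_right this hk0
  obtain ⟨i₁, hi₁⟩ := Nat.exists_eq_add_of_le' him
  obtain ⟨j₁, hj₁⟩ := Nat.exists_eq_add_of_le' (show 2 * m ≤ jc by omega)
  have hi₁' : (ic : ℝ) = i₁ + 2 * m := by rw [hi₁]; push_cast; ring
  have hj₁' : (jc : ℝ) = j₁ + 2 * m := by rw [hj₁]; push_cast; ring
  rw [hi₁'] at ic1 ic2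
  rw [hj₁'] at jc1 jc2
  have a1 : τ ≤ i₁ * h := by linarith
  have a0 : i₀ ≤ i₁ := by
    have : (i₀ : ℝ) * h ≤ i₁ * h := hi₀.trans a1
    exact_mod_cast le_of_mul_le_mul_right this hh
  have a2 : i₁ + (4 * m + 2) + 1 ≤ N := by
    have : ((i₁ + (4 * m + 2) + 1 : ℕ) : ℝ) * h ≤ N * h := by
      rw [N_mul_dt hN]
      push_cast
      linarith
    exact_mod_cast le_of_mul_le_mul_right this hh
  have hNk : ((2 * N : ℕ) : ℝ) * k = Real.pi := ang_two_mul (D := D) hN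
  have a3 : j₁ + (4 * m + 2) + 1 < 2 * N := by
    have : ((j₁ + (4 * m + 2) + 1 : ℕ) : ℝ) * k < (2 * N : ℕ) * k := by
      rw [hNk]
      push_cast
      linarith
    exact_mod_cast lt_of_mul_lt_mul_right this hk0.le
  set y := min ϑ (Real.pi - ϑ) with hy
  have hy0 : 0 < y := lt_of_lt_of_le (by linarith) (le_min hϑ hϑ')
  have a4 : ∀ j, j₁ ≤ j → j ≤ j₁ + (4 * m + 2) + 1 →
      D.sn N j ∈ Icc (y / Real.pi) (5 * (y / Real.pi)) := by
    intro j h1 h2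
    refine sin_mem_of_near hρ hϑ hϑ' ?_
    have h1' : (j₁ : ℝ) * k ≤ j * k := by gcongr
    have h2' : (j : ℝ) * k ≤ (j₁ + (4 * m + 2) + 1 : ℕ) * k := by gcongr
    push_cast at h2'
    rw [hang, abs_le]
    constructor <;> linarith
  have near_i : ∀ i : ℕ, |i * h - t| ≤ D.T * (ρ * Q) / 16 →
      i₁ + 2 * m ≤ i + r ∧ i ≤ i₁ + 2 * m + r := by
    intro i hi
    rw [abs_le, ← hxk] at hi
    have b1 : (x + 1) * h ≤ r * h := by gcongr
    have b2 : x * (D.T * k) ≤ x * (2 * h) := by gcongr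
    have c1 : ((i₁ + 2 * m : ℕ) : ℝ) * h ≤ (i + r : ℕ) * h := by push_cast; linarith
    have c2 : ((i : ℕ) : ℝ) * h ≤ (i₁ + 2 * m + r : ℕ) * h := by push_cast; linarith
    exact ⟨by exact_mod_cast le_of_mul_le_mul_right c1 hh,
      by exact_mod_cast le_of_mul_le_mul_right c2 hh⟩
  have near_j : ∀ j : ℕ, |D.ang N j - ϑ| ≤ ρ * Q / 8 →
      j₁ + 2 * m ≤ j + r ∧ j ≤ j₁ + 2 * m + r := by
    intro i hi
    rw [abs_le, ← hxk, hang] at hi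
    have b1 : (x + 1) * k ≤ r * k := by gcongr
    have c1 : ((j₁ + 2 * m : ℕ) : ℝ) * k ≤ (i + r : ℕ) * k := by push_cast; linarith
    have c2 : ((i : ℕ) : ℝ) * k ≤ (j₁ + 2 * m + r : ℕ) * k := by push_cast; linarith
    exact ⟨by exact_mod_cast le_of_mul_le_mul_right c1 hk0,
      by exact_mod_cast le_of_mul_le_mul_right c2 hk0⟩
  have hs0 : 0 < y / Real.pi := by positivity
  obtain ⟨r1, r2⟩ := H N i₀ P X i₁ j₁ m r (y / Real.pi) hF hs0 a0 a1 a2 (by omega) a3 a4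
    (hr4.trans hrm) hrm i j i' j' (near_i i hi).1 (near_i i hi).2 (near_j j hj).1 (near_j j hj).2
    (near_i i' hi').1 (near_i i' hi').2 (near_j j' hj').1 (near_j j' hj').2
  have hH := half_le_harmSum_two_pow hr4 q
  rw [← hm] at hH
  have hp := prof_pos (D := D) hs0
  constructor
  · have := mul_le_mul_of_nonneg_left hH (sq_nonneg (D.spec N P i j - D.spec N P i' j'))
    calc _ ≤ 2 * (C / D.prof (y / Real.pi) ^ 2) := by linarith
      _ = _ := by ring
  · have := mul_le_mul_of_nonneg_left hH (sq_nonneg (D.vel N X i j - D.vel N X i' j'))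
    have e1 : (y / Real.pi) ^ 2 ≤ y ^ 2 :=
      pow_le_pow_left₀ hs0.le (div_le_self hy0.le (by linarith)) 2
    have := mul_le_mul_of_nonneg_left e1 hC.le
    linarith

end Data

theorem abs_rpow_quadratic_le {θ e x y lo : ℝ} (hθ : 0 < θ) (he : e = 1 + θ) (hlo : 0 < lo)
    (hx : lo ≤ x) (hy : lo ≤ y) :
    |θ / (1 + θ) * (y ^ (-e) - x ^ (-e)) * x - (y ^ (-θ) - x ^ (-θ))| ≤
      θ * lo ^ (-e - 1) * (y - x) ^ 2 := by
  set g : ℝ → ℝ := fun z => θ / (1 + θ) * z ^ (-e) * x - z ^ (-θ) with hg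
  have hd : ∀ z ∈ uIcc x y, HasDerivWithinAt g (θ * z ^ (-e - 1) * (z - x)) (uIcc x y) z := by
    intro z hz
    have hz0 : 0 < z := hlo.trans_le (le_trans (le_min hx hy) hz.1)
    have h1 := (((Real.hasDerivAt_rpow_const (p := -e) (Or.inl hz0.ne')).const_mul
      (θ / (1 + θ))).mul_const x).sub (Real.hasDerivAt_rpow_const (p := -θ) (Or.inl hz0.ne'))
    refine (HasDerivAt.congr_deriv h1 ?_).hasDerivWithinAt
    have e1 : z ^ (-θ - 1) = z ^ (-e - 1) * z := by
      rw [← Real.rpow_add_one hz0.ne']; congr 1; rw [he]; ring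
    rw [e1, he]
    field_simp
    ring
  have hb : ∀ z ∈ uIcc x y, ‖θ * z ^ (-e - 1) * (z - x)‖ ≤ θ * lo ^ (-e - 1) * |y - x| := by
    intro z hz
    have hz1 : lo ≤ z := le_trans (le_min hx hy) hz.1
    have hz0 : 0 < z := hlo.trans_le hz1
    rw [Real.norm_eq_abs, abs_mul, abs_of_pos (by positivity)]
    have h1 : z ^ (-e - 1) ≤ lo ^ (-e - 1) :=
      Real.rpow_le_rpow_of_nonpos hlo hz1 (by rw [he]; linarith)
    have h2 : |z - x| ≤ |y - x| := abs_sub_left_of_mem_uIcc hz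
    gcongr
  have := (convex_uIcc x y).norm_image_sub_le_of_norm_hasDerivWithin_le hd hb left_mem_uIcc
    right_mem_uIcc
  rw [Real.norm_eq_abs, Real.norm_eq_abs, mul_assoc, abs_mul_abs_self] at this
  calc _ = |g y - g x| := by congr 1; simp only [hg]; ring
    _ ≤ _ := this
    _ = _ := by ring

theorem midpoint_bounds {A B c σ q : ℝ} (hA : 0 < A) (hB : 0 < B) (hc : 0 < c) (hc1 : c ≤ 1)
    (hq : 1 ≤ q) (hAB : B ≤ q * A) (hBA : A ≤ q * B) (h : A + B = 2 * σ * c) :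
    0 < σ ∧ A ≤ q * σ ∧ c * σ ≤ q * A := by
  have hσ : 0 < σ := by
    by_contra hcon; push Not at hcon
    nlinarith [mul_nonneg (neg_nonneg.2 hcon) hc.le]
  refine ⟨hσ, ?_, ?_⟩
  · have h1 : 2 * σ * c ≤ 2 * σ := by nlinarith
    have h2 : (q + 1) * A ≤ (q + 1) * (q * σ) := by
      have : q * (A + B) ≤ q * (2 * σ) := by rw [h]; gcongr
      have : 0 ≤ (q - 1) * (q * σ) := mul_nonneg (by linarith) (by positivity)
      nlinarith
    exact le_of_mul_le_mul_left h2 (by linarith)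
  · nlinarith [mul_nonneg (sub_nonneg.2 hq) hA.le]

namespace Data

variable {D : Data} {N i₀ : ℕ} {P X : ℕ → ℕ → ℝ}

theorem abs_sn_succ_sub_le (hN : 1 ≤ N) (j : ℕ) :
    |D.sn N (j + 1) - D.sn N j| ≤ Real.pi / (2 * N) := by
  have h := Real.abs_sin_sub_sin_le (D.ang N (j + 1)) (D.ang N j)
  rw [ang_succ] at h
  unfold sn
  rw [ang_succ]
  refine h.trans ?_
  rw [add_sub_cancel_left, abs_of_pos (step_pos hN)]

set_option maxHeartbeats 800000 in
theorem exists_mass_ratio (D : Data) {s ε : ℝ} (hs : 0 < s) (hε : 0 < ε) :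
    ∃ k₀ > 0, ∀ N j : ℕ, 1 ≤ N → Real.pi / (2 * N) ≤ k₀ → j < 2 * N → s ≤ D.sn N j →
      s ≤ D.sn N (j + 1) → |D.Δ N j * D.ph N j / D.μ N j - 1| ≤ ε := by
  have hγ := D.γ_pos
  have ha := D.a₀_pos
  have hR := D.R_pos
  set f : ℝ → ℝ := fun k => ((1 + k / s) ^ (1 + 2 * D.γ))⁻¹ with hf
  set g : ℝ → ℝ := fun k => (1 + k / s) ^ (1 + 2 * D.γ) / Real.cos (k / 2) with hg
  have hbase : ContinuousAt (fun k : ℝ => (1 + k / s) ^ (1 + 2 * D.γ)) 0 := by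
    refine ContinuousAt.rpow_const (by fun_prop) (Or.inl (by simp))
  have hfc : ContinuousAt f 0 := hbase.inv₀ (by simp)
  have hgc : ContinuousAt g 0 := hbase.div (by fun_prop) (by simp)
  have hf0 : f 0 = 1 := by simp [hf]
  have hg0 : g 0 = 1 := by simp [hg]
  have h1 : ∀ᶠ k in 𝓝 (0 : ℝ), 1 - ε < f k := hfc.eventually (lt_mem_nhds (by rw [hf0]; linarith))
  have h2 : ∀ᶠ k in 𝓝 (0 : ℝ), g k < 1 + ε := hgc.eventually (gt_mem_nhds (by rw [hg0]; linarith))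
  obtain ⟨δ, hδ, hball⟩ := Metric.eventually_nhds_iff.1 (h1.and h2)
  refine ⟨δ / 2, by positivity, fun N j hN hk hj hs1 hs2 => ?_⟩
  have hk0 := step_pos hN
  have hk1 := step_le hN
  have hpi := Real.pi_pos
  have hlip := abs_sn_succ_sub_le (D := D) hN j
  have hadd := sn_add_sn (D := D) N j
  obtain ⟨ξ, h0, hξ1, hξ2, he⟩ := exists_μ_eq (D := D) hN hj
  rw [he]
  unfold Δ ph
  have hfg := hball (y := Real.pi / (2 * N)) (by rw [Real.dist_eq, sub_zero, abs_of_pos hk0]; linarith)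
  set k := Real.pi / (2 * N)
  set A := D.sn N j
  set B := D.sn N (j + 1)
  set σ := Real.sin (D.ang N j + k / 2)
  have hc : 0 < Real.cos (k / 2) := Real.cos_pos_of_mem_Ioo ⟨by linarith, by linarith⟩
  have hc1 : Real.cos (k / 2) ≤ 1 := Real.cos_le_one _
  have hsk : 0 < Real.sin (k / 2) := Real.sin_pos_of_pos_of_lt_pi (by linarith) (by linarith)
  have e2 : Real.sin k = 2 * Real.sin (k / 2) * Real.cos (k / 2) := by
    rw [← Real.sin_two_mul]; congr 1; ring
  set q := 1 + k / s with hq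
  have hq1 : 1 ≤ q := by
    have : 0 < k / s := by positivity
    linarith
  have hq0 : 0 < q := by linarith
  have hAB : B ≤ q * A := by
    have : k ≤ k / s * A := by rw [div_mul_eq_mul_div, le_div_iff₀ hs]; gcongr
    have := (abs_le.1 hlip).2
    rw [hq]; linarith
  have hBA : A ≤ q * B := by
    have : k ≤ k / s * B := by rw [div_mul_eq_mul_div, le_div_iff₀ hs]; gcongr
    have := (abs_le.1 hlip).1
    rw [hq]; linarith
  have hA : 0 < A := hs.trans_le hs1
  have hB : 0 < B := hs.trans_le hs2
  obtain ⟨hσ0, hσ1, hσ2⟩ := midpoint_bounds hA hB hc hc1 hq1 hAB hBA hadd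
  have hξ3 : A ^ 2 ≤ q ^ 2 * ξ := by
    rcases le_total (A ^ 2) (B ^ 2) with h | h
    · rw [min_eq_left h] at hξ1
      nlinarith
    · rw [min_eq_right h] at hξ1
      have : A ^ 2 ≤ (q * B) ^ 2 := pow_le_pow_left₀ hA.le hBA 2
      nlinarith [sq_nonneg q]
  have hξ4 : ξ ≤ q ^ 2 * A ^ 2 := by
    refine hξ2.trans (max_le ?_ ?_)
    · nlinarith [sq_nonneg A]
    · rw [← mul_pow]; exact pow_le_pow_left₀ hB.le hAB 2
  have hqγ : (q ^ 2) ^ D.γ * q = q ^ (1 + 2 * D.γ) := by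
    rw [← Real.rpow_natCast, ← Real.rpow_mul hq0.le, add_comm, Real.rpow_add_one hq0.ne']
    norm_num
  have g1 : (D.a₀ * A ^ 2) ^ D.γ ≤ (q ^ 2) ^ D.γ * (D.a₀ * ξ) ^ D.γ := by
    rw [← Real.mul_rpow (by positivity) (by positivity)]
    refine Real.rpow_le_rpow (by positivity) ?_ hγ.le
    calc _ ≤ D.a₀ * (q ^ 2 * ξ) := by gcongr
      _ = _ := by ring
  have g2 : (D.a₀ * ξ) ^ D.γ ≤ (q ^ 2) ^ D.γ * (D.a₀ * A ^ 2) ^ D.γ := by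
    rw [← Real.mul_rpow (by positivity) (by positivity)]
    refine Real.rpow_le_rpow (by positivity) ?_ hγ.le
    calc _ ≤ D.a₀ * (q ^ 2 * A ^ 2) := by gcongr
      _ = _ := by ring
  set Gξ := (D.a₀ * ξ) ^ D.γ
  set GA := (D.a₀ * A ^ 2) ^ D.γ
  have hGξ : 0 < Gξ := by positivity
  have hGA : 0 < GA := by positivity
  have hQ : 0 < (q ^ 2) ^ D.γ := by positivity
  set Q := (q ^ 2) ^ D.γ
  have eq : 2 * D.R * Real.sin (k / 2) * A * GA / (D.R * Real.sin k * σ * Gξ) =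
      A * GA / (Real.cos (k / 2) * σ * Gξ) := by
    rw [e2]; field_simp
  rw [eq]
  have up : A * GA / (Real.cos (k / 2) * σ * Gξ) ≤ g k := by
    simp only [hg]
    rw [← hq, ← hqγ, div_le_div_iff₀ (by positivity) hc]
    calc A * GA * Real.cos (k / 2) ≤ (q * σ) * (Q * Gξ) * Real.cos (k / 2) := by gcongr
      _ = _ := by ring
  have dn : f k ≤ A * GA / (Real.cos (k / 2) * σ * Gξ) := by
    simp only [hf]
    rw [← hq, ← hqγ, le_div_iff₀ (by positivity), inv_mul_le_iff₀ (by positivity)]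
    calc Real.cos (k / 2) * σ * Gξ ≤ (q * A) * (Q * GA) := by gcongr
      _ = _ := by ring
  rw [abs_le]
  constructor <;> linarith [hfg.1, hfg.2]

end Data

theorem sum_shift_le_edgeEnergy (n₁ n₂ : ℕ) (g : ℕ → ℕ → ℝ) :
    ∑ i ∈ Finset.range n₁, ∑ j ∈ Finset.range n₂, (g (i + 1) (j + 2) - g (i + 1) (j + 1)) ^ 2 ≤
      edgeEnergy (n₁ + 1) (n₂ + 1) g := by
  have hG : ∀ i j, 0 ≤ (g (i + 1) j - g i j) ^ 2 + (g i (j + 1) - g i j) ^ 2 := fun i j => by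
    positivity
  unfold edgeEnergy
  rw [Finset.sum_range_succ']
  refine le_trans (Finset.sum_le_sum fun i _ => ?_)
    (le_add_of_nonneg_right (Finset.sum_nonneg fun j _ => hG _ _))
  rw [Finset.sum_range_succ']
  refine le_trans (Finset.sum_le_sum fun j _ => ?_) (le_add_of_nonneg_right (hG _ _))
  exact le_add_of_nonneg_left (sq_nonneg _)

theorem sum_le_edgeEnergy (n₁ n₂ : ℕ) (g : ℕ → ℕ → ℝ) :
    ∑ i ∈ Finset.range n₁, ∑ j ∈ Finset.range n₂, (g i (j + 1) - g i j) ^ 2 ≤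
      edgeEnergy n₁ n₂ g :=
  Finset.sum_le_sum fun _ _ => Finset.sum_le_sum fun _ _ => le_add_of_nonneg_left (sq_nonneg _)

namespace Data

/-- The momentum of a lattice cell. -/
noncomputable def momentum (D : Data) (N : ℕ) (X : ℕ → ℕ → ℝ) (i j : ℕ) : ℝ :=
  D.vel N X i j * (X i j - X i (j - 1))

/-- The action of a lattice cell. -/
noncomputable def action (D : Data) (N : ℕ) (P X : ℕ → ℕ → ℝ) (i j : ℕ) : ℝ :=
  D.dt N * (D.vel N X i j ^ 2 / 2 + D.spec N P (i + 1) (j + 1) ^ (-D.θ))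

/-- The circulation of the momentum and the action around a lattice cell. -/
noncomputable def defect (D : Data) (N : ℕ) (P X : ℕ → ℕ → ℝ) (i j : ℕ) : ℝ :=
  D.momentum N X (i + 1) (j + 1) - D.momentum N X i (j + 1) -
    (D.action N P X i (j + 1) - D.action N P X i j)

variable {D : Data} {N i₀ : ℕ} {P X : ℕ → ℕ → ℝ}

theorem DiscreteFlow.defect_eq (h : D.DiscreteFlow N i₀ P X) {i j : ℕ} (hi : i₀ ≤ i)
    (hiN : i + 2 ≤ N) (hj' : j + 2 < 2 * N) :
    D.defect N P X i j = D.dt N * ((D.vel N X i (j + 1) - D.vel N X i j) ^ 2 / 2 +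
      (D.Δ N (j + 1) * D.ph N (j + 1) / D.μ N (j + 1)) * (D.θ / (1 + D.θ) *
        (D.spec N P (i + 1) (j + 2) ^ (-D.e) - D.spec N P (i + 1) (j + 1) ^ (-D.e)) *
          D.spec N P (i + 1) (j + 1)) -
      (D.spec N P (i + 1) (j + 2) ^ (-D.θ) - D.spec N P (i + 1) (j + 1) ^ (-D.θ))) := by
  have hh := dt_pos (D := D) h.N_pos
  have r1 := h.rel (i + 1) j (by omega) (by omega) (by omega)
  have r2 := h.rel i j hi (by omega) (by omega)
  have r3 := h.vel_succ_snd hi hiN (show 1 ≤ j + 1 by omega) (by omega)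
  have hph := ph_pos (D := D) h.N_pos (show 1 ≤ j + 1 by omega) (by omega)
  have r4 : D.Δ N (j + 1) * (P (i + 1) (j + 1) - P i (j + 1)) =
      D.dt N * (D.vel N X i (j + 1) - D.vel N X i j) := by
    simp only [vel]; field_simp; linarith
  have r5 : P (i + 1) (j + 1) = D.spec N P (i + 1) (j + 1) * D.ph N (j + 1) := by
    unfold spec; field_simp
  unfold defect momentum action
  rw [Nat.add_sub_cancel, r1, r2]
  have e1 : D.vel N X (i + 1) (j + 1) = D.vel N X i (j + 1) +
    (D.vel N X (i + 1) (j + 1) - D.vel N X i (j + 1)) := by ring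
  rw [e1, r3]
  have r6 : P i (j + 1) * D.Δ N (j + 1) = D.spec N P (i + 1) (j + 1) * D.ph N (j + 1) *
      D.Δ N (j + 1) - D.dt N * (D.vel N X i (j + 1) - D.vel N X i j) := by
    rw [← r5]; linarith
  have r7 : D.Δ N (j + 1) * P i (j + 1) = D.spec N P (i + 1) (j + 1) * D.ph N (j + 1) *
      D.Δ N (j + 1) - D.dt N * (D.vel N X i (j + 1) - D.vel N X i j) := by
    rw [← r6]; ring
  rw [r7, r5]
  ring

theorem DiscreteFlow.abs_defect_le (h : D.DiscreteFlow N i₀ P X) {i j : ℕ} (hi : i₀ ≤ i)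
    (hiN : i + 2 ≤ N) (hj' : j + 2 < 2 * N) {lo hi' ε : ℝ} (hlo : 0 < lo)
    (h1 : D.spec N P (i + 1) (j + 1) ∈ Icc lo hi') (h2 : D.spec N P (i + 1) (j + 2) ∈ Icc lo hi')
    (hω : |D.Δ N (j + 1) * D.ph N (j + 1) / D.μ N (j + 1) - 1| ≤ ε) :
    |D.defect N P X i j| ≤ D.dt N * ((D.vel N X i (j + 1) - D.vel N X i j) ^ 2 +
      (D.θ * lo ^ (-D.e - 1) + ε * (D.e * lo ^ (-D.e - 1) * hi' * N)) *
        (D.spec N P (i + 1) (j + 2) - D.spec N P (i + 1) (j + 1)) ^ 2 +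
      ε * (D.e * lo ^ (-D.e - 1) * hi') / N) := by
  have hh := dt_pos (D := D) h.N_pos
  have hθ := D.θ_pos
  have he := D.e_pos
  have hN : (0 : ℝ) < N := by exact_mod_cast h.N_pos
  rw [h.defect_eq hi hiN hj', abs_mul, abs_of_pos hh]
  refine mul_le_mul_of_nonneg_left ?_ hh.le
  set x := D.spec N P (i + 1) (j + 1)
  set y := D.spec N P (i + 1) (j + 2)
  set ω := D.Δ N (j + 1) * D.ph N (j + 1) / D.μ N (j + 1)
  set V := D.vel N X i (j + 1) - D.vel N X i j
  have q1 := abs_rpow_quadratic_le hθ (e := D.e) rfl hlo h1.1 h2.1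
  have hx : 0 < x := hlo.trans_le h1.1
  have hhi : 0 < hi' := hx.trans_le h1.2
  have q2 : |D.θ / (1 + D.θ) * (y ^ (-D.e) - x ^ (-D.e)) * x| ≤
      D.e * lo ^ (-D.e - 1) * hi' * |y - x| := by
    have c1 : D.θ / (1 + D.θ) ≤ 1 := by rw [div_le_one (by linarith)]; linarith
    have c0 : 0 ≤ D.θ / (1 + D.θ) := by positivity
    have b1 := (negSlope_bounds he hlo h1 h2).2
    have b0 := negSlope_pos he hx (hlo.trans_le h2.1)
    rw [← negSlope_mul, abs_mul, abs_mul, abs_mul, abs_of_nonneg c0, abs_of_pos b0, abs_of_pos hx,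
      abs_sub_comm x y]
    calc _ ≤ 1 * ((D.e * lo ^ (-D.e - 1)) * |y - x|) * hi' := by gcongr; exact h1.2
      _ = _ := by ring
  have hε : 0 ≤ ε := (abs_nonneg _).trans hω
  set K := D.e * lo ^ (-D.e - 1) * hi' with hK
  have hK0 : 0 ≤ K := by positivity
  have q3 : |y - x| ≤ N * (y - x) ^ 2 + 1 / N := by
    have e1 : N * (y - x) ^ 2 + 1 / N - |y - x| =
      (N * (|y - x| - 1 / N) ^ 2 + |y - x|) := by
      rw [← sq_abs (y - x)]; field_simp; ring
    have : 0 ≤ (N * (|y - x| - 1 / N) ^ 2 + |y - x|) := by positivity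
    linarith
  have e : V ^ 2 / 2 + ω * (D.θ / (1 + D.θ) * (y ^ (-D.e) - x ^ (-D.e)) * x) -
      (y ^ (-D.θ) - x ^ (-D.θ)) = V ^ 2 / 2 +
      (D.θ / (1 + D.θ) * (y ^ (-D.e) - x ^ (-D.e)) * x - (y ^ (-D.θ) - x ^ (-D.θ))) +
      (ω - 1) * (D.θ / (1 + D.θ) * (y ^ (-D.e) - x ^ (-D.e)) * x) := by ring
  rw [e]
  refine (abs_add_three _ _ _).trans ?_
  rw [abs_mul (ω - 1), abs_of_nonneg (show 0 ≤ V ^ 2 / 2 by positivity)]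
  have q4 : |ω - 1| * |D.θ / (1 + D.θ) * (y ^ (-D.e) - x ^ (-D.e)) * x| ≤
      ε * (K * (N * (y - x) ^ 2 + 1 / N)) := by
    refine mul_le_mul hω (q2.trans ?_) (abs_nonneg _) hε
    gcongr
  have q5 : ε * (K * (N * (y - x) ^ 2 + 1 / N)) = ε * (K * N) * (y - x) ^ 2 + ε * K / N := by
    field_simp
  nlinarith [sq_nonneg V]

end Data

namespace Data

variable {D : Data}

theorem exists_sum_defect_le (D : Data) {τ s ε : ℝ} (hτ : 0 < τ) (hs : 0 < s) (hε : 0 < ε) :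
    ∃ N₀ : ℕ, ∀ N ≥ N₀, ∀ (i₀ : ℕ) (P X : ℕ → ℕ → ℝ), D.DiscreteFlow N i₀ P X →
      i₀ * D.dt N ≤ τ → ∀ i₁ j₁ n₁ n₂ : ℕ, 2 * τ ≤ i₁ * D.dt N →
      (i₁ + n₁ : ℕ) * D.dt N ≤ D.T - τ → 2 * s ≤ D.ang N j₁ →
      D.ang N (j₁ + n₂) ≤ Real.pi - 2 * s →
      ∑ i ∈ Finset.range n₁, ∑ j ∈ Finset.range n₂, |D.defect N P X (i₁ + i) (j₁ + j)| ≤ ε := by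
  have hT := D.T_pos
  have hθ := D.θ_pos
  have he := D.e_pos
  have hpi := Real.pi_pos
  by_cases hsπ : Real.pi - 2 * s < 2 * s
  · refine ⟨1, fun N hN i₀ P X hF _ i₁ j₁ n₁ n₂ _ _ h1 h2 => ?_⟩
    have := D.ang_mono hN (show j₁ ≤ j₁ + n₂ by omega)
    linarith
  push Not at hsπ
  have hs' : 0 < Real.sin s := Real.sin_pos_of_pos_of_lt_pi hs (by linarith)
  obtain ⟨C, hC, hbox⟩ := D.exists_flow_box_bounds hτ (one_div_pos.2 hs')
  have hC0 : 0 < C := by linarith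
  have hp := prof_pos (D := D) hs'
  have hw := wsize_pos (D := D) hs'
  set δ := min (τ / (2 * D.T)) (s / Real.pi) with hδ
  have hδ0 : 0 < δ := by rw [hδ]; positivity
  have hδ1 : δ * D.T ≤ τ / 2 := by
    have : δ ≤ τ / (2 * D.T) := min_le_left _ _
    calc δ * D.T ≤ τ / (2 * D.T) * D.T := by gcongr
      _ = _ := by field_simp
  have hδ2 : δ * (Real.pi / 2) ≤ s / 2 := by
    have : δ ≤ s / Real.pi := min_le_right _ _
    calc δ * (Real.pi / 2) ≤ s / Real.pi * (Real.pi / 2) := by gcongr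
      _ = _ := by field_simp
  set lo := C⁻¹ / D.prof (Real.sin s) with hlo
  have hlo0 : 0 < lo := by rw [hlo]; positivity
  set hi := C / D.prof (Real.sin s) with hhi
  set c₂ := C * D.wsize (Real.sin s) with hc₂
  have hhi0 : 0 < hi := by rw [hhi]; positivity
  set E := 2 * C ^ 2 * hi ^ 2 * (2 / δ) ^ 2 * 2 with hE
  have hE0 : 0 < E := by positivity
  set K₁ := D.θ * lo ^ (-D.e - 1) with hK₁
  set K₂ := D.e * lo ^ (-D.e - 1) * hi with hK₂
  have hK₁0 : 0 < K₁ := by positivity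
  have hK₂0 : 0 < K₂ := by positivity
  set ε' := ε / (2 * D.T * K₂ * (E + 2)) with hε'
  have hε'0 : 0 < ε' := by positivity
  obtain ⟨k₀, hk₀, hmass⟩ := D.exists_mass_ratio hs' hε'0
  obtain ⟨N₀, hN₀⟩ := exists_nat_ge (max (max (1 / δ) (Real.pi / (2 * k₀)))
    (max (max (8 * D.T / τ) (5 * Real.pi / s)) (2 * D.T * (c₂ ^ 2 + K₁) * E / ε)))
  simp only [max_le_iff] at hN₀
  obtain ⟨⟨w1, w2⟩, ⟨w3, w4⟩, w5⟩ := hN₀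
  refine ⟨N₀, fun N hNN i₀ P X hF hi₀ i₁ j₁ n₁ n₂ h1 h2 h3 h4 => ?_⟩
  have hN := hF.N_pos
  have hNr : (0 : ℝ) < N := by exact_mod_cast hN
  have hNN' : (N₀ : ℝ) ≤ N := by exact_mod_cast hNN
  replace w1 := (div_le_iff₀ hδ0).1 (w1.trans hNN')
  replace w2 := (div_le_iff₀ (by positivity)).1 (w2.trans hNN')
  replace w3 := (div_le_iff₀ hτ).1 (w3.trans hNN')
  replace w4 := (div_le_iff₀ hs).1 (w4.trans hNN')
  replace w5 := (div_le_iff₀ hε).1 (w5.trans hNN')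
  have hh := dt_pos (D := D) hN
  have hNh := N_mul_dt (D := D) hN
  have hk := step_pos hN
  have hNk : ((2 * N : ℕ) : ℝ) * (Real.pi / (2 * N)) = Real.pi := ang_two_mul (D := D) hN
  have hang : ∀ j : ℕ, D.ang N j = j * (Real.pi / (2 * N)) := fun j => rfl
  have hkk₀ : Real.pi / (2 * N) ≤ k₀ := by rw [div_le_iff₀ (by positivity)]; linarith
  have hk5 : 5 * (Real.pi / (2 * N)) ≤ s / 2 := by
    rw [← mul_div_assoc, div_le_iff₀ (by positivity)]; linarith
  have hh4 : 4 * D.dt N ≤ τ / 2 := by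
    rw [dt, ← mul_div_assoc, div_le_iff₀ hNr]; linarith
  set m := ⌊δ * N⌋₊ with hm
  have hm1 : (m : ℝ) ≤ δ * N := Nat.floor_le (by positivity)
  have hm2 : δ * N < m + 1 := Nat.lt_floor_add_one _
  have hm3 : 1 ≤ m := by rw [hm]; exact Nat.le_floor (by push_cast; linarith)
  have hm3' : (1 : ℝ) ≤ m := by exact_mod_cast hm3
  have hmh : m * D.dt N ≤ τ / 2 := by
    calc (m : ℝ) * D.dt N ≤ δ * N * D.dt N := by gcongr
      _ = δ * (N * D.dt N) := by ring
      _ ≤ _ := by rw [hNh]; exact hδ1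
  set k := Real.pi / (2 * N)
  have hmk : m * k ≤ s / 2 := by
    have e : (N : ℝ) * k = Real.pi / 2 := by push_cast at hNk; linarith
    calc (m : ℝ) * k ≤ δ * N * k := by gcongr
      _ = δ * (N * k) := by ring
      _ ≤ _ := by rw [e]; exact hδ2
  rw [hang] at h3 h4
  push_cast at h2 h4
  have him : m ≤ i₁ := by
    have : (m : ℝ) * D.dt N ≤ i₁ * D.dt N := by linarith
    exact_mod_cast le_of_mul_le_mul_right this hh
  have hjm : m + 1 ≤ j₁ := by
    have : ((m + 1 : ℕ) : ℝ) * k ≤ j₁ * k := by push_cast; linarith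
    exact_mod_cast le_of_mul_le_mul_right this hk
  obtain ⟨ib, hib⟩ := Nat.exists_eq_add_of_le' him
  obtain ⟨jb, hjb⟩ := Nat.exists_eq_add_of_le' (show m ≤ j₁ by omega)
  have hib' : (i₁ : ℝ) = ib + m := by rw [hib]; push_cast; ring
  have hjb' : (j₁ : ℝ) = jb + m := by rw [hjb]; push_cast; ring
  rw [hib'] at h1 h2
  rw [hjb'] at h3 h4
  have a1 : τ ≤ ib * D.dt N := by linarith
  have a0 : i₀ ≤ ib := by
    have : (i₀ : ℝ) * D.dt N ≤ ib * D.dt N := hi₀.trans a1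
    exact_mod_cast le_of_mul_le_mul_right this hh
  have a2 : ib + (m + (n₁ + 2) + m) + 1 ≤ N := by
    have : ((ib + (m + (n₁ + 2) + m) + 1 : ℕ) : ℝ) * D.dt N ≤ N * D.dt N := by
      rw [hNh]; push_cast; linarith
    exact_mod_cast le_of_mul_le_mul_right this hh
  have a3 : jb + (m + (n₂ + 2) + m) + 1 < 2 * N := by
    have : ((jb + (m + (n₂ + 2) + m) + 1 : ℕ) : ℝ) * k < (2 * N : ℕ) * k := by
      rw [hNk]; push_cast; linarith
    exact_mod_cast lt_of_mul_lt_mul_right this hk.le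
  have a4 : ∀ j, jb ≤ j → j ≤ jb + (m + (n₂ + 2) + m) + 1 →
      D.sn N j ∈ Icc (Real.sin s) (1 / Real.sin s * Real.sin s) := by
    intro j h1 h2
    rw [one_div_mul_cancel hs'.ne']
    refine ⟨?_, Real.sin_le_one _⟩
    have h1' : (jb : ℝ) * k ≤ j * k := by gcongr
    have h2' : (j : ℝ) * k ≤ (jb + (m + (n₂ + 2) + m) + 1 : ℕ) * k := by gcongr
    push_cast at h2'
    unfold sn
    rw [hang]
    rcases le_total ((j : ℝ) * k) (Real.pi / 2) with h | h
    · exact Real.sin_le_sin_of_le_of_le_pi_div_two (by linarith) h (by linarith)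
    · rw [← Real.sin_pi_sub ((j : ℝ) * k)]
      exact Real.sin_le_sin_of_le_of_le_pi_div_two (by linarith) (by linarith) (by linarith)
  obtain ⟨hA, hB, hS⟩ := hbox N i₀ P X ib jb (m + (n₁ + 2) + m) (m + (n₂ + 2) + m) _ hF hs' a0 a1
    (by omega) a3 a4
  have hcp := hF.conjPair a0 a2 (show 1 ≤ jb by omega) a3
  have hEp := hcp.edgeEnergy_fst_le (by positivity) hA hB (fun i j hi hj => (hS i j hi hj).1) hm3
    (n₁ := n₁ + 2) (n₂ := n₂ + 2) le_rfl le_rfl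
  have hEp' : edgeEnergy (n₁ + 2) (n₂ + 2) (fun i j => D.spec N P (ib + (m + i)) (jb + (m + j))) ≤
      E := by
    refine hEp.trans ?_
    have e1 : c₂ / (C⁻¹ * D.wsize (Real.sin s)) = C ^ 2 := by rw [hc₂]; field_simp
    have e2 : ((m + (n₁ + 2) + m : ℕ) : ℝ) ≤ N := by exact_mod_cast (by omega)
    have e3 : ((m + (n₂ + 2) + m : ℕ) : ℝ) ≤ 2 * N := by exact_mod_cast (by omega)
    have e4 : 1 / (m : ℝ) * N ≤ 2 / δ := by
      rw [div_mul_eq_mul_div, div_le_div_iff₀ (by linarith) hδ0]; linarith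
    rw [e1]
    calc _ ≤ 2 * C ^ 2 * hi ^ 2 * (1 / m) ^ 2 * N * (2 * N) := by gcongr
      _ = 2 * C ^ 2 * hi ^ 2 * (1 / m * N) ^ 2 * 2 := by ring
      _ ≤ _ := by rw [hE]; gcongr
  have hmono : edgeEnergy (n₁ + 1) (n₂ + 1)
      (fun i j => D.spec N P (ib + (m + i)) (jb + (m + j))) ≤ E := by
    refine le_trans ?_ hEp'
    unfold edgeEnergy
    refine (Finset.sum_le_sum fun i _ => ?_).trans (Finset.sum_le_sum_of_subset_of_nonneg
      (Finset.range_subset_range.2 (by omega)) fun i _ _ => Finset.sum_nonneg fun j _ => ?_)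
    · exact Finset.sum_le_sum_of_subset_of_nonneg
        (Finset.range_subset_range.2 (by omega)) fun j _ _ => by positivity
    · positivity
  have hs1 := hcp.shift m m (n₁ + 2) (n₂ + 2) (by omega) (by omega)
  have hEv := hs1.edgeEnergy_snd_le (n₁ := n₁) (n₂ := n₂) (c₁ := C⁻¹ * D.wsize (Real.sin s))
    (c₂ := c₂) (by positivity)
    (fun i j hi hj => hA (m + i) (m + j) (by omega) (by omega))
    (fun i j hi hj => hB (m + i) (m + j) (by omega) (by omega)) (by omega) (by omega)
  have hEv' := (sum_le_edgeEnergy _ _ _).trans (hEv.trans (mul_le_mul_of_nonneg_left hmono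
    (sq_nonneg c₂)))
  have hEp'' := (sum_shift_le_edgeEnergy n₁ n₂ _).trans hmono
  have hnn : (n₁ : ℝ) * n₂ ≤ 2 * N ^ 2 := by
    have e2 : (n₁ : ℝ) ≤ N := by exact_mod_cast (by omega)
    have e3 : (n₂ : ℝ) ≤ 2 * N := by exact_mod_cast (by omega)
    calc (n₁ : ℝ) * n₂ ≤ N * (2 * N) := by gcongr
      _ = _ := by ring
  calc ∑ i ∈ Finset.range n₁, ∑ j ∈ Finset.range n₂, |D.defect N P X (i₁ + i) (j₁ + j)|
      ≤ ∑ i ∈ Finset.range n₁, ∑ j ∈ Finset.range n₂, D.dt N *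
        ((D.vel N X (ib + (m + i)) (jb + (m + (j + 1))) -
          D.vel N X (ib + (m + i)) (jb + (m + j))) ^ 2 +
        (K₁ + ε' * (K₂ * N)) * (D.spec N P (ib + (m + (i + 1))) (jb + (m + (j + 2))) -
          D.spec N P (ib + (m + (i + 1))) (jb + (m + (j + 1)))) ^ 2 + ε' * K₂ / N) := by
        refine Finset.sum_le_sum fun i hi => Finset.sum_le_sum fun j hj => ?_
        rw [Finset.mem_range] at hi hj
        have e1 : i₁ + i = ib + (m + i) := by omega
        have e2 : j₁ + j = jb + (m + j) := by omega
        rw [e1, e2]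
        have b1 := hS (m + (i + 1)) (m + (j + 1)) (by omega) (by omega)
        have b2 := hS (m + (i + 1)) (m + (j + 2)) (by omega) (by omega)
        exact hF.abs_defect_le (by omega) (by omega) (by omega) hlo0
          ⟨b1.2, (le_abs_self _).trans b1.1⟩ ⟨b2.2, (le_abs_self _).trans b2.1⟩
          (hmass N _ hN hkk₀ (by omega) (a4 _ (by omega) (by omega)).1
            (a4 _ (by omega) (by omega)).1)
    _ = D.dt N * (∑ i ∈ Finset.range n₁, ∑ j ∈ Finset.range n₂,
        (D.vel N X (ib + (m + i)) (jb + (m + (j + 1))) -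
          D.vel N X (ib + (m + i)) (jb + (m + j))) ^ 2 +
        (K₁ + ε' * (K₂ * N)) * ∑ i ∈ Finset.range n₁, ∑ j ∈ Finset.range n₂,
          (D.spec N P (ib + (m + (i + 1))) (jb + (m + (j + 2))) -
          D.spec N P (ib + (m + (i + 1))) (jb + (m + (j + 1)))) ^ 2 +
        n₁ * n₂ * (ε' * K₂ / N)) := by
        simp only [← Finset.mul_sum, Finset.sum_add_distrib, Finset.sum_const, Finset.card_range,
          nsmul_eq_mul]
        ring
    _ ≤ D.dt N * (c₂ ^ 2 * E + (K₁ + ε' * (K₂ * N)) * E + 2 * N ^ 2 * (ε' * K₂ / N)) := by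
        gcongr
    _ = D.dt N * ((c₂ ^ 2 + K₁) * E) + (N * D.dt N) * ε' * K₂ * (E + 2) := by
        field_simp; ring
    _ ≤ ε / 2 + ε / 2 := by
        rw [hNh]
        refine add_le_add ?_ (le_of_eq ?_)
        · rw [dt, div_mul_eq_mul_div, div_le_iff₀ hNr]; linarith
        · rw [hε']; field_simp
    _ = ε := by ring

end Data

/-- A sequence of discrete flows on refining lattices. -/
structure FlowSeq (D : Data) where
  /-- number of time steps -/
  N : ℕ → ℕ
  /-- initial time index -/
  i₀ : ℕ → ℕ
  /-- Jacobians -/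
  P : ℕ → ℕ → ℕ → ℝ
  /-- positions -/
  X : ℕ → ℕ → ℕ → ℝ
  flow : ∀ n, D.DiscreteFlow (N n) (i₀ n) (P n) (X n)
  N_tendsto : Tendsto N atTop atTop
  i₀_tendsto : Tendsto (fun n => i₀ n * D.dt (N n)) atTop (𝓝 0)

theorem Data.exists_flowSeq (D : Data) : Nonempty (FlowSeq D) := by
  have hT := D.T_pos
  have key : ∀ n : ℕ, ∃ N i₀ : ℕ, ∃ P X : ℕ → ℕ → ℝ, D.DiscreteFlow N i₀ P X ∧ n ≤ N ∧
      i₀ * D.dt N = D.T / (n + 2) := by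
    intro n
    have hA : 0 < min D.Am D.Ap := lt_min D.Am_pos D.Ap_pos
    obtain ⟨K, hK⟩ := exists_nat_ge (D.T * (D.T / (n + 2)) ^ (D.α - 2) / min D.Am D.Ap)
    have e : ((K + 1 : ℕ) : ℝ) * D.dt ((n + 2) * (K + 1)) = D.T / (n + 2) := by
      unfold dt; push_cast; field_simp
    have hle : D.dt ((n + 2) * (K + 1)) * (D.T / (n + 2)) ^ (D.α - 2) ≤ min D.Am D.Ap := by
      rw [div_le_iff₀ hA] at hK
      unfold dt
      push_cast
      rw [div_mul_eq_mul_div, div_le_iff₀ (by positivity)]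
      refine hK.trans ?_
      have h0 : (0 : ℝ) ≤ n * (K + 1) := by positivity
      have h1 : (K : ℝ) ≤ (n + 2) * (K + 1) := by
        have := Nat.cast_nonneg (α := ℝ) K
        linarith
      rw [mul_comm (min D.Am D.Ap)]
      gcongr
    obtain ⟨P, X, h⟩ := exists_discreteFlow (D := D) (N := (n + 2) * (K + 1)) (i₀ := K + 1)
      (by omega) (by nlinarith) (by rw [e]; exact hle.trans (min_le_left _ _))
      (by rw [e]; exact hle.trans (min_le_right _ _))
    exact ⟨_, _, P, X, h, by nlinarith, e⟩
  choose N i₀ P X h hN hi using key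
  refine ⟨⟨N, i₀, P, X, h, tendsto_atTop_mono hN tendsto_id, ?_⟩⟩
  simp only [hi]
  exact tendsto_const_nhds.div_atTop (tendsto_atTop_add_const_right _ _ tendsto_natCast_atTop_atTop)

namespace FlowSeq

variable {D : Data} (Q : FlowSeq D)

/-- The ultrafilter along which limits are taken. -/
noncomputable def ult : Ultrafilter ℕ := hyperfilter ℕ

/-- The index set of the lattices. -/
def dom : Set (ℕ × ℕ × ℕ) := {a | Q.i₀ a.1 ≤ a.2.1 ∧ a.2.1 ≤ Q.N a.1 ∧ a.2.2 < 2 * Q.N a.1}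

/-- The time of a lattice node. -/
noncomputable def tm (a : ℕ × ℕ × ℕ) : ℝ := a.2.1 * D.dt (Q.N a.1)

/-- The label of a lattice node. -/
noncomputable def lb (a : ℕ × ℕ × ℕ) : ℝ := D.lab (Q.N a.1) a.2.2

/-- Lattice nodes close to a point. -/
noncomputable def near (z : ℝ × ℝ) : Filter (ℕ × ℕ × ℕ) :=
  comap Prod.fst (ult : Filter ℕ) ⊓ comap (fun a => (Q.tm a, Q.lb a)) (𝓝 z) ⊓ 𝓟 Q.dom

theorem ult_le : (ult : Filter ℕ) ≤ atTop := by
  rw [← Nat.cofinite_eq_atTop]; exact hyperfilter_le_cofinite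

theorem mem_near {z : ℝ × ℝ} {s : Set (ℕ × ℕ × ℕ)} :
    s ∈ Q.near z ↔ ∃ δ > 0, ∀ᶠ n in (ult : Filter ℕ), ∀ i j, (n, i, j) ∈ Q.dom →
      |Q.tm (n, i, j) - z.1| < δ → |Q.lb (n, i, j) - z.2| < δ → (n, i, j) ∈ s := by
  have hb := (((ult : Filter ℕ).basis_sets.comap Prod.fst).inf
    ((Metric.nhds_basis_ball (x := z)).comap (fun a => (Q.tm a, Q.lb a)))).inf_principal Q.dom
  unfold near
  rw [hb.mem_iff]
  constructor
  · rintro ⟨⟨A, δ⟩, ⟨hA, hδ⟩, h⟩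
    refine ⟨δ, hδ, ?_⟩
    filter_upwards [hA] with n hn i j hd h1 h2
    refine h ⟨⟨hn, ?_⟩, hd⟩
    simp only [mem_preimage, Metric.mem_ball, Prod.dist_eq, Real.dist_eq, sup_lt_iff]
    exact ⟨h1, h2⟩
  · rintro ⟨δ, hδ, hA⟩
    refine ⟨(_, δ), ⟨hA, hδ⟩, ?_⟩
    rintro ⟨n, i, j⟩ ⟨⟨h1, h2⟩, h3⟩
    simp only [mem_preimage, Metric.mem_ball, Prod.dist_eq, Real.dist_eq, sup_lt_iff] at h2
    exact h1 i j h3 h2.1 h2.2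

theorem eventually_near {z : ℝ × ℝ} {p : ℕ × ℕ × ℕ → Prop} :
    (∀ᶠ a in Q.near z, p a) ↔ ∃ δ > 0, ∀ᶠ n in (ult : Filter ℕ), ∀ i j, (n, i, j) ∈ Q.dom →
      |Q.tm (n, i, j) - z.1| < δ → |Q.lb (n, i, j) - z.2| < δ → p (n, i, j) := Q.mem_near

theorem tendsto_fst (z : ℝ × ℝ) : Tendsto Prod.fst (Q.near z) (ult : Filter ℕ) :=
  tendsto_comap.mono_left (inf_le_left.trans inf_le_left)

theorem tendsto_pos (z : ℝ × ℝ) : Tendsto (fun a => (Q.tm a, Q.lb a)) (Q.near z) (𝓝 z) :=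
  tendsto_comap.mono_left (inf_le_left.trans inf_le_right)

theorem tendsto_tm (z : ℝ × ℝ) : Tendsto Q.tm (Q.near z) (𝓝 z.1) :=
  (continuous_fst.tendsto z).comp (Q.tendsto_pos z)

theorem tendsto_lb (z : ℝ × ℝ) : Tendsto Q.lb (Q.near z) (𝓝 z.2) :=
  (continuous_snd.tendsto z).comp (Q.tendsto_pos z)

theorem eventually_dom (z : ℝ × ℝ) : ∀ᶠ a in Q.near z, a ∈ Q.dom :=
  (inf_le_right : Q.near z ≤ _) (mem_principal_self _)

theorem tendsto_near {β : Type*} {l : Filter β} {f : β → ℕ × ℕ × ℕ} {z : ℝ × ℝ}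
    (h1 : Tendsto (fun b => (f b).1) l (ult : Filter ℕ)) (h2 : Tendsto (fun b => Q.tm (f b)) l (𝓝 z.1))
    (h3 : Tendsto (fun b => Q.lb (f b)) l (𝓝 z.2)) (h4 : ∀ᶠ b in l, f b ∈ Q.dom) :
    Tendsto f l (Q.near z) := by
  refine tendsto_inf.2 ⟨tendsto_inf.2 ⟨tendsto_comap_iff.2 h1, tendsto_comap_iff.2 ?_⟩,
    tendsto_principal.2 h4⟩
  exact h2.prodMk_nhds h3

theorem tendsto_dt : Tendsto (fun n => D.dt (Q.N n)) (ult : Filter ℕ) (𝓝 0) := by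
  have : Tendsto (fun n => D.dt (Q.N n)) atTop (𝓝 0) :=
    tendsto_const_nhds.div_atTop (tendsto_natCast_atTop_atTop.comp Q.N_tendsto)
  exact this.mono_left ult_le

theorem tendsto_step : Tendsto (fun n => Real.pi / (2 * (Q.N n : ℝ))) (ult : Filter ℕ) (𝓝 0) := by
  have : Tendsto (fun n => Real.pi / (2 * (Q.N n : ℝ))) atTop (𝓝 0) :=
    tendsto_const_nhds.div_atTop ((tendsto_natCast_atTop_atTop.comp Q.N_tendsto).const_mul_atTop
      (by norm_num))
  exact this.mono_left ult_le

theorem tendsto_i₀ : Tendsto (fun n => Q.i₀ n * D.dt (Q.N n)) (ult : Filter ℕ) (𝓝 0) :=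
  Q.i₀_tendsto.mono_left ult_le

theorem N_pos (n : ℕ) : 1 ≤ Q.N n := (Q.flow n).N_pos

theorem abs_lab_succ_sub_le (n j : ℕ) :
    |D.lab (Q.N n) (j + 1) - D.lab (Q.N n) j| ≤ D.R * (Real.pi / (2 * (Q.N n : ℝ))) := by
  have h := Real.abs_cos_sub_cos_le (D.ang (Q.N n) (j + 1) + Real.pi / (2 * (Q.N n : ℝ)) / 2)
    (D.ang (Q.N n) j + Real.pi / (2 * (Q.N n : ℝ)) / 2)
  have hk := Data.step_pos (Q.N_pos n)
  unfold Data.lab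
  rw [← mul_sub, abs_mul, abs_neg, abs_of_pos D.R_pos]
  refine mul_le_mul_of_nonneg_left (h.trans ?_) D.R_pos.le
  rw [Data.ang_succ, add_right_comm, add_sub_cancel_left, abs_of_pos hk]

theorem tm_mem {a : ℕ × ℕ × ℕ} (ha : a ∈ Q.dom) : Q.tm a ∈ Ioc 0 D.T := by
  have hh := Data.dt_pos (D := D) (Q.N_pos a.1)
  have h1 : (1 : ℝ) ≤ a.2.1 := by exact_mod_cast (Q.flow a.1).one_le.trans ha.1
  refine ⟨by unfold tm; positivity, ?_⟩
  rw [← Data.N_mul_dt (D := D) (Q.N_pos a.1)]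
  unfold tm
  have : (a.2.1 : ℝ) ≤ Q.N a.1 := by exact_mod_cast ha.2.1
  gcongr

/-- An index of a time. -/
noncomputable def tidx (t : ℝ) (n : ℕ) : ℕ := max (Q.i₀ n) ⌊t / D.dt (Q.N n)⌋₊

/-- An index of a label. -/
noncomputable def lidx (r : ℝ) (n : ℕ) : ℕ :=
  min (2 * Q.N n - 1) ⌊Real.arccos (-r / D.R) / (Real.pi / (2 * (Q.N n : ℝ)))⌋₊

theorem tidx_mem {t : ℝ} (ht : t ∈ Icc 0 D.T) (n : ℕ) :
    Q.i₀ n ≤ Q.tidx t n ∧ Q.tidx t n ≤ Q.N n := by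
  have hh := Data.dt_pos (D := D) (Q.N_pos n)
  refine ⟨le_max_left _ _, max_le (Q.flow n).lt.le (Nat.floor_le_of_le ?_)⟩
  rw [div_le_iff₀ hh, Data.N_mul_dt (Q.N_pos n)]
  exact ht.2

theorem lidx_lt (r : ℝ) (n : ℕ) : Q.lidx r n < 2 * Q.N n := by
  have := Q.N_pos n
  have := min_le_left (2 * Q.N n - 1) ⌊Real.arccos (-r / D.R) / (Real.pi / (2 * (Q.N n : ℝ)))⌋₊
  unfold lidx
  omega

theorem tendsto_tidx {t : ℝ} (ht : t ∈ Icc 0 D.T) :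
    Tendsto (fun n => Q.tidx t n * D.dt (Q.N n)) (ult : Filter ℕ) (𝓝 t) := by
  have h1 : ∀ n, |Q.tidx t n * D.dt (Q.N n) - t| ≤ Q.i₀ n * D.dt (Q.N n) + D.dt (Q.N n) := by
    intro n
    have hh := Data.dt_pos (D := D) (Q.N_pos n)
    have a1 : (⌊t / D.dt (Q.N n)⌋₊ : ℝ) * D.dt (Q.N n) ≤ t := by
      rw [← le_div_iff₀ hh]; exact Nat.floor_le (div_nonneg ht.1 hh.le)
    have a2 : t < (⌊t / D.dt (Q.N n)⌋₊ + 1) * D.dt (Q.N n) := by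
      rw [← div_lt_iff₀ hh]; exact Nat.lt_floor_add_one _
    have a3 : 0 ≤ Q.i₀ n * D.dt (Q.N n) := by positivity
    unfold tidx
    push_cast
    rw [max_mul_of_nonneg _ _ hh.le, abs_le]
    rcases max_cases (Q.i₀ n * D.dt (Q.N n)) (⌊t / D.dt (Q.N n)⌋₊ * D.dt (Q.N n)) with h | h <;>
      rw [h.1] <;> constructor <;> linarith [ht.1, h.2]
  rw [tendsto_iff_norm_sub_tendsto_zero]
  refine squeeze_zero (fun _ => norm_nonneg _) h1 ?_
  simpa using Q.tendsto_i₀.add Q.tendsto_dt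

theorem tendsto_lidx {r : ℝ} (hr : r ∈ Icc (-D.R) D.R) :
    Tendsto (fun n => D.lab (Q.N n) (Q.lidx r n)) (ult : Filter ℕ) (𝓝 r) := by
  have hR := D.R_pos
  have h1 : ∀ n, |D.lab (Q.N n) (Q.lidx r n) - r| ≤ D.R * (2 * (Real.pi / (2 * (Q.N n : ℝ)))) := by
    intro n
    have hN := Q.N_pos n
    have hk := Data.step_pos hN
    have hNk : ((2 * Q.N n : ℕ) : ℝ) * (Real.pi / (2 * (Q.N n : ℝ))) = Real.pi :=
      Data.ang_two_mul (D := D) hN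
    set k := Real.pi / (2 * (Q.N n : ℝ)) with hkd
    set ϑ := Real.arccos (-r / D.R) with hϑ
    have hr' : r = - D.R * Real.cos ϑ := by
      rw [hϑ, Real.cos_arccos (by rw [le_div_iff₀ hR]; linarith [hr.2])
        (by rw [div_le_iff₀ hR]; linarith [hr.1])]
      field_simp
    have c1 : |D.ang (Q.N n) (Q.lidx r n) + k / 2 - ϑ| ≤ 2 * k := by
      have a1 : (⌊ϑ / k⌋₊ : ℝ) * k ≤ ϑ := by
        rw [← le_div_iff₀ hk]; exact Nat.floor_le (div_nonneg (Real.arccos_nonneg _) hk.le)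
      have a2 : ϑ < (⌊ϑ / k⌋₊ + 1) * k := by
        rw [← div_lt_iff₀ hk]; exact Nat.lt_floor_add_one _
      have a4 : ϑ ≤ Real.pi := Real.arccos_le_pi _
      have a5 : (((2 * Q.N n - 1 : ℕ) : ℝ)) = (2 * Q.N n : ℕ) - 1 := by
        rw [Nat.cast_sub (by omega)]; norm_num
      have e : D.ang (Q.N n) (Q.lidx r n) = (Q.lidx r n : ℕ) * k := rfl
      rw [e]
      unfold lidx
      rw [← hkd, ← hϑ, Nat.cast_min, a5, min_mul_of_nonneg _ _ hk.le, sub_mul, hNk, abs_le]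
      rcases min_cases (Real.pi - 1 * k) (⌊ϑ / k⌋₊ * k) with h | h <;>
        rw [h.1] <;> constructor <;> linarith [h.2]
    have h := Real.abs_cos_sub_cos_le (D.ang (Q.N n) (Q.lidx r n) + k / 2) ϑ
    unfold Data.lab
    conv_lhs => rw [hr']
    rw [← mul_sub, abs_mul, abs_neg, abs_of_pos hR, ← hr']
    exact mul_le_mul_of_nonneg_left (h.trans c1) hR.le
  rw [tendsto_iff_norm_sub_tendsto_zero]
  refine squeeze_zero (fun _ => norm_nonneg _) h1 ?_
  simpa using (Q.tendsto_step.const_mul 2).const_mul D.R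

/-- The rectangle of times and labels. -/
def rect (D : Data) : Set (ℝ × ℝ) := Icc 0 D.T ×ˢ Icc (-D.R) D.R

theorem tendsto_idx {z : ℝ × ℝ} (hz : z ∈ rect D) :
    Tendsto (fun n => (n, Q.tidx z.1 n, Q.lidx z.2 n)) (ult : Filter ℕ) (Q.near z) :=
  Q.tendsto_near tendsto_id (Q.tendsto_tidx hz.1) (Q.tendsto_lidx hz.2)
    (Eventually.of_forall fun n => ⟨(Q.tidx_mem hz.1 n).1, (Q.tidx_mem hz.1 n).2, Q.lidx_lt _ n⟩)

theorem near_neBot {z : ℝ × ℝ} (hz : z ∈ rect D) : (Q.near z).NeBot := (Q.tendsto_idx hz).neBot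

theorem exists_limit {z : ℝ × ℝ} (hz : z ∈ rect D) {F : ℕ × ℕ × ℕ → ℝ} {M : ℝ}
    (hM : ∀ᶠ a in Q.near z, |F a| ≤ M)
    (hF : ∀ ε > 0, ∃ s ∈ Q.near z, ∀ a ∈ s, ∀ b ∈ s, a.1 = b.1 → |F a - F b| ≤ ε) :
    ∃ f, Tendsto F (Q.near z) (𝓝 f) := by
  have hc := Q.tendsto_idx hz
  have h1 : Icc (-M) M ∈ Ultrafilter.map (fun n => F (n, Q.tidx z.1 n, Q.lidx z.2 n)) ult := by
    rw [Ultrafilter.mem_map]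
    filter_upwards [hc.eventually hM] with n hn using abs_le.1 hn
  obtain ⟨f, -, hf⟩ := isCompact_Icc.ultrafilter_le_nhds' _ h1
  have hf' : Tendsto (fun n => F (n, Q.tidx z.1 n, Q.lidx z.2 n)) (ult : Filter ℕ) (𝓝 f) := hf
  refine ⟨f, Metric.tendsto_nhds.2 fun ε hε => ?_⟩
  obtain ⟨s, hs, H⟩ := hF (ε / 2) (by positivity)
  have h2 : ∀ᶠ n in (ult : Filter ℕ), (n, Q.tidx z.1 n, Q.lidx z.2 n) ∈ s ∧
      |F (n, Q.tidx z.1 n, Q.lidx z.2 n) - f| < ε / 2 :=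
    (hc.eventually hs).and ((Metric.tendsto_nhds.1 hf') _ (by positivity))
  filter_upwards [hs, (Q.tendsto_fst z).eventually h2] with a ha hn
  rw [Real.dist_eq]
  have := H a ha _ hn.1 rfl
  exact (abs_sub_le _ (F (a.1, Q.tidx z.1 a.1, Q.lidx z.2 a.1)) _).trans_lt (by linarith [hn.2])

theorem eventually_eventually_near {z : ℝ × ℝ} {p : ℕ × ℕ × ℕ → Prop}
    (h : ∀ᶠ a in Q.near z, p a) : ∀ᶠ z' in 𝓝 z, ∀ᶠ a in Q.near z', p a := by
  obtain ⟨δ, hδ, h⟩ := Q.eventually_near.1 h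
  filter_upwards [Metric.ball_mem_nhds z (half_pos hδ)] with z' hz'
  rw [Metric.mem_ball, Prod.dist_eq, Real.dist_eq, Real.dist_eq, sup_lt_iff] at hz'
  refine Q.eventually_near.2 ⟨δ / 2, by positivity, h.mono fun n hn i j hd h1 h2 => hn i j hd ?_ ?_⟩
  · exact (abs_sub_le _ z'.1 _).trans_lt (by linarith [hz'.1])
  · exact (abs_sub_le _ z'.2 _).trans_lt (by linarith [hz'.2])

theorem continuousOn_limit {A : Set (ℝ × ℝ)} (hA : A ⊆ rect D) {F : ℕ × ℕ × ℕ → ℝ}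
    {g : ℝ × ℝ → ℝ} (h : ∀ z ∈ A, Tendsto F (Q.near z) (𝓝 (g z))) : ContinuousOn g A := by
  intro z hz
  refine Metric.tendsto_nhds.2 fun ε hε => ?_
  have h1 := Q.eventually_eventually_near ((Metric.tendsto_nhds.1 (h z hz)) (ε / 2) (by positivity))
  filter_upwards [mem_nhdsWithin_of_mem_nhds h1, self_mem_nhdsWithin] with z' hz' hA'
  have := Q.near_neBot (hA hA')
  have h2 : Tendsto (fun a => dist (F a) (g z)) (Q.near z') (𝓝 (dist (g z') (g z))) :=
    (h z' hA').dist tendsto_const_nhds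
  have := le_of_tendsto h2 (hz'.mono fun a ha => ha.le)
  linarith

theorem eventually_forall_of_isCompact {K : Set (ℝ × ℝ)} (hK : IsCompact K)
    {p : ℕ × ℕ × ℕ → Prop} (h : ∀ z ∈ K, ∀ᶠ a in Q.near z, p a) :
    ∀ᶠ n in (ult : Filter ℕ), ∀ i j, (n, i, j) ∈ Q.dom →
      (Q.tm (n, i, j), Q.lb (n, i, j)) ∈ K → p (n, i, j) := by
  refine hK.induction_on (p := fun K => ∀ᶠ n in (ult : Filter ℕ), ∀ i j, (n, i, j) ∈ Q.dom →
      (Q.tm (n, i, j), Q.lb (n, i, j)) ∈ K → p (n, i, j)) ?_ ?_ ?_ ?_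
  · simp
  · exact fun s t hst ht => ht.mono fun n hn i j hd hs => hn i j hd (hst hs)
  · intro s t hs ht
    filter_upwards [hs, ht] with n h1 h2 i j hd hm
    exact hm.elim (h1 i j hd) (h2 i j hd)
  · intro z hz
    obtain ⟨δ, hδ, hn⟩ := Q.eventually_near.1 (h z hz)
    refine ⟨_, mem_nhdsWithin_of_mem_nhds (Metric.ball_mem_nhds z hδ),
      hn.mono fun n hn i j hd hm => ?_⟩
    rw [Metric.mem_ball, Prod.dist_eq, Real.dist_eq, Real.dist_eq, sup_lt_iff] at hm
    exact hn i j hd hm.1 hm.2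

end FlowSeq

theorem hasDerivAt_of_two_point {g : ℝ → ℝ} {f x₀ : ℝ}
    (h : ∀ ε > 0, ∃ δ > 0, ∀ x y, |x - x₀| < δ → |y - x₀| < δ → x < y →
      |g y - g x - f * (y - x)| ≤ ε * (y - x)) : HasDerivAt g f x₀ := by
  rw [hasDerivAt_iff_isLittleO, Asymptotics.isLittleO_iff]
  intro ε hε
  obtain ⟨δ, hδ, H⟩ := h ε hε
  filter_upwards [Metric.ball_mem_nhds x₀ hδ] with y hy
  rw [Metric.mem_ball, Real.dist_eq] at hy
  have h0 : |x₀ - x₀| < δ := by simpa using hδ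
  rw [Real.norm_eq_abs, Real.norm_eq_abs, smul_eq_mul]
  rcases lt_trichotomy y x₀ with hlt | rfl | hlt
  · have := H y x₀ hy h0 hlt
    rw [abs_of_neg (sub_neg.2 hlt), neg_sub, ← abs_neg]
    convert this using 2
    ring
  · simp
  · have := H x₀ y h0 hy hlt
    rw [abs_of_pos (sub_pos.2 hlt)]
    convert this using 2
    ring

namespace Data

variable {D : Data} {N : ℕ}

theorem lab_mono (hN : 1 ≤ N) {j j' : ℕ} (h : j ≤ j') (hj' : j' ≤ 2 * N) :
    D.lab N j ≤ D.lab N j' := by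
  induction j', h using Nat.le_induction with
  | base => exact le_rfl
  | succ m hm ih =>
    refine (ih (by omega)).trans ?_
    rcases Nat.lt_or_ge (m + 1) (2 * N) with h | h
    · have := Δ_pos (D := D) hN (show 1 ≤ m + 1 by omega) h
      linarith [lab_succ_sub (D := D) (N := N) m]
    · have e : m + 1 = 2 * N := by omega
      have := lab_succ_sub (D := D) (N := N) m
      rw [e, Δ, sn_two_mul hN, mul_zero] at this
      rw [e]; linarith

end Data

namespace FlowSeq

variable {D : Data} (Q : FlowSeq D)

/-- The next node in time. -/
def nxt (a : ℕ × ℕ × ℕ) : ℕ × ℕ × ℕ := (a.1, a.2.1 + 1, a.2.2)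
/-- The next node in space. -/
def rgt (a : ℕ × ℕ × ℕ) : ℕ × ℕ × ℕ := (a.1, a.2.1, a.2.2 + 1)

theorem tendsto_nxt {z : ℝ × ℝ} (hz : z.1 < D.T) : Tendsto nxt (Q.near z) (Q.near z) := by
  have hdt := Q.tendsto_dt.comp (Q.tendsto_fst z)
  have h1 : Tendsto (fun a => Q.tm (nxt a)) (Q.near z) (𝓝 z.1) := by
    have := (Q.tendsto_tm z).add hdt
    rw [add_zero] at this
    refine this.congr fun a => ?_
    simp only [tm, nxt, Function.comp]
    push_cast
    ring
  refine Q.tendsto_near (Q.tendsto_fst z) h1 (Q.tendsto_lb z) ?_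
  filter_upwards [Q.eventually_dom z, h1.eventually (gt_mem_nhds hz)] with a ha h
  refine ⟨ha.1.trans (Nat.le_succ _), ?_, ha.2.2⟩
  have hh := Data.dt_pos (D := D) (Q.N_pos a.1)
  rw [← Data.N_mul_dt (D := D) (Q.N_pos a.1)] at h
  exact_mod_cast (lt_of_mul_lt_mul_right h hh.le).le

theorem abs_lab_two_mul_sub_le (n : ℕ) :
    |D.lab (Q.N n) (2 * Q.N n) - D.R| ≤ D.R * (Real.pi / (2 * (Q.N n : ℝ))) := by
  have hk := Data.step_pos (Q.N_pos n)
  have h := Real.abs_cos_sub_cos_le (Real.pi / (2 * (Q.N n : ℝ)) / 2) 0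
  have e : D.lab (Q.N n) (2 * Q.N n) = D.R * Real.cos (Real.pi / (2 * (Q.N n : ℝ)) / 2) := by
    unfold Data.lab
    rw [Data.ang_two_mul (Q.N_pos n), add_comm, Real.cos_add_pi]; ring
  rw [Real.cos_zero, sub_zero, abs_of_pos (half_pos hk)] at h
  rw [e, show D.R * Real.cos (Real.pi / (2 * (Q.N n : ℝ)) / 2) - D.R =
    D.R * (Real.cos (Real.pi / (2 * (Q.N n : ℝ)) / 2) - 1) by ring, abs_mul, abs_of_pos D.R_pos]
  have := D.R_pos
  gcongr
  linarith

theorem tendsto_rgt {z : ℝ × ℝ} (hz : z.2 < D.R) : Tendsto rgt (Q.near z) (Q.near z) := by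
  have hst := (Q.tendsto_step.comp (Q.tendsto_fst z)).const_mul D.R
  rw [mul_zero] at hst
  have h1 : Tendsto (fun a => Q.lb (rgt a)) (Q.near z) (𝓝 z.2) := by
    have h0 : Tendsto (fun a => Q.lb (rgt a) - Q.lb a) (Q.near z) (𝓝 0) :=
      squeeze_zero_norm (fun a => Q.abs_lab_succ_sub_le a.1 a.2.2) hst
    have := (Q.tendsto_lb z).add h0
    rw [add_zero] at this
    exact this.congr fun a => by ring
  refine Q.tendsto_near (Q.tendsto_fst z) (Q.tendsto_tm z) h1 ?_
  have h2 := h1.add hst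
  rw [add_zero] at h2
  filter_upwards [Q.eventually_dom z, h2.eventually (gt_mem_nhds hz)] with a ha h
  refine ⟨ha.1, ha.2.1, ?_⟩
  by_contra hcon
  have e : a.2.2 + 1 = 2 * Q.N a.1 := by have := ha.2.2; simp only [rgt] at hcon; omega
  have := (abs_le.1 (Q.abs_lab_two_mul_sub_le a.1)).1
  simp only [lb, rgt, e, Function.comp] at h
  linarith

theorem near_of_between {z : ℝ × ℝ} {δ : ℝ} {n i j' j j'' : ℕ} (hd : (n, i, j'') ∈ Q.dom)
    (h1 : j' ≤ j) (h2 : j ≤ j'') (h3 : |Q.lb (n, i, j') - z.2| < δ)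
    (h4 : |Q.lb (n, i, j'') - z.2| < δ) : (n, i, j) ∈ Q.dom ∧ |Q.lb (n, i, j) - z.2| < δ := by
  refine ⟨⟨hd.1, hd.2.1, lt_of_le_of_lt h2 hd.2.2⟩, ?_⟩
  have a1 := Data.lab_mono (D := D) (Q.N_pos n) h1 (h2.trans hd.2.2.le)
  have a2 := Data.lab_mono (D := D) (Q.N_pos n) h2 hd.2.2.le
  rw [abs_lt] at h3 h4 ⊢
  simp only [lb] at *
  constructor <;> linarith [h3.1, h4.2]

theorem near_of_between' {z : ℝ × ℝ} {δ : ℝ} {n i' i i'' j : ℕ} (hd : (n, i', j) ∈ Q.dom)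
    (hd' : (n, i'', j) ∈ Q.dom)
    (h1 : i' ≤ i) (h2 : i ≤ i'') (h3 : |Q.tm (n, i', j) - z.1| < δ)
    (h4 : |Q.tm (n, i'', j) - z.1| < δ) : (n, i, j) ∈ Q.dom ∧ |Q.tm (n, i, j) - z.1| < δ := by
  refine ⟨⟨hd.1.trans h1, h2.trans hd'.2.1, hd.2.2⟩, ?_⟩
  have hh := Data.dt_pos (D := D) (Q.N_pos n)
  have a1 : (i' : ℝ) * D.dt (Q.N n) ≤ i * D.dt (Q.N n) := by gcongr
  have a2 : (i : ℝ) * D.dt (Q.N n) ≤ i'' * D.dt (Q.N n) := by gcongr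
  rw [abs_lt] at h3 h4 ⊢
  simp only [tm] at *
  constructor <;> linarith [h3.1, h4.2]

theorem hasDerivAt_label {t r f : ℝ} {F G : ℕ × ℕ × ℕ → ℝ} {g : ℝ → ℝ} (ht : t ∈ Icc 0 D.T)
    (hr : r ∈ Ioo (-D.R) D.R)
    (hg : ∀ r' ∈ Ioo (-D.R) D.R, Tendsto G (Q.near (t, r')) (𝓝 (g r')))
    (hF : Tendsto F (Q.near (t, r)) (𝓝 f))
    (hG : ∀ᶠ a in Q.near (t, r), G (rgt a) - G a = (Q.lb (rgt a) - Q.lb a) * F a) :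
    HasDerivAt g f r := by
  refine hasDerivAt_of_two_point fun ε hε => ?_
  obtain ⟨δ, hδ, hev⟩ := Q.eventually_near.1 (hG.and ((Metric.tendsto_nhds.1 hF) ε hε))
  obtain ⟨δ', hδ', hsub⟩ := Metric.isOpen_iff.1 isOpen_Ioo r hr
  refine ⟨min δ δ', lt_min hδ hδ', fun x y hx hy hxy => ?_⟩
  have hx' : x ∈ Ioo (-D.R) D.R := hsub (hx.trans_le (min_le_right _ _))
  have hy' : y ∈ Ioo (-D.R) D.R := hsub (hy.trans_le (min_le_right _ _))
  have cx := Q.tendsto_idx (z := (t, x)) ⟨ht, Ioo_subset_Icc_self hx'⟩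
  have cy := Q.tendsto_idx (z := (t, y)) ⟨ht, Ioo_subset_Icc_self hy'⟩
  have lx := (Q.tendsto_lb _).comp cx
  have ly := (Q.tendsto_lb _).comp cy
  have lim := ((((hg y hy').comp cy).sub ((hg x hx').comp cx)).sub ((ly.sub lx).const_mul f)).abs
  have lim2 := (ly.sub lx).const_mul ε
  refine le_of_tendsto_of_tendsto lim lim2 ?_
  have tt := (Q.tendsto_tm _).comp cx
  filter_upwards [hev, lx.eventually (Metric.ball_mem_nhds x (sub_pos.2 (hx.trans_le
    (min_le_left δ δ')))), ly.eventually (Metric.ball_mem_nhds y (sub_pos.2 (hy.trans_le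
    (min_le_left δ δ')))), tt.eventually (Metric.ball_mem_nhds t hδ),
    lx.eventually (gt_mem_nhds (show x < (x + y) / 2 by linarith)),
    ly.eventually (lt_mem_nhds (show (x + y) / 2 < y by linarith)),
    cx.eventually (Q.eventually_dom _), cy.eventually (Q.eventually_dom _)]
    with n hn bx bY bt mx my dx dy
  simp only [Function.comp] at bx bY bt mx my ⊢
  set i := Q.tidx t n
  set j' := Q.lidx x n
  set j'' := Q.lidx y n
  have hjj : j' ≤ j'' := by
    by_contra hcon
    have := Data.lab_mono (D := D) (Q.N_pos n) (le_of_not_ge hcon) dx.2.2.le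
    simp only [lb] at mx my
    linarith
  rw [Real.dist_eq] at bx bY bt
  have ax : |Q.lb (n, i, j') - r| < δ := (abs_sub_le _ x _).trans_lt (by linarith)
  have ay : |Q.lb (n, i, j'') - r| < δ := (abs_sub_le _ y _).trans_lt (by linarith)
  have e1 := Finset.sum_Ico_sub (fun j => G (n, i, j)) hjj
  have e2 := Finset.sum_Ico_sub (fun j => Q.lb (n, i, j)) hjj
  rw [← e1, ← e2, Finset.mul_sum, ← Finset.sum_sub_distrib, Finset.mul_sum]
  refine (Finset.abs_sum_le_sum_abs _ _).trans (Finset.sum_le_sum fun j hj => ?_)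
  rw [Finset.mem_Ico] at hj
  obtain ⟨hd, hb⟩ := Q.near_of_between (z := (t, r)) dy hj.1 hj.2.le ax ay
  obtain ⟨h1, h2⟩ := hn i j hd bt hb
  simp only [rgt] at h1
  rw [h1, mul_comm f, ← mul_sub, abs_mul, mul_comm ε]
  have h0 : 0 ≤ Q.lb (n, i, j + 1) - Q.lb (n, i, j) :=
    sub_nonneg.2 (Data.lab_mono (D := D) (Q.N_pos n) (Nat.le_succ _) hd.2.2)
  rw [abs_of_nonneg h0]
  rw [Real.dist_eq] at h2
  exact mul_le_mul_of_nonneg_left h2.le h0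

theorem hasDerivAt_time {t r f : ℝ} {F G : ℕ × ℕ × ℕ → ℝ} {g : ℝ → ℝ} (ht : t ∈ Ioo 0 D.T)
    (hr : r ∈ Icc (-D.R) D.R)
    (hg : ∀ t' ∈ Ioo 0 D.T, Tendsto G (Q.near (t', r)) (𝓝 (g t')))
    (hF : Tendsto F (Q.near (t, r)) (𝓝 f))
    (hG : ∃ δ > 0, ∀ ε > 0, ∀ᶠ n in (ult : Filter ℕ), ∀ i' i'' j, i' ≤ i'' → (n, i', j) ∈ Q.dom →
      (n, i'', j) ∈ Q.dom → |Q.tm (n, i', j) - t| < δ → |Q.tm (n, i'', j) - t| < δ →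
      |Q.lb (n, i', j) - r| < δ → |G (n, i'', j) - G (n, i', j) -
        ∑ i ∈ Finset.Ico i' i'', D.dt (Q.N n) * F (n, i, j)| ≤ ε) :
    HasDerivAt g f t := by
  obtain ⟨δ₀, hδ₀, hG⟩ := hG
  refine hasDerivAt_of_two_point fun ε hε => ?_
  obtain ⟨δ₁, hδ₁, hev⟩ := Q.eventually_near.1 ((Metric.tendsto_nhds.1 hF) ε hε)
  obtain ⟨δ', hδ', hsub⟩ := Metric.isOpen_iff.1 isOpen_Ioo t ht
  set δ := min δ₀ δ₁ with hδd
  have hδ : 0 < δ := lt_min hδ₀ hδ₁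
  refine ⟨min δ δ', lt_min hδ hδ', fun x y hx hy hxy => ?_⟩
  have hx' : x ∈ Ioo 0 D.T := hsub (hx.trans_le (min_le_right _ _))
  have hy' : y ∈ Ioo 0 D.T := hsub (hy.trans_le (min_le_right _ _))
  have cx := Q.tendsto_idx (z := (x, r)) ⟨Ioo_subset_Icc_self hx', hr⟩
  have cy := Q.tendsto_idx (z := (y, r)) ⟨Ioo_subset_Icc_self hy', hr⟩
  have lx := (Q.tendsto_tm _).comp cx
  have ly := (Q.tendsto_tm _).comp cy
  have lim := ((((hg y hy').comp cy).sub ((hg x hx').comp cx)).sub ((ly.sub lx).const_mul f)).abs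
  have lim2 := (ly.sub lx).const_mul ε
  refine le_of_forall_pos_le_add fun η hη => ?_
  refine le_of_tendsto_of_tendsto lim (lim2.add_const η) ?_
  have tt := (Q.tendsto_lb _).comp cx
  filter_upwards [hG η hη, hev, lx.eventually (Metric.ball_mem_nhds x (sub_pos.2 (hx.trans_le
    (min_le_left δ δ')))), ly.eventually (Metric.ball_mem_nhds y (sub_pos.2 (hy.trans_le
    (min_le_left δ δ')))), tt.eventually (Metric.ball_mem_nhds r hδ),
    lx.eventually (gt_mem_nhds (show x < (x + y) / 2 by linarith)),
    ly.eventually (lt_mem_nhds (show (x + y) / 2 < y by linarith)),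
    cx.eventually (Q.eventually_dom _), cy.eventually (Q.eventually_dom _)]
    with n hGn hn bx bY bt mx my dx dy
  have hh := Data.dt_pos (D := D) (Q.N_pos n)
  simp only [Function.comp] at bx bY bt mx my ⊢
  set j := Q.lidx r n
  set i' := Q.tidx x n
  set i'' := Q.tidx y n
  have hjj : i' ≤ i'' := by
    have : (i' : ℝ) * D.dt (Q.N n) ≤ i'' * D.dt (Q.N n) := by
      simp only [tm] at mx my; linarith
    exact_mod_cast le_of_mul_le_mul_right this hh
  rw [Real.dist_eq] at bx bY bt
  have ax : |Q.tm (n, i', j) - t| < δ := (abs_sub_le _ x _).trans_lt (by linarith)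
  have ay : |Q.tm (n, i'', j) - t| < δ := (abs_sub_le _ y _).trans_lt (by linarith)
  have hd0 : δ ≤ δ₀ := min_le_left _ _
  have hd1 : δ ≤ δ₁ := min_le_right _ _
  have k1 := hGn i' i'' j hjj dx dy (ax.trans_le hd0) (ay.trans_le hd0) (bt.trans_le hd0)
  have e2 := Finset.sum_Ico_sub (fun i => Q.tm (n, i, j)) hjj
  have e3 : ∀ i, Q.tm (n, i + 1, j) - Q.tm (n, i, j) = D.dt (Q.N n) := fun i => by
    simp only [tm]; push_cast; ring
  simp only [e3] at e2
  have k2 : |∑ i ∈ Finset.Ico i' i'', D.dt (Q.N n) * F (n, i, j) -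
      f * (Q.tm (n, i'', j) - Q.tm (n, i', j))| ≤
      ε * (Q.tm (n, i'', j) - Q.tm (n, i', j)) := by
    rw [← e2, Finset.mul_sum, ← Finset.sum_sub_distrib, Finset.mul_sum]
    refine (Finset.abs_sum_le_sum_abs _ _).trans (Finset.sum_le_sum fun i hi => ?_)
    rw [Finset.mem_Ico] at hi
    obtain ⟨hd, hb⟩ := Q.near_of_between' (z := (t, r)) dx dy hi.1 hi.2.le ax ay
    have h2 := hn i j hd (hb.trans_le hd1) (bt.trans_le hd1)
    rw [mul_comm f, ← mul_sub, abs_mul, mul_comm ε, abs_of_pos hh]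
    rw [Real.dist_eq] at h2
    exact mul_le_mul_of_nonneg_left h2.le hh.le
  exact (abs_sub_le _ (∑ i ∈ Finset.Ico i' i'', D.dt (Q.N n) * F (n, i, j)) _).trans (by linarith)

end FlowSeq

/-- A bounded sequence with bounded second differences is Lipschitz. -/
theorem abs_sub_le_of_second_diff {a : ℕ → ℝ} {B C h L : ℝ} {M : ℕ} (hh : 0 < h) (hC : 0 ≤ C)
    (hL : M * h = L) (hM : 1 ≤ M) (ha : ∀ i ≤ M, |a i| ≤ B)
    (h2 : ∀ i, i + 2 ≤ M → |a (i + 2) - 2 * a (i + 1) + a i| ≤ C * h ^ 2) {i i' : ℕ}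
    (hi : i ≤ i') (hi' : i' ≤ M) :
    |a i' - a i| ≤ (2 * B / L + C * L) * ((i' - i : ℝ) * h) := by
  have hM' : (0 : ℝ) < M := by exact_mod_cast hM
  have hLp : 0 < L := by rw [← hL]; positivity
  have w1 : ∀ k l, k ≤ l → l < M → |(a (l + 1) - a l) - (a (k + 1) - a k)| ≤ (l - k) * (C * h ^ 2) := by
    intro k l hkl
    induction l, hkl using Nat.le_induction with
    | base => intro; simp
    | succ l hl ih =>
      intro hlt
      have e : (a (l + 1 + 1) - a (l + 1)) - (a (k + 1) - a k) =
        (a (l + 2) - 2 * a (l + 1) + a l) + ((a (l + 1) - a l) - (a (k + 1) - a k)) := by ring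
      rw [e]
      refine (abs_add_le _ _).trans ?_
      have := h2 l (by omega)
      have := ih (by omega)
      push_cast
      linarith
  have w2 : ∀ k l, k < M → l < M → |(a (l + 1) - a l) - (a (k + 1) - a k)| ≤ M * (C * h ^ 2) := by
    have key : ∀ k l, k ≤ l → l < M →
        |(a (l + 1) - a l) - (a (k + 1) - a k)| ≤ M * (C * h ^ 2) := by
      intro k l hkl hl
      refine (w1 k l hkl hl).trans ?_
      have : (l : ℝ) ≤ M := by exact_mod_cast hl.le
      have : (0 : ℝ) ≤ k := Nat.cast_nonneg k
      gcongr
      linarith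
    intro k l hk hl
    rcases le_total k l with hkl | hkl
    · exact key k l hkl hl
    · rw [abs_sub_comm]; exact key l k hkl hk
  have w3 : ∀ k < M, |a (k + 1) - a k| ≤ (2 * B / L + C * L) * h := by
    intro k hk
    have s1 : ∑ l ∈ Finset.range M, ((a (k + 1) - a k) - (a (l + 1) - a l)) =
        M * (a (k + 1) - a k) - (a M - a 0) := by
      rw [Finset.sum_sub_distrib, Finset.sum_range_sub a, Finset.sum_const, Finset.card_range,
        nsmul_eq_mul]
    have s2 : |∑ l ∈ Finset.range M, ((a (k + 1) - a k) - (a (l + 1) - a l))| ≤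
        M * (M * (C * h ^ 2)) := by
      refine (Finset.abs_sum_le_sum_abs _ _).trans ?_
      refine (Finset.sum_le_card_nsmul _ _ _ fun l hl => w2 l k (Finset.mem_range.1 hl) hk).trans ?_
      rw [Finset.card_range, nsmul_eq_mul]
    rw [s1] at s2
    have b1 := ha M le_rfl
    have b0 := ha 0 (Nat.zero_le _)
    have : |M * (a (k + 1) - a k)| ≤ M * (M * (C * h ^ 2)) + 2 * B := by
      rw [abs_le] at *
      constructor <;> linarith [s2.1, s2.2, b1.1, b1.2, b0.1, b0.2]
    rw [abs_mul, abs_of_pos hM'] at this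
    have hh' : h = L / M := by rw [← hL]; field_simp
    have e : (2 * B / L + C * L) * h = (M * (M * (C * h ^ 2)) + 2 * B) / M := by
      rw [hh']; field_simp; ring
    rw [e, le_div_iff₀ hM']
    linarith
  have s := Finset.sum_Ico_sub a hi
  rw [← s]
  refine (Finset.abs_sum_le_sum_abs _ _).trans ?_
  refine (Finset.sum_le_card_nsmul _ _ _ fun l hl => w3 l ?_).trans ?_
  · have := (Finset.mem_Ico.1 hl).2; omega
  · rw [Nat.card_Ico, nsmul_eq_mul, Nat.cast_sub hi]
    exact le_of_eq (by ring)

namespace Data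

variable {D : Data} {N i₀ : ℕ} {P X : ℕ → ℕ → ℝ}

theorem DiscreteFlow.X_sub_mem (h : D.DiscreteFlow N i₀ P X) {i j j' : ℕ} (hi : i₀ ≤ i)
    (hiN : i ≤ N) (hj : j ≤ j') (hj' : j' < 2 * N) :
    X i j' - X i j ∈ Icc (D.lower (i * D.dt N) * (D.lab N j' - D.lab N j))
      (D.upper (i * D.dt N) * (D.lab N j' - D.lab N j)) := by
  induction j', hj using Nat.le_induction with
  | base => simp
  | succ l hl ih =>
    have ih := ih (by omega)
    have h1 := h.rel i l hi hiN hj'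
    have h2 := h.bounds i (l + 1) hi hiN
    have h3 := Δ_pos (D := D) h.N_pos (show 1 ≤ l + 1 by omega) hj'
    have h4 := lab_succ_sub (D := D) (N := N) l
    have e : D.lab N (l + 1) - D.lab N j = (D.lab N l - D.lab N j) + D.Δ N (l + 1) := by
      rw [← h4]; ring
    have e' : X i (l + 1) - X i j = (X i l - X i j) + D.Δ N (l + 1) * P i (l + 1) := by
      rw [← h1]; ring
    rw [e, e']
    constructor <;> nlinarith [ih.1, ih.2, h2.1, h2.2]

theorem upper_mono {s t : ℝ} (hs : 0 ≤ s) (h : s ≤ t) : D.upper s ≤ D.upper t := by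
  have := D.Ap_pos
  have := D.α_pos
  unfold upper
  gcongr

theorem DiscreteFlow.abs_X_sub_le (h : D.DiscreteFlow N i₀ P X) {i j j' : ℕ} (hi : i₀ ≤ i)
    (hiN : i ≤ N) (hj : j < 2 * N) (hj' : j' < 2 * N) :
    |X i j' - X i j| ≤ D.upper D.T * |D.lab N j' - D.lab N j| := by
  have hdt := dt_pos (D := D) h.N_pos
  have ht : (i : ℝ) * D.dt N ≤ D.T := mul_dt_le h.N_pos hiN
  have hu := D.upper_mono (by positivity) ht
  have key : ∀ {j j' : ℕ}, j ≤ j' → j' < 2 * N →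
      |X i j' - X i j| ≤ D.upper D.T * |D.lab N j' - D.lab N j| := by
    intro j j' hjj hj'
    have h1 := h.X_sub_mem hi hiN hjj hj'
    have h2 := lab_mono (D := D) h.N_pos hjj hj'.le
    have h3 := h.lower_time_pos hi hiN
    rw [abs_of_nonneg (sub_nonneg.2 h2), abs_of_nonneg (le_trans
      (mul_nonneg h3.le (sub_nonneg.2 h2)) h1.1)]
    refine h1.2.trans ?_
    have := sub_nonneg.2 h2
    gcongr
  rcases le_total j j' with hjj | hjj
  · exact key hjj hj'
  · rw [abs_sub_comm, abs_sub_comm (D.lab N j')]; exact key hjj hj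

theorem sn_sq_le (j : ℕ) : D.sn N j ^ 2 ≤ 1 := by
  unfold sn; exact Real.sin_sq_le_one _

theorem β_le (j : ℕ) : D.β N j ≤ D.θ / (1 + D.θ) * D.a₀ ^ (1 + D.γ) := by
  have h0 := D.a₀_pos
  have h1 := D.γ_pos
  have h2 := D.θ_pos
  have h3 := sn_sq_le (D := D) (N := N) j
  unfold β
  gcongr
  nlinarith

/-- Bound for the flux at times at least `τ`. -/
noncomputable def fluxBound (D : Data) (τ : ℝ) : ℝ :=
  D.θ / (1 + D.θ) * D.a₀ ^ (1 + D.γ) * (Classical.choose D.mul_rpow_le_lower * τ ^ D.α) ^ (-D.e)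

theorem fluxBound_nonneg {τ : ℝ} (hτ : 0 < τ) : 0 ≤ D.fluxBound τ := by
  have h0 := D.a₀_pos
  have h2 := D.θ_pos
  have := (Classical.choose_spec D.mul_rpow_le_lower).1
  unfold fluxBound
  positivity

theorem DiscreteFlow.P_rpow_le (h : D.DiscreteFlow N i₀ P X) {i : ℕ} (j : ℕ) {τ : ℝ} (hτ : 0 < τ)
    (hi : i₀ ≤ i) (hiN : i ≤ N) (hiτ : τ ≤ i * D.dt N) :
    P i j ^ (-D.e) ≤ (Classical.choose D.mul_rpow_le_lower * τ ^ D.α) ^ (-D.e) := by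
  have hη := Classical.choose_spec D.mul_rpow_le_lower
  set η := Classical.choose D.mul_rpow_le_lower
  have h1 := (h.bounds i j hi hiN).1
  have h2 := hη.2 (i * D.dt N) (hτ.le.trans hiτ) (mul_dt_le h.N_pos hiN)
  have hα := D.α_pos
  have h3 : η * τ ^ D.α ≤ η * (i * D.dt N) ^ D.α := by have := hη.1; gcongr
  have h4 : 0 < η * τ ^ D.α := by have := hη.1; positivity
  exact Real.rpow_le_rpow_of_nonpos h4 (by linarith) (by linarith [D.e_pos])

theorem DiscreteFlow.β_mul_le (h : D.DiscreteFlow N i₀ P X) {i : ℕ} (j : ℕ) {τ : ℝ} (hτ : 0 < τ)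
    (hi : i₀ ≤ i) (hiN : i ≤ N) (hiτ : τ ≤ i * D.dt N) :
    D.β N j * P i j ^ (-D.e) ∈ Icc 0 (D.fluxBound τ) := by
  have h1 := h.P_rpow_le j hτ hi hiN hiτ
  have h2 := h.P_pos hi hiN j
  have h3 := β_nonneg (D := D) N j
  have h4 := Real.rpow_nonneg h2.le (-D.e)
  exact ⟨mul_nonneg h3 h4, mul_le_mul (β_le j) h1 h4 (h3.trans (β_le j))⟩

theorem DiscreteFlow.abs_X_le (h : D.DiscreteFlow N i₀ P X) {i j : ℕ} (hi : i₀ ≤ i)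
    (hiN : i ≤ N) (hj : j < 2 * N) :
    |X i j| ≤ (i * D.dt N) ^ D.α * D.R + D.C₀ * (i * D.dt N) := by
  have hdt := dt_pos (D := D) h.N_pos
  have h1 := h.center i j hi hiN hj
  have h2 : |(i * D.dt N) ^ D.α * D.lab N j| ≤ (i * D.dt N) ^ D.α * D.R := by
    have h0 : 0 ≤ (i * D.dt N) ^ D.α := Real.rpow_nonneg (by positivity) _
    rw [abs_mul, abs_of_nonneg h0]
    exact mul_le_mul_of_nonneg_left (abs_le.2 ⟨(neg_R_lt_lab h.N_pos hj).le,
      (lab_lt_R h.N_pos hj).le⟩) h0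
  have := abs_sub_abs_le_abs_sub (X i j) ((i * D.dt N) ^ D.α * D.lab N j)
  linarith

theorem C₀_nonneg : 0 ≤ D.C₀ := by
  have := D.R_pos
  have := D.Am_pos
  have := D.Ap_pos
  have := D.Λ_pos
  have := D.T_pos
  unfold C₀
  positivity

/-- Bound for the positions. -/
noncomputable def posBound (D : Data) : ℝ := D.T ^ D.α * D.R + D.C₀ * D.T

theorem posBound_nonneg (D : Data) : 0 ≤ D.posBound := by
  have := D.R_pos; have := D.C₀_nonneg; have := D.T_pos; unfold posBound; positivity

theorem DiscreteFlow.abs_X_le' (h : D.DiscreteFlow N i₀ P X) {i j : ℕ} (hi : i₀ ≤ i)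
    (hiN : i ≤ N) (hj : j < 2 * N) : |X i j| ≤ D.posBound := by
  have hdt := dt_pos (D := D) h.N_pos
  refine (h.abs_X_le hi hiN hj).trans ?_
  have := mul_dt_le (D := D) h.N_pos hiN
  have := D.R_pos
  have := D.α_pos
  have := D.C₀_nonneg
  unfold posBound
  gcongr

/-- Averages of positions over blocks of labels are Lipschitz in time. -/
theorem DiscreteFlow.abs_block_sub_le (h : D.DiscreteFlow N i₀ P X) {i₁ j₁ j₂ : ℕ} {τ L m : ℝ}
    (hτ : 0 < τ) (hi : i₀ ≤ i₁) (hi₁ : i₁ < N) (hiτ : τ ≤ i₁ * D.dt N)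
    (hL : L = D.T - i₁ * D.dt N) (hj : j₁ ≤ j₂) (hj₂ : j₂ ≤ 2 * N)
    (hm : m = ∑ l ∈ Finset.Ico j₁ j₂, D.μ N l) (hm0 : 0 < m) {i i' : ℕ} (h1 : i₁ ≤ i) (h2 : i ≤ i')
    (h3 : i' ≤ N) :
    |(∑ l ∈ Finset.Ico j₁ j₂, D.μ N l * X i' l) / m - (∑ l ∈ Finset.Ico j₁ j₂, D.μ N l * X i l) / m| ≤
      (2 * D.posBound / L + D.fluxBound τ / m * L) * ((i' - i : ℝ) * D.dt N) := by
  have hdt := dt_pos (D := D) h.N_pos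
  have hμ : ∀ l ∈ Finset.Ico j₁ j₂, 0 ≤ D.μ N l := fun l hl =>
    (μ_pos h.N_pos (by have := (Finset.mem_Ico.1 hl).2; omega)).le
  have hf := D.fluxBound_nonneg hτ
  obtain ⟨s, rfl⟩ := Nat.exists_eq_add_of_le h1
  obtain ⟨s', rfl⟩ := Nat.exists_eq_add_of_le (h1.trans h2)
  have key := abs_sub_le_of_second_diff (a := fun k => (∑ l ∈ Finset.Ico j₁ j₂,
    D.μ N l * X (i₁ + k) l) / m) (B := D.posBound) (C := D.fluxBound τ / m) (M := N - i₁) (L := L)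
    (i := s) (i' := s') hdt
    (by positivity) ?_ (by omega) ?_ ?_ (by omega) (by omega)
  · convert key using 3
    push_cast; ring
  · rw [Nat.cast_sub hi₁.le, sub_mul, N_mul_dt h.N_pos, hL]
  · intro k hk
    rw [abs_div, abs_of_pos hm0, div_le_iff₀ hm0]
    refine (Finset.abs_sum_le_sum_abs _ _).trans ?_
    rw [hm, Finset.mul_sum]
    refine Finset.sum_le_sum fun l hl => ?_
    rw [abs_mul, abs_of_nonneg (hμ l hl), mul_comm]
    refine mul_le_mul_of_nonneg_right (h.abs_X_le' (by omega) (by omega) ?_) (hμ l hl)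
    have := (Finset.mem_Ico.1 hl).2; omega
  · intro k hk
    have e : (∑ l ∈ Finset.Ico j₁ j₂, D.μ N l * X (i₁ + (k + 2)) l) / m -
        2 * ((∑ l ∈ Finset.Ico j₁ j₂, D.μ N l * X (i₁ + (k + 1)) l) / m) +
        (∑ l ∈ Finset.Ico j₁ j₂, D.μ N l * X (i₁ + k) l) / m =
        D.dt N ^ 2 * (D.β N j₂ * P (i₁ + k + 1) j₂ ^ (-D.e) -
          D.β N j₁ * P (i₁ + k + 1) j₁ ^ (-D.e)) / m := by
      rw [← Finset.sum_Ico_sub (fun l => D.β N l * P (i₁ + k + 1) l ^ (-D.e)) hj, Finset.mul_sum]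
      rw [← mul_div_assoc, ← sub_div, ← add_div, Finset.mul_sum, ← Finset.sum_sub_distrib,
        ← Finset.sum_add_distrib]
      congr 1
      refine Finset.sum_congr rfl fun l hl => ?_
      have := h.eqn (i₁ + k) l (by omega) (by omega) (by have := (Finset.mem_Ico.1 hl).2; omega)
      rw [← this, ← add_assoc, ← add_assoc]
      field_simp
    rw [e, abs_div, abs_of_pos hm0, abs_mul, abs_of_nonneg (sq_nonneg _)]
    have hi1 : τ ≤ (i₁ + k + 1 : ℕ) * D.dt N := by
      refine hiτ.trans ?_
      push_cast
      have : (0 : ℝ) ≤ k := Nat.cast_nonneg k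
      gcongr
      linarith
    have b1 := h.β_mul_le (i := i₁ + k + 1) j₁ hτ (by omega) (by omega) hi1
    have b2 := h.β_mul_le (i := i₁ + k + 1) j₂ hτ (by omega) (by omega) hi1
    have : |D.β N j₂ * P (i₁ + k + 1) j₂ ^ (-D.e) - D.β N j₁ * P (i₁ + k + 1) j₁ ^ (-D.e)| ≤
        D.fluxBound τ := by
      rw [abs_le]; constructor <;> linarith [b1.1, b1.2, b2.1, b2.2]
    rw [div_mul_eq_mul_div, mul_comm (D.fluxBound τ)]
    gcongr

/-- Lower bound for the mass of a block. -/
theorem abs_β_sub_le (hN : 1 ≤ N) {j₁ j₂ : ℕ} (hj : j₁ ≤ j₂) (hj₂ : j₂ ≤ 2 * N) :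
    |D.β N j₁ - D.β N j₂| ≤ D.κ * D.R * ∑ l ∈ Finset.Ico j₁ j₂, D.μ N l := by
  have hκ := D.κ_pos
  have hR := D.R_pos
  rw [abs_sub_comm, ← Finset.sum_Ico_sub _ hj, Finset.mul_sum]
  refine (Finset.abs_sum_le_sum_abs _ _).trans (Finset.sum_le_sum fun l hl => ?_)
  have hl2 : l < 2 * N := by have := (Finset.mem_Ico.1 hl).2; omega
  have h1 := μ_mul_lab (D := D) hN l
  have h2 := μ_pos (D := D) hN hl2
  rw [abs_sub_comm, ← h1, abs_mul, abs_mul, abs_of_pos hκ, abs_of_pos h2]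
  have : |D.lab N l| ≤ D.R := abs_le.2 ⟨(neg_R_lt_lab hN hl2).le, (lab_lt_R hN hl2).le⟩
  gcongr

end Data

namespace Data

/-- The limit of the flux coefficients. -/
noncomputable def flux (D : Data) (r : ℝ) : ℝ :=
  D.θ / (1 + D.θ) * (D.a₀ * (1 - (r / D.R) ^ 2)) ^ (1 + D.γ)

/-- The self-similar density. -/
noncomputable def dens (D : Data) (r : ℝ) : ℝ := (D.a₀ * (1 - (r / D.R) ^ 2)) ^ D.γ

variable {D : Data}

theorem one_sub_sq_nonneg {r : ℝ} (hr : r ∈ Icc (-D.R) D.R) : 0 ≤ 1 - (r / D.R) ^ 2 := by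
  have := D.R_pos
  rw [div_pow, sub_nonneg, div_le_one (by positivity)]
  nlinarith [hr.1, hr.2]

theorem one_sub_sq_pos {r : ℝ} (hr : r ∈ Ioo (-D.R) D.R) : 0 < 1 - (r / D.R) ^ 2 := by
  have := D.R_pos
  rw [div_pow, sub_pos, div_lt_one (by positivity)]
  nlinarith [hr.1, hr.2]

theorem flux_ne {r₁ r₂ : ℝ} (h₁ : r₁ ∈ Icc (-D.R) D.R) (h₂ : r₂ ∈ Icc (-D.R) D.R)
    (h : r₁ ^ 2 ≠ r₂ ^ 2) : D.flux r₁ ≠ D.flux r₂ := by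
  have hR := D.R_pos
  have ha := D.a₀_pos
  have hg := D.γ_pos
  have hθ := D.θ_pos
  intro he
  unfold flux at he
  have e1 := mul_left_cancel₀ (by positivity : D.θ / (1 + D.θ) ≠ 0) he
  have e2 := (Real.rpow_left_inj (mul_nonneg ha.le (one_sub_sq_nonneg h₁))
    (mul_nonneg ha.le (one_sub_sq_nonneg h₂)) (by positivity)).1 e1
  have e3 := mul_left_cancel₀ ha.ne' e2
  rw [div_pow, div_pow] at e3
  have e4 : r₁ ^ 2 / D.R ^ 2 = r₂ ^ 2 / D.R ^ 2 := by linarith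
  rw [div_left_inj' (by positivity)] at e4
  exact h e4

theorem exists_flux_pair {r : ℝ} (hr : r ∈ Icc (-D.R) D.R) {η : ℝ} (hη : 0 < η) :
    ∃ r₁ r₂, r₁ < r₂ ∧ r₁ ∈ Icc (-D.R) D.R ∧ r₂ ∈ Icc (-D.R) D.R ∧ |r₁ - r| < η ∧ |r₂ - r| < η ∧
      D.flux r₁ ≠ D.flux r₂ := by
  have hR := D.R_pos
  have h2 : 0 < η / 2 := by positivity
  rcases lt_or_ge 0 r with h | h
  · refine ⟨max 0 (r - η / 2), r, max_lt h (by linarith), ⟨by linarith [le_max_left 0 (r - η / 2)],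
      max_le hR.le (by linarith [hr.2])⟩, hr, ?_, by simpa using hη,
      flux_ne ⟨by linarith [le_max_left 0 (r - η / 2)], max_le hR.le (by linarith [hr.2])⟩ hr ?_⟩
    · have h1 := le_max_right 0 (r - η / 2)
      have h2 : max 0 (r - η / 2) ≤ r := max_le h.le (by linarith)
      rw [abs_lt]; constructor <;> linarith
    · have h0 := le_max_left 0 (r - η / 2)
      have h1 : max 0 (r - η / 2) < r := max_lt h (by linarith)
      nlinarith
  · have m1 : r < min (max 0 (r / 2) + D.R * 0 + (if r = 0 then D.R else 0)) (r + η / 2) := by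
      refine lt_min ?_ (by linarith)
      split_ifs with h0
      · rw [h0]; simpa using hR
      · have : r < 0 := lt_of_le_of_ne h h0
        have := le_max_left 0 (r / 2)
        linarith
    set s := min (max 0 (r / 2) + D.R * 0 + (if r = 0 then D.R else 0)) (r + η / 2) with hs
    have m2 : s ≤ r + η / 2 := min_le_right _ _
    have m3 : max 0 (r / 2) = 0 := max_eq_left (by linarith)
    have m4 : s ≤ if r = 0 then D.R else 0 := by
      have := min_le_left (max 0 (r / 2) + D.R * 0 + (if r = 0 then D.R else 0)) (r + η / 2)
      rw [← hs, m3] at this; linarith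
    have m5 : s ≤ D.R := m4.trans (by split_ifs <;> linarith)
    refine ⟨r, s, m1, hr, ⟨by linarith [hr.1], m5⟩, by simpa using hη, ?_,
      flux_ne hr ⟨by linarith [hr.1], m5⟩ ?_⟩
    · rw [abs_lt]; constructor <;> linarith
    · split_ifs at m4 with h0
      · rw [h0]; rw [h0] at m1; have : 0 < s := m1; exact ne_of_lt (by nlinarith)
      · nlinarith

end Data

namespace FlowSeq

variable {D : Data} (Q : FlowSeq D)

theorem tendsto_sn_sq (z : ℝ × ℝ) :
    Tendsto (fun a => D.sn (Q.N a.1) a.2.2 ^ 2) (Q.near z) (𝓝 (1 - (z.2 / D.R) ^ 2)) := by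
  have hR := D.R_pos
  have h1 : Tendsto (fun a => 1 - (Q.lb a / D.R) ^ 2) (Q.near z) (𝓝 (1 - (z.2 / D.R) ^ 2)) :=
    (((Q.tendsto_lb z).div_const _).pow 2).const_sub 1
  have h2 : Tendsto (fun a : ℕ × ℕ × ℕ => Real.pi / (2 * (Q.N a.1 : ℝ))) (Q.near z) (𝓝 0) :=
    Q.tendsto_step.comp (Q.tendsto_fst z)
  have h3 : Tendsto (fun a => D.sn (Q.N a.1) a.2.2 ^ 2 - (1 - (Q.lb a / D.R) ^ 2)) (Q.near z)
      (𝓝 0) := by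
    refine squeeze_zero_norm (fun a => ?_) h2
    have hk := Data.step_pos (Q.N_pos a.1)
    have e : 1 - (Q.lb a / D.R) ^ 2 =
        Real.sin (D.ang (Q.N a.1) a.2.2 + Real.pi / (2 * (Q.N a.1 : ℝ)) / 2) ^ 2 := by
      unfold lb Data.lab
      rw [Real.sin_sq]
      field_simp
    rw [e, Data.sn, Real.norm_eq_abs, sq_sub_sq, abs_mul]
    set x := D.ang (Q.N a.1) a.2.2
    set k := Real.pi / (2 * (Q.N a.1 : ℝ))
    have b1 := Real.abs_sin_sub_sin_le x (x + k / 2)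
    rw [show x - (x + k / 2) = - (k / 2) by ring, abs_neg, abs_of_pos (half_pos hk)] at b1
    have b2 : |Real.sin x + Real.sin (x + k / 2)| ≤ 2 := by
      have := Real.abs_sin_le_one x
      have := Real.abs_sin_le_one (x + k / 2)
      exact (abs_add_le _ _).trans (by linarith)
    calc _ ≤ 2 * (k / 2) := by gcongr
      _ = k := by ring
  simpa using h3.add h1

theorem tendsto_β (z : ℝ × ℝ) :
    Tendsto (fun a => D.β (Q.N a.1) a.2.2) (Q.near z) (𝓝 (D.flux z.2)) := by
  have := D.γ_pos
  exact (((Q.tendsto_sn_sq z).const_mul _).rpow_const (Or.inr (by linarith))).const_mul _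

theorem tendsto_ph (z : ℝ × ℝ) :
    Tendsto (fun a => D.ph (Q.N a.1) a.2.2) (Q.near z) (𝓝 (D.dens z.2)) := by
  have := D.γ_pos
  exact ((Q.tendsto_sn_sq z).const_mul _).rpow_const (Or.inr this.le)

/-- Positions, as a function of the node. -/
def x (a : ℕ × ℕ × ℕ) : ℝ := Q.X a.1 a.2.1 a.2.2

theorem abs_x_le {a : ℕ × ℕ × ℕ} (ha : a ∈ Q.dom) : |Q.x a| ≤ D.posBound :=
  (Q.flow a.1).abs_X_le' ha.1 ha.2.1 ha.2.2

theorem tendsto_x_zero (r : ℝ) : Tendsto Q.x (Q.near (0, r)) (𝓝 0) := by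
  have h1 : Tendsto (fun a => Q.tm a ^ D.α * D.R + D.C₀ * Q.tm a) (Q.near (0, r)) (𝓝 0) := by
    have h0 : Tendsto Q.tm (Q.near (0, r)) (𝓝 0) := Q.tendsto_tm (0, r)
    have := ((h0.rpow_const (Or.inr D.α_pos.le)).mul_const D.R).add (h0.const_mul D.C₀)
    simpa [Real.zero_rpow D.α_pos.ne'] using this
  refine squeeze_zero_norm' ?_ h1
  filter_upwards [Q.eventually_dom (0, r)] with a ha
  exact (Q.flow a.1).abs_X_le ha.1 ha.2.1 ha.2.2

theorem exists_limit_x {z : ℝ × ℝ} (hz : z ∈ rect D) :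
    ∃ f, Tendsto Q.x (Q.near z) (𝓝 f) := by
  obtain ⟨t, r⟩ := z
  rcases hz.1.1.eq_or_lt with h0 | ht
  · simp only at h0
    rw [← h0]
    exact ⟨0, Q.tendsto_x_zero r⟩
  simp only at ht
  have htT : t ≤ D.T := hz.1.2
  refine Q.exists_limit hz ((Q.eventually_dom _).mono fun a ha => Q.abs_x_le ha) fun ε hε => ?_
  have hU : 0 < D.upper D.T := D.upper_pos D.T_pos
  have hκR : 0 < D.κ * D.R := mul_pos D.κ_pos D.R_pos
  set η := ε / (16 * D.upper D.T) with hη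
  have hη0 : 0 < η := by positivity
  have hτ : 0 < t / 4 := by positivity
  obtain ⟨r₁, r₂, h12, hr₁, hr₂, d1, d2, hne⟩ := D.exists_flux_pair hz.2 hη0
  set c := |D.flux r₁ - D.flux r₂| / 2 / (D.κ * D.R) with hc
  have hflux : 0 < |D.flux r₁ - D.flux r₂| := abs_pos.2 (sub_ne_zero.2 hne)
  have hc0 : 0 < c := by positivity
  set K := 2 * D.posBound / (t / 4) + D.fluxBound (t / 4) / c * D.T with hK
  have hT := D.T_pos
  have hpb := D.posBound_nonneg
  have hfb := D.fluxBound_nonneg hτ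
  have hK0 : 0 ≤ K := by positivity
  set δ := min (min (t / 4) η) (ε / (8 * (K + 1))) with hδ
  have hδ0 : 0 < δ := by positivity
  have hδ1 : δ ≤ t / 4 := (min_le_left _ _).trans (min_le_left _ _)
  have hδ2 : δ ≤ η := (min_le_left _ _).trans (min_le_right _ _)
  have hδ3 : K * δ ≤ ε / 8 := by
    have : δ ≤ ε / (8 * (K + 1)) := min_le_right _ _
    calc K * δ ≤ (K + 1) * (ε / (8 * (K + 1))) := by gcongr; linarith
      _ = ε / 8 := by field_simp
  have c1 := Q.tendsto_idx (z := (t / 2, r₁)) ⟨⟨by simp only; linarith, by simp only; linarith⟩, hr₁⟩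
  have c2 := Q.tendsto_idx (z := (t / 2, r₂)) ⟨⟨by simp only; linarith, by simp only; linarith⟩, hr₂⟩
  have g1 := ((Q.tendsto_β _).comp c1).sub ((Q.tendsto_β _).comp c2)
  have g2 := g1.abs.eventually (lt_mem_nhds (show |D.flux r₁ - D.flux r₂| / 2 <
    |D.flux r₁ - D.flux r₂| by linarith))
  have l1 := (Q.tendsto_lb _).comp c1
  have l2 := (Q.tendsto_lb _).comp c2
  have t1 := (Q.tendsto_tm _).comp c1
  have good : ∀ᶠ n in (ult : Filter ℕ), ∀ i j i' j', (n, i, j) ∈ Q.dom → (n, i', j') ∈ Q.dom →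
      |Q.tm (n, i, j) - t| < δ → |Q.tm (n, i', j') - t| < δ → |Q.lb (n, i, j) - r| < δ →
      |Q.lb (n, i', j') - r| < δ → i ≤ i' → |Q.x (n, i', j') - Q.x (n, i, j)| ≤ ε := by
    filter_upwards [g2, l1.eventually (Metric.ball_mem_nhds r₁ hη0),
      l2.eventually (Metric.ball_mem_nhds r₂ hη0),
      l1.eventually (gt_mem_nhds (show r₁ < (r₁ + r₂) / 2 by linarith)),
      l2.eventually (lt_mem_nhds (show (r₁ + r₂) / 2 < r₂ by linarith)),
      t1.eventually (Metric.ball_mem_nhds (t / 2) hτ), c1.eventually (Q.eventually_dom _),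
      c2.eventually (Q.eventually_dom _)]
      with n hβ b1 b2 m1 m2 bt dom1 dom2 i j i' j' hd hd' ht1 ht2 hl1 hl2 hii
    simp only [Function.comp, lb, tm, Real.dist_eq] at *
    set i₁ := Q.tidx (t / 2) n
    set j₁ := Q.lidx r₁ n
    set j₂ := Q.lidx r₂ n
    have hF := Q.flow n
    have hN := hF.N_pos
    have hdt := Data.dt_pos (D := D) hN
    have hjj : j₁ ≤ j₂ := by
      by_contra hcon
      have := Data.lab_mono (D := D) hN (le_of_not_ge hcon) dom1.2.2.le
      linarith
    set m := ∑ l ∈ Finset.Ico j₁ j₂, D.μ (Q.N n) l with hm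
    have hcm : c ≤ m := by
      have := Data.abs_β_sub_le (D := D) hN hjj dom2.2.2.le
      rw [hc, div_le_iff₀ hκR]
      rw [mul_comm] at this
      linarith
    have hm0 : 0 < m := hc0.trans_le hcm
    rw [abs_lt] at bt ht1 ht2
    have hi₁ : (i₁ : ℝ) * D.dt (Q.N n) < i * D.dt (Q.N n) := by linarith
    have hi₁' : i₁ < i := by exact_mod_cast lt_of_mul_lt_mul_right hi₁ hdt.le
    have hK' : 2 * D.posBound / (D.T - i₁ * D.dt (Q.N n)) + D.fluxBound (t / 4) / m *
        (D.T - i₁ * D.dt (Q.N n)) ≤ K := by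
      have hL1 : t / 4 ≤ D.T - i₁ * D.dt (Q.N n) := by linarith
      have hL2 : D.T - i₁ * D.dt (Q.N n) ≤ D.T := by
        have : 0 ≤ (i₁ : ℝ) * D.dt (Q.N n) := by positivity
        linarith
      have hL0 : 0 < D.T - i₁ * D.dt (Q.N n) := hτ.trans_le hL1
      rw [hK]
      gcongr
    have hb := hF.abs_block_sub_le hτ dom1.1 (lt_of_lt_of_le hi₁' hd.2.1) (by linarith) rfl hjj
      dom2.2.2.le hm hm0 hi₁'.le hii hd'.2.1
    have hb' : |(∑ l ∈ Finset.Ico j₁ j₂, D.μ (Q.N n) l * Q.X n i' l) / m -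
        (∑ l ∈ Finset.Ico j₁ j₂, D.μ (Q.N n) l * Q.X n i l) / m| ≤ 2 * (ε / 8) := by
      refine hb.trans ?_
      have h5 : (0 : ℝ) ≤ (i' - i : ℝ) * D.dt (Q.N n) := by
        have : (i : ℝ) ≤ i' := by exact_mod_cast hii
        have := sub_nonneg.2 this
        positivity
      have h6 : (i' - i : ℝ) * D.dt (Q.N n) ≤ 2 * δ := by rw [sub_mul]; linarith
      calc _ ≤ K * (2 * δ) := by gcongr
        _ ≤ _ := by linarith
    have avg : ∀ i j, (n, i, j) ∈ Q.dom → |D.lab (Q.N n) j - r| < δ →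
        |(∑ l ∈ Finset.Ico j₁ j₂, D.μ (Q.N n) l * Q.X n i l) / m - Q.X n i j| ≤ 3 * (ε / 16) := by
      intro i j hd hlr
      have e : (∑ l ∈ Finset.Ico j₁ j₂, D.μ (Q.N n) l * Q.X n i l) / m - Q.X n i j =
          (∑ l ∈ Finset.Ico j₁ j₂, D.μ (Q.N n) l * (Q.X n i l - Q.X n i j)) / m := by
        simp only [mul_sub]
        rw [Finset.sum_sub_distrib, ← Finset.sum_mul, ← hm]
        field_simp
      rw [e, abs_div, abs_of_pos hm0, div_le_iff₀ hm0]
      refine (Finset.abs_sum_le_sum_abs _ _).trans ?_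
      rw [hm, Finset.mul_sum]
      refine Finset.sum_le_sum fun l hl => ?_
      rw [Finset.mem_Ico] at hl
      have hl2 : l < 2 * Q.N n := hl.2.trans dom2.2.2
      have hμ := Data.μ_pos (D := D) hN hl2
      rw [abs_mul, abs_of_pos hμ, mul_comm]
      refine mul_le_mul_of_nonneg_right ?_ hμ.le
      refine (hF.abs_X_sub_le hd.1 hd.2.1 hd.2.2 hl2).trans ?_
      have o1 := Data.lab_mono (D := D) hN hl.1 hl2.le
      have o2 := Data.lab_mono (D := D) hN hl.2.le dom2.2.2.le
      rw [abs_lt] at hlr d1 d2 b1 b2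
      have : |D.lab (Q.N n) l - D.lab (Q.N n) j| ≤ 3 * η := by
        rw [abs_le]; constructor <;> linarith
      calc _ ≤ D.upper D.T * (3 * η) := by gcongr
        _ = _ := by rw [hη]; field_simp
    have a1 := avg i j hd hl1
    have a2 := avg i' j' hd' hl2
    rw [abs_le] at *
    constructor <;> simp only [x] <;> linarith [hb'.1, hb'.2, a1.1, a1.2, a2.1, a2.2]
  have hs := (Q.mem_near (z := (t, r)) (s := {a | a ∈ Q.dom ∧ |Q.tm a - t| < δ ∧ |Q.lb a - r| < δ})).2
    ⟨δ, hδ0, Eventually.of_forall fun n i j hd h1 h2 => ⟨hd, h1, h2⟩⟩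
  have hs' := (Q.tendsto_fst (t, r)).eventually good
  refine ⟨_, inter_mem hs hs', ?_⟩
  rintro ⟨n, i, j⟩ ⟨⟨hd, h1, h2⟩, hg⟩ ⟨n', i', j'⟩ ⟨⟨hd', h1', h2'⟩, -⟩ hn
  simp only at hn
  subst hn
  rcases le_total i i' with h | h
  · rw [abs_sub_comm]; exact hg i j i' j' hd hd' h1 h1' h2 h2' h
  · exact hg i' j' i j hd' hd h1' h1 h2' h2 h

/-- The limit flow. -/
noncomputable def flowMap (t r : ℝ) : ℝ := limUnder (Q.near (t, r)) Q.x

theorem tendsto_x {z : ℝ × ℝ} (hz : z ∈ rect D) :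
    Tendsto Q.x (Q.near z) (𝓝 (Q.flowMap z.1 z.2)) := by
  have := Q.near_neBot hz
  exact tendsto_nhds_limUnder (Q.exists_limit_x hz)

theorem continuousOn_flowMap : ContinuousOn (fun z : ℝ × ℝ => Q.flowMap z.1 z.2) (rect D) :=
  Q.continuousOn_limit subset_rfl fun _ hz => Q.tendsto_x hz

theorem flowMap_sub_mem {t r r' : ℝ} (ht : t ∈ Icc 0 D.T) (hr : -D.R ≤ r) (hrr : r ≤ r')
    (hr' : r' ≤ D.R) : Q.flowMap t r' - Q.flowMap t r ∈
      Icc (D.lower t * (r' - r)) (D.upper t * (r' - r)) := by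
  rcases hrr.eq_or_lt with rfl | hlt
  · simp
  have hz : (t, r) ∈ rect D := ⟨ht, hr, hrr.trans hr'⟩
  have hz' : (t, r') ∈ rect D := ⟨ht, hr.trans hrr, hr'⟩
  have c := Q.tendsto_idx hz
  have c' := Q.tendsto_idx hz'
  have l1 := (Q.tendsto_lb _).comp c
  have l2 := (Q.tendsto_lb _).comp c'
  have t1 := (Q.tendsto_tm _).comp c
  have lim := ((Q.tendsto_x hz').comp c').sub ((Q.tendsto_x hz).comp c)
  have low := ((D.continuous_lower.tendsto t).comp t1).mul (l2.sub l1)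
  have upp := ((D.continuous_upper.tendsto t).comp t1).mul (l2.sub l1)
  have ev : ∀ᶠ n in (ult : Filter ℕ), Q.X n (Q.tidx t n) (Q.lidx r' n) -
      Q.X n (Q.tidx t n) (Q.lidx r n) ∈ Icc
        (D.lower (Q.tidx t n * D.dt (Q.N n)) * (D.lab (Q.N n) (Q.lidx r' n) -
          D.lab (Q.N n) (Q.lidx r n)))
        (D.upper (Q.tidx t n * D.dt (Q.N n)) * (D.lab (Q.N n) (Q.lidx r' n) -
          D.lab (Q.N n) (Q.lidx r n))) := by
    filter_upwards [l1.eventually (gt_mem_nhds (show r < (r + r') / 2 by linarith)),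
      l2.eventually (lt_mem_nhds (show (r + r') / 2 < r' by linarith))] with n m1 m2
    simp only [Function.comp, lb] at m1 m2
    refine (Q.flow n).X_sub_mem (Q.tidx_mem ht n).1 (Q.tidx_mem ht n).2 ?_ (Q.lidx_lt _ _)
    by_contra hcon
    have := Data.lab_mono (D := D) (Q.N_pos n) (le_of_not_ge hcon) (Q.lidx_lt _ _).le
    linarith
  exact ⟨le_of_tendsto_of_tendsto low lim (ev.mono fun n h => h.1),
    le_of_tendsto_of_tendsto lim upp (ev.mono fun n h => h.2)⟩

theorem abs_flowMap_sub_le {t r : ℝ} (ht : t ∈ Icc 0 D.T) (hr : r ∈ Icc (-D.R) D.R) :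
    |Q.flowMap t r - t ^ D.α * r| ≤ D.C₀ * t := by
  have hz : (t, r) ∈ rect D := ⟨ht, hr⟩
  have := Q.near_neBot hz
  have h1 := ((Q.tendsto_x hz).sub (((Q.tendsto_tm (t, r)).rpow_const (Or.inr D.α_pos.le)).mul
    (Q.tendsto_lb (t, r)))).abs
  refine le_of_tendsto_of_tendsto h1 ((Q.tendsto_tm (t, r)).const_mul D.C₀) ?_
  filter_upwards [Q.eventually_dom (t, r)] with a ha
  exact (Q.flow a.1).center _ _ ha.1 ha.2.1 ha.2.2

theorem flowMap_terminal {r : ℝ} (hr : r ∈ Icc (-D.R) D.R) : Q.flowMap D.T r = D.S r := by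
  have hz : (D.T, r) ∈ rect D := ⟨⟨D.T_pos.le, le_rfl⟩, hr⟩
  have c : Tendsto (fun n => (n, Q.N n, Q.lidx r n)) (ult : Filter ℕ) (Q.near (D.T, r)) := by
    refine Q.tendsto_near tendsto_id ?_ (Q.tendsto_lidx hr)
      (Eventually.of_forall fun n => ⟨(Q.flow n).lt.le, le_rfl, Q.lidx_lt _ n⟩)
    refine tendsto_const_nhds.congr fun n => ?_
    exact (Data.N_mul_dt (D := D) (Q.N_pos n)).symm
  have h1 := (Q.tendsto_x hz).comp c
  have h2 : Tendsto (fun n => D.Λ * |D.lab (Q.N n) (Q.lidx r n) - r|) (ult : Filter ℕ) (𝓝 0) := by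
    have := (((Q.tendsto_lidx hr).sub_const r).abs).const_mul D.Λ
    simpa using this
  have h3 : Tendsto (fun n => D.S (D.lab (Q.N n) (Q.lidx r n)) - D.S r) (ult : Filter ℕ) (𝓝 0) := by
    refine squeeze_zero_norm (fun n => ?_) h2
    have m1 := Data.neg_R_lt_lab (D := D) (Q.N_pos n) (Q.lidx_lt r n)
    have m2 := Data.lab_lt_R (D := D) (Q.N_pos n) (Q.lidx_lt r n)
    have hΛ := inv_pos.2 D.Λ_pos
    rw [Real.norm_eq_abs]
    rcases le_total r (D.lab (Q.N n) (Q.lidx r n)) with h | h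
    · have := D.bilip _ _ hr.1 h m2.le
      rw [abs_of_nonneg (sub_nonneg.2 h), abs_of_nonneg]
      · exact this.2
      · nlinarith [this.1]
    · have := D.bilip _ _ m1.le h hr.2
      rw [abs_sub_comm, abs_sub_comm _ r, abs_of_nonneg (sub_nonneg.2 h), abs_of_nonneg]
      · exact this.2
      · nlinarith [this.1]
  have h4 := h3.add_const (D.S r)
  rw [zero_add] at h4
  refine tendsto_nhds_unique h1 (h4.congr fun n => ?_)
  simp only [Function.comp, x]
  rw [(Q.flow n).terminal _ (Q.lidx_lt _ n)]
  ring

/-- The angle of a label. -/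
noncomputable def angle (D : Data) (r : ℝ) : ℝ := Real.arccos (-r / D.R)

theorem angle_mem {r : ℝ} (hr : r ∈ Ioo (-D.R) D.R) : angle D r ∈ Ioo 0 Real.pi := by
  have hR := D.R_pos
  refine ⟨Real.arccos_pos.2 ?_, (Real.arccos_le_pi _).lt_of_ne fun h => ?_⟩
  · rw [div_lt_one hR]; linarith [hr.1]
  · have h' := Real.arccos_eq_pi.1 h
    rw [div_le_iff₀ hR] at h'
    linarith [hr.2]

theorem tendsto_ang (z : ℝ × ℝ) :
    Tendsto (fun a => D.ang (Q.N a.1) a.2.2) (Q.near z) (𝓝 (angle D z.2)) := by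
  have hR := D.R_pos
  have h2 : Tendsto (fun a : ℕ × ℕ × ℕ => Real.pi / (2 * (Q.N a.1 : ℝ)) / 2) (Q.near z) (𝓝 0) := by
    simpa using (Q.tendsto_step.comp (Q.tendsto_fst z)).div_const 2
  have h1 : Tendsto (fun a => Real.arccos (-Q.lb a / D.R)) (Q.near z) (𝓝 (angle D z.2)) :=
    (Real.continuous_arccos.tendsto _).comp ((Q.tendsto_lb z).neg.div_const _)
  have h3 := h1.sub h2
  rw [sub_zero] at h3
  refine h3.congr' ?_
  filter_upwards [Q.eventually_dom z] with a ha
  have hm := Data.mid_mem (D := D) (Q.N_pos a.1) ha.2.2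
  have e : -Q.lb a / D.R = Real.cos (D.ang (Q.N a.1) a.2.2 + Real.pi / (2 * (Q.N a.1 : ℝ)) / 2) := by
    unfold lb Data.lab; field_simp
  rw [e, Real.arccos_cos hm.1.le hm.2.le]
  ring

/-- Specific volumes, as a function of the node. -/
noncomputable def sp (a : ℕ × ℕ × ℕ) : ℝ := D.spec (Q.N a.1) (Q.P a.1) a.2.1 a.2.2
/-- Velocities, as a function of the node. -/
noncomputable def ve (a : ℕ × ℕ × ℕ) : ℝ := D.vel (Q.N a.1) (Q.X a.1) a.2.1 a.2.2
/-- Jacobians, as a function of the node. -/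
def ja (a : ℕ × ℕ × ℕ) : ℝ := Q.P a.1 a.2.1 a.2.2

/-- Oscillation estimates in a neighbourhood of a point. -/
theorem exists_osc_le {τ : ℝ} (hτ : 0 < τ) : ∃ C : ℝ, 0 < C ∧ ∀ (t r ρ : ℝ) (q : ℕ),
    2 * τ ≤ t → t ≤ D.T - τ → r ∈ Ioo (-D.R) D.R → 0 < ρ → 2 * ρ ≤ angle D r →
    2 * ρ ≤ Real.pi - angle D r → D.T * ρ ≤ τ / 2 →
    ∀ t' r', |t' - t| < D.T * (ρ * (1 / 2) ^ q) / 16 →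
      |angle D r' - angle D r| < ρ * (1 / 2) ^ q / 8 →
      ∃ s' ∈ Q.near (t', r'), ∃ s ∈ Q.near (t, r), ∀ a ∈ s', ∀ b ∈ s, a.1 = b.1 →
        (Q.sp a - Q.sp b) ^ 2 * q ≤
          C / D.prof (min (angle D r) (Real.pi - angle D r) / Real.pi) ^ 2 ∧
        (Q.ve a - Q.ve b) ^ 2 * q ≤ C * min (angle D r) (Real.pi - angle D r) ^ 2 := by
  obtain ⟨C, hC, H⟩ := D.exists_osc hτ
  refine ⟨C, hC, fun t r ρ q ht htT hr hρ h1 h2 h3 t' r' ht' hr' => ?_⟩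
  have hT := D.T_pos
  have hq : (0 : ℝ) < (1 / 2) ^ q := by positivity
  have ev1 := (Q.tendsto_fst (t', r')).eventually
    ((Q.tendsto_i₀.eventually (gt_mem_nhds hτ)).and
    (Q.tendsto_step.eventually (gt_mem_nhds (show 0 < ρ * (1 / 2) ^ q / 16 by positivity))))
  have ta := ((Q.tendsto_tm (t', r')).sub_const t).abs.eventually (gt_mem_nhds ht')
  have la := ((Q.tendsto_ang (t', r')).sub_const (angle D r)).abs.eventually (gt_mem_nhds hr')
  have tb := ((Q.tendsto_tm (t, r)).sub_const t).abs.eventually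
    (gt_mem_nhds (show |t - t| < D.T * (ρ * (1 / 2) ^ q) / 16 by
      rw [sub_self, abs_zero]; positivity))
  have lb := ((Q.tendsto_ang (t, r)).sub_const (angle D r)).abs.eventually
    (gt_mem_nhds (show |angle D r - angle D r| < ρ * (1 / 2) ^ q / 8 by
      rw [sub_self, abs_zero]; positivity))
  refine ⟨_, inter_mem ev1 (inter_mem ta la), _, inter_mem tb lb, ?_⟩
  rintro ⟨n, i, j⟩ ⟨ha1, ha2, ha3⟩ ⟨n', i', j'⟩ ⟨hb1, hb2⟩ hab
  simp only at hab
  subst hab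
  exact H t (angle D r) ρ q (Q.N n) (Q.i₀ n) (Q.P n) (Q.X n) ht htT hρ h1 h2 h3 (Q.flow n)
    ha1.1.le ha1.2.le i j i' j' (le_of_lt ha2) (le_of_lt ha3) (le_of_lt hb1) (le_of_lt hb2)

/-- The open rectangle of times and labels. -/
def openRect (D : Data) : Set (ℝ × ℝ) := Ioo 0 D.T ×ˢ Ioo (-D.R) D.R

theorem openRect_subset : openRect D ⊆ rect D := prod_mono Ioo_subset_Icc_self Ioo_subset_Icc_self

theorem exists_osc_mem {z : ℝ × ℝ} (hz : z ∈ openRect D) {ε : ℝ} (hε : 0 < ε) :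
    ∃ s ∈ Q.near z, ∀ a ∈ s, ∀ b ∈ s, a.1 = b.1 → |Q.sp a - Q.sp b| ≤ ε ∧ |Q.ve a - Q.ve b| ≤ ε := by
  obtain ⟨⟨h1, h2⟩, hr⟩ := hz
  have hT := D.T_pos
  have hang := angle_mem hr
  set ϑ := angle D z.2 with hϑ
  set τ := min (z.1 / 2) (D.T - z.1) with hτd
  have hτ : 0 < τ := lt_min (by linarith) (by linarith)
  have hτ1 : τ ≤ z.1 / 2 := min_le_left _ _
  have hτ2 : τ ≤ D.T - z.1 := min_le_right _ _
  set ρ := min (min (ϑ / 2) ((Real.pi - ϑ) / 2)) (τ / (2 * D.T)) with hρd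
  have hρ : 0 < ρ := lt_min (lt_min (by linarith [hang.1]) (by linarith [hang.2])) (by positivity)
  have hρ1 : ρ ≤ ϑ / 2 := (min_le_left _ _).trans (min_le_left _ _)
  have hρ2 : ρ ≤ (Real.pi - ϑ) / 2 := (min_le_left _ _).trans (min_le_right _ _)
  have hρ3 : D.T * ρ ≤ τ / 2 := by
    calc D.T * ρ ≤ D.T * (τ / (2 * D.T)) := by gcongr; exact min_le_right _ _
      _ = τ / 2 := by field_simp
  obtain ⟨C, hC, H⟩ := D.exists_osc hτ
  set K := max (C / D.prof (min ϑ (Real.pi - ϑ) / Real.pi) ^ 2) (C * min ϑ (Real.pi - ϑ) ^ 2)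
  obtain ⟨q, hq⟩ := exists_nat_gt (K / ε ^ 2)
  have hK0 : 0 ≤ K := le_max_of_le_right (by positivity)
  have hq0 : (0 : ℝ) < q := lt_of_le_of_lt (by positivity) hq
  have hpq : (0 : ℝ) < (1 / 2) ^ q := by positivity
  have fin : ∀ x : ℝ, x ^ 2 * q ≤ K → |x| ≤ ε := by
    intro x hx
    rw [div_lt_iff₀ (by positivity)] at hq
    refine abs_le_of_sq_le_sq ?_ hε.le
    have : x ^ 2 * q < ε ^ 2 * q := by linarith
    exact (lt_of_mul_lt_mul_right this hq0.le).le
  have ev1 := (Q.tendsto_fst z).eventually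
    ((Q.tendsto_i₀.eventually (gt_mem_nhds hτ)).and
    (Q.tendsto_step.eventually (gt_mem_nhds (show 0 < ρ * (1 / 2) ^ q / 16 by positivity))))
  have tb := ((Q.tendsto_tm z).sub_const z.1).abs.eventually
    (gt_mem_nhds (show |z.1 - z.1| < D.T * (ρ * (1 / 2) ^ q) / 16 by
      rw [sub_self, abs_zero]; positivity))
  have lb := ((Q.tendsto_ang z).sub_const ϑ).abs.eventually
    (gt_mem_nhds (show |angle D z.2 - ϑ| < ρ * (1 / 2) ^ q / 8 by
      rw [← hϑ, sub_self, abs_zero]; positivity))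
  refine ⟨_, inter_mem ev1 (inter_mem tb lb), ?_⟩
  rintro ⟨n, i, j⟩ ⟨he, ha1, ha2⟩ ⟨n', i', j'⟩ ⟨-, hb1, hb2⟩ hn
  simp only at hn
  subst hn
  have := H z.1 ϑ ρ q (Q.N n) (Q.i₀ n) (Q.P n) (Q.X n) (by linarith) (by linarith) hρ
    (by linarith) (by linarith) hρ3 (Q.flow n)
    he.1.le he.2.le i j i' j' (le_of_lt ha1) (le_of_lt ha2) (le_of_lt hb1) (le_of_lt hb2)
  exact ⟨fin _ (this.1.trans (le_max_left _ _)), fin _ (this.2.trans (le_max_right _ _))⟩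

theorem dens_pos {r : ℝ} (hr : r ∈ Ioo (-D.R) D.R) : 0 < D.dens r := by
  have := D.a₀_pos
  have := Data.one_sub_sq_pos hr
  unfold Data.dens
  positivity

theorem ja_mem {a : ℕ × ℕ × ℕ} (ha : a ∈ Q.dom) :
    Q.ja a ∈ Icc (D.lower (Q.tm a)) (D.upper (Q.tm a)) := (Q.flow a.1).bounds _ _ ha.1 ha.2.1

theorem exists_limit_sp {z : ℝ × ℝ} (hz : z ∈ openRect D) :
    ∃ f, Tendsto Q.sp (Q.near z) (𝓝 f) := by
  have hd := dens_pos hz.2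
  refine Q.exists_limit (openRect_subset hz) (M := D.upper D.T / (D.dens z.2 / 2)) ?_ fun ε hε => ?_
  · filter_upwards [Q.eventually_dom z, (Q.tendsto_ph z).eventually (lt_mem_nhds
      (show D.dens z.2 / 2 < D.dens z.2 by linarith))] with a ha hp
    have h1 := Q.ja_mem ha
    have h2 := Q.tm_mem ha
    have h3 := D.upper_mono h2.1.le h2.2
    have h4 := D.lower_pos h2.1 h2.2
    have hja : 0 < Q.ja a := h4.trans_le h1.1
    have hU := D.upper_pos D.T_pos
    have e : Q.sp a = Q.ja a / D.ph (Q.N a.1) a.2.2 := rfl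
    rw [e, abs_of_pos (by have : 0 < D.ph (Q.N a.1) a.2.2 := by linarith
                          positivity)]
    have := h1.2.trans h3
    gcongr
  · obtain ⟨s, hs, H⟩ := Q.exists_osc_mem hz hε
    exact ⟨s, hs, fun a ha b hb hab => (H a ha b hb hab).1⟩

theorem exists_limit_ve {z : ℝ × ℝ} (hz : z ∈ openRect D) :
    ∃ f, Tendsto Q.ve (Q.near z) (𝓝 f) := by
  obtain ⟨s, hs, H⟩ := Q.exists_osc_mem hz one_pos
  obtain ⟨δ', hδ', hev⟩ := Q.mem_near.1 hs
  set δ := min δ' (D.T - z.1) with hδd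
  have hδ : 0 < δ := lt_min hδ' (sub_pos.2 hz.1.2)
  have hδ1 : δ ≤ δ' := min_le_left _ _
  have hδ2 : δ ≤ D.T - z.1 := min_le_right _ _
  have hpb := D.posBound_nonneg
  refine Q.exists_limit (openRect_subset hz) (M := 2 * D.posBound / (δ / 8) + 1) ?_ fun ε hε => ?_
  · refine Q.eventually_near.2 ⟨δ / 2, by positivity, ?_⟩
    filter_upwards [hev, Q.tendsto_dt.eventually (gt_mem_nhds (show 0 < δ / 8 by positivity))]
      with n hn hdtn i j hd ht hl
    have hdt := Data.dt_pos (D := D) (Q.N_pos n)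
    set h := D.dt (Q.N n)
    set B := ⌊δ / (4 * h)⌋₊
    have hB1 : (B : ℝ) * h ≤ δ / 4 := by
      have := Nat.floor_le (show 0 ≤ δ / (4 * h) by positivity)
      calc (B : ℝ) * h ≤ δ / (4 * h) * h := by gcongr
        _ = δ / 4 := by field_simp
    have hB2 : δ / 8 ≤ B * h := by
      have := Nat.lt_floor_add_one (δ / (4 * h))
      have h2 : δ / (4 * h) * h ≤ (B + 1) * h := by gcongr
      have h3 : δ / (4 * h) * h = δ / 4 := by field_simp
      linarith
    have nodes : ∀ k ≤ B, (n, i + k, j) ∈ Q.dom ∧ (n, i + k, j) ∈ s := by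
      intro k hk
      have hk' : (k : ℝ) * h ≤ δ / 4 := by
        have : (k : ℝ) ≤ B := by exact_mod_cast hk
        have : (k : ℝ) * h ≤ B * h := by gcongr
        linarith
      have hk0 : (0 : ℝ) ≤ k * h := by positivity
      have e : Q.tm (n, i + k, j) = Q.tm (n, i, j) + k * h := by simp only [tm]; push_cast; ring
      rw [abs_lt] at ht
      have hdom : (n, i + k, j) ∈ Q.dom := by
        refine ⟨hd.1.trans (Nat.le_add_right _ _), ?_, hd.2.2⟩
        have : ((i + k : ℕ) : ℝ) * h ≤ Q.N n * h := by
          have e2 : Q.tm (n, i + k, j) = ((i + k : ℕ) : ℝ) * h := rfl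
          rw [Data.N_mul_dt (Q.N_pos n), ← e2, e]
          linarith
        exact_mod_cast le_of_mul_le_mul_right this hdt
      refine ⟨hdom, hn _ _ hdom ?_ (by
        have : Q.lb (n, i + k, j) = Q.lb (n, i, j) := rfl
        rw [this]; linarith)⟩
      rw [e, abs_lt]
      constructor <;> linarith
    have sum : ∑ k ∈ Finset.range B, h * Q.ve (n, i + k, j) = Q.x (n, i + B, j) - Q.x (n, i, j) := by
      have hs := Finset.sum_range_sub (fun k => Q.x (n, i + k, j)) B
      simp only [add_zero] at hs
      rw [← hs]
      refine Finset.sum_congr rfl fun k hk => ?_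
      simp only [ve, x, Data.vel, ← add_assoc]
      exact mul_div_cancel₀ _ hdt.ne'
    have b1 := abs_le.1 (Q.abs_x_le (nodes B le_rfl).1)
    have b0 := abs_le.1 (Q.abs_x_le hd)
    have diff : |B * h * Q.ve (n, i, j) - (Q.x (n, i + B, j) - Q.x (n, i, j))| ≤ B * h := by
      have e : B * h * Q.ve (n, i, j) - (Q.x (n, i + B, j) - Q.x (n, i, j)) =
          ∑ k ∈ Finset.range B, h * (Q.ve (n, i, j) - Q.ve (n, i + k, j)) := by
        simp only [mul_sub]
        rw [← sum, Finset.sum_sub_distrib]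
        simp [mul_assoc]
      rw [e]
      refine (Finset.abs_sum_le_sum_abs _ _).trans ?_
      refine (Finset.sum_le_card_nsmul _ _ h fun k hk => ?_).trans
        (le_of_eq (by rw [Finset.card_range, nsmul_eq_mul]))
      have := (H _ (nodes 0 (Nat.zero_le _)).2 _ (nodes k (Finset.mem_range.1 hk).le).2 rfl).2
      rw [add_zero] at this
      rw [abs_mul, abs_of_pos hdt]
      exact mul_le_of_le_one_right hdt.le this
    have hBh : 0 < B * h := lt_of_lt_of_le (by positivity) hB2
    have : |B * h * Q.ve (n, i, j)| ≤ 2 * D.posBound + B * h := by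
      rw [abs_le] at *
      constructor <;> linarith [diff.1, diff.2, b1.1, b1.2, b0.1, b0.2]
    rw [abs_mul, abs_of_pos hBh] at this
    have h5 : |Q.ve (n, i, j)| ≤ 2 * D.posBound / (B * h) + 1 := by
      rw [← mul_le_mul_iff_right₀ hBh]
      refine this.trans (le_of_eq ?_)
      rw [mul_add, mul_div_cancel₀ _ hBh.ne', mul_one]
    refine h5.trans ?_
    gcongr
  · obtain ⟨s, hs, H⟩ := Q.exists_osc_mem hz hε
    exact ⟨s, hs, fun a ha b hb hab => (H a ha b hb hab).2⟩

/-- The limit velocity. -/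
noncomputable def velMap (t r : ℝ) : ℝ := limUnder (Q.near (t, r)) Q.ve
/-- The limit specific volume. -/
noncomputable def specMap (t r : ℝ) : ℝ := limUnder (Q.near (t, r)) Q.sp
/-- The limit Jacobian. -/
noncomputable def jac (t r : ℝ) : ℝ := Q.specMap t r * D.dens r

theorem tendsto_ve {z : ℝ × ℝ} (hz : z ∈ openRect D) :
    Tendsto Q.ve (Q.near z) (𝓝 (Q.velMap z.1 z.2)) := by
  have := Q.near_neBot (openRect_subset hz)
  exact tendsto_nhds_limUnder (Q.exists_limit_ve hz)

theorem tendsto_sp {z : ℝ × ℝ} (hz : z ∈ openRect D) :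
    Tendsto Q.sp (Q.near z) (𝓝 (Q.specMap z.1 z.2)) := by
  have := Q.near_neBot (openRect_subset hz)
  exact tendsto_nhds_limUnder (Q.exists_limit_sp hz)

theorem tendsto_ja {z : ℝ × ℝ} (hz : z ∈ openRect D) :
    Tendsto Q.ja (Q.near z) (𝓝 (Q.jac z.1 z.2)) := by
  have hd := dens_pos hz.2
  refine ((Q.tendsto_sp hz).mul (Q.tendsto_ph z)).congr' ?_
  filter_upwards [(Q.tendsto_ph z).eventually (lt_mem_nhds hd)] with a ha
  simp only [sp, ja, Data.spec]
  exact div_mul_cancel₀ _ ha.ne'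

theorem continuousOn_velMap : ContinuousOn (fun z : ℝ × ℝ => Q.velMap z.1 z.2) (openRect D) :=
  Q.continuousOn_limit openRect_subset fun _ hz => Q.tendsto_ve hz

theorem continuousOn_jac : ContinuousOn (fun z : ℝ × ℝ => Q.jac z.1 z.2) (openRect D) :=
  Q.continuousOn_limit openRect_subset fun _ hz => Q.tendsto_ja hz

theorem jac_mem {t r : ℝ} (hz : (t, r) ∈ openRect D) :
    Q.jac t r ∈ Icc (D.lower t) (D.upper t) := by
  have := Q.near_neBot (openRect_subset hz)
  have h1 : Tendsto (fun a => D.lower (Q.tm a)) (Q.near (t, r)) (𝓝 (D.lower t)) :=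
    (D.continuous_lower.tendsto t).comp (Q.tendsto_tm (t, r))
  have h2 : Tendsto (fun a => D.upper (Q.tm a)) (Q.near (t, r)) (𝓝 (D.upper t)) :=
    (D.continuous_upper.tendsto t).comp (Q.tendsto_tm (t, r))
  have h3 : Tendsto Q.ja (Q.near (t, r)) (𝓝 (Q.jac t r)) := Q.tendsto_ja hz
  constructor
  · refine le_of_tendsto_of_tendsto h1 h3 ?_
    filter_upwards [Q.eventually_dom (t, r)] with a ha
    exact (Q.ja_mem ha).1
  · refine le_of_tendsto_of_tendsto h3 h2 ?_
    filter_upwards [Q.eventually_dom (t, r)] with a ha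
    exact (Q.ja_mem ha).2

theorem jac_pos {t r : ℝ} (hz : (t, r) ∈ openRect D) : 0 < Q.jac t r :=
  (D.lower_pos hz.1.1 hz.1.2.le).trans_le (Q.jac_mem hz).1

theorem specMap_pos {t r : ℝ} (hz : (t, r) ∈ openRect D) : 0 < Q.specMap t r :=
  pos_of_mul_pos_left (Q.jac_pos hz) (dens_pos hz.2).le

theorem hasDerivAt_flowMap_label {t r : ℝ} (hz : (t, r) ∈ openRect D) :
    HasDerivAt (Q.flowMap t) (Q.jac t r) r := by
  have ht : t ∈ Icc 0 D.T := Ioo_subset_Icc_self hz.1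
  have hrg := Q.tendsto_rgt (z := (t, r)) hz.2.2
  refine Q.hasDerivAt_label ht hz.2
    (fun r' hr' => Q.tendsto_x (z := (t, r')) ⟨ht, Ioo_subset_Icc_self hr'⟩)
    ((Q.tendsto_ja hz).comp hrg) ?_
  filter_upwards [Q.eventually_dom (t, r), hrg.eventually (Q.eventually_dom (t, r))] with a ha hb
  have := (Q.flow a.1).rel a.2.1 a.2.2 ha.1 ha.2.1 hb.2.2
  rw [← Data.lab_succ_sub] at this
  exact this

theorem hasDerivAt_flowMap_time {t r : ℝ} (hz : (t, r) ∈ openRect D) :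
    HasDerivAt (fun s => Q.flowMap s r) (Q.velMap t r) t := by
  have hr : r ∈ Icc (-D.R) D.R := Ioo_subset_Icc_self hz.2
  refine Q.hasDerivAt_time hz.1 hr
    (fun t' ht' => Q.tendsto_x (z := (t', r)) ⟨Ioo_subset_Icc_self ht', hr⟩)
    (Q.tendsto_ve hz) ⟨1, one_pos, fun ε hε => Eventually.of_forall ?_⟩
  intro n i' i'' j hij _ _ _ _ _
  have hdt := Data.dt_pos (D := D) (Q.N_pos n)
  have : ∑ i ∈ Finset.Ico i' i'', D.dt (Q.N n) * Q.ve (n, i, j) =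
      Q.x (n, i'', j) - Q.x (n, i', j) := by
    rw [← Finset.sum_Ico_sub (fun i => Q.x (n, i, j)) hij]
    refine Finset.sum_congr rfl fun i _ => ?_
    simp only [ve, x, Data.vel]
    exact mul_div_cancel₀ _ hdt.ne'
  rw [this, sub_self, abs_zero]
  exact hε.le

/-- The energy density on the lattice. -/
noncomputable def act (a : ℕ × ℕ × ℕ) : ℝ := Q.ve a ^ 2 / 2 + Q.sp (nxt (rgt a)) ^ (-D.θ)

/-- The momentum on the lattice. -/
noncomputable def mom (a : ℕ × ℕ × ℕ) : ℝ := Q.ve (rgt a) * Q.ja (rgt a)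

theorem tendsto_act {z : ℝ × ℝ} (hz : z ∈ openRect D) :
    Tendsto Q.act (Q.near z) (𝓝 (Q.velMap z.1 z.2 ^ 2 / 2 + Q.specMap z.1 z.2 ^ (-D.θ))) := by
  have h1 := (Q.tendsto_nxt hz.1.2).comp (Q.tendsto_rgt hz.2.2)
  exact (((Q.tendsto_ve hz).pow 2).div_const 2).add
    (((Q.tendsto_sp hz).comp h1).rpow_const (Or.inl (Q.specMap_pos hz).ne'))

theorem tendsto_mom {z : ℝ × ℝ} (hz : z ∈ openRect D) :
    Tendsto Q.mom (Q.near z) (𝓝 (Q.velMap z.1 z.2 * Q.jac z.1 z.2)) :=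
  ((Q.tendsto_ve hz).comp (Q.tendsto_rgt hz.2.2)).mul
    ((Q.tendsto_ja hz).comp (Q.tendsto_rgt hz.2.2))

theorem action_eq (n i j : ℕ) :
    D.action (Q.N n) (Q.P n) (Q.X n) i j = D.dt (Q.N n) * Q.act (n, i, j) := rfl

theorem momentum_eq {n i j : ℕ} (h1 : Q.i₀ n ≤ i) (h2 : i ≤ Q.N n) (h3 : j + 1 < 2 * Q.N n) :
    D.momentum (Q.N n) (Q.X n) i (j + 1) =
      (Q.lb (n, i, j + 1) - Q.lb (n, i, j)) * Q.mom (n, i, j) := by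
  have := (Q.flow n).rel i j h1 h2 h3
  rw [← Data.lab_succ_sub] at this
  simp only [Data.momentum, mom, rgt, ja, ve, lb, Nat.add_sub_cancel]
  rw [this]
  ring

/-- The lattice potential, normalized at a base node. -/
noncomputable def pot (a : ℕ × ℕ × ℕ) : ℝ :=
  -(∑ l ∈ Finset.range a.2.2, D.momentum (Q.N a.1) (Q.X a.1) a.2.1 (l + 1) -
    ∑ l ∈ Finset.range (Q.lidx 0 a.1), D.momentum (Q.N a.1) (Q.X a.1) a.2.1 (l + 1)) -
  (∑ k ∈ Finset.range a.2.1, D.action (Q.N a.1) (Q.P a.1) (Q.X a.1) k (Q.lidx 0 a.1) -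
    ∑ k ∈ Finset.range (Q.tidx (D.T / 2) a.1),
      D.action (Q.N a.1) (Q.P a.1) (Q.X a.1) k (Q.lidx 0 a.1))

theorem pot_base (n : ℕ) : Q.pot (n, Q.tidx (D.T / 2) n, Q.lidx 0 n) = 0 := by
  simp [pot]

theorem pot_rgt_sub {n i j : ℕ} :
    Q.pot (n, i, j + 1) - Q.pot (n, i, j) = -D.momentum (Q.N n) (Q.X n) i (j + 1) := by
  simp only [pot, Finset.sum_range_succ]
  ring

theorem sum_range_sub_sum_range_eq {f g h : ℕ → ℝ} (H : ∀ l, f l = g l + (h (l + 1) - h l))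
    (j j' : ℕ) : ∑ l ∈ Finset.range j, f l - ∑ l ∈ Finset.range j', f l =
      (∑ l ∈ Finset.range j, g l - ∑ l ∈ Finset.range j', g l) + (h j - h j') := by
  simp only [H, Finset.sum_add_distrib, Finset.sum_range_sub]
  ring

theorem pot_nxt_sub {n i j : ℕ} :
    Q.pot (n, i + 1, j) - Q.pot (n, i, j) = -D.action (Q.N n) (Q.P n) (Q.X n) i j -
      (∑ l ∈ Finset.range j, D.defect (Q.N n) (Q.P n) (Q.X n) i l -
        ∑ l ∈ Finset.range (Q.lidx 0 n), D.defect (Q.N n) (Q.P n) (Q.X n) i l) := by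
  have := sum_range_sub_sum_range_eq
    (f := fun l => D.momentum (Q.N n) (Q.X n) (i + 1) (l + 1) - D.momentum (Q.N n) (Q.X n) i (l + 1))
    (g := fun l => D.defect (Q.N n) (Q.P n) (Q.X n) i l)
    (h := fun l => D.action (Q.N n) (Q.P n) (Q.X n) i l)
    (fun l => by simp only [Data.defect]; ring) j (Q.lidx 0 n)
  simp only [Finset.sum_sub_distrib] at this
  simp only [pot, Finset.sum_range_succ]
  linarith

theorem abs_sum_range_sub_sum_range_le {f : ℕ → ℝ} {j j' J₁ J₂ : ℕ} (h1 : J₁ ≤ j) (h2 : J₁ ≤ j')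
    (h3 : j ≤ J₂) (h4 : j' ≤ J₂) :
    |∑ l ∈ Finset.range j, f l - ∑ l ∈ Finset.range j', f l| ≤ ∑ l ∈ Finset.Ico J₁ J₂, |f l| := by
  wlog hjj : j' ≤ j generalizing j j'
  · rw [abs_sub_comm]; exact this h2 h1 h4 h3 (le_of_not_ge hjj)
  rw [← Finset.sum_Ico_eq_sub _ hjj]
  refine (Finset.abs_sum_le_sum_abs _ _).trans ?_
  exact Finset.sum_le_sum_of_subset_of_nonneg (Finset.Ico_subset_Ico h2 h3) fun _ _ _ => abs_nonneg _

theorem angle_mono {r r' : ℝ} (h : r ≤ r') : angle D r ≤ angle D r' := by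
  have hR := D.R_pos
  exact Real.arccos_le_arccos (by gcongr)

theorem angle_lb (n i j : ℕ) (hj : j < 2 * Q.N n) :
    angle D (Q.lb (n, i, j)) = D.ang (Q.N n) j + Real.pi / (2 * (Q.N n : ℝ)) / 2 := by
  have hR := D.R_pos
  have hm := Data.mid_mem (D := D) (Q.N_pos n) hj
  have e : -Q.lb (n, i, j) / D.R = Real.cos (D.ang (Q.N n) j + Real.pi / (2 * (Q.N n : ℝ)) / 2) := by
    unfold lb Data.lab; field_simp
  rw [angle, e, Real.arccos_cos hm.1.le hm.2.le]

theorem eventually_sum_defect_le {t₁ t₂ r₁ r₂ : ℝ} (ht₁ : 0 < t₁) (ht₂ : t₂ < D.T)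
    (hr₁ : -D.R < r₁) (hrr : r₁ < r₂) (hr₂ : r₂ < D.R) {ε : ℝ} (hε : 0 < ε) :
    ∀ᶠ n in (ult : Filter ℕ), ∀ i' i'' J₁ J₂, i' ≤ i'' → J₁ ≤ J₂ → J₂ < 2 * Q.N n →
      t₁ ≤ Q.tm (n, i', J₁) → Q.tm (n, i'', J₁) ≤ t₂ → r₁ ≤ Q.lb (n, i', J₁) →
      Q.lb (n, i', J₂) ≤ r₂ →
      ∑ i ∈ Finset.Ico i' i'', ∑ l ∈ Finset.Ico J₁ J₂,
        |D.defect (Q.N n) (Q.P n) (Q.X n) i l| ≤ ε := by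
  have a1 := (angle_mem (D := D) (r := r₁) ⟨hr₁, hrr.trans hr₂⟩).1
  have a2 := (angle_mem (D := D) (r := r₂) ⟨hr₁.trans hrr, hr₂⟩).2
  set τ := min (t₁ / 2) (D.T - t₂) with hτd
  have hτ : 0 < τ := lt_min (by linarith) (by linarith)
  have hτ1 : τ ≤ t₁ / 2 := min_le_left _ _
  have hτ2 : τ ≤ D.T - t₂ := min_le_right _ _
  set s := min (angle D r₁ / 4) ((Real.pi - angle D r₂) / 4) with hsd
  have hs : 0 < s := lt_min (by linarith) (by linarith)
  have hs1 : s ≤ angle D r₁ / 4 := min_le_left _ _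
  have hs2 : s ≤ (Real.pi - angle D r₂) / 4 := min_le_right _ _
  obtain ⟨N₀, H⟩ := D.exists_sum_defect_le hτ hs hε
  filter_upwards [Q.N_tendsto.eventually_ge_atTop N₀ |> fun h => ult_le h,
    Q.tendsto_i₀.eventually (gt_mem_nhds hτ), Q.tendsto_step.eventually (gt_mem_nhds a1)]
    with n hn hi hst i' i'' J₁ J₂ hii hJ hJ2 h1 h2 h3 h4
  obtain ⟨n₁, rfl⟩ := Nat.exists_eq_add_of_le hii
  obtain ⟨n₂, rfl⟩ := Nat.exists_eq_add_of_le hJ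
  have b1 := angle_mono (D := D) h3
  have b2 := angle_mono (D := D) h4
  rw [Q.angle_lb _ _ _ (by omega)] at b1 b2
  have hk := Data.step_pos (Q.N_pos n)
  have := H (Q.N n) hn (Q.i₀ n) (Q.P n) (Q.X n) (Q.flow n) hi.le i' J₁ n₁ n₂
    (by unfold tm at h1; simp only at h1; linarith)
    (by unfold tm at h2; simp only at h2; linarith) (by linarith) (by linarith)
  rw [Finset.sum_Ico_eq_sum_range]
  simp only [Finset.sum_Ico_eq_sum_range, Nat.add_sub_cancel_left]
  exact this

theorem lb_mono {n i i' j j' : ℕ} (h : j ≤ j') (hj : j' ≤ 2 * Q.N n) :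
    Q.lb (n, i, j) ≤ Q.lb (n, i', j') :=
  Data.lab_mono (D := D) (Q.N_pos n) h hj

theorem eventually_pot_time {t₁ t₂ r₁ r₂ : ℝ} (ht₁ : 0 < t₁) (ht₂ : t₂ < D.T)
    (hr₁ : -D.R < r₁) (hr₁' : r₁ < 0) (hr₂' : 0 < r₂) (hr₂ : r₂ < D.R) {ε : ℝ} (hε : 0 < ε) :
    ∀ᶠ n in (ult : Filter ℕ), ∀ i' i'' j, i' ≤ i'' → (n, i', j) ∈ Q.dom → (n, i'', j) ∈ Q.dom →
      Q.tm (n, i', j) ∈ Icc t₁ t₂ → Q.tm (n, i'', j) ∈ Icc t₁ t₂ → Q.lb (n, i', j) ∈ Icc r₁ r₂ →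
      |Q.pot (n, i'', j) - Q.pot (n, i', j) -
        ∑ i ∈ Finset.Ico i' i'', D.dt (Q.N n) * -Q.act (n, i, j)| ≤ ε := by
  have hR := D.R_pos
  have hl := Q.tendsto_lidx (r := 0) ⟨by linarith, hR.le⟩
  filter_upwards [Q.eventually_sum_defect_le ht₁ ht₂ hr₁ (hr₁'.trans hr₂') hr₂ hε,
    hl.eventually (Ioo_mem_nhds hr₁' hr₂')] with n hn hb i' i'' j hij hd' hd'' hm' hm'' hlb
  have e : Q.pot (n, i'', j) - Q.pot (n, i', j) -
        ∑ i ∈ Finset.Ico i' i'', D.dt (Q.N n) * -Q.act (n, i, j) = -∑ i ∈ Finset.Ico i' i'',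
        (∑ l ∈ Finset.range j, D.defect (Q.N n) (Q.P n) (Q.X n) i l -
        ∑ l ∈ Finset.range (Q.lidx 0 n), D.defect (Q.N n) (Q.P n) (Q.X n) i l) := by
    rw [← Finset.sum_Ico_sub (fun i => Q.pot (n, i, j)) hij, ← Finset.sum_sub_distrib,
      ← Finset.sum_neg_distrib]
    refine Finset.sum_congr rfl fun i _ => ?_
    rw [pot_nxt_sub, action_eq]
    ring
  rw [e, abs_neg]
  refine (Finset.abs_sum_le_sum_abs _ _).trans ?_
  have hj0 := Q.lidx_lt 0 n
  have hjd := hd'.2.2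
  simp only at hjd
  refine (Finset.sum_le_sum fun i _ => abs_sum_range_sub_sum_range_le (min_le_left j (Q.lidx 0 n))
    (min_le_right _ _) (le_max_left j (Q.lidx 0 n)) (le_max_right _ _)).trans ?_
  refine hn i' i'' _ _ hij min_le_max (max_lt hjd hj0) hm'.1 hm''.2 ?_ ?_
  · rcases min_choice j (Q.lidx 0 n) with h | h <;> rw [h]
    · exact hlb.1
    · exact hb.1.le
  · rcases max_choice j (Q.lidx 0 n) with h | h <;> rw [h]
    · exact hlb.2
    · exact hb.2.le

theorem exists_bound {t₁ t₂ r₁ r₂ : ℝ} (ht₁ : 0 < t₁) (ht₂ : t₂ < D.T)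
    (hr₁ : -D.R < r₁) (hr₂ : r₂ < D.R) {F : ℕ × ℕ × ℕ → ℝ} {g : ℝ × ℝ → ℝ}
    (h : ∀ z ∈ openRect D, Tendsto F (Q.near z) (𝓝 (g z))) :
    ∃ C, 0 < C ∧ ∀ᶠ n in (ult : Filter ℕ), ∀ i j, (n, i, j) ∈ Q.dom →
      Q.tm (n, i, j) ∈ Icc t₁ t₂ → Q.lb (n, i, j) ∈ Icc r₁ r₂ → |F (n, i, j)| ≤ C := by
  have hK : Icc t₁ t₂ ×ˢ Icc r₁ r₂ ⊆ openRect D := prod_mono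
    (fun t ht => ⟨ht₁.trans_le ht.1, ht.2.trans_lt ht₂⟩)
    (fun r hr => ⟨hr₁.trans_le hr.1, hr.2.trans_lt hr₂⟩)
  have hc : IsCompact (Icc t₁ t₂ ×ˢ Icc r₁ r₂) := isCompact_Icc.prod isCompact_Icc
  obtain ⟨C, hC⟩ := hc.exists_bound_of_continuousOn
    ((Q.continuousOn_limit openRect_subset h).mono hK)
  refine ⟨max C 0 + 1, by positivity, ?_⟩
  have := Q.eventually_forall_of_isCompact hc (p := fun a => |F a| ≤ max C 0 + 1) fun z hz => by
    have h1 : |g z| < max C 0 + 1 := by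
      have := hC z hz
      rw [Real.norm_eq_abs] at this
      linarith [le_max_left C 0]
    exact ((h z (hK hz)).abs.eventually (gt_mem_nhds h1)).mono fun a ha => ha.le
  exact this.mono fun n hn i j hd h1 h2 => hn i j hd ⟨h1, h2⟩

theorem exists_pot_lipschitz {t₁ t₂ r₁ r₂ : ℝ} (ht₁ : 0 < t₁) (ht₂ : t₂ < D.T)
    (hr₁ : -D.R < r₁) (hr₁' : r₁ < 0) (hr₂' : 0 < r₂) (hr₂ : r₂ < D.R) :
    ∃ C, 0 < C ∧ ∀ ε > 0, ∀ᶠ n in (ult : Filter ℕ), ∀ i i' j j', (n, i, j) ∈ Q.dom →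
      (n, i', j') ∈ Q.dom → Q.tm (n, i, j) ∈ Icc t₁ t₂ → Q.tm (n, i', j') ∈ Icc t₁ t₂ →
      Q.lb (n, i, j) ∈ Icc r₁ r₂ → Q.lb (n, i', j') ∈ Icc r₁ r₂ →
      |Q.pot (n, i, j) - Q.pot (n, i', j')| ≤
        C * (|Q.tm (n, i, j) - Q.tm (n, i', j')| + |Q.lb (n, i, j) - Q.lb (n, i', j')|) + ε := by
  obtain ⟨C₁, hC₁, H₁⟩ := Q.exists_bound ht₁ ht₂ hr₁ hr₂ fun z hz => Q.tendsto_act hz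
  obtain ⟨C₂, hC₂, H₂⟩ := Q.exists_bound ht₁ ht₂ hr₁ hr₂ fun z hz => Q.tendsto_mom hz
  refine ⟨C₁ + C₂, by positivity, fun ε hε => ?_⟩
  filter_upwards [H₁, H₂, Q.eventually_pot_time ht₁ ht₂ hr₁ hr₁' hr₂' hr₂ hε]
    with n h1 h2 h3 i i' j j' hd hd' ht ht' hl hl'
  have hdt := Data.dt_pos (D := D) (Q.N_pos n)
  have time : ∀ k k', k ≤ k' → (n, k, j) ∈ Q.dom → (n, k', j) ∈ Q.dom →
      Q.tm (n, k, j) ∈ Icc t₁ t₂ → Q.tm (n, k', j) ∈ Icc t₁ t₂ →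
      |Q.pot (n, k', j) - Q.pot (n, k, j)| ≤ C₁ * |Q.tm (n, k', j) - Q.tm (n, k, j)| + ε := by
    intro k k' hkk hk hk' htk htk'
    have a1 := h3 k k' j hkk hk hk' htk htk' hl
    have e2 := Finset.sum_Ico_sub (fun i => Q.tm (n, i, j)) hkk
    have e3 : ∀ i, Q.tm (n, i + 1, j) - Q.tm (n, i, j) = D.dt (Q.N n) := fun i => by
      simp only [tm]; push_cast; ring
    simp only [e3] at e2
    have a2 : |∑ i ∈ Finset.Ico k k', D.dt (Q.N n) * -Q.act (n, i, j)| ≤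
        C₁ * (Q.tm (n, k', j) - Q.tm (n, k, j)) := by
      rw [← e2, Finset.mul_sum]
      refine (Finset.abs_sum_le_sum_abs _ _).trans (Finset.sum_le_sum fun l hl' => ?_)
      rw [Finset.mem_Ico] at hl'
      have hdl : (n, l, j) ∈ Q.dom := ⟨hk.1.trans hl'.1, hl'.2.le.trans hk'.2.1, hd.2.2⟩
      have htl : Q.tm (n, l, j) ∈ Icc t₁ t₂ := by
        have b1 : (k : ℝ) * D.dt (Q.N n) ≤ l * D.dt (Q.N n) := by
          have : (k : ℝ) ≤ l := by exact_mod_cast hl'.1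
          gcongr
        have b2 : (l : ℝ) * D.dt (Q.N n) ≤ k' * D.dt (Q.N n) := by
          have : (l : ℝ) ≤ k' := by exact_mod_cast hl'.2.le
          gcongr
        exact ⟨htk.1.trans b1, b2.trans htk'.2⟩
      rw [abs_mul, abs_neg, abs_of_pos hdt, mul_comm]
      exact mul_le_mul_of_nonneg_right (h1 l j hdl htl hl) hdt.le
    have a3 : Q.tm (n, k', j) - Q.tm (n, k, j) ≤ |Q.tm (n, k', j) - Q.tm (n, k, j)| := le_abs_self _
    have a4 : C₁ * (Q.tm (n, k', j) - Q.tm (n, k, j)) ≤ C₁ * |Q.tm (n, k', j) - Q.tm (n, k, j)| :=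
      mul_le_mul_of_nonneg_left a3 hC₁.le
    have a5 := abs_sub_abs_le_abs_sub (Q.pot (n, k', j) - Q.pot (n, k, j))
      (∑ i ∈ Finset.Ico k k', D.dt (Q.N n) * -Q.act (n, i, j))
    linarith
  have space : ∀ l l', l ≤ l' → (n, i', l) ∈ Q.dom → (n, i', l') ∈ Q.dom →
      Q.lb (n, i', l) ∈ Icc r₁ r₂ → Q.lb (n, i', l') ∈ Icc r₁ r₂ →
      |Q.pot (n, i', l') - Q.pot (n, i', l)| ≤ C₂ * |Q.lb (n, i', l') - Q.lb (n, i', l)| := by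
    intro l l' hll hk hk' htk htk'
    rw [← Finset.sum_Ico_sub (fun l => Q.pot (n, i', l)) hll,
      abs_of_nonneg (sub_nonneg.2 (Q.lb_mono hll hk'.2.2.le)),
      ← Finset.sum_Ico_sub (fun l => Q.lb (n, i', l)) hll, Finset.mul_sum]
    refine (Finset.abs_sum_le_sum_abs _ _).trans (Finset.sum_le_sum fun m hm => ?_)
    rw [Finset.mem_Ico] at hm
    have hk2 := hk'.2.2
    simp only at hk2
    have hm1 : m + 1 ≤ 2 * Q.N n := by omega
    have hm2 : m + 1 < 2 * Q.N n := by omega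
    have hm0 : m ≤ 2 * Q.N n := by omega
    have hl0 : l' ≤ 2 * Q.N n := by omega
    have hnn : 0 ≤ Q.lb (n, i', m + 1) - Q.lb (n, i', m) :=
      sub_nonneg.2 (Q.lb_mono (Nat.le_succ m) hm1)
    rw [pot_rgt_sub, abs_neg, Q.momentum_eq (n := n) hk.1 hk.2.1 hm2, abs_mul, mul_comm,
      abs_of_nonneg hnn]
    refine mul_le_mul_of_nonneg_right (h2 i' m ⟨hk.1, hk.2.1, show m < 2 * Q.N n by omega⟩ ht'
      ⟨htk.1.trans (Q.lb_mono hm.1 hm0), (Q.lb_mono hm.2.le hl0).trans htk'.2⟩) hnn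
  have hm : (n, i', j) ∈ Q.dom := ⟨hd'.1, hd'.2.1, hd.2.2⟩
  have s1 : |Q.pot (n, i, j) - Q.pot (n, i', j)| ≤
      C₁ * |Q.tm (n, i, j) - Q.tm (n, i', j')| + ε := by
    rcases le_total i' i with h | h
    · exact time i' i h hm hd ht' ht
    · rw [abs_sub_comm, abs_sub_comm (Q.tm (n, i, j))]
      exact time i i' h hd hm ht ht'
  have s2 : |Q.pot (n, i', j) - Q.pot (n, i', j')| ≤ C₂ * |Q.lb (n, i, j) - Q.lb (n, i', j')| := by
    rcases le_total j' j with h | h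
    · exact space j' j h hd' hm hl' hl
    · rw [abs_sub_comm, abs_sub_comm (Q.lb (n, i, j))]
      exact space j j' h hm hd' hl hl'
  have p1 : 0 ≤ C₁ * |Q.lb (n, i, j) - Q.lb (n, i', j')| := by positivity
  have p2 : 0 ≤ C₂ * |Q.tm (n, i, j) - Q.tm (n, i', j')| := by positivity
  exact (abs_sub_le _ (Q.pot (n, i', j)) _).trans (by linarith)

theorem exists_box {z : ℝ × ℝ} (hz : z ∈ openRect D) : ∃ t₁ t₂ r₁ r₂ δ : ℝ, 0 < t₁ ∧ t₂ < D.T ∧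
    -D.R < r₁ ∧ r₁ < 0 ∧ 0 < r₂ ∧ r₂ < D.R ∧ t₁ < D.T / 2 ∧ D.T / 2 < t₂ ∧ 0 < δ ∧
    ∀ t r, |t - z.1| < δ → |r - z.2| < δ → t ∈ Icc t₁ t₂ ∧ r ∈ Icc r₁ r₂ := by
  obtain ⟨⟨h1, h2⟩, h3, h4⟩ := hz
  have hR := D.R_pos
  have hT := D.T_pos
  set δ := min (min (z.1 / 2) ((D.T - z.1) / 2)) (min ((z.2 + D.R) / 2) ((D.R - z.2) / 2))
  have d1 : δ ≤ z.1 / 2 := (min_le_left _ _).trans (min_le_left _ _)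
  have d2 : δ ≤ (D.T - z.1) / 2 := (min_le_left _ _).trans (min_le_right _ _)
  have d3 : δ ≤ (z.2 + D.R) / 2 := (min_le_right _ _).trans (min_le_left _ _)
  have d4 : δ ≤ (D.R - z.2) / 2 := (min_le_right _ _).trans (min_le_right _ _)
  have hδ : 0 < δ := lt_min (lt_min (by linarith) (by linarith)) (lt_min (by linarith) (by linarith))
  refine ⟨min (z.1 - δ) (D.T / 4), max (z.1 + δ) (3 * D.T / 4), min (z.2 - δ) (-D.R / 2),
    max (z.2 + δ) (D.R / 2), δ, lt_min (by linarith) (by linarith), max_lt (by linarith)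
    (by linarith), lt_min (by linarith) (by linarith), min_lt_of_right_lt (by linarith),
    lt_max_of_lt_right (by linarith), max_lt (by linarith) (by linarith),
    min_lt_of_right_lt (by linarith), lt_max_of_lt_right (by linarith), hδ, fun t r ht hr => ?_⟩
  rw [abs_lt] at ht hr
  exact ⟨⟨min_le_of_left_le (by linarith), le_max_of_le_left (by linarith)⟩,
    ⟨min_le_of_left_le (by linarith), le_max_of_le_left (by linarith)⟩⟩

theorem exists_limit_pot {z : ℝ × ℝ} (hz : z ∈ openRect D) :
    ∃ f, Tendsto Q.pot (Q.near z) (𝓝 f) := by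
  have hT := D.T_pos
  have hR := D.R_pos
  obtain ⟨t₁, t₂, r₁, r₂, δ, a1, a2, a3, a4, a5, a6, a7, a8, hδ, hbox⟩ := exists_box hz
  obtain ⟨C, hC, H⟩ := Q.exists_pot_lipschitz a1 a2 a3 a4 a5 a6
  have htb := Q.tendsto_tidx (t := D.T / 2) ⟨by linarith, by linarith⟩
  have hlb := Q.tendsto_lidx (r := 0) ⟨by linarith, by linarith⟩
  refine Q.exists_limit (openRect_subset hz) (M := C * ((t₂ - t₁) + (r₂ - r₁)) + 1) ?_
    fun ε hε => ?_
  · refine Q.eventually_near.2 ⟨δ, hδ, ?_⟩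
    filter_upwards [H 1 one_pos, htb.eventually (Ioo_mem_nhds a7 a8),
      hlb.eventually (Ioo_mem_nhds a4 a5)] with n hn hnt hnl i j hd h1 h2
    obtain ⟨b1, b2⟩ := hbox _ _ h1 h2
    have hbd : (n, Q.tidx (D.T / 2) n, Q.lidx 0 n) ∈ Q.dom :=
      ⟨(Q.tidx_mem ⟨by linarith, by linarith⟩ n).1, (Q.tidx_mem ⟨by linarith, by linarith⟩ n).2,
        Q.lidx_lt _ n⟩
    have := hn i _ j _ hd hbd b1 (Ioo_subset_Icc_self hnt) b2 (Ioo_subset_Icc_self hnl)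
    rw [pot_base, sub_zero] at this
    refine this.trans ?_
    have c1 := abs_sub_le_of_le_of_le b1.1 b1.2 hnt.1.le hnt.2.le
    have c2 := abs_sub_le_of_le_of_le b2.1 b2.2 hnl.1.le hnl.2.le
    gcongr
    · exact c1
    · exact c2
  · set δ' := min δ (ε / (8 * C))
    have hδ' : 0 < δ' := lt_min hδ (by positivity)
    have e1 : δ' ≤ δ := min_le_left _ _
    have e2 : C * δ' ≤ ε / 8 := by
      calc C * δ' ≤ C * (ε / (8 * C)) := by gcongr; exact min_le_right _ _
        _ = ε / 8 := by field_simp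
    have ev : ∀ᶠ a in Q.near z, a ∈ Q.dom ∧ |Q.tm a - z.1| < δ' ∧ |Q.lb a - z.2| < δ' ∧
        ∀ i i' j j', (a.1, i, j) ∈ Q.dom →
      (a.1, i', j') ∈ Q.dom → Q.tm (a.1, i, j) ∈ Icc t₁ t₂ → Q.tm (a.1, i', j') ∈ Icc t₁ t₂ →
      Q.lb (a.1, i, j) ∈ Icc r₁ r₂ → Q.lb (a.1, i', j') ∈ Icc r₁ r₂ →
      |Q.pot (a.1, i, j) - Q.pot (a.1, i', j')| ≤
        C * (|Q.tm (a.1, i, j) - Q.tm (a.1, i', j')| + |Q.lb (a.1, i, j) - Q.lb (a.1, i', j')|) +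
          ε / 4 := by
      refine Q.eventually_near.2 ⟨δ', hδ', ?_⟩
      filter_upwards [H (ε / 4) (by positivity)] with n hn i j hd h1 h2
      exact ⟨hd, h1, h2, hn⟩
    refine ⟨_, ev, ?_⟩
    rintro ⟨n, i, j⟩ ⟨ha, h1, h2, h3⟩ ⟨n', i', j'⟩ ⟨hb, h1', h2', -⟩ hnn
    simp only at hnn
    subst hnn
    obtain ⟨b1, b2⟩ := hbox _ _ (h1.trans_le e1) (h2.trans_le e1)
    obtain ⟨b1', b2'⟩ := hbox _ _ (h1'.trans_le e1) (h2'.trans_le e1)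
    refine (h3 i i' j j' ha hb b1 b1' b2 b2').trans ?_
    have k1 : |Q.tm (n, i, j) - Q.tm (n, i', j')| ≤ 2 * δ' := by
      rw [abs_lt] at h1 h1'; rw [abs_le]; constructor <;> linarith [h1.1, h1.2, h1'.1, h1'.2]
    have k2 : |Q.lb (n, i, j) - Q.lb (n, i', j')| ≤ 2 * δ' := by
      rw [abs_lt] at h2 h2'; rw [abs_le]; constructor <;> linarith [h2.1, h2.2, h2'.1, h2'.2]
    calc _ ≤ C * (2 * δ' + 2 * δ') + ε / 4 := by gcongr
      _ ≤ ε := by linarith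

/-- The limit potential. -/
noncomputable def potMap (t r : ℝ) : ℝ := limUnder (Q.near (t, r)) Q.pot

theorem tendsto_pot {z : ℝ × ℝ} (hz : z ∈ openRect D) :
    Tendsto Q.pot (Q.near z) (𝓝 (Q.potMap z.1 z.2)) := by
  have := Q.near_neBot (openRect_subset hz)
  exact tendsto_nhds_limUnder (Q.exists_limit_pot hz)

theorem hasDerivAt_potMap_label {t r : ℝ} (hz : (t, r) ∈ openRect D) :
    HasDerivAt (Q.potMap t) (-(Q.velMap t r * Q.jac t r)) r := by
  have hrg := Q.tendsto_rgt (z := (t, r)) hz.2.2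
  refine Q.hasDerivAt_label (Ioo_subset_Icc_self hz.1) hz.2
    (fun r' hr' => Q.tendsto_pot (z := (t, r')) ⟨hz.1, hr'⟩) (Q.tendsto_mom hz).neg ?_
  filter_upwards [Q.eventually_dom (t, r), hrg.eventually (Q.eventually_dom (t, r))] with a ha hb
  have := Q.momentum_eq (n := a.1) ha.1 ha.2.1 hb.2.2
  have e := Q.pot_rgt_sub (n := a.1) (i := a.2.1) (j := a.2.2)
  rw [this] at e
  have e' : Q.pot (rgt a) - Q.pot a = -((Q.lb (rgt a) - Q.lb a) * Q.mom a) := e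
  rw [e']
  ring

theorem hasDerivAt_potMap_time {t r : ℝ} (hz : (t, r) ∈ openRect D) :
    HasDerivAt (fun s => Q.potMap s r)
      (-(Q.velMap t r ^ 2 / 2 + Q.specMap t r ^ (-D.θ))) t := by
  obtain ⟨t₁, t₂, r₁, r₂, δ, a1, a2, a3, a4, a5, a6, a7, a8, hδ, hbox⟩ := exists_box hz
  refine Q.hasDerivAt_time hz.1 (Ioo_subset_Icc_self hz.2)
    (fun t' ht' => Q.tendsto_pot (z := (t', r)) ⟨ht', hz.2⟩) (Q.tendsto_act hz).neg
    ⟨δ, hδ, fun ε hε => ?_⟩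
  filter_upwards [Q.eventually_pot_time a1 a2 a3 a4 a5 a6 hε] with n hn i' i'' j hij hd hd' h1 h2 h3
  exact hn i' i'' j hij hd hd' (hbox _ _ h1 h3).1 (hbox _ _ h2 h3).1 (hbox _ _ h1 h3).2

end FlowSeq

theorem abs_sub_le_of_geometric {w : ℝ → ℝ} {C ϑ₀ : ℝ} (hC : 0 ≤ C)
    (h : ∀ ϑ ϑ', 0 < ϑ → ϑ < ϑ₀ → 63 / 64 * ϑ ≤ ϑ' → ϑ' ≤ ϑ → |w ϑ' - w ϑ| ≤ C * ϑ)
    {ϑ ϑ' : ℝ} (h0 : 0 < ϑ') (h1 : ϑ' ≤ ϑ) (h2 : ϑ < ϑ₀) : |w ϑ' - w ϑ| ≤ 64 * C * ϑ := by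
  have key : ∀ k : ℕ, ∀ ϑ, 0 < ϑ → ϑ < ϑ₀ → (63 / 64) ^ k * ϑ ≤ ϑ' → ϑ' ≤ ϑ →
      |w ϑ' - w ϑ| ≤ 64 * C * ϑ := by
    intro k
    induction k with
    | zero =>
      intro ϑ hϑ _ h3 h4
      rw [pow_zero, one_mul] at h3
      rw [le_antisymm h4 h3, sub_self, abs_zero]
      positivity
    | succ k ih =>
      intro ϑ hϑ h2 h3 h4
      have hCϑ : 0 ≤ C * ϑ := by positivity
      rcases le_total (63 / 64 * ϑ) ϑ' with h' | h'
      · exact (h ϑ ϑ' hϑ h2 h' h4).trans (by linarith)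
      · have a1 := ih (63 / 64 * ϑ) (by positivity) (by linarith)
          (by rw [pow_succ, mul_assoc] at h3; exact h3) h'
        have a2 := h ϑ (63 / 64 * ϑ) hϑ h2 le_rfl (by linarith)
        exact (abs_sub_le _ (w (63 / 64 * ϑ)) _).trans (by linarith)
  have hϑ : 0 < ϑ := h0.trans_le h1
  obtain ⟨k, hk⟩ := exists_pow_lt_of_lt_one (div_pos h0 hϑ) (show (63 / 64 : ℝ) < 1 by norm_num)
  rw [lt_div_iff₀ hϑ] at hk
  exact key k ϑ hϑ h2 hk.le h1

namespace FlowSeq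

variable {D : Data} (Q : FlowSeq D)

theorem exists_velMap_osc {τ : ℝ} (hτ : 0 < τ) : ∃ C ϑ₀ : ℝ, 0 ≤ C ∧ 0 < ϑ₀ ∧ ∀ t r r' : ℝ,
    2 * τ ≤ t → t ≤ D.T - τ → r ∈ Ioo (-D.R) D.R → r' ∈ Ioo (-D.R) D.R →
    min (angle D r) (Real.pi - angle D r) < ϑ₀ →
    |angle D r' - angle D r| ≤ min (angle D r) (Real.pi - angle D r) / 64 →
    |Q.velMap t r' - Q.velMap t r| ≤ C * min (angle D r) (Real.pi - angle D r) := by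
  obtain ⟨C, hC, H⟩ := Q.exists_osc_le hτ
  have hT := D.T_pos
  refine ⟨Real.sqrt C, τ / D.T, Real.sqrt_nonneg _, by positivity, fun t r r' h1 h2 hr hr' h3 h4 => ?_⟩
  have ha := angle_mem hr
  set ϑ := min (angle D r) (Real.pi - angle D r) with hϑ
  have hϑ0 : 0 < ϑ := lt_min ha.1 (by linarith [ha.2])
  have hϑ1 : ϑ ≤ angle D r := min_le_left _ _
  have hϑ2 : ϑ ≤ Real.pi - angle D r := min_le_right _ _
  have hT3 : D.T * (ϑ / 2) ≤ τ / 2 := by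
    rw [lt_div_iff₀ hT] at h3; linarith
  have hz : (t, r) ∈ openRect D := ⟨⟨by linarith, by linarith⟩, hr⟩
  have hz' : (t, r') ∈ openRect D := ⟨⟨by linarith, by linarith⟩, hr'⟩
  obtain ⟨s', hs', s, hs, K⟩ := H t r (ϑ / 2) 1 h1 h2 hr (by positivity) (by linarith) (by linarith)
    hT3 t r' (by rw [sub_self, abs_zero]; positivity) (by linarith)
  have c := Q.tendsto_idx (openRect_subset hz)
  have c' := Q.tendsto_idx (openRect_subset hz')
  have lim := ((((Q.tendsto_ve hz').comp c').sub ((Q.tendsto_ve hz).comp c)).pow 2)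
  have key : (Q.velMap t r' - Q.velMap t r) ^ 2 ≤ C * ϑ ^ 2 := by
    refine le_of_tendsto lim ?_
    filter_upwards [c'.eventually hs', c.eventually hs] with n hn' hn
    have := (K _ hn' _ hn rfl).2
    rw [Nat.cast_one, mul_one] at this
    exact this
  refine abs_le_of_sq_le_sq ?_ (by positivity)
  rw [mul_pow, Real.sq_sqrt hC.le]
  exact key

theorem angle_cos {s ϑ : ℝ} (hs : s = 1 ∨ s = -1) (h0 : 0 ≤ ϑ) (h1 : ϑ ≤ Real.pi / 2) :
    (angle D (s * D.R * Real.cos ϑ) = ϑ ∧ s = -1) ∨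
      (angle D (s * D.R * Real.cos ϑ) = Real.pi - ϑ ∧ s = 1) := by
  have hR := D.R_pos
  have hp := Real.pi_pos
  rcases hs with rfl | rfl
  · right
    refine ⟨?_, rfl⟩
    rw [angle, show -(1 * D.R * Real.cos ϑ) / D.R = -Real.cos ϑ by field_simp, Real.arccos_neg,
      Real.arccos_cos h0 (by linarith)]
  · left
    refine ⟨?_, rfl⟩
    rw [angle, show -(-1 * D.R * Real.cos ϑ) / D.R = Real.cos ϑ by field_simp,
      Real.arccos_cos h0 (by linarith)]

theorem cos_label_mem {s ϑ : ℝ} (hs : s = 1 ∨ s = -1) (h0 : 0 < ϑ) (h1 : ϑ ≤ Real.pi / 2) :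
    s * D.R * Real.cos ϑ ∈ Ioo (-D.R) D.R := by
  have hR := D.R_pos
  have hp := Real.pi_pos
  have c1 : Real.cos ϑ < 1 := by
    rw [← Real.cos_zero]
    exact Real.cos_lt_cos_of_nonneg_of_le_pi_div_two le_rfl h1 h0
  have c0 : 0 ≤ Real.cos ϑ := Real.cos_nonneg_of_mem_Icc ⟨by linarith, h1⟩
  rcases hs with rfl | rfl <;> constructor <;> nlinarith

theorem exists_velMap_edge_osc {τ : ℝ} (hτ : 0 < τ) {s : ℝ} (hs : s = 1 ∨ s = -1) :
    ∃ C ϑ₀ : ℝ, 0 ≤ C ∧ 0 < ϑ₀ ∧ ϑ₀ ≤ Real.pi / 2 ∧ ∀ t ϑ ϑ' : ℝ,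
      2 * τ ≤ t → t ≤ D.T - τ → 0 < ϑ' → ϑ' ≤ ϑ → ϑ < ϑ₀ →
      |Q.velMap t (s * D.R * Real.cos ϑ') - Q.velMap t (s * D.R * Real.cos ϑ)| ≤ C * ϑ := by
  obtain ⟨C, ϑ₀, hC, hϑ₀, H⟩ := Q.exists_velMap_osc hτ
  have hp := Real.pi_pos
  refine ⟨64 * C, min ϑ₀ (Real.pi / 2), by positivity, lt_min hϑ₀ (by positivity), min_le_right _ _,
    fun t ϑ ϑ' h1 h2 h3 h4 h5 => ?_⟩
  refine abs_sub_le_of_geometric (w := fun ϑ => Q.velMap t (s * D.R * Real.cos ϑ)) hC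
    (fun ϑ ϑ' a1 a2 a3 a4 => ?_) h3 h4 h5
  have b1 := a2.trans_le (min_le_left _ _)
  have b2 := a2.trans_le (min_le_right _ _)
  have m : min (angle D (s * D.R * Real.cos ϑ)) (Real.pi - angle D (s * D.R * Real.cos ϑ)) = ϑ := by
    rcases angle_cos (D := D) hs a1.le b2.le with h | h <;> rw [h.1]
    · exact min_eq_left (by linarith)
    · rw [sub_sub_cancel]; exact min_eq_right (by linarith)
  have d : |angle D (s * D.R * Real.cos ϑ') - angle D (s * D.R * Real.cos ϑ)| ≤ ϑ / 64 := by
    rcases angle_cos (D := D) hs a1.le b2.le with h | h <;>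
      rcases angle_cos (D := D) hs (ϑ := ϑ') (by linarith) (by linarith) with h' | h'
    · rw [h.1, h'.1, abs_le]; constructor <;> linarith
    · have := h.2.symm.trans h'.2; norm_num at this
    · have := h.2.symm.trans h'.2; norm_num at this
    · rw [h.1, h'.1, abs_le]; constructor <;> linarith
  have := H t (s * D.R * Real.cos ϑ) (s * D.R * Real.cos ϑ') h1 h2 (cos_label_mem hs a1 b2.le)
    (cos_label_mem hs (by linarith) (by linarith)) (by rw [m]; exact b1) (by rw [m]; exact d)
  rwa [m] at this

/-- The strip of times and labels, edges included. -/
def strip (D : Data) : Set (ℝ × ℝ) := Ioo 0 D.T ×ˢ Icc (-D.R) D.R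

theorem strip_subset_closure : strip D ⊆ closure (openRect D) := by
  have hR := D.R_pos
  rw [openRect, closure_prod_eq, closure_Ioo (by linarith : -D.R ≠ D.R)]
  exact prod_mono subset_closure subset_rfl

theorem exists_velMap_limit_edge {t s : ℝ} (ht : t ∈ Ioo 0 D.T) (hs : s = 1 ∨ s = -1) :
    ∃ y, Tendsto (fun z : ℝ × ℝ => Q.velMap z.1 z.2) (𝓝[openRect D] (t, s * D.R)) (𝓝 y) := by
  have hR := D.R_pos
  have hp := Real.pi_pos
  set τ := min (t / 4) ((D.T - t) / 2)
  have hτ : 0 < τ := lt_min (by linarith [ht.1]) (by linarith [ht.2])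
  have hτ1 : τ ≤ t / 4 := min_le_left _ _
  have hτ2 : τ ≤ (D.T - t) / 2 := min_le_right _ _
  obtain ⟨C, ϑ₀, hC, hϑ₀, hϑp, H⟩ := Q.exists_velMap_edge_osc hτ hs
  have hmem : (t, s * D.R) ∈ strip D := ⟨ht, by rcases hs with rfl | rfl <;> constructor <;> linarith⟩
  have : (𝓝[openRect D] (t, s * D.R)).NeBot :=
    mem_closure_iff_nhdsWithin_neBot.1 (strip_subset_closure hmem)
  refine cauchy_map_iff_exists_tendsto.1 (Metric.cauchy_iff.2 ⟨inferInstance, fun ε hε => ?_⟩)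
  set ϑ := min (ϑ₀ / 2) (ε / (8 * (C + 1)))
  have hϑ : 0 < ϑ := lt_min (by positivity) (by positivity)
  have hϑ1 : ϑ < ϑ₀ := (min_le_left _ _).trans_lt (by linarith)
  have hϑ2 : C * ϑ ≤ ε / 8 := by
    calc C * ϑ ≤ (C + 1) * (ε / (8 * (C + 1))) := by
          gcongr
          · linarith
          · exact min_le_right _ _
      _ = ε / 8 := by field_simp
  set ρ := s * D.R * Real.cos ϑ with hρ
  have hρm : ρ ∈ Ioo (-D.R) D.R := cos_label_mem hs hϑ (by linarith)
  have hcont : ContinuousAt (fun t => Q.velMap t ρ) t := by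
    have h1 : ContinuousAt (fun z : ℝ × ℝ => Q.velMap z.1 z.2) (t, ρ) :=
      Q.continuousOn_velMap.continuousAt ((isOpen_Ioo.prod isOpen_Ioo).mem_nhds ⟨ht, hρm⟩)
    exact h1.comp (f := fun t => (t, ρ)) (by fun_prop)
  have e1 : ∀ᶠ z : ℝ × ℝ in 𝓝 (t, s * D.R), |Q.velMap z.1 ρ - Q.velMap t ρ| < ε / 8 := by
    have := (hcont.comp_of_eq (f := Prod.fst) (x := (t, s * D.R)) continuousAt_fst rfl)
    exact Metric.tendsto_nhds.1 this (ε / 8) (by positivity)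
  have e2 : ∀ᶠ z : ℝ × ℝ in 𝓝 (t, s * D.R), 2 * τ < z.1 ∧ z.1 < D.T - τ ∧
      D.R * Real.cos ϑ < s * z.2 := by
    have c1 : Real.cos ϑ < 1 := by
      rw [← Real.cos_zero]
      exact Real.cos_lt_cos_of_nonneg_of_le_pi_div_two le_rfl (by linarith) hϑ
    have c2 : D.R * Real.cos ϑ < s * (s * D.R) := by
      rcases hs with rfl | rfl <;> nlinarith
    exact (continuousAt_fst.eventually (lt_mem_nhds (show 2 * τ < t by linarith))).and
      ((continuousAt_fst.eventually (gt_mem_nhds (show t < D.T - τ by linarith))).and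
      ((continuousAt_snd.const_mul s).eventually (lt_mem_nhds c2)))
  have e3 : ∀ᶠ z : ℝ × ℝ in 𝓝[openRect D] (t, s * D.R),
      |Q.velMap z.1 z.2 - Q.velMap t ρ| < ε / 2 := by
    filter_upwards [mem_nhdsWithin_of_mem_nhds e1, mem_nhdsWithin_of_mem_nhds e2,
      self_mem_nhdsWithin] with z z1 z2 z3
    set ϑ' := Real.arccos (s * z.2 / D.R)
    have u1 : s * z.2 / D.R < 1 := by
      rw [div_lt_one hR]; rcases hs with rfl | rfl <;> linarith [z3.2.1, z3.2.2]
    have u2 : Real.cos ϑ < s * z.2 / D.R := by rw [lt_div_iff₀ hR]; linarith [z2.2.2]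
    have u3 : ϑ' ≤ ϑ := by
      rw [← Real.arccos_cos hϑ.le (by linarith)]
      exact Real.arccos_le_arccos u2.le
    have u4 : 0 < ϑ' := Real.arccos_pos.2 u1
    have u5 : s * D.R * Real.cos ϑ' = z.2 := by
      rw [Real.cos_arccos (by linarith [Real.neg_one_le_cos ϑ]) u1.le]
      rcases hs with rfl | rfl <;> field_simp
    have := H z.1 ϑ ϑ' z2.1.le z2.2.1.le u4 u3 hϑ1
    rw [u5] at this
    exact (abs_sub_le _ (Q.velMap z.1 ρ) _).trans_lt (by linarith)
  refine ⟨_, image_mem_map e3, ?_⟩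
  rintro _ ⟨z, hz, rfl⟩ _ ⟨z', hz', rfl⟩
  simp only [mem_ofPred_eq] at hz hz'
  rw [Real.dist_eq]
  rw [abs_lt] at *
  constructor <;> linarith [hz.1, hz.2, hz'.1, hz'.2]

/-- The limit velocity, extended to the edges. -/
noncomputable def velExt (z : ℝ × ℝ) : ℝ :=
  extendFrom (openRect D) (fun z : ℝ × ℝ => Q.velMap z.1 z.2) z

theorem continuousOn_velExt : ContinuousOn Q.velExt (strip D) := by
  refine continuousOn_extendFrom strip_subset_closure fun z hz => ?_
  obtain ⟨ht, h1, h2⟩ := hz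
  rcases h1.eq_or_lt with h1 | h1
  · have := Q.exists_velMap_limit_edge ht (s := -1) (Or.inr rfl)
    rw [neg_one_mul, h1] at this
    exact this
  rcases h2.eq_or_lt with h2 | h2
  · have := Q.exists_velMap_limit_edge ht (s := 1) (Or.inl rfl)
    rw [one_mul, ← h2] at this
    exact this
  · exact ⟨_, Q.continuousOn_velMap z ⟨ht, h1, h2⟩⟩

theorem velExt_eq {t r : ℝ} (hz : (t, r) ∈ openRect D) : Q.velExt (t, r) = Q.velMap t r :=
  extendFrom_eq (subset_closure hz) (Q.continuousOn_velMap _ hz)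

theorem hasDerivAt_flowMap_time_ext {t r : ℝ} (hz : (t, r) ∈ strip D) :
    HasDerivAt (fun s => Q.flowMap s r) (Q.velExt (t, r)) t := by
  have hR := D.R_pos
  refine hasDerivAt_of_two_point fun ε hε => ?_
  obtain ⟨δ, hδ, H⟩ := Metric.continuousWithinAt_iff.1 (Q.continuousOn_velExt _ hz) ε hε
  obtain ⟨δ', hδ', hsub⟩ := Metric.isOpen_iff.1 isOpen_Ioo t hz.1
  refine ⟨min δ δ', lt_min hδ hδ', fun x y hx hy hxy => ?_⟩
  have hball : ∀ s ∈ Icc x y, |s - t| < min δ δ' := fun s hs => by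
    rw [abs_lt] at *; constructor <;> linarith [hs.1, hs.2]
  have hT : ∀ s ∈ Icc x y, s ∈ Ioo 0 D.T := fun s hs => hsub ((hball s hs).trans_le (min_le_right _ _))
  have hx' := hT x (left_mem_Icc.2 hxy.le)
  have hy' := hT y (right_mem_Icc.2 hxy.le)
  have lim : ∀ s ∈ Ioo 0 D.T, Tendsto (fun r' => Q.flowMap s r') (𝓝[Ioo (-D.R) D.R] r)
      (𝓝 (Q.flowMap s r)) := by
    intro s hs
    have h1 := Q.continuousOn_flowMap (s, r) ⟨Ioo_subset_Icc_self hs, hz.2⟩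
    refine h1.tendsto.comp (f := fun r' => (s, r')) (tendsto_nhdsWithin_iff.2 ⟨?_, ?_⟩)
    · exact Continuous.tendsto' (by fun_prop) _ _ rfl |>.mono_left nhdsWithin_le_nhds
    · filter_upwards [self_mem_nhdsWithin] with r' hr'
      exact ⟨Ioo_subset_Icc_self hs, Ioo_subset_Icc_self hr'⟩
  have : (𝓝[Ioo (-D.R) D.R] r).NeBot := by
    refine mem_closure_iff_nhdsWithin_neBot.1 ?_
    rw [closure_Ioo (by linarith)]; exact hz.2
  refine le_of_tendsto ((((lim y hy').sub (lim x hx')).sub_const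
    (Q.velExt (t, r) * (y - x))).abs) ?_
  filter_upwards [self_mem_nhdsWithin, mem_nhdsWithin_of_mem_nhds (Metric.ball_mem_nhds r hδ)]
    with r' hr' hrr
  have hd : ∀ s ∈ Icc x y, HasDerivWithinAt (fun s => Q.flowMap s r' - Q.velExt (t, r) * s)
      (Q.velMap s r' - Q.velExt (t, r)) (Icc x y) s := fun s hs => by
    have h1 := (Q.hasDerivAt_flowMap_time (t := s) (r := r') ⟨hT s hs, hr'⟩).sub
      ((hasDerivAt_id s).const_mul (Q.velExt (t, r)))
    rw [mul_one] at h1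
    exact h1.hasDerivWithinAt
  have hb : ∀ s ∈ Icc x y, ‖Q.velMap s r' - Q.velExt (t, r)‖ ≤ ε := fun s hs => by
    have h1 : (s, r') ∈ openRect D := ⟨hT s hs, hr'⟩
    rw [← Q.velExt_eq h1, ← dist_eq_norm]
    refine (H (x := (s, r')) ⟨h1.1, Ioo_subset_Icc_self hr'⟩ ?_).le
    rw [Prod.dist_eq, Real.dist_eq, Real.dist_eq]
    exact max_lt ((hball s hs).trans_le (min_le_left _ _)) hrr
  have := (convex_Icc x y).norm_image_sub_le_of_norm_hasDerivWithin_le hd hb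
    (left_mem_Icc.2 hxy.le) (right_mem_Icc.2 hxy.le)
  rw [Real.norm_eq_abs, Real.norm_eq_abs, abs_of_pos (sub_pos.2 hxy)] at this
  refine le_trans (le_of_eq ?_) this
  congr 1
  ring

end FlowSeq

theorem three_point_of_second_diff_nonpos {y : ℕ → ℝ} {i₀ N : ℕ}
    (h : ∀ i, i₀ ≤ i → i + 2 ≤ N → y (i + 2) - 2 * y (i + 1) + y i ≤ 0) {i j k : ℕ} (hi : i₀ ≤ i)
    (hij : i ≤ j) (hjk : j ≤ k) (hk : k ≤ N) :
    ((k : ℝ) - j) * (y j - y i) ≥ (j - i) * (y k - y j) := by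
  rcases hjk.eq_or_lt with rfl | hjk'
  · simp
  have d1 : ∀ m, j + m + 1 ≤ N → y (j + m + 1) - y (j + m) ≤ y (j + 1) - y j := by
    intro m
    induction m with
    | zero => intro _; exact le_rfl
    | succ m ih =>
      intro hm
      have := h (j + m) (by omega) (by omega)
      have := ih (by omega)
      rw [show j + (m + 1) + 1 = j + m + 2 by ring, show j + (m + 1) = j + m + 1 by ring]
      linarith
  have d2 : ∀ m, j + m ≤ N → y (j + m) - y j ≤ m * (y (j + 1) - y j) := by
    intro m
    induction m with
    | zero => intro _; simp
    | succ m ih =>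
      intro hm
      have := d1 m hm
      have := ih (by omega)
      rw [← add_assoc]
      push_cast
      linarith
  have d3 : ∀ m l, l + m = j → i₀ ≤ l → y (j + 1) - y j ≤ y (l + 1) - y l ∧
      (m : ℝ) * (y (j + 1) - y j) ≤ y j - y l := by
    intro m
    induction m with
    | zero => rintro l rfl _; simp
    | succ m ih =>
      intro l hl h0
      have a := h l h0 (by omega)
      obtain ⟨b, c⟩ := ih (l + 1) (by omega) (by omega)
      rw [show l + 1 + 1 = l + 2 by ring] at b
      push_cast
      constructor <;> linarith
  have e2 := d2 (k - j) (by omega)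
  have e3 := (d3 (j - i) i (by omega) hi).2
  rw [Nat.add_sub_cancel' hjk, Nat.cast_sub hjk] at e2
  rw [Nat.cast_sub hij] at e3
  have f1 : (0 : ℝ) ≤ k - j := by rw [sub_nonneg]; exact_mod_cast hjk
  have f2 : (0 : ℝ) ≤ j - i := by rw [sub_nonneg]; exact_mod_cast hij
  have g1 := mul_le_mul_of_nonneg_left e2 f2
  have g2 := mul_le_mul_of_nonneg_left e3 f1
  linarith

namespace Data

variable {D : Data} {N i₀ : ℕ} {P X : ℕ → ℕ → ℝ}

theorem DiscreteFlow.edge_second_diff (h : D.DiscreteFlow N i₀ P X) {i j : ℕ} {s : ℝ}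
    (hs : s = 1 ∧ j + 1 = 2 * N ∨ s = -1 ∧ j = 0) (hl : D.R / 2 ≤ s * D.lab N j) (hi : i₀ ≤ i)
    (hiN : i + 2 ≤ N) :
    s * (X (i + 2) j - 2 * X (i + 1) j + X i j) ≤
      -(D.κ * (D.R / 2) * D.upper D.T ^ (-D.e) * D.dt N ^ 2) := by
  have hN := h.N_pos
  have hj : j < 2 * N := by rcases hs with h | h <;> omega
  have hd := Data.dt_pos (D := D) hN
  have hμ := D.μ_pos hN hj
  have hκ := D.κ_pos
  have hR := D.R_pos
  have hU := Real.rpow_pos_of_pos (D.upper_pos D.T_pos) (-D.e)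
  have ht0 : 0 < ((i + 1 : ℕ) : ℝ) * D.dt N := by positivity
  have htT : ((i + 1 : ℕ) : ℝ) * D.dt N ≤ D.T := by
    rw [← Data.N_mul_dt (D := D) hN]
    have : ((i + 1 : ℕ) : ℝ) ≤ N := by exact_mod_cast (by omega : i + 1 ≤ N)
    gcongr
  have hP : ∀ l, D.upper D.T ^ (-D.e) ≤ P (i + 1) l ^ (-D.e) := fun l => by
    have b := h.bounds (i + 1) l (by omega) (by omega)
    exact Real.rpow_le_rpow_of_nonpos ((D.lower_pos ht0 htT).trans_le b.1)
      (b.2.trans (D.upper_mono ht0.le htT)) (by linarith [D.e_pos])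
  have hE := h.eqn i j hi hiN hj
  have hm := D.μ_mul_lab hN j
  have key : ∃ l, (X (i + 2) j - 2 * X (i + 1) j + X i j) =
      -(D.κ * D.lab N j * P (i + 1) l ^ (-D.e) * D.dt N ^ 2) := by
    rcases hs with ⟨-, hj1⟩ | ⟨-, rfl⟩
    · rw [hj1, β_two_mul hN] at hE hm
      refine ⟨j, ?_⟩
      rw [sub_zero] at hm
      rw [← hm, div_eq_iff (by positivity)] at hE
      refine mul_left_cancel₀ hμ.ne' (hE.trans (by ring))
    · rw [β_zero] at hE hm
      refine ⟨1, ?_⟩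
      rw [div_eq_iff (by positivity)] at hE
      refine mul_left_cancel₀ hμ.ne' (hE.trans ?_)
      linear_combination (P (i + 1) 1 ^ (-D.e) * D.dt N ^ 2) * hm
  obtain ⟨l, e⟩ := key
  rw [e]
  have : D.κ * (D.R / 2) * D.upper D.T ^ (-D.e) * D.dt N ^ 2 ≤
      D.κ * (s * D.lab N j) * P (i + 1) l ^ (-D.e) * D.dt N ^ 2 := by
    have := hP l
    have : 0 ≤ D.κ * (s * D.lab N j) := mul_nonneg hκ.le (by linarith)
    gcongr
  linarith

end Data

namespace FlowSeq

variable {D : Data} (Q : FlowSeq D)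

theorem lidx_edge {s : ℝ} (hs : s = 1 ∨ s = -1) (n : ℕ) :
    s = 1 ∧ Q.lidx (s * D.R) n + 1 = 2 * Q.N n ∨ s = -1 ∧ Q.lidx (s * D.R) n = 0 := by
  have hR := D.R_pos
  have hN := Q.N_pos n
  have hN' : (0 : ℝ) < Q.N n := by exact_mod_cast hN
  unfold lidx
  rcases hs with rfl | rfl
  · refine Or.inl ⟨rfl, ?_⟩
    have e : Real.pi / (Real.pi / (2 * (Q.N n : ℝ))) = ((2 * Q.N n : ℕ) : ℝ) := by
      have := Real.pi_ne_zero
      push_cast; field_simp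
    rw [one_mul, neg_div, div_self hR.ne', Real.arccos_neg_one, e, Nat.floor_natCast]
    omega
  · refine Or.inr ⟨rfl, ?_⟩
    rw [neg_one_mul, neg_neg, div_self hR.ne', Real.arccos_one]
    simp

theorem edge_mem {s : ℝ} (hs : s = 1 ∨ s = -1) : s * D.R ∈ Icc (-D.R) D.R := by
  have := D.R_pos
  rcases hs with rfl | rfl <;> constructor <;> linarith

theorem exists_concaveOn_edge {s : ℝ} (hs : s = 1 ∨ s = -1) : ∃ c > 0,
    ConcaveOn ℝ (Icc 0 D.T) (fun t => s * Q.flowMap t (s * D.R) + c / 2 * t ^ 2) := by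
  have hR := D.R_pos
  have hκ := D.κ_pos
  have hss : s * s = 1 := by rcases hs with rfl | rfl <;> norm_num
  refine ⟨D.κ * (D.R / 2) * D.upper D.T ^ (-D.e),
    mul_pos (by positivity) (Real.rpow_pos_of_pos (D.upper_pos D.T_pos) _), ?_⟩
  set c := D.κ * (D.R / 2) * D.upper D.T ^ (-D.e) with hc
  set r := s * D.R
  have hr : r ∈ Icc (-D.R) D.R := edge_mem hs
  set y : ℕ → ℕ → ℝ := fun n i => s * Q.X n i (Q.lidx r n) + c / 2 * (i * D.dt (Q.N n)) ^ 2 with hy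
  set f : ℝ → ℝ := fun t => s * Q.flowMap t r + c / 2 * t ^ 2 with hf
  have lim : ∀ t ∈ Icc 0 D.T, Tendsto (fun n => y n (Q.tidx t n)) (ult : Filter ℕ) (𝓝 (f t)) := by
    intro t ht
    have h1 := (Q.tendsto_x (z := (t, r)) ⟨ht, hr⟩).comp (Q.tendsto_idx ⟨ht, hr⟩)
    exact (h1.const_mul s).add (((Q.tendsto_tidx ht).pow 2).const_mul _)
  have hl : ∀ᶠ n in (ult : Filter ℕ), D.R / 2 ≤ s * D.lab (Q.N n) (Q.lidx r n) := by
    have := (Q.tendsto_lidx hr).const_mul s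
    rw [show s * r = s * s * D.R from (mul_assoc _ _ _).symm, hss, one_mul] at this
    filter_upwards [this.eventually (lt_mem_nhds (half_lt_self hR))] with n hn using hn.le
  have hmono : ∀ {t t' : ℝ} (n), t ≤ t' → Q.tidx t n ≤ Q.tidx t' n := by
    intro t t' n h
    have := Data.dt_pos (D := D) (Q.N_pos n)
    exact max_le_max le_rfl (Nat.floor_mono (by gcongr))
  refine concaveOn_of_slope_anti_adjacent (convex_Icc _ _) ?_
  intro t₁ t₂ t₃ h1 h3 h12 h23
  have h2 : t₂ ∈ Icc 0 D.T := ⟨h1.1.trans h12.le, h23.le.trans h3.2⟩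
  rw [div_le_div_iff₀ (by linarith) (by linarith), mul_comm, mul_comm (f t₂ - f t₁)]
  refine le_of_tendsto_of_tendsto
    (((Q.tendsto_tidx h2).sub (Q.tendsto_tidx h1)).mul ((lim t₃ h3).sub (lim t₂ h2)))
    (((Q.tendsto_tidx h3).sub (Q.tendsto_tidx h2)).mul ((lim t₂ h2).sub (lim t₁ h1))) ?_
  filter_upwards [hl] with n hn
  have hd := Data.dt_pos (D := D) (Q.N_pos n)
  have := three_point_of_second_diff_nonpos (y := y n) (i₀ := Q.i₀ n) (N := Q.N n) ?_
    (Q.tidx_mem h1 n).1 (hmono n h12.le) (hmono n h23.le) (Q.tidx_mem h3 n).2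
  · have := mul_le_mul_of_nonneg_left this hd.le
    linarith
  · intro i hi hiN
    have := (Q.flow n).edge_second_diff (Q.lidx_edge hs n) hn hi hiN
    rw [← hc] at this
    simp only [hy]
    push_cast
    linarith

theorem strictAntiOn_edge {s : ℝ} (hs : s = 1 ∨ s = -1) :
    StrictAntiOn (fun t => s * Q.velExt (t, s * D.R)) (Ioo 0 D.T) := by
  obtain ⟨c, hc, H⟩ := Q.exists_concaveOn_edge hs
  have hd : ∀ t ∈ Ioo 0 D.T, HasDerivAt (fun t => s * Q.flowMap t (s * D.R) + c / 2 * t ^ 2)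
      (s * Q.velExt (t, s * D.R) + c * t) t := by
    intro t ht
    refine (((Q.hasDerivAt_flowMap_time_ext ⟨ht, edge_mem hs⟩).const_mul s).add
      ((hasDerivAt_pow 2 t).const_mul (c / 2))).congr_deriv ?_
    norm_num
    ring
  intro t₁ h1 t₂ h2 h12
  have a := (H.subset Ioo_subset_Icc_self (convex_Ioo _ _)).le_slope_of_hasDerivAt h1 h2 h12 (hd t₂ h2)
  have b := (H.subset Ioo_subset_Icc_self (convex_Ioo _ _)).slope_le_of_hasDerivAt h1 h2 h12 (hd t₁ h1)
  have := mul_lt_mul_of_pos_left h12 hc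
  simp only
  linarith [a.trans b]

end FlowSeq

/-! ### The vacuum region beyond a strictly concave free boundary -/

/-- A strictly concave free boundary `x = γ t` with velocity `w` and boundary value `B` of the
potential. -/
structure Edge (T : ℝ) (γ w B : ℝ → ℝ) : Prop where
  hasDerivAt_pos : ∀ t ∈ Ioo 0 T, HasDerivAt γ (w t) t
  hasDerivAt_val : ∀ t ∈ Ioo 0 T, HasDerivAt B (-(w t ^ 2 / 2)) t
  anti : StrictAntiOn w (Ioo 0 T)
  cont : ContinuousOn w (Ioo 0 T)
  init : Tendsto γ (𝓝[>] 0) (𝓝 0)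
  blowup : Tendsto w (𝓝[>] 0) atTop

/-- The tangent line to the free boundary at time `s`. -/
def rayPt (γ w : ℝ → ℝ) (s t : ℝ) : ℝ := γ s + w s * (t - s)

open Classical in
/-- The time of emission of the tangent line through a point of the vacuum region. -/
noncomputable def emit (γ w : ℝ → ℝ) (z : ℝ × ℝ) : ℝ :=
  if h : ∃ s ∈ Ioc 0 z.1, rayPt γ w s z.1 = z.2 then h.choose else 0

namespace Edge

variable {T : ℝ} {γ w B : ℝ → ℝ}

/-- The vacuum region, with its free boundary. -/
def vac (T : ℝ) (γ : ℝ → ℝ) : Set (ℝ × ℝ) := {z | z.1 ∈ Ioo 0 T ∧ γ z.1 ≤ z.2}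

theorem continuousOn_pos (h : Edge T γ w B) : ContinuousOn γ (Ioo 0 T) := fun t ht =>
  (h.hasDerivAt_pos t ht).continuousAt.continuousWithinAt

theorem continuousOn_val (h : Edge T γ w B) : ContinuousOn B (Ioo 0 T) := fun t ht =>
  (h.hasDerivAt_val t ht).continuousAt.continuousWithinAt

theorem ray_anti (h : Edge T γ w B) {s s' t : ℝ} (hs : 0 < s) (hss : s < s') (hst : s' ≤ t)
    (ht : t < T) : rayPt γ w s' t < rayPt γ w s t := by
  obtain ⟨q, hq, e⟩ := exists_hasDerivAt_eq_slope γ w hss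
    (h.continuousOn_pos.mono fun x hx => ⟨hs.trans_le hx.1, hx.2.trans_lt (hst.trans_lt ht)⟩)
    (fun x hx => h.hasDerivAt_pos x ⟨hs.trans hx.1, hx.2.trans (hst.trans_lt ht)⟩)
  have hT : s' < T := hst.trans_lt ht
  have h1 := h.anti ⟨hs, hss.trans hT⟩ ⟨hs.trans hq.1, hq.2.trans hT⟩ hq.1
  have h2 := h.anti ⟨hs, hss.trans hT⟩ ⟨hs.trans hss, hT⟩ hss
  rw [eq_div_iff (by linarith)] at e
  have h3 : w q * (s' - s) < w s * (s' - s) := by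
    have : 0 < s' - s := by linarith
    gcongr
  have h4 : w s' * (t - s') ≤ w s * (t - s') := by
    have : 0 ≤ t - s' := by linarith
    gcongr
  unfold rayPt
  linarith

theorem exists_emit (h : Edge T γ w B) {t x : ℝ} (hz : (t, x) ∈ vac T γ) :
    ∃ s ∈ Ioc 0 t, rayPt γ w s t = x := by
  obtain ⟨ht, hx⟩ := hz
  have h1 : Tendsto (fun s => γ s + w s * (t - s)) (𝓝[>] 0) atTop := by
    refine tendsto_atTop_add_left_of_le' _ (-1)
      (h.init.eventually (le_mem_nhds (by norm_num : (-1 : ℝ) < 0))) ?_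
    refine h.blowup.atTop_mul_pos (C := t) ht.1 ?_
    have : Tendsto (fun s : ℝ => t - s) (𝓝 0) (𝓝 (t - 0)) := tendsto_const_nhds.sub tendsto_id
    rw [sub_zero] at this
    exact this.mono_left nhdsWithin_le_nhds
  obtain ⟨s, hs, hs'⟩ := ((h1.eventually_ge_atTop x).and
    (Ioo_mem_nhdsGT ht.1 : ∀ᶠ s in 𝓝[>] (0 : ℝ), s ∈ Ioo 0 t)).exists
  have hc : ContinuousOn (fun s => γ s + w s * (t - s)) (Icc s t) := by
    have hsub : Icc s t ⊆ Ioo 0 T := fun y hy => ⟨hs'.1.trans_le hy.1, hy.2.trans_lt ht.2⟩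
    exact (h.continuousOn_pos.mono hsub).add ((h.cont.mono hsub).mul (by fun_prop))
  obtain ⟨y, hy, e⟩ := intermediate_value_Icc' hs'.2.le hc (show x ∈ Icc _ _ from
    ⟨by simpa using hx, hs⟩)
  exact ⟨y, ⟨hs'.1.trans_le hy.1, hy.2⟩, e⟩

theorem emit_spec (h : Edge T γ w B) {t x : ℝ} (hz : (t, x) ∈ vac T γ) :
    emit γ w (t, x) ∈ Ioc 0 t ∧ rayPt γ w (emit γ w (t, x)) t = x := by
  have H := h.exists_emit hz
  rw [emit, dif_pos H]
  exact H.choose_spec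

theorem emit_eq (h : Edge T γ w B) {t s : ℝ} (hs : 0 < s) (hst : s ≤ t) (ht : t < T) :
    (t, rayPt γ w s t) ∈ vac T γ ∧ emit γ w (t, rayPt γ w s t) = s := by
  have hz : (t, rayPt γ w s t) ∈ vac T γ := by
    refine ⟨⟨hs.trans_le hst, ht⟩, ?_⟩
    rcases hst.eq_or_lt with rfl | hlt
    · simp [rayPt]
    · simpa [rayPt] using (h.ray_anti hs hlt le_rfl ht).le
  obtain ⟨h1, h2⟩ := h.emit_spec hz
  refine ⟨hz, ?_⟩
  rcases lt_trichotomy (emit γ w (t, rayPt γ w s t)) s with hlt | he | hlt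
  · exact absurd h2 (h.ray_anti h1.1 hlt hst ht).ne'
  · exact he
  · exact absurd h2 (h.ray_anti hs hlt h1.2 ht).ne

theorem emit_mem (h : Edge T γ w B) {z : ℝ × ℝ} (hz : z ∈ vac T γ) : emit γ w z ∈ Ioo 0 T :=
  ⟨(h.emit_spec hz).1.1, (h.emit_spec hz).1.2.trans_lt hz.1.2⟩

theorem continuousOn_emit (h : Edge T γ w B) : ContinuousOn (emit γ w) (vac T γ) := by
  rintro ⟨t₀, x₀⟩ hz
  obtain ⟨⟨hτ, hτt⟩, he⟩ := h.emit_spec hz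
  have hray : ∀ s, ∀ z : ℝ × ℝ, ContinuousAt (fun z : ℝ × ℝ => rayPt γ w s z.1 - z.2) z :=
    fun s z => by unfold rayPt; fun_prop
  refine tendsto_order.2 ⟨fun a ha => ?_, fun b hb => ?_⟩
  · set a' := max a (emit γ w (t₀, x₀) / 2)
    have ha' : a' < emit γ w (t₀, x₀) := max_lt ha (half_lt_self hτ)
    have ha0 : 0 < a' := (half_pos hτ).trans_le (le_max_right _ _)
    have h1 := h.ray_anti ha0 ha' hτt hz.1.2
    rw [he] at h1
    have ev1 : ∀ᶠ z in 𝓝[vac T γ] (t₀, x₀), 0 < rayPt γ w a' z.1 - z.2 :=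
      ((hray a' (t₀, x₀)).eventually (lt_mem_nhds (by simpa using h1))).filter_mono nhdsWithin_le_nhds
    have ev2 : ∀ᶠ z in 𝓝[vac T γ] (t₀, x₀), a' < z.1 :=
      (continuousAt_fst.eventually (lt_mem_nhds (ha'.trans_le hτt))).filter_mono nhdsWithin_le_nhds
    filter_upwards [ev1, ev2, self_mem_nhdsWithin] with z h1 h2 h3
    refine (le_max_left a _).trans_lt (lt_of_not_ge (a := a') (b := emit γ w z) fun hle => ?_)
    obtain ⟨⟨b1, b2⟩, b3⟩ := h.emit_spec (t := z.1) (x := z.2) h3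
    rcases (show emit γ w (z.1, z.2) ≤ a' from hle).eq_or_lt with he | hlt
    · rw [he] at b3; linarith
    · have := h.ray_anti b1 hlt h2.le h3.1.2
      linarith
  · rcases hτt.eq_or_lt with heq | hlt
    · have ev2 : ∀ᶠ z in 𝓝[vac T γ] (t₀, x₀), z.1 < b :=
        (continuousAt_fst.eventually (gt_mem_nhds (heq ▸ hb))).filter_mono nhdsWithin_le_nhds
      filter_upwards [ev2, self_mem_nhdsWithin] with z h1 h2
      exact (h.emit_spec (t := z.1) (x := z.2) h2).1.2.trans_lt h1
    · obtain ⟨b', hb1, hb2⟩ := exists_between (lt_min hb hlt)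
      rw [lt_min_iff] at hb2
      have h1 := h.ray_anti hτ hb1 hb2.2.le hz.1.2
      rw [he] at h1
      have ev1 : ∀ᶠ z in 𝓝[vac T γ] (t₀, x₀), rayPt γ w b' z.1 - z.2 < 0 :=
        ((hray b' (t₀, x₀)).eventually (gt_mem_nhds (by simpa using h1))).filter_mono
          nhdsWithin_le_nhds
      filter_upwards [ev1, self_mem_nhdsWithin] with z h1 h3
      refine lt_of_lt_of_le (lt_of_not_ge fun hle => ?_) hb2.1.le
      obtain ⟨⟨b1, b2⟩, b3⟩ := h.emit_spec (t := z.1) (x := z.2) h3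
      rcases (show b' ≤ emit γ w (z.1, z.2) from hle).eq_or_lt with he | hlt
      · rw [← he] at b3; linarith
      · have := h.ray_anti (hτ.trans hb1) hlt b2 h3.1.2
        linarith

theorem continuousOn_vel (h : Edge T γ w B) :
    ContinuousOn (fun z => w (emit γ w z)) (vac T γ) :=
  h.cont.comp h.continuousOn_emit fun _ hz => h.emit_mem hz

theorem monotoneOn_of_hasDerivAt {f f' : ℝ → ℝ} {a b : ℝ}
    (hf : ∀ q ∈ Icc a b, HasDerivAt f (f' q) q) (h : ∀ q ∈ Icc a b, 0 ≤ f' q) :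
    MonotoneOn f (Icc a b) :=
  monotoneOn_of_hasDerivWithinAt_nonneg (convex_Icc a b)
    (fun q hq => (hf q hq).continuousAt.continuousWithinAt)
    (fun q hq => (hf q (interior_subset hq)).hasDerivWithinAt) fun q hq => h q (interior_subset hq)

theorem le_affine (h : Edge T γ w B) {s τ t : ℝ} (hs : s ∈ Ioc 0 t) (hτ : τ ∈ Ioc 0 t) (ht : t < T) :
    B τ - w τ ^ 2 / 2 * (t - τ) ≤
      B s - w s * (rayPt γ w τ t - γ s) + w s ^ 2 / 2 * (t - s) := by
  have sub : ∀ {q}, q ∈ Ioc 0 t → q ∈ Ioo 0 T := fun hq => ⟨hq.1, hq.2.trans_lt ht⟩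
  have wle : ∀ {p q}, p ∈ Ioc 0 t → q ∈ Ioc 0 t → p ≤ q → w q ≤ w p := fun hp hq =>
    h.anti.antitoneOn (sub hp) (sub hq)
  rcases le_total s τ with hle | hle
  · have mono : MonotoneOn (fun q => B s - w s * (γ q - γ s) + w s ^ 2 / 2 * (q - s) - B q) (Icc s τ) := by
      have hsub : ∀ q ∈ Icc s τ, q ∈ Ioc 0 t := fun q hq => ⟨hs.1.trans_le hq.1, hq.2.trans hτ.2⟩
      have hd : ∀ q ∈ Icc s τ, HasDerivAt
          (fun q => B s - w s * (γ q - γ s) + w s ^ 2 / 2 * (q - s) - B q)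
          (-(w s * w q) + w s ^ 2 / 2 * 1 - -(w q ^ 2 / 2)) q := fun q hq => by
        have a := h.hasDerivAt_pos q (sub (hsub q hq))
        have b := h.hasDerivAt_val q (sub (hsub q hq))
        exact ((((a.sub_const _).const_mul _).const_sub _).add
          (((hasDerivAt_id q).sub_const _).const_mul _)).sub b
      refine monotoneOn_of_hasDerivAt hd fun q hq => ?_
      linarith [sq_nonneg (w s - w q)]
    have := mono (left_mem_Icc.2 hle) (right_mem_Icc.2 hle) hle
    have h2 : 0 ≤ (t - τ) * (w s - w τ) ^ 2 := mul_nonneg (by linarith [hτ.2]) (sq_nonneg _)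
    simp only [sub_self, mul_zero, sub_zero, add_zero] at this
    unfold rayPt
    linarith
  · have mono : MonotoneOn (fun q => B q + w τ ^ 2 / 2 * (q - τ)
        - w s * (γ τ + w τ * (q - τ) - γ q)) (Icc τ s) := by
      have hsub : ∀ q ∈ Icc τ s, q ∈ Ioc 0 t := fun q hq => ⟨hτ.1.trans_le hq.1, hq.2.trans hs.2⟩
      have hd : ∀ q ∈ Icc τ s, HasDerivAt
          (fun q => B q + w τ ^ 2 / 2 * (q - τ) - w s * (γ τ + w τ * (q - τ) - γ q))
          (-(w q ^ 2 / 2) + w τ ^ 2 / 2 * 1 - w s * (w τ * 1 - w q)) q := fun q hq => by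
        have a := h.hasDerivAt_pos q (sub (hsub q hq))
        have b := h.hasDerivAt_val q (sub (hsub q hq))
        exact (b.add (((hasDerivAt_id q).sub_const _).const_mul _)).sub
          ((((((hasDerivAt_id q).sub_const _).const_mul _).const_add _).sub a).const_mul _)
      refine monotoneOn_of_hasDerivAt hd fun q hq => ?_
      have a1 := wle hτ (hsub q hq) hq.1
      have a2 := wle (hsub q hq) hs hq.2
      have : 0 ≤ (w τ - w q) * ((w τ + w q) / 2 - w s) := mul_nonneg (by linarith) (by linarith)
      linarith
    have := mono (left_mem_Icc.2 hle) (right_mem_Icc.2 hle) hle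
    have h2 : 0 ≤ (t - s) * (w s - w τ) ^ 2 := mul_nonneg (by linarith [hs.2]) (sq_nonneg _)
    simp only [sub_self, mul_zero, sub_zero, add_zero] at this
    unfold rayPt
    linarith

theorem integral_vel (h : Edge T γ w B) {t x : ℝ} (hz : (t, x) ∈ vac T γ) :
    ∫ y in γ t..x, w (emit γ w (t, y)) =
      B t - (B (emit γ w (t, x)) - w (emit γ w (t, x)) ^ 2 / 2 * (t - emit γ w (t, x))) := by
  obtain ⟨ht, hx⟩ := hz
  set E : ℝ → ℝ := fun y => B (emit γ w (t, y)) - w (emit γ w (t, y)) ^ 2 / 2 * (t - emit γ w (t, y))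
    with hE
  have hmaps : MapsTo (fun y : ℝ => (t, y)) (Icc (γ t) x) (vac T γ) := fun y hy => ⟨ht, hy.1⟩
  have hce : ContinuousOn (fun y => emit γ w (t, y)) (Icc (γ t) x) :=
    h.continuousOn_emit.comp (by fun_prop) hmaps
  have hcv : ContinuousOn (fun y => w (emit γ w (t, y))) (Icc (γ t) x) :=
    h.continuousOn_vel.comp (by fun_prop) hmaps
  have hcE : ContinuousOn E (Icc (γ t) x) :=
    (h.continuousOn_val.comp hce fun y hy => h.emit_mem (hmaps hy)).sub
      (((hcv.pow 2).div_const 2).mul (continuousOn_const.sub hce))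
  have two : ∀ y y', γ t ≤ y → γ t ≤ y' → E y' ≤ E y - w (emit γ w (t, y)) * (y' - y) := by
    intro y y' hy hy'
    have s := h.emit_spec (t := t) (x := y) ⟨ht, hy⟩
    have s' := h.emit_spec (t := t) (x := y') ⟨ht, hy'⟩
    have := h.le_affine s.1 s'.1 ht.2
    have e := s.2
    rw [s'.2] at this
    simp only [rayPt] at e
    simp only [hE]
    refine this.trans (le_of_eq ?_)
    linear_combination w (emit γ w (t, y)) * e
  have hd : ∀ y ∈ Ioo (γ t) x, HasDerivAt (fun y => -E y) (w (emit γ w (t, y))) y := by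
    intro y hy
    refine hasDerivAt_of_two_point fun ε hε => ?_
    obtain ⟨δ, hδ, H⟩ := Metric.continuousAt_iff.1 (hcv.continuousAt (Icc_mem_nhds hy.1 hy.2)) ε hε
    refine ⟨min δ (y - γ t), lt_min hδ (by linarith [hy.1]), fun p q hp hq hpq => ?_⟩
    rw [lt_min_iff] at hp hq
    have a1 := H (show dist p y < δ from hp.1)
    have a2 := H (show dist q y < δ from hq.1)
    rw [Real.dist_eq, abs_lt] at a1 a2
    have b1 := two p q (by linarith [(abs_lt.1 hp.2).1]) (by linarith [(abs_lt.1 hq.2).1])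
    have b2 := two q p (by linarith [(abs_lt.1 hq.2).1]) (by linarith [(abs_lt.1 hp.2).1])
    have hpq' : 0 < q - p := by linarith
    have c1 := mul_lt_mul_of_pos_right a1.1 hpq'
    have c2 := mul_lt_mul_of_pos_right a2.2 hpq'
    rw [abs_le]
    constructor <;> linarith
  rw [intervalIntegral.integral_eq_sub_of_hasDerivAt_of_le hx hcE.neg hd
    (hcv.intervalIntegrable_of_Icc hx)]
  have e := (h.emit_eq ht.1 le_rfl ht.2).2
  simp only [rayPt, sub_self, mul_zero, add_zero] at e
  simp only [hE, Pi.neg_apply, e, sub_self, mul_zero, sub_zero]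
  ring

end Edge

/-! ### Transport of one-dimensional densities -/

theorem map_withDensity_eq {p q : ℝ} {φ π h ρ : ℝ → ℝ} (hpq : p < q)
    (hm : StrictMonoOn h (Icc p q)) (hc : ContinuousOn h (Icc p q))
    (hd : ∀ r ∈ Ioo p q, HasDerivAt h (π r) r) (hπ : ∀ r ∈ Ioo p q, 0 < π r)
    (hρ : ∀ r ∈ Ioo p q, ρ (h r) * π r = φ r) (h0 : ∀ x, x ∉ Icc (h p) (h q) → ρ x = 0) :
    Measure.map h ((volume.restrict (Ioo p q)).withDensity fun r => ENNReal.ofReal (φ r)) =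
      volume.withDensity fun x => ENNReal.ofReal (ρ x) := by
  have hae : AEMeasurable h (volume.restrict (Ioo p q)) :=
    (hc.mono Ioo_subset_Icc_self).aemeasurable measurableSet_Ioo
  have him : h '' Ioo p q = Ioo (h p) (h q) := by
    refine Subset.antisymm ?_ (intermediate_value_Ioo hpq.le hc)
    rintro _ ⟨r, hr, rfl⟩
    have hr' := Ioo_subset_Icc_self hr
    exact ⟨hm (left_mem_Icc.2 hpq.le) hr' hr.1, hm hr' (right_mem_Icc.2 hpq.le) hr.2⟩
  ext A hA
  rw [Measure.map_apply_of_aemeasurable (hae.mono_ac (withDensity_absolutelyContinuous _ _)) hA,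
    withDensity_apply' _ _, withDensity_apply _ hA, ← lintegral_indicator hA,
    ← lintegral_indicator₀ (hae.nullMeasurable hA)]
  set g := A.indicator fun x => ENNReal.ofReal (ρ x) with hg
  have e1 : ∫⁻ x, g x = ∫⁻ x in Ioo (h p) (h q), g x := by
    rw [setLIntegral_congr Ioo_ae_eq_Icc, ← lintegral_indicator measurableSet_Icc]
    congr 1
    refine (indicator_eq_self.2 fun x hx => ?_).symm
    by_contra hn
    refine hx ?_
    simp [hg, h0 x hn]
  rw [e1, ← him, lintegral_image_eq_lintegral_abs_deriv_mul measurableSet_Ioo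
    (fun r hr => (hd r hr).hasDerivWithinAt) (hm.mono Ioo_subset_Icc_self).injOn g]
  refine setLIntegral_congr_fun measurableSet_Ioo fun r hr => ?_
  by_cases hA' : h r ∈ A
  · rw [indicator_of_mem (show r ∈ h ⁻¹' A from hA'), hg, indicator_of_mem hA', abs_of_pos (hπ r hr),
      ← ENNReal.ofReal_mul (hπ r hr).le, ← hρ r hr, mul_comm]
  · simp [hA', hg]

/-- A probability density on `[p, q]` comparable to the power `γ` of the distance to the
boundary. -/
structure Bump (γ c C p q : ℝ) (ψ : ℝ → ℝ) : Prop where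
  lt : p < q
  integrable : IntervalIntegrable ψ volume p q
  cont : ContinuousOn ψ (Ioo p q)
  lb : ∀ x ∈ Icc p q, c * min (x - p) (q - x) ^ γ ≤ ψ x
  ub : ∀ x ∈ Icc p q, ψ x ≤ C * min (x - p) (q - x) ^ γ
  mass : ∫ x in p..q, ψ x = 1

theorem le_of_rpow_le {γ c C x y : ℝ} (hγ : 0 < γ) (hc : 0 < c) (hC : 0 < C) (hx : 0 ≤ x)
    (hy : 0 ≤ y) (h : c / (γ + 1) * (x / 2) ^ (γ + 1) ≤ C / (γ + 1) * y ^ (γ + 1)) :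
    x ≤ 2 * (C / c) ^ (1 / (γ + 1)) * y := by
  have hk : 0 ≤ (C / c) ^ (1 / (γ + 1)) := by positivity
  have h1 : (x / 2) ^ (γ + 1) ≤ ((C / c) ^ (1 / (γ + 1)) * y) ^ (γ + 1) := by
    rw [Real.mul_rpow hk hy, ← Real.rpow_mul (by positivity), one_div_mul_cancel (by linarith),
      Real.rpow_one, div_mul_eq_mul_div, le_div_iff₀ hc]
    rw [div_mul_eq_mul_div, div_mul_eq_mul_div, div_le_div_iff_of_pos_right (by linarith)] at h
    linarith
  rw [Real.rpow_le_rpow_iff (by positivity) (by positivity) (by linarith)] at h1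
  linarith

namespace Bump

variable {γ c C p q : ℝ} {ψ : ℝ → ℝ}

theorem neg (h : Bump γ c C p q ψ) : Bump γ c C (-q) (-p) (fun x => ψ (-x)) where
  lt := neg_lt_neg h.lt
  integrable := by simpa using h.integrable.symm.comp_sub_left 0
  cont := h.cont.comp continuous_neg.continuousOn fun x hx => ⟨by linarith [hx.2], by linarith [hx.1]⟩
  lb x hx := by
    have := h.lb (-x) ⟨by linarith [hx.2], by linarith [hx.1]⟩
    rwa [min_comm, show x - -q = q - -x by ring, show -p - x = -x - p by ring]
  ub x hx := by
    have := h.ub (-x) ⟨by linarith [hx.2], by linarith [hx.1]⟩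
    rwa [min_comm, show x - -q = q - -x by ring, show -p - x = -x - p by ring]
  mass := by rw [intervalIntegral.integral_comp_neg, neg_neg, neg_neg, h.mass]

theorem integrable_of_mem (h : Bump γ c C p q ψ) {x y : ℝ} (hx : x ∈ Icc p q) (hy : y ∈ Icc p q) :
    IntervalIntegrable ψ volume x y :=
  h.integrable.mono_set (by
    rw [uIcc_of_le h.lt.le]; exact uIcc_subset_Icc hx hy)

theorem nonneg (h : Bump γ c C p q ψ) (hc : 0 < c) {x : ℝ} (hx : x ∈ Icc p q) : 0 ≤ ψ x := by
  refine le_trans ?_ (h.lb x hx)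
  have : 0 ≤ min (x - p) (q - x) := le_min (by linarith [hx.1]) (by linarith [hx.2])
  positivity

theorem pos (h : Bump γ c C p q ψ) (hc : 0 < c) {x : ℝ} (hx : x ∈ Ioo p q) : 0 < ψ x := by
  refine lt_of_lt_of_le ?_ (h.lb x (Ioo_subset_Icc_self hx))
  have : 0 < min (x - p) (q - x) := lt_min (by linarith [hx.1]) (by linarith [hx.2])
  positivity

theorem le_mass (h : Bump γ c C p q ψ) (hγ : 0 < γ) (hc : 0 < c) {x : ℝ} (hx : x ∈ Icc p q) :
    c / (γ + 1) * ((x - p) / 2) ^ (γ + 1) ≤ ∫ y in p..x, ψ y := by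
  have hp := left_mem_Icc.2 h.lt.le
  have hm : (x + p) / 2 ∈ Icc p q := ⟨by linarith [hx.1], by linarith [hx.1, hx.2]⟩
  have h1 : ∫ y in p..(x + p) / 2, c * (y - p) ^ γ = c / (γ + 1) * ((x - p) / 2) ^ (γ + 1) := by
    rw [intervalIntegral.integral_const_mul,
      intervalIntegral.integral_comp_sub_right (fun y => y ^ γ) p, integral_rpow (Or.inl (by linarith)),
      sub_self, Real.zero_rpow (by linarith), show (x + p) / 2 - p = (x - p) / 2 by ring]
    ring
  rw [← h1, ← intervalIntegral.integral_add_adjacent_intervals (h.integrable_of_mem hp hm)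
    (h.integrable_of_mem hm hx)]
  have h2 : 0 ≤ ∫ y in (x + p) / 2..x, ψ y :=
    intervalIntegral.integral_nonneg (by linarith [hx.1]) fun y hy =>
      h.nonneg hc ⟨hm.1.trans hy.1, hy.2.trans hx.2⟩
  have h3 : ∫ y in p..(x + p) / 2, c * (y - p) ^ γ ≤ ∫ y in p..(x + p) / 2, ψ y := by
    refine intervalIntegral.integral_mono_on hm.1 (Continuous.intervalIntegrable ?_ _ _)
      (h.integrable_of_mem hp hm) fun y hy => ?_
    · exact continuous_const.mul ((continuous_id.sub continuous_const).rpow_const fun _ => Or.inr hγ.le)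
    · have := h.lb y ⟨hy.1, hy.2.trans hm.2⟩
      rwa [min_eq_left (by linarith [hy.2, hx.2])] at this
  linarith

theorem mass_le (h : Bump γ c C p q ψ) (hγ : 0 < γ) (hC : 0 < C) {x : ℝ} (hx : x ∈ Icc p q) :
    ∫ y in p..x, ψ y ≤ C / (γ + 1) * (x - p) ^ (γ + 1) := by
  have hp := left_mem_Icc.2 h.lt.le
  have h1 : ∫ y in p..x, C * (y - p) ^ γ = C / (γ + 1) * (x - p) ^ (γ + 1) := by
    rw [intervalIntegral.integral_const_mul,
      intervalIntegral.integral_comp_sub_right (fun y => y ^ γ) p, integral_rpow (Or.inl (by linarith)),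
      sub_self, Real.zero_rpow (by linarith)]
    ring
  rw [← h1]
  refine intervalIntegral.integral_mono_on hx.1 (h.integrable_of_mem hp hx)
    (Continuous.intervalIntegrable ?_ _ _) fun y hy => ?_
  · exact continuous_const.mul ((continuous_id.sub continuous_const).rpow_const fun _ => Or.inr hγ.le)
  · refine (h.ub y ⟨hy.1, hy.2.trans hx.2⟩).trans ?_
    have : 0 ≤ min (y - p) (q - y) := le_min (by linarith [hy.1]) (by linarith [hy.2, hx.2])
    have := min_le_left (y - p) (q - y)
    gcongr

/-- The distribution function. -/
noncomputable def cdf (p : ℝ) (ψ : ℝ → ℝ) (x : ℝ) : ℝ := ∫ y in p..x, ψ y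

theorem cdf_sub (h : Bump γ c C p q ψ) {x y : ℝ} (hx : x ∈ Icc p q) (hy : y ∈ Icc p q) :
    cdf p ψ y - cdf p ψ x = ∫ z in x..y, ψ z :=
  intervalIntegral.integral_interval_sub_left (h.integrable_of_mem (left_mem_Icc.2 h.lt.le) hy)
    (h.integrable_of_mem (left_mem_Icc.2 h.lt.le) hx)

theorem strictMonoOn_cdf (h : Bump γ c C p q ψ) (hc : 0 < c) : StrictMonoOn (cdf p ψ) (Icc p q) := by
  intro x hx y hy hxy
  rw [← sub_pos, h.cdf_sub hx hy]
  exact intervalIntegral.intervalIntegral_pos_of_pos_on (h.integrable_of_mem hx hy)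
    (fun z hz => h.pos hc ⟨hx.1.trans_lt hz.1, hz.2.trans_le hy.2⟩) hxy

theorem continuousOn_cdf (h : Bump γ c C p q ψ) : ContinuousOn (cdf p ψ) (Icc p q) := by
  have := intervalIntegral.continuousOn_primitive_interval (a := p) (b := q) (f := ψ) (μ := volume) (by
    rw [uIcc_of_le h.lt.le]; exact (intervalIntegrable_iff_integrableOn_Icc_of_le h.lt.le).1 h.integrable)
  rwa [uIcc_of_le h.lt.le] at this

theorem hasDerivAt_cdf (h : Bump γ c C p q ψ) {x : ℝ} (hx : x ∈ Ioo p q) :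
    HasDerivAt (cdf p ψ) (ψ x) x :=
  intervalIntegral.integral_hasDerivAt_right
    (h.integrable_of_mem (left_mem_Icc.2 h.lt.le) (Ioo_subset_Icc_self hx))
    (h.cont.stronglyMeasurableAtFilter isOpen_Ioo x hx)
    (h.cont.continuousAt (isOpen_Ioo.mem_nhds hx))

theorem cdf_mem (h : Bump γ c C p q ψ) (hc : 0 < c) {x : ℝ} (hx : x ∈ Icc p q) :
    cdf p ψ x ∈ Icc 0 1 := by
  have m := (h.strictMonoOn_cdf hc).monotoneOn
  have a := m (left_mem_Icc.2 h.lt.le) hx hx.1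
  have b := m hx (right_mem_Icc.2 h.lt.le) hx.2
  rw [show cdf p ψ q = 1 from h.mass] at b
  rw [show cdf p ψ p = 0 from intervalIntegral.integral_same] at a
  exact ⟨a, b⟩

theorem exists_quantile (h : Bump γ c C p q ψ) (hc : 0 < c) : ∃ G : ℝ → ℝ,
    (∀ s ∈ Icc (0 : ℝ) 1, G s ∈ Icc p q ∧ cdf p ψ (G s) = s) ∧ ContinuousOn G (Icc 0 1) := by
  have key : ∀ s, ∃ x, s ∈ Icc (0 : ℝ) 1 → x ∈ Icc p q ∧ cdf p ψ x = s := fun s => by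
    by_cases hs : s ∈ Icc (0 : ℝ) 1
    · obtain ⟨x, hx, e⟩ := intermediate_value_Icc h.lt.le h.continuousOn_cdf (show s ∈ Icc _ _ by
        rwa [show cdf p ψ q = 1 from h.mass, show cdf p ψ p = 0 from intervalIntegral.integral_same])
      exact ⟨x, fun _ => ⟨hx, e⟩⟩
    · exact ⟨0, fun h => absurd h hs⟩
  choose G hG using key
  have hm := h.strictMonoOn_cdf hc
  refine ⟨G, hG, fun s hs => tendsto_order.2 ⟨fun a ha => ?_, fun a ha => ?_⟩⟩
  · rcases lt_or_ge a p with hap | hap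
    · filter_upwards [self_mem_nhdsWithin] with s' hs' using hap.trans_le (hG s' hs').1.1
    · have ha' : a ∈ Icc p q := ⟨hap, ha.le.trans (hG s hs).1.2⟩
      have := hm ha' (hG s hs).1 ha
      rw [(hG s hs).2] at this
      filter_upwards [self_mem_nhdsWithin, (lt_mem_nhds this).filter_mono nhdsWithin_le_nhds] with s' hs' h2
      rwa [← (hG s' hs').2, hm.lt_iff_lt ha' (hG s' hs').1] at h2
  · rcases lt_or_ge q a with hap | hap
    · filter_upwards [self_mem_nhdsWithin] with s' hs' using (hG s' hs').1.2.trans_lt hap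
    · have ha' : a ∈ Icc p q := ⟨(hG s hs).1.1.trans ha.le, hap⟩
      have := hm (hG s hs).1 ha' ha
      rw [(hG s hs).2] at this
      filter_upwards [self_mem_nhdsWithin, (gt_mem_nhds this).filter_mono nhdsWithin_le_nhds] with s' hs' h2
      rwa [← (hG s' hs').2, hm.lt_iff_lt (hG s' hs').1 ha'] at h2

variable {p' q' : ℝ} {ψ' : ℝ → ℝ}

theorem dist_le (h : Bump γ c C p q ψ) (h' : Bump γ c C p' q' ψ') (hγ : 0 < γ) (hc : 0 < c)
    (hC : 0 < C) {x x' : ℝ} (hx : x ∈ Icc p q) (hx' : x' ∈ Icc p' q')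
    (e : cdf p ψ x = cdf p' ψ' x') :
    min (x - p) (q - x) ≤ 2 * (C / c) ^ (1 / (γ + 1)) * min (x' - p') (q' - x') := by
  have e' : cdf (-q) (fun y => ψ (-y)) (-x) = cdf (-q') (fun y => ψ' (-y)) (-x') := by
    unfold cdf
    rw [intervalIntegral.integral_comp_neg, intervalIntegral.integral_comp_neg]
    simp only [neg_neg]
    rw [← h.cdf_sub hx (right_mem_Icc.2 h.lt.le), ← h'.cdf_sub hx' (right_mem_Icc.2 h'.lt.le), e,
      show cdf p ψ q = 1 from h.mass, show cdf p' ψ' q' = 1 from h'.mass]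
  have hn : -x ∈ Icc (-q) (-p) := ⟨by linarith [hx.2], by linarith [hx.1]⟩
  have hn' : -x' ∈ Icc (-q') (-p') := ⟨by linarith [hx'.2], by linarith [hx'.1]⟩
  have a := le_of_rpow_le hγ hc hC (by linarith [hx.1]) (by linarith [hx'.1])
    ((h.le_mass hγ hc hx).trans (e.le.trans (h'.mass_le hγ hC hx')))
  have b := le_of_rpow_le hγ hc hC (by linarith [hx.2]) (by linarith [hx'.2])
    ((h.neg.le_mass hγ hc hn).trans (e'.le.trans (h'.neg.mass_le hγ hC hn')))
  rw [mul_min_of_nonneg _ _ (by positivity)]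
  refine min_le_min a ?_
  rwa [show -x - -q = q - x by ring, show -x' - -q' = q' - x' by ring] at b

theorem ratio_le (h : Bump γ c C p q ψ) (h' : Bump γ c C p' q' ψ') (hγ : 0 < γ) (hc : 0 < c)
    (hC : 0 < C) {x x' : ℝ} (hx : x ∈ Ioo p q) (hx' : x' ∈ Ioo p' q')
    (e : cdf p ψ x = cdf p' ψ' x') :
    ψ x / ψ' x' ≤ C / c * (2 * (C / c) ^ (1 / (γ + 1))) ^ γ := by
  have hx1 := Ioo_subset_Icc_self hx
  have hx2 := Ioo_subset_Icc_self hx'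
  have h0 : 0 ≤ min (x - p) (q - x) := le_min (by linarith [hx.1]) (by linarith [hx.2])
  have h0' : 0 ≤ min (x' - p') (q' - x') := le_min (by linarith [hx'.1]) (by linarith [hx'.2])
  have hk : 0 ≤ 2 * (C / c) ^ (1 / (γ + 1)) := by positivity
  rw [div_le_iff₀ (h'.pos hc hx')]
  calc ψ x ≤ C * min (x - p) (q - x) ^ γ := h.ub x hx1
    _ ≤ C * (2 * (C / c) ^ (1 / (γ + 1)) * min (x' - p') (q' - x')) ^ γ := by
      gcongr
      exact h.dist_le h' hγ hc hC hx1 hx2 e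
    _ = C / c * (2 * (C / c) ^ (1 / (γ + 1))) ^ γ * (c * min (x' - p') (q' - x') ^ γ) := by
      rw [Real.mul_rpow hk h0']; field_simp
    _ ≤ _ := by
      have := h'.lb x' hx2
      gcongr

/-- The monotone transport between two bumps of the same kind is bi-Lipschitz. -/
theorem exists_transport (h : Bump γ c C p q ψ) (h' : Bump γ c C p' q' ψ') (hγ : 0 < γ) (hc : 0 < c)
    (hC : 0 < C) : ∃ Λ > 0, ∃ S : ℝ → ℝ,
      (∀ r r', p ≤ r → r ≤ r' → r' ≤ q → Λ⁻¹ * (r' - r) ≤ S r' - S r ∧ S r' - S r ≤ Λ * (r' - r)) ∧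
      S p = p' ∧ S q = q' ∧ ContinuousOn S (Icc p q) ∧
      ∀ r ∈ Ioo p q, HasDerivAt S (ψ r / ψ' (S r)) r ∧ 0 < ψ r ∧ 0 < ψ' (S r) := by
  obtain ⟨G, hG, hGc⟩ := h'.exists_quantile hc
  have hm' := h'.strictMonoOn_cdf hc
  have hl := left_mem_Icc.2 h.lt.le
  have hr := right_mem_Icc.2 h.lt.le
  set S : ℝ → ℝ := fun r => G (cdf p ψ r) with hS
  have hS1 : ∀ r ∈ Icc p q, S r ∈ Icc p' q' ∧ cdf p' ψ' (S r) = cdf p ψ r := fun r hr =>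
    hG _ (h.cdf_mem hc hr)
  have hSp : S p = p' := by
    refine hm'.injOn (hS1 p hl).1 (left_mem_Icc.2 h'.lt.le) ((hS1 p hl).2.trans ?_)
    simp [cdf]
  have hSq : S q = q' := by
    refine hm'.injOn (hS1 q hr).1 (right_mem_Icc.2 h'.lt.le) ((hS1 q hr).2.trans ?_)
    exact h.mass.trans h'.mass.symm
  have hSm : StrictMonoOn S (Icc p q) := fun x hx y hy hxy => by
    rw [← hm'.lt_iff_lt (hS1 x hx).1 (hS1 y hy).1, (hS1 x hx).2, (hS1 y hy).2]
    exact h.strictMonoOn_cdf hc hx hy hxy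
  have hSi : ∀ r ∈ Ioo p q, S r ∈ Ioo p' q' := fun r hr' => by
    have := Ioo_subset_Icc_self hr'
    rw [← hSp, ← hSq]
    exact ⟨hSm hl this hr'.1, hSm this hr hr'.2⟩
  have hSc : ContinuousOn S (Icc p q) := hGc.comp h.continuousOn_cdf fun r hr => h.cdf_mem hc hr
  have hd : ∀ r ∈ Ioo p q, HasDerivAt S (ψ r / ψ' (S r)) r := fun r hr' => by
    have hs : cdf p ψ r ∈ Ioo 0 1 := by
      have m := h.strictMonoOn_cdf hc
      have := Ioo_subset_Icc_self hr'
      have a := m hl this hr'.1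
      have b := m this hr hr'.2
      rw [show cdf p ψ q = 1 from h.mass] at b
      rw [show cdf p ψ p = 0 from intervalIntegral.integral_same] at a
      exact ⟨a, b⟩
    have hGd := HasDerivAt.of_local_left_inverse (hGc.continuousAt (Icc_mem_nhds hs.1 hs.2))
      (h'.hasDerivAt_cdf (hSi r hr')) (h'.pos hc (hSi r hr')).ne'
      (eventually_of_mem (Icc_mem_nhds hs.1 hs.2) fun s hs => (hG s hs).2)
    refine (hGd.comp r (h.hasDerivAt_cdf hr')).congr_deriv ?_
    rw [div_eq_inv_mul]
  have hΛ : 0 < C / c * (2 * (C / c) ^ (1 / (γ + 1))) ^ γ := by positivity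
  refine ⟨_, hΛ, S, fun r r' h1 h2 h3 => ?_, hSp, hSq, hSc, fun r hr =>
    ⟨hd r hr, h.pos hc hr, h'.pos hc (hSi r hr)⟩⟩
  rcases h2.eq_or_lt with rfl | h2
  · simp
  obtain ⟨ξ, hξ, e⟩ := exists_hasDerivAt_eq_slope S _ h2 (hSc.mono (Icc_subset_Icc h1 h3))
    fun x hx => hd x ⟨h1.trans_lt hx.1, hx.2.trans_le h3⟩
  have hξ' : ξ ∈ Ioo p q := ⟨h1.trans_lt hξ.1, hξ.2.trans_le h3⟩
  have e' := (hS1 ξ (Ioo_subset_Icc_self hξ')).2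
  have a := h.ratio_le h' hγ hc hC hξ' (hSi ξ hξ') e'.symm
  have b := h'.ratio_le h hγ hc hC (hSi ξ hξ') hξ' e'
  rw [← inv_div] at b
  have b' := inv_le_of_inv_le₀ (div_pos (h.pos hc hξ') (h'.pos hc (hSi ξ hξ'))) b
  have h4 : 0 < r' - r := by linarith
  rw [eq_div_iff h4.ne'] at e
  rw [← e]
  constructor <;> gcongr

end Bump

namespace FlowSeq

variable {D : Data} (Q : FlowSeq D)

/-! ### Eulerian coordinates -/

/-- The time interval times the line. -/
def slab (T : ℝ) : Set (ℝ × ℝ) := Ioo 0 T ×ˢ univ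

theorem isOpen_slab (T : ℝ) : IsOpen (slab T) := isOpen_Ioo.prod isOpen_univ

/-- The position `z.2` clamped to the support at time `z.1`. -/
noncomputable def clampPos (z : ℝ × ℝ) : ℝ :=
  max (Q.flowMap z.1 (-D.R)) (min z.2 (Q.flowMap z.1 D.R))

open Classical in
/-- The label of the particle closest to `z.2` at time `z.1`. -/
noncomputable def label (z : ℝ × ℝ) : ℝ :=
  if h : ∃ r ∈ Icc (-D.R) D.R, Q.flowMap z.1 r = Q.clampPos z then h.choose else 0

theorem slice_continuousOn {t : ℝ} (ht : t ∈ Icc 0 D.T) :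
    ContinuousOn (Q.flowMap t) (Icc (-D.R) D.R) :=
  Q.continuousOn_flowMap.comp (f := fun r => (t, r)) (by fun_prop) fun _ hr => ⟨ht, hr⟩

theorem slice_strictMonoOn {t : ℝ} (ht : t ∈ Ioc 0 D.T) :
    StrictMonoOn (Q.flowMap t) (Icc (-D.R) D.R) := fun r hr r' hr' h => by
  have := (Q.flowMap_sub_mem ⟨ht.1.le, ht.2⟩ hr.1 h.le hr'.2).1
  have := mul_pos (D.lower_pos ht.1 ht.2) (sub_pos.2 h)
  linarith

theorem left_mem : -D.R ∈ Icc (-D.R) D.R := ⟨le_rfl, by linarith [D.R_pos]⟩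

theorem right_mem : D.R ∈ Icc (-D.R) D.R := ⟨by linarith [D.R_pos], le_rfl⟩

theorem slice_edge_lt {t : ℝ} (ht : t ∈ Ioc 0 D.T) : Q.flowMap t (-D.R) < Q.flowMap t D.R :=
  Q.slice_strictMonoOn ht left_mem right_mem (by linarith [D.R_pos])

theorem label_spec {t x : ℝ} (ht : t ∈ Ioc 0 D.T) :
    Q.label (t, x) ∈ Icc (-D.R) D.R ∧ Q.flowMap t (Q.label (t, x)) = Q.clampPos (t, x) := by
  have h : ∃ r ∈ Icc (-D.R) D.R, Q.flowMap t r = Q.clampPos (t, x) :=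
    intermediate_value_Icc (left_mem.2) (Q.slice_continuousOn ⟨ht.1.le, ht.2⟩)
      ⟨le_max_left _ _, max_le (Q.slice_edge_lt ht).le (min_le_right _ _)⟩
  have e : Q.label (t, x) = h.choose := dif_pos h
  rw [e]
  exact h.choose_spec

attribute [irreducible] label

theorem label_eq {t x r : ℝ} (ht : t ∈ Ioc 0 D.T) (hr : r ∈ Icc (-D.R) D.R)
    (h : Q.clampPos (t, x) = Q.flowMap t r) : Q.label (t, x) = r :=
  (Q.slice_strictMonoOn ht).injOn (Q.label_spec ht).1 hr ((Q.label_spec ht).2.trans h)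

theorem label_flowMap {t r : ℝ} (ht : t ∈ Ioc 0 D.T) (hr : r ∈ Icc (-D.R) D.R) :
    Q.label (t, Q.flowMap t r) = r := by
  have m := (Q.slice_strictMonoOn ht).monotoneOn
  refine Q.label_eq ht hr ?_
  rw [clampPos, min_eq_left (m hr right_mem hr.2), max_eq_right (m left_mem hr hr.1)]

theorem label_of_ge {t x : ℝ} (ht : t ∈ Ioc 0 D.T) (h : Q.flowMap t D.R ≤ x) :
    Q.label (t, x) = D.R := by
  refine Q.label_eq ht right_mem ?_
  rw [clampPos, min_eq_right h, max_eq_right (Q.slice_edge_lt ht).le]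

theorem label_of_le {t x : ℝ} (ht : t ∈ Ioc 0 D.T) (h : x ≤ Q.flowMap t (-D.R)) :
    Q.label (t, x) = -D.R := by
  refine Q.label_eq ht left_mem ?_
  rw [clampPos, min_eq_left (h.trans (Q.slice_edge_lt ht).le), max_eq_left h]

theorem flowMap_label {t x : ℝ} (ht : t ∈ Ioc 0 D.T) (h1 : Q.flowMap t (-D.R) ≤ x)
    (h2 : x ≤ Q.flowMap t D.R) : Q.flowMap t (Q.label (t, x)) = x := by
  rw [(Q.label_spec ht).2, clampPos, min_eq_left h2, max_eq_right h1]

theorem continuousOn_path {r : ℝ} (hr : r ∈ Icc (-D.R) D.R) :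
    ContinuousOn (fun z : ℝ × ℝ => Q.flowMap z.1 r) (slab D.T) :=
  Q.continuousOn_flowMap.comp (f := fun z : ℝ × ℝ => (z.1, r)) (by fun_prop) fun _ hz =>
    ⟨Ioo_subset_Icc_self hz.1, hr⟩

theorem continuousOn_clampPos : ContinuousOn Q.clampPos (slab D.T) :=
  (Q.continuousOn_path left_mem).sup (continuousOn_snd.inf (Q.continuousOn_path right_mem))

theorem lower_mul_abs_le {t r r' : ℝ} (ht : t ∈ Icc 0 D.T) (hr : r ∈ Icc (-D.R) D.R)
    (hr' : r' ∈ Icc (-D.R) D.R) :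
    D.lower t * |r' - r| ≤ |Q.flowMap t r' - Q.flowMap t r| := by
  rcases le_total r r' with h | h
  · rw [abs_of_nonneg (sub_nonneg.2 h)]
    exact (Q.flowMap_sub_mem ht hr.1 h hr'.2).1.trans (le_abs_self _)
  · rw [abs_sub_comm, abs_of_nonneg (sub_nonneg.2 h), abs_sub_comm (Q.flowMap t r')]
    exact (Q.flowMap_sub_mem ht hr'.1 h hr.2).1.trans (le_abs_self _)

theorem continuousOn_label : ContinuousOn Q.label (slab D.T) := by
  rintro ⟨t₀, x₀⟩ hz
  have ht₀ := Ioo_subset_Ioc_self hz.1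
  obtain ⟨hr₀, e₀⟩ := Q.label_spec (x := x₀) ht₀
  set r₀ := Q.label (t₀, x₀) with hr
  have hF : ContinuousWithinAt (fun z : ℝ × ℝ => |Q.clampPos z - Q.flowMap z.1 r₀| / D.lower z.1)
      (slab D.T) (t₀, x₀) :=
    (((Q.continuousOn_clampPos _ hz).sub (Q.continuousOn_path hr₀ _ hz)).abs).div
      (D.continuous_lower.comp continuous_fst).continuousWithinAt (D.lower_pos ht₀.1 ht₀.2).ne'
  have hF0 : |Q.clampPos (t₀, x₀) - Q.flowMap t₀ r₀| / D.lower t₀ = 0 := by rw [e₀]; simp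
  rw [ContinuousWithinAt, hF0] at hF
  refine tendsto_iff_dist_tendsto_zero.2 (squeeze_zero' (Eventually.of_forall fun _ => dist_nonneg) ?_ hF)
  filter_upwards [self_mem_nhdsWithin] with ⟨t, x⟩ hz'
  have ht := Ioo_subset_Ioc_self hz'.1
  obtain ⟨h1, h2⟩ := Q.label_spec (x := x) ht
  rw [Real.dist_eq, le_div_iff₀ (D.lower_pos ht.1 ht.2), ← h2, mul_comm]
  exact Q.lower_mul_abs_le (Ioo_subset_Icc_self hz'.1) hr₀ h1

/-! ### The density -/

/-- The density at time `t`. -/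
noncomputable def eulerDens (z : ℝ × ℝ) : ℝ := D.dens (Q.label z) / Q.jac z.1 (Q.label z)

theorem dens_edge {r : ℝ} (h : r = -D.R ∨ r = D.R) : D.dens r = 0 := by
  have := D.R_pos
  have hg := D.γ_pos
  rw [Data.dens, show 1 - (r / D.R) ^ 2 = 0 by rcases h with rfl | rfl <;> field_simp <;> ring,
    mul_zero, Real.zero_rpow hg.ne']

theorem mem_Ioo_or_edge {r : ℝ} (h : r ∈ Icc (-D.R) D.R) :
    r ∈ Ioo (-D.R) D.R ∨ r = -D.R ∨ r = D.R := by
  rcases h.1.eq_or_lt with e | h1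
  · exact Or.inr (Or.inl e.symm)
  rcases h.2.eq_or_lt with e | h2
  · exact Or.inr (Or.inr e)
  exact Or.inl ⟨h1, h2⟩

theorem dens_nonneg {r : ℝ} (h : r ∈ Icc (-D.R) D.R) : 0 ≤ D.dens r := by
  rcases mem_Ioo_or_edge h with h | h
  · exact (dens_pos h).le
  · exact (dens_edge h).ge

theorem continuous_dens : Continuous D.dens := by
  unfold Data.dens
  exact Continuous.rpow_const (by fun_prop) fun _ => Or.inr D.γ_pos.le

theorem eulerDens_mem {t x : ℝ} (ht : t ∈ Ioo 0 D.T) :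
    Q.eulerDens (t, x) ∈ Icc (D.dens (Q.label (t, x)) / D.upper t) (D.dens (Q.label (t, x)) / D.lower t) := by
  have hr := (Q.label_spec (x := x) (Ioo_subset_Ioc_self ht)).1
  unfold eulerDens
  rcases mem_Ioo_or_edge hr with h | h
  · have hj := Q.jac_mem ⟨ht, h⟩
    have := D.lower_pos ht.1 ht.2.le
    have : 0 < Q.jac (t, x).1 (Q.label (t, x)) := Q.jac_pos ⟨ht, h⟩
    have := dens_nonneg hr
    constructor
    · have := hj.2
      gcongr
    · have := hj.1
      gcongr
  · simp [dens_edge h]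

theorem eulerDens_nonneg {t x : ℝ} (ht : t ∈ Ioo 0 D.T) : 0 ≤ Q.eulerDens (t, x) :=
  (div_nonneg (dens_nonneg (Q.label_spec (Ioo_subset_Ioc_self ht)).1) (D.upper_pos ht.1).le).trans
    (Q.eulerDens_mem ht).1

theorem eulerDens_of_edge {z : ℝ × ℝ} (h : Q.label z = -D.R ∨ Q.label z = D.R) :
    Q.eulerDens z = 0 := by
  rw [eulerDens, dens_edge h, zero_div]

theorem continuousOn_eulerDens : ContinuousOn Q.eulerDens (slab D.T) := by
  rintro ⟨t₀, x₀⟩ hz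
  have ht₀ := Ioo_subset_Ioc_self hz.1
  obtain ⟨hr₀, -⟩ := Q.label_spec (x := x₀) ht₀
  have hd := (continuous_dens (D := D)).continuousAt.comp_continuousWithinAt (Q.continuousOn_label _ hz)
  rcases mem_Ioo_or_edge hr₀ with h | h
  · refine hd.div ?_ (Q.jac_pos (t := t₀) (r := Q.label (t₀, x₀)) ⟨hz.1, h⟩).ne'
    have := (Q.continuousOn_jac.continuousAt
      ((isOpen_Ioo.prod isOpen_Ioo).mem_nhds (show (t₀, Q.label (t₀, x₀)) ∈ openRect D from ⟨hz.1, h⟩)))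
    exact this.comp_continuousWithinAt (f := fun z => (z.1, Q.label z)) (x := (t₀, x₀))
      (continuousWithinAt_fst.prodMk (Q.continuousOn_label _ hz))
  · have hl : ContinuousWithinAt (fun z => D.dens (Q.label z) / D.lower z.1) (slab D.T) (t₀, x₀) :=
      hd.div (D.continuous_lower.comp continuous_fst).continuousWithinAt (D.lower_pos ht₀.1 ht₀.2).ne'
    rw [ContinuousWithinAt, dens_edge h, zero_div] at hl
    rw [ContinuousWithinAt, Q.eulerDens_of_edge h]
    refine squeeze_zero' ?_ ?_ hl
    · filter_upwards [self_mem_nhdsWithin] with z hz using Q.eulerDens_nonneg hz.1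
    · filter_upwards [self_mem_nhdsWithin] with z hz using (Q.eulerDens_mem hz.1).2

theorem eulerDens_flowMap_mul {t r : ℝ} (hz : (t, r) ∈ openRect D) :
    Q.eulerDens (t, Q.flowMap t r) * Q.jac t r = D.dens r := by
  rw [eulerDens, Q.label_flowMap (Ioo_subset_Ioc_self hz.1) (Ioo_subset_Icc_self hz.2),
    div_mul_cancel₀ _ (Q.jac_pos hz).ne']

theorem eulerDens_rpow {t r : ℝ} (hz : (t, r) ∈ openRect D) :
    Q.eulerDens (t, Q.flowMap t r) ^ D.θ = Q.specMap t r ^ (-D.θ) := by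
  have h := Q.specMap_pos hz
  rw [eulerDens, Q.label_flowMap (Ioo_subset_Ioc_self hz.1) (Ioo_subset_Icc_self hz.2), jac,
    mul_comm, div_mul_cancel_left₀ (dens_pos hz.2).ne', Real.inv_rpow h.le, Real.rpow_neg h.le]

/-! ### The free boundary and the velocity field -/

/-- The right (`s = 1`) or reflected left (`s = -1`) free boundary. -/
noncomputable def bdPos (s t : ℝ) : ℝ := s * Q.flowMap t (s * D.R)

/-- The velocity of `bdPos`. -/
noncomputable def bdVel (s t : ℝ) : ℝ := s * Q.velExt (t, s * D.R)

/-- The velocity excess in the vacuum beyond the free boundary. -/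
noncomputable def excess (s : ℝ) (z : ℝ × ℝ) : ℝ :=
  Q.bdVel s (emit (Q.bdPos s) (Q.bdVel s) (z.1, max (s * z.2) (Q.bdPos s z.1))) - Q.bdVel s z.1

/-- The velocity field. -/
noncomputable def eulerVel (z : ℝ × ℝ) : ℝ :=
  Q.velExt (z.1, Q.label z) + Q.excess 1 z - Q.excess (-1) z

theorem hasDerivAt_bdPos {s t : ℝ} (hs : s = 1 ∨ s = -1) (ht : t ∈ Ioo 0 D.T) :
    HasDerivAt (Q.bdPos s) (Q.bdVel s t) t :=
  (Q.hasDerivAt_flowMap_time_ext ⟨ht, edge_mem hs⟩).const_mul s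

theorem continuousOn_bdVel {s : ℝ} (hs : s = 1 ∨ s = -1) : ContinuousOn (Q.bdVel s) (Ioo 0 D.T) :=
  (Q.continuousOn_velExt.comp (f := fun t => (t, s * D.R)) (by fun_prop) fun _ ht =>
    ⟨ht, edge_mem hs⟩).const_smul s

theorem abs_bdPos_sub_le {s t : ℝ} (hs : s = 1 ∨ s = -1) (ht : t ∈ Icc 0 D.T) :
    |Q.bdPos s t - t ^ D.α * D.R| ≤ D.C₀ * t := by
  have h := Q.abs_flowMap_sub_le ht (edge_mem hs)
  have hss : s * s = 1 := by rcases hs with rfl | rfl <;> norm_num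
  have ha : |s| = 1 := by rcases hs with rfl | rfl <;> norm_num
  rw [show Q.bdPos s t - t ^ D.α * D.R = s * (Q.flowMap t (s * D.R) - t ^ D.α * (s * D.R)) by
    unfold bdPos; linear_combination (t ^ D.α * D.R) * hss, abs_mul, ha, one_mul]
  exact h

theorem tendsto_rpow_α : Tendsto (fun t : ℝ => t ^ D.α) (𝓝[>] 0) (𝓝 0) := by
  have := (Real.continuousAt_rpow_const 0 D.α (Or.inr D.α_pos.le)).tendsto
  rw [Real.zero_rpow D.α_pos.ne'] at this
  exact this.mono_left nhdsWithin_le_nhds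

theorem tendsto_mul_self (c : ℝ) : Tendsto (fun t : ℝ => c * t) (𝓝[>] 0) (𝓝 0) := by
  have : Tendsto (fun t : ℝ => c * t) (𝓝 0) (𝓝 (c * 0)) := (continuous_const_mul c).tendsto 0
  rw [mul_zero] at this
  exact this.mono_left nhdsWithin_le_nhds

theorem eventually_Ioo : ∀ᶠ t in 𝓝[>] (0 : ℝ), t ∈ Ioo 0 D.T := Ioo_mem_nhdsGT D.T_pos

theorem tendsto_bdPos {s : ℝ} (hs : s = 1 ∨ s = -1) : Tendsto (Q.bdPos s) (𝓝[>] 0) (𝓝 0) := by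
  have h1 : Tendsto (fun t : ℝ => t ^ D.α * D.R) (𝓝[>] 0) (𝓝 0) := by
    simpa using tendsto_rpow_α.mul_const D.R
  have h2 : Tendsto (fun t => Q.bdPos s t - t ^ D.α * D.R) (𝓝[>] 0) (𝓝 0) := by
    refine squeeze_zero_norm' ?_ (tendsto_mul_self D.C₀)
    filter_upwards [eventually_Ioo (D := D)] with t ht
      using Q.abs_bdPos_sub_le hs (Ioo_subset_Icc_self ht)
  simpa using h2.add h1

theorem tendsto_bdVel {s : ℝ} (hs : s = 1 ∨ s = -1) : Tendsto (Q.bdVel s) (𝓝[>] 0) atTop := by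
  refine tendsto_atTop.2 fun M => ?_
  by_contra hn
  have hle : ∀ t ∈ Ioo 0 D.T, Q.bdVel s t ≤ M := by
    intro t ht
    by_contra hlt
    refine hn ?_
    filter_upwards [Ioo_mem_nhdsGT ht.1] with τ hτ
    exact (not_le.1 hlt).le.trans (Q.strictAntiOn_edge hs ⟨hτ.1, hτ.2.trans ht.2⟩ ht hτ.2).le
  have hlin : ∀ t ∈ Ioo 0 D.T, Q.bdPos s t ≤ M * t := by
    intro t ht
    have h1 : Tendsto (fun τ => Q.bdPos s τ + M * (t - τ)) (𝓝[>] 0) (𝓝 (0 + M * (t - 0))) :=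
      (Q.tendsto_bdPos hs).add (((tendsto_const_nhds.sub tendsto_id).const_mul M).mono_left
        nhdsWithin_le_nhds)
    rw [zero_add, sub_zero] at h1
    refine ge_of_tendsto h1 ?_
    filter_upwards [Ioo_mem_nhdsGT ht.1] with τ hτ
    have := Convex.image_sub_le_mul_sub_of_deriv_le (convex_Icc τ t) (f := Q.bdPos s) (C := M)
      (fun y hy => (Q.hasDerivAt_bdPos hs
        ⟨hτ.1.trans_le hy.1, hy.2.trans_lt ht.2⟩).continuousAt.continuousWithinAt)
      (fun y hy => by
        rw [interior_Icc] at hy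
        exact (Q.hasDerivAt_bdPos hs ⟨hτ.1.trans hy.1,
          hy.2.trans ht.2⟩).differentiableAt.differentiableWithinAt)
      (fun y hy => by
        rw [interior_Icc] at hy
        have hy' : y ∈ Ioo 0 D.T := ⟨hτ.1.trans hy.1, hy.2.trans ht.2⟩
        rw [(Q.hasDerivAt_bdPos hs hy').deriv]
        exact hle y hy') τ (left_mem_Icc.2 hτ.2.le) t (right_mem_Icc.2 hτ.2.le) hτ.2.le
    linarith
  have hα := D.α_lt_one
  have h3 : Tendsto (fun t : ℝ => (M + D.C₀) * t ^ (1 - D.α)) (𝓝[>] 0) (𝓝 0) := by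
    have := (Real.continuousAt_rpow_const 0 (1 - D.α) (Or.inr (by linarith))).tendsto.const_mul (M + D.C₀)
    rw [Real.zero_rpow (by linarith), mul_zero] at this
    exact this.mono_left nhdsWithin_le_nhds
  obtain ⟨t, ht, h4⟩ := ((eventually_Ioo (D := D)).and (h3.eventually (gt_mem_nhds D.R_pos))).exists
  have h5 := abs_le.1 (Q.abs_bdPos_sub_le hs (Ioo_subset_Icc_self ht))
  have h6 := hlin t ht
  have h7 := Real.rpow_pos_of_pos ht.1 D.α
  have h8 : t = t ^ D.α * t ^ (1 - D.α) := by
    rw [← Real.rpow_add ht.1]; simp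
  have h9 := mul_lt_mul_of_pos_left h4 h7
  have : t ^ D.α * ((M + D.C₀) * t ^ (1 - D.α)) = (M + D.C₀) * t := by
    rw [mul_left_comm, ← h8]
  linarith

theorem continuousOn_velExt_label :
    ContinuousOn (fun z : ℝ × ℝ => Q.velExt (z.1, Q.label z)) (slab D.T) := by
  have h : ContinuousOn (fun z : ℝ × ℝ => (z.1, Q.label z)) (slab D.T) :=
    continuousOn_fst.prodMk Q.continuousOn_label
  have hm : MapsTo (fun z : ℝ × ℝ => (z.1, Q.label z)) (slab D.T) (strip D) := fun z hz =>
    ⟨hz.1, (Q.label_spec (x := z.2) (Ioo_subset_Ioc_self hz.1)).1⟩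
  exact Q.continuousOn_velExt.comp h hm

end FlowSeq

/-! ### A potential which is differentiable along curves -/

theorem hasDerivAt_of_curve {T t x W : ℝ} {u V : ℝ × ℝ → ℝ} {c : ℝ → ℝ} (ht : t ∈ Ioo 0 T)
    (hV : ContinuousOn V (FlowSeq.slab T))
    (hu : ∀ t ∈ Ioo 0 T, ∀ x, HasDerivAt (fun y => u (t, y)) (-V (t, x)) x) (hc0 : c t = x)
    (hc : HasDerivAt c (V (t, x)) t)
    (huc : HasDerivAt (fun s => u (s, c s)) (W - V (t, x) ^ 2) t) :
    HasDerivAt (fun s => u (s, x)) W t := by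
  have mvt : ∀ s, ∃ ξ ∈ uIcc x (c s), s ∈ Ioo 0 T → u (s, c s) - u (s, x) = -V (s, ξ) * (c s - x) := by
    intro s
    by_cases hs : s ∈ Ioo 0 T
    swap
    · exact ⟨x, left_mem_uIcc, fun h => absurd h hs⟩
    rcases lt_trichotomy x (c s) with h | h | h
    · obtain ⟨ξ, hξ, e⟩ := exists_hasDerivAt_eq_slope (fun y => u (s, y)) _ h
        (fun y _ => (hu s hs y).continuousAt.continuousWithinAt) fun y _ => hu s hs y
      exact ⟨ξ, by rw [uIcc_of_le h.le]; exact Ioo_subset_Icc_self hξ, fun _ => by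
        rw [e, div_mul_cancel₀ _ (sub_pos.2 h).ne']⟩
    · exact ⟨x, left_mem_uIcc, fun _ => by rw [← h]; simp⟩
    · obtain ⟨ξ, hξ, e⟩ := exists_hasDerivAt_eq_slope (fun y => u (s, y)) _ h
        (fun y _ => (hu s hs y).continuousAt.continuousWithinAt) fun y _ => hu s hs y
      refine ⟨ξ, by rw [uIcc_of_ge h.le]; exact Ioo_subset_Icc_self hξ, fun _ => ?_⟩
      rw [e, ← neg_sub x (c s), mul_neg, div_mul_cancel₀ _ (sub_pos.2 h).ne', neg_sub]
  choose ξ hξ hξ' using mvt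
  have hξt : Tendsto ξ (𝓝 t) (𝓝 x) := by
    have h1 : Tendsto (fun s => |c s - x|) (𝓝 t) (𝓝 0) := by
      have := hc.continuousAt.tendsto.sub_const x
      rw [hc0, sub_self] at this
      simpa using this.abs
    refine tendsto_iff_dist_tendsto_zero.2 (squeeze_zero (fun _ => dist_nonneg) (fun s => ?_) h1)
    rw [Real.dist_eq]
    exact abs_sub_left_of_mem_uIcc (hξ s)
  have hVt : Tendsto (fun s => V (s, ξ s)) (𝓝 t) (𝓝 (V (t, x))) :=
    (hV.continuousAt ((FlowSeq.isOpen_slab T).mem_nhds ⟨ht, mem_univ x⟩)).tendsto.comp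
      (tendsto_id.prodMk_nhds hξt)
  have h2 : HasDerivAt (fun s => u (s, c s) - u (s, x)) (-V (t, x) * V (t, x)) t := by
    rw [hasDerivAt_iff_tendsto_slope] at hc ⊢
    refine ((hVt.neg.mono_left nhdsWithin_le_nhds).mul hc).congr' ?_
    filter_upwards [nhdsWithin_le_nhds (isOpen_Ioo.mem_nhds ht)] with s hs
    simp only [slope_def_field, hξ' s hs, hc0, sub_self, sub_zero]
    ring
  refine ((huc.sub h2).congr_of_eventuallyEq (Eventually.of_forall fun s => ?_)).congr_deriv ?_
  · simp
  · ring

theorem contDiffOn_of_partials {T : ℝ} {u V W : ℝ × ℝ → ℝ} (hV : ContinuousOn V (FlowSeq.slab T))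
    (hW : ContinuousOn W (FlowSeq.slab T))
    (hx : ∀ t ∈ Ioo 0 T, ∀ x, HasDerivAt (fun y => u (t, y)) (-V (t, x)) x)
    (ht : ∀ t ∈ Ioo 0 T, ∀ x, HasDerivAt (fun s => u (s, x)) (W (t, x)) t) :
    ContDiffOn ℝ 1 u (FlowSeq.slab T) := by
  have ho := FlowSeq.isOpen_slab T
  set f₁ : ℝ → ℝ → ℝ →L[ℝ] ℝ := fun t x => ContinuousLinearMap.toSpanSingleton ℝ (W (t, x))
  set f₂ : ℝ → ℝ → ℝ →L[ℝ] ℝ := fun t x => ContinuousLinearMap.toSpanSingleton ℝ (-V (t, x))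
  have hc : Continuous fun y : ℝ => (ContinuousLinearMap.toSpanSingleton ℝ y : ℝ →L[ℝ] ℝ) :=
    (ContinuousLinearMap.toSpanSingletonCLE (𝕜 := ℝ) (E := ℝ)).continuous
  have c₁ : ContinuousOn ↿f₁ (FlowSeq.slab T) := hc.comp_continuousOn hW
  have c₂ : ContinuousOn ↿f₂ (FlowSeq.slab T) := hc.comp_continuousOn hV.neg
  have key : ∀ z ∈ FlowSeq.slab T, HasFDerivAt u ((↿f₁ z).coprod (↿f₂ z)) z := fun z hz =>
    (hasStrictFDerivAt_uncurry_coprod (f := fun t x => u (t, x))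
      (eventually_of_mem (ho.mem_nhds hz) fun v hv => (ht v.1 hv.1 v.2).hasFDerivAt)
      (eventually_of_mem (ho.mem_nhds hz) fun v hv => (hx v.1 hv.1 v.2).hasFDerivAt)
      (c₁.continuousAt (ho.mem_nhds hz)) (c₂.continuousAt (ho.mem_nhds hz))).hasFDerivAt
  rw [show (1 : WithTop ℕ∞) = 0 + 1 from rfl,
    contDiffOn_succ_iff_hasFDerivWithinAt_of_uniqueDiffOn ho.uniqueDiffOn]
  refine ⟨by simp, _, contDiffOn_zero.2 ?_, fun z hz => (key z hz).hasFDerivWithinAt⟩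
  exact (ContinuousLinearMap.coprodEquivL (𝕜 := ℝ) (E := ℝ) (F := ℝ) (G := ℝ) ℝ).continuous.comp_continuousOn
    (c₁.prodMk c₂)

namespace FlowSeq

variable {D : Data} (Q : FlowSeq D)

theorem exists_edge {s : ℝ} (hs : s = 1 ∨ s = -1) :
    ∃ B, Edge D.T (Q.bdPos s) (Q.bdVel s) B := by
  have hc := Q.continuousOn_bdVel hs
  have hc' : ContinuousOn (fun t => -(Q.bdVel s t ^ 2 / 2)) (Ioo 0 D.T) := ((hc.pow 2).div_const 2).neg
  have hT : D.T / 2 ∈ Ioo 0 D.T := ⟨half_pos D.T_pos, half_lt_self D.T_pos⟩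
  refine ⟨fun t => ∫ τ in D.T / 2..t, -(Q.bdVel s τ ^ 2 / 2), fun t ht => Q.hasDerivAt_bdPos hs ht,
    fun t ht => ?_, Q.strictAntiOn_edge hs, hc, Q.tendsto_bdPos hs, Q.tendsto_bdVel hs⟩
  exact intervalIntegral.integral_hasDerivAt_right
    (hc'.mono (ordConnected_Ioo.uIcc_subset hT ht)).intervalIntegrable
    (hc'.stronglyMeasurableAtFilter isOpen_Ioo t ht) (hc'.continuousAt (isOpen_Ioo.mem_nhds ht))

theorem continuousOn_bdPos {s : ℝ} (hs : s = 1 ∨ s = -1) : ContinuousOn (Q.bdPos s) (Ioo 0 D.T) :=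
  fun _ ht => (Q.hasDerivAt_bdPos hs ht).continuousAt.continuousWithinAt

theorem continuousOn_excess {s : ℝ} (hs : s = 1 ∨ s = -1) :
    ContinuousOn (Q.excess s) (slab D.T) := by
  obtain ⟨B, h⟩ := Q.exists_edge hs
  have hm : MapsTo (fun z : ℝ × ℝ => z.1) (slab D.T) (Ioo 0 D.T) := fun z hz => hz.1
  have h1 : ContinuousOn (fun z : ℝ × ℝ => (z.1, max (s * z.2) (Q.bdPos s z.1))) (slab D.T) :=
    continuousOn_fst.prodMk ((continuousOn_snd.const_smul s).sup
      ((Q.continuousOn_bdPos hs).comp continuousOn_fst hm))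
  have h2 : MapsTo (fun z : ℝ × ℝ => (z.1, max (s * z.2) (Q.bdPos s z.1))) (slab D.T)
    (Edge.vac D.T (Q.bdPos s)) := fun z hz => ⟨hz.1, le_max_right _ _⟩
  exact (h.continuousOn_vel.comp h1 h2).sub ((Q.continuousOn_bdVel hs).comp continuousOn_fst hm)

theorem excess_of_le {s t x : ℝ} (hs : s = 1 ∨ s = -1) (ht : t ∈ Ioo 0 D.T)
    (h : s * x ≤ Q.bdPos s t) : Q.excess s (t, x) = 0 := by
  obtain ⟨B, hE⟩ := Q.exists_edge hs
  have := (hE.emit_eq ht.1 le_rfl ht.2).2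
  rw [show rayPt (Q.bdPos s) (Q.bdVel s) t t = Q.bdPos s t by simp [rayPt]] at this
  rw [excess, max_eq_right h, this, sub_self]

theorem continuousOn_eulerVel : ContinuousOn Q.eulerVel (slab D.T) :=
  (Q.continuousOn_velExt_label.add (Q.continuousOn_excess (Or.inl rfl))).sub
    (Q.continuousOn_excess (Or.inr rfl))

theorem eulerVel_flowMap {t r : ℝ} (hz : (t, r) ∈ strip D) :
    Q.eulerVel (t, Q.flowMap t r) = Q.velExt (t, r) := by
  have ht := Ioo_subset_Ioc_self hz.1
  have m := (Q.slice_strictMonoOn ht).monotoneOn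
  rw [eulerVel, Q.label_flowMap ht hz.2, Q.excess_of_le (Or.inl rfl) hz.1,
    Q.excess_of_le (Or.inr rfl) hz.1]
  · simp
  · rw [bdPos, neg_one_mul D.R]
    linarith [m left_mem hz.2 hz.2.1]
  · rw [bdPos, one_mul D.R]
    linarith [m hz.2 right_mem hz.2.2]

theorem eulerVel_of_ge {s t x : ℝ} (hs : s = 1 ∨ s = -1) (ht : t ∈ Ioo 0 D.T)
    (h : Q.bdPos s t ≤ s * x) :
    Q.eulerVel (t, x) = s * Q.bdVel s (emit (Q.bdPos s) (Q.bdVel s) (t, s * x)) := by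
  have ht' := Ioo_subset_Ioc_self ht
  have hlt := Q.slice_edge_lt ht'
  rcases hs with rfl | rfl
  · have h' := h
    rw [bdPos, one_mul, one_mul, one_mul] at h'
    rw [eulerVel, Q.label_of_ge ht' h', Q.excess_of_le (Or.inr rfl) ht, excess, max_eq_left h]
    · simp [bdVel]
    · rw [bdPos, neg_one_mul D.R]
      linarith
  · have h' := h
    rw [bdPos, neg_one_mul, neg_one_mul, neg_one_mul, neg_le_neg_iff] at h'
    rw [eulerVel, Q.label_of_le ht' h', Q.excess_of_le (Or.inl rfl) ht, excess, max_eq_left h]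
    · simp [bdVel]
    · rw [bdPos, one_mul D.R]
      linarith

/-! ### The potential -/

/-- The potential. -/
noncomputable def eulerPot (z : ℝ × ℝ) : ℝ :=
  Q.potMap z.1 0 - ∫ y in Q.flowMap z.1 0..z.2, Q.eulerVel (z.1, y)

theorem continuous_eulerVel_slice {t : ℝ} (ht : t ∈ Ioo 0 D.T) : Continuous fun y => Q.eulerVel (t, y) :=
  Q.continuousOn_eulerVel.comp_continuous (by fun_prop) fun _ => ⟨ht, mem_univ _⟩

theorem hasDerivAt_eulerPot {t : ℝ} (ht : t ∈ Ioo 0 D.T) (x : ℝ) :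
    HasDerivAt (fun y => Q.eulerPot (t, y)) (-Q.eulerVel (t, x)) x := by
  have hc := Q.continuous_eulerVel_slice ht
  exact (intervalIntegral.integral_hasDerivAt_right (a := Q.flowMap t 0) (b := x)
    (hc.intervalIntegrable _ _) (hc.stronglyMeasurableAtFilter _ _) hc.continuousAt).const_sub
    (Q.potMap t 0)

theorem zero_mem : (0 : ℝ) ∈ Ioo (-D.R) D.R := ⟨by linarith [D.R_pos], D.R_pos⟩

theorem eulerPot_flowMap {t r : ℝ} (hz : (t, r) ∈ openRect D) :
    Q.eulerPot (t, Q.flowMap t r) = Q.potMap t r := by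
  have hd : ∀ ρ ∈ Ioo (-D.R) D.R,
      HasDerivAt (fun ρ => Q.eulerPot (t, Q.flowMap t ρ) - Q.potMap t ρ) 0 ρ := by
    intro ρ hρ
    have hz' : (t, ρ) ∈ openRect D := ⟨hz.1, hρ⟩
    refine (((Q.hasDerivAt_eulerPot hz.1 (Q.flowMap t ρ)).comp ρ (Q.hasDerivAt_flowMap_label hz')).sub
      (Q.hasDerivAt_potMap_label hz')).congr_deriv ?_
    rw [Q.eulerVel_flowMap (t := t) (r := ρ) ⟨hz.1, Ioo_subset_Icc_self hρ⟩, Q.velExt_eq hz']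
    ring
  have := isOpen_Ioo.is_const_of_deriv_eq_zero isPreconnected_Ioo
    (fun ρ hρ => (hd ρ hρ).differentiableAt.differentiableWithinAt) (fun ρ hρ => (hd ρ hρ).deriv)
    hz.2 zero_mem
  simp only [eulerPot, intervalIntegral.integral_same] at this ⊢
  linarith

/-- The time derivative of the potential. -/
noncomputable def eulerRate (z : ℝ × ℝ) : ℝ := Q.eulerVel z ^ 2 / 2 - Q.eulerDens z ^ D.θ

theorem continuousOn_eulerRate : ContinuousOn Q.eulerRate (slab D.T) :=
  ((Q.continuousOn_eulerVel.pow 2).div_const 2).sub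
    (Q.continuousOn_eulerDens.rpow_const fun _ _ => Or.inr D.θ_pos.le)

theorem hasDerivAt_eulerPot_path {t r : ℝ} (hz : (t, r) ∈ openRect D) :
    HasDerivAt (fun s => Q.eulerPot (s, Q.flowMap s r))
      (Q.eulerRate (t, Q.flowMap t r) - Q.eulerVel (t, Q.flowMap t r) ^ 2) t := by
  refine ((Q.hasDerivAt_potMap_time hz).congr_of_eventuallyEq ?_).congr_deriv ?_
  · filter_upwards [isOpen_Ioo.mem_nhds hz.1] with s hs using Q.eulerPot_flowMap ⟨hs, hz.2⟩
  · rw [eulerRate, Q.eulerDens_rpow hz, Q.eulerVel_flowMap ⟨hz.1, Ioo_subset_Icc_self hz.2⟩,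
      Q.velExt_eq hz]
    ring

theorem hasDerivAt_eulerPot_edge {s t : ℝ} (hs : s = 1 ∨ s = -1) (ht : t ∈ Ioo 0 D.T) :
    HasDerivAt (fun τ => Q.eulerPot (τ, Q.flowMap τ (s * D.R)))
      (Q.eulerRate (t, Q.flowMap t (s * D.R)) - Q.eulerVel (t, Q.flowMap t (s * D.R)) ^ 2) t := by
  set r₀ := s * D.R
  have hr₀ : r₀ ∈ Icc (-D.R) D.R := edge_mem hs
  have hcl : r₀ ∈ closure (Ioo (-D.R) D.R) := by
    rwa [closure_Ioo (by linarith [D.R_pos])]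
  have : (𝓝[Ioo (-D.R) D.R] r₀).NeBot := mem_closure_iff_nhdsWithin_neBot.1 hcl
  have hp : ContinuousOn (fun z : ℝ × ℝ => (z.1, Q.flowMap z.1 z.2)) (strip D) :=
    continuousOn_fst.prodMk (Q.continuousOn_flowMap.mono (prod_mono Ioo_subset_Icc_self subset_rfl))
  have hm : MapsTo (fun z : ℝ × ℝ => (z.1, Q.flowMap z.1 z.2)) (strip D) (slab D.T) :=
    fun z hz => ⟨hz.1, mem_univ _⟩
  obtain ⟨G, hG0⟩ : ∃ G : ℝ × ℝ → ℝ, ∀ z, G z = Q.eulerRate (z.1, Q.flowMap z.1 z.2) -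
    Q.eulerVel (z.1, Q.flowMap z.1 z.2) ^ 2 := ⟨_, fun _ => rfl⟩
  have hG : ContinuousOn G (strip D) :=
    ((Q.continuousOn_eulerRate.comp hp hm).sub ((Q.continuousOn_eulerVel.comp hp hm).pow 2)).congr
      fun z _ => hG0 z
  have h := (hG (t, r₀) ⟨ht, hr₀⟩).tendsto
  rw [strip, nhdsWithin_prod_eq, isOpen_Ioo.nhdsWithin_eq ht] at h
  have h1 : Tendsto (fun z : ℝ × ℝ => (z.2, z.1)) (𝓝[Ioo (-D.R) D.R] r₀ ×ˢ 𝓝 t)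
      (𝓝 t ×ˢ 𝓝[Icc (-D.R) D.R] r₀) :=
    tendsto_snd.prodMk (Filter.tendsto_fst.mono_right (nhdsWithin_mono _ Ioo_subset_Icc_self))
  have h2 : Tendsto (fun z : ℝ × ℝ => (z.2, r₀)) (𝓝[Ioo (-D.R) D.R] r₀ ×ˢ 𝓝 t)
      (𝓝 t ×ˢ 𝓝[Icc (-D.R) D.R] r₀) :=
    tendsto_snd.prodMk (tendsto_const_pure.mono_right (pure_le_nhdsWithin hr₀))
  rw [← hG0 (t, r₀)]
  refine hasDerivAt_of_tendstoUniformlyOnFilter (l := 𝓝[Ioo (-D.R) D.R] r₀)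
    (f' := fun r τ => G (τ, r)) (f := fun r τ => Q.eulerPot (τ, Q.flowMap τ r))
    (g' := fun τ => G (τ, r₀)) ?_ ?_ ?_
  · rw [tendstoUniformlyOnFilter_iff_tendsto]
    exact ((h.comp h2).prodMk_nhds (h.comp h1)).mono_right (nhds_le_uniformity _)
  · refine eventually_prod_iff.2 ⟨_, self_mem_nhdsWithin, _, isOpen_Ioo.mem_nhds ht, ?_⟩
    intro r hr τ hτ
    have := Q.hasDerivAt_eulerPot_path (t := τ) (r := r) ⟨hτ, hr⟩
    rwa [← hG0 (τ, r)] at this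
  · filter_upwards [isOpen_Ioo.mem_nhds ht] with τ hτ
    have h1 : ContinuousWithinAt (Q.flowMap τ) (Ioo (-D.R) D.R) r₀ :=
      (Q.slice_continuousOn (Ioo_subset_Icc_self hτ) r₀ hr₀).mono Ioo_subset_Icc_self
    exact (Q.hasDerivAt_eulerPot hτ _).continuousAt.comp_continuousWithinAt h1

theorem eulerRate_edge {s t : ℝ} (hs : s = 1 ∨ s = -1) (ht : t ∈ Ioo 0 D.T) :
    Q.eulerRate (t, Q.flowMap t (s * D.R)) - Q.eulerVel (t, Q.flowMap t (s * D.R)) ^ 2 =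
      -(Q.bdVel s t ^ 2 / 2) := by
  rw [eulerRate, Q.eulerVel_flowMap ⟨ht, edge_mem hs⟩, Q.eulerDens_of_edge,
    Real.zero_rpow D.θ_pos.ne', bdVel]
  · rcases hs with rfl | rfl <;> ring
  · rw [Q.label_flowMap (Ioo_subset_Ioc_self ht) (edge_mem hs)]
    rcases hs with rfl | rfl
    · right; ring
    · left; ring

theorem edge {s : ℝ} (hs : s = 1 ∨ s = -1) : Edge D.T (Q.bdPos s) (Q.bdVel s)
    (fun t => Q.eulerPot (t, Q.flowMap t (s * D.R))) where
  hasDerivAt_pos _ ht := Q.hasDerivAt_bdPos hs ht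
  hasDerivAt_val _ ht := Q.eulerRate_edge hs ht ▸ Q.hasDerivAt_eulerPot_edge hs ht
  anti := Q.strictAntiOn_edge hs
  cont := Q.continuousOn_bdVel hs
  init := Q.tendsto_bdPos hs
  blowup := Q.tendsto_bdVel hs

theorem eulerDens_of_ge {s t x : ℝ} (hs : s = 1 ∨ s = -1) (ht : t ∈ Ioo 0 D.T)
    (h : Q.bdPos s t ≤ s * x) : Q.eulerDens (t, x) = 0 := by
  have ht' := Ioo_subset_Ioc_self ht
  apply Q.eulerDens_of_edge
  rcases hs with rfl | rfl <;> rw [bdPos] at h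
  · rw [one_mul, one_mul, one_mul] at h
    exact Or.inr (Q.label_of_ge ht' h)
  · rw [neg_one_mul, neg_one_mul, neg_one_mul, neg_le_neg_iff] at h
    exact Or.inl (Q.label_of_le ht' h)

theorem hasDerivAt_eulerPot_vac {s t x : ℝ} (hs : s = 1 ∨ s = -1) (ht : t ∈ Ioo 0 D.T)
    (h : Q.bdPos s t < s * x) :
    HasDerivAt (fun τ => Q.eulerPot (τ, x)) (Q.eulerRate (t, x)) t := by
  have E := Q.edge hs
  have hss : ∀ y : ℝ, s * (s * y) = y := fun y => by rcases hs with rfl | rfl <;> ring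
  have hV := Q.eulerVel_of_ge hs ht h.le
  obtain ⟨hτ, hray⟩ := E.emit_spec (t := t) (x := s * x) ⟨ht, h.le⟩
  set γ := Q.bdPos s
  set w := Q.bdVel s
  obtain ⟨τ, hτe⟩ : ∃ τ, emit γ w (t, s * x) = τ := ⟨_, rfl⟩
  simp only [hτe] at hV hτ hray
  have hlt : τ < t := by
    rcases hτ.2.eq_or_lt with e | h'
    · rw [e] at hray
      simp only [rayPt, sub_self, mul_zero, add_zero] at hray
      exact absurd hray h.ne
    · exact h'
  have hc : HasDerivAt (fun σ => s * rayPt γ w τ σ) (Q.eulerVel (t, x)) t := by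
    rw [hV]
    refine HasDerivAt.const_mul s ?_
    exact ((((hasDerivAt_id t).sub_const τ).const_mul (w τ)).const_add (γ τ)).congr_deriv (mul_one _)
  refine hasDerivAt_of_curve ht Q.continuousOn_eulerVel
    (fun _ h x => Q.hasDerivAt_eulerPot h x) ?_ hc ?_
  · rw [hray, hss]
  have hval : ∀ σ ∈ Ioo τ D.T, Q.eulerPot (σ, s * rayPt γ w τ σ) =
      Q.eulerPot (τ, Q.flowMap τ (s * D.R)) - w τ ^ 2 / 2 * (σ - τ) := by
    intro σ hσ
    have hσ' : σ ∈ Ioo 0 D.T := ⟨hτ.1.trans hσ.1, hσ.2⟩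
    obtain ⟨hm, he⟩ := E.emit_eq hτ.1 hσ.1.le hσ.2
    have h1 := E.integral_vel hm
    rw [he] at h1
    have h2 := intervalIntegral.integral_eq_sub_of_hasDerivAt (a := γ σ) (b := rayPt γ w τ σ)
      (f := fun y => Q.eulerPot (σ, s * y)) (f' := fun y => -Q.eulerVel (σ, s * y) * s)
      (fun y _ => (Q.hasDerivAt_eulerPot hσ' (s * y)).comp y (by
        simpa using (hasDerivAt_id y).const_mul s))
      (Continuous.intervalIntegrable
        ((((Q.continuous_eulerVel_slice hσ').comp (by fun_prop : Continuous fun y => s * y)).neg).mul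
          continuous_const) _ _)
    have h3 : ∫ y in γ σ..rayPt γ w τ σ, -Q.eulerVel (σ, s * y) * s =
        -∫ y in γ σ..rayPt γ w τ σ, w (emit γ w (σ, y)) := by
      rw [← intervalIntegral.integral_neg]
      refine intervalIntegral.integral_congr fun y hy => ?_
      rw [uIcc_of_le hm.2] at hy
      rw [Q.eulerVel_of_ge hs hσ' (by rw [hss]; exact hy.1), hss, neg_mul, mul_comm _ s, hss]
    rw [h3, h1] at h2
    have h4 : s * γ σ = Q.flowMap σ (s * D.R) := hss _
    simp only [h4] at h2
    linarith
  have hd : HasDerivAt (fun σ => Q.eulerPot (τ, Q.flowMap τ (s * D.R)) - w τ ^ 2 / 2 * (σ - τ))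
      (-(w τ ^ 2 / 2)) t := by
    simpa using (((hasDerivAt_id t).sub_const τ).const_mul (w τ ^ 2 / 2)).const_sub
      (Q.eulerPot (τ, Q.flowMap τ (s * D.R)))
  refine (hd.congr_of_eventuallyEq ?_).congr_deriv ?_
  · filter_upwards [isOpen_Ioo.mem_nhds (⟨hlt, ht.2⟩ : t ∈ Ioo τ D.T)] with σ hσ using hval σ hσ
  · rw [eulerRate, Q.eulerDens_of_ge hs ht h.le, Real.zero_rpow D.θ_pos.ne', hV]
    rcases hs with rfl | rfl <;> ring

theorem hasDerivAt_eulerPot_time {t : ℝ} (ht : t ∈ Ioo 0 D.T) (x : ℝ) :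
    HasDerivAt (fun s => Q.eulerPot (s, x)) (Q.eulerRate (t, x)) t := by
  have ht' := Ioo_subset_Ioc_self ht
  rcases lt_or_ge (Q.flowMap t D.R) x with h | h2
  · refine Q.hasDerivAt_eulerPot_vac (Or.inl rfl) ht ?_
    rwa [bdPos, one_mul, one_mul, one_mul]
  rcases lt_or_ge x (Q.flowMap t (-D.R)) with h | h1
  · refine Q.hasDerivAt_eulerPot_vac (Or.inr rfl) ht ?_
    rwa [bdPos, neg_one_mul, neg_one_mul, neg_one_mul, neg_lt_neg_iff]
  have e := Q.flowMap_label ht' h1 h2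
  have hr := (Q.label_spec (x := x) ht').1
  obtain ⟨r, hre⟩ : ∃ r, Q.label (t, x) = r := ⟨_, rfl⟩
  rw [hre] at e hr
  subst e
  have hc := Q.hasDerivAt_flowMap_time_ext (t := t) (r := r) ⟨ht, hr⟩
  rw [← Q.eulerVel_flowMap ⟨ht, hr⟩] at hc
  refine hasDerivAt_of_curve ht Q.continuousOn_eulerVel
    (fun _ h x => Q.hasDerivAt_eulerPot h x) rfl hc ?_
  rcases mem_Ioo_or_edge hr with h | h | h
  · exact Q.hasDerivAt_eulerPot_path ⟨ht, h⟩
  · have := Q.hasDerivAt_eulerPot_edge (Or.inr rfl) ht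
    rwa [neg_one_mul, ← h] at this
  · have := Q.hasDerivAt_eulerPot_edge (Or.inl rfl) ht
    rwa [one_mul, ← h] at this

end FlowSeq

/-- The distribution of the labels. -/
noncomputable def Data.labelLaw (D : Data) : Measure ℝ :=
  (volume.restrict (Ioo (-D.R) D.R)).withDensity fun r => ENNReal.ofReal (D.dens r)

theorem ae_mem_labelLaw (D : Data) : ∀ᵐ r ∂D.labelLaw, r ∈ Ioo (-D.R) D.R :=
  (withDensity_absolutelyContinuous _ _).ae_le (ae_restrict_mem measurableSet_Ioo)

theorem aestronglyMeasurable_labelLaw {D : Data} {f : ℝ → ℝ} (hf : ContinuousOn f (Icc (-D.R) D.R)) :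
    AEStronglyMeasurable f D.labelLaw :=
  ((hf.mono Ioo_subset_Icc_self).aestronglyMeasurable measurableSet_Ioo).mono_ac
    (withDensity_absolutelyContinuous _ _)

namespace FlowSeq

variable {D : Data} (Q : FlowSeq D)

theorem clamp_mem (D : Data) (t : ℝ) : max 0 (min t D.T) ∈ Icc 0 D.T :=
  ⟨le_max_left _ _, max_le D.T_pos.le (min_le_right _ _)⟩

theorem clamp_eq {t : ℝ} (ht : t ∈ Icc 0 D.T) : max 0 (min t D.T) = t := by
  rw [min_eq_left ht.2, max_eq_right ht.1]

theorem aemeasurable_flowMap {t : ℝ} (ht : t ∈ Icc 0 D.T) : AEMeasurable (Q.flowMap t) D.labelLaw :=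
  (aestronglyMeasurable_labelLaw (Q.slice_continuousOn ht)).aemeasurable

theorem map_labelLaw {t : ℝ} (ht : t ∈ Ioo 0 D.T) : D.labelLaw.map (Q.flowMap t) =
    volume.withDensity fun x => ENNReal.ofReal (Q.eulerDens (t, x)) := by
  have ht' := Ioo_subset_Ioc_self ht
  refine map_withDensity_eq (π := fun r => Q.jac t r) (ρ := fun x => Q.eulerDens (t, x))
    (by linarith [D.R_pos]) (Q.slice_strictMonoOn ht')
    (Q.slice_continuousOn (Ioo_subset_Icc_self ht)) (fun r hr => Q.hasDerivAt_flowMap_label ⟨ht, hr⟩)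
    (fun r hr => Q.jac_pos ⟨ht, hr⟩) (fun r hr => Q.eulerDens_flowMap_mul ⟨ht, hr⟩) fun x hx => ?_
  apply Q.eulerDens_of_edge
  by_cases h : Q.flowMap t (-D.R) ≤ x
  · exact Or.inr (Q.label_of_ge ht' (not_le.1 fun h' => hx ⟨h, h'⟩).le)
  · exact Or.inl (Q.label_of_le ht' (not_le.1 h).le)

theorem integral_eulerDens_mul {t : ℝ} (ht : t ∈ Ioo 0 D.T) {f : ℝ → ℝ} (hf : Continuous f) :
    ∫ x, Q.eulerDens (t, x) * f x = ∫ r, f (Q.flowMap t r) ∂D.labelLaw := by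
  rw [← integral_map (Q.aemeasurable_flowMap (Ioo_subset_Icc_self ht)) hf.aestronglyMeasurable,
    Q.map_labelLaw ht, integral_withDensity_eq_integral_toReal_smul]
  · refine integral_congr_ae (Eventually.of_forall fun x => ?_)
    simp only [smul_eq_mul]
    rw [ENNReal.toReal_ofReal (Q.eulerDens_nonneg ht)]
  · exact (Q.continuousOn_eulerDens.comp_continuous (f := fun x : ℝ => (t, x)) (by fun_prop)
      fun _ => ⟨ht, mem_univ _⟩).measurable.ennreal_ofReal
  · exact Eventually.of_forall fun _ => ENNReal.ofReal_lt_top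

variable [IsProbabilityMeasure D.labelLaw]

/-- The distribution of the particles at time `t`. -/
noncomputable def law (t : ℝ) : ProbabilityMeasure ℝ :=
  ⟨D.labelLaw.map (Q.flowMap (max 0 (min t D.T))),
    Measure.isProbabilityMeasure_map (Q.aemeasurable_flowMap (clamp_mem D t))⟩

theorem law_eq {t : ℝ} (ht : t ∈ Icc 0 D.T) :
    (Q.law t : Measure ℝ) = D.labelLaw.map (Q.flowMap t) := by
  change D.labelLaw.map (Q.flowMap (max 0 (min t D.T))) = _
  rw [clamp_eq ht]

theorem continuous_law : Continuous Q.law := by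
  rw [ProbabilityMeasure.continuous_iff_forall_continuous_integral]
  intro f
  have e : ∀ t, ∫ x, f x ∂(Q.law t : Measure ℝ) =
      ∫ r, f (Q.flowMap (max 0 (min t D.T)) r) ∂D.labelLaw := fun t =>
    integral_map (Q.aemeasurable_flowMap (clamp_mem D t)) f.continuous.aestronglyMeasurable
  simp_rw [e]
  refine continuous_of_dominated (bound := fun _ => ‖f‖) (fun t => ?_)
    (fun t => Eventually.of_forall fun r => f.norm_coe_le_norm _) (integrable_const _) ?_
  · exact aestronglyMeasurable_labelLaw
      (f.continuous.comp_continuousOn (Q.slice_continuousOn (clamp_mem D t)))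
  · filter_upwards [ae_mem_labelLaw D] with r hr
    exact f.continuous.comp (Q.continuousOn_flowMap.comp_continuous
      (f := fun t : ℝ => (max 0 (min t D.T), r)) (by fun_prop)
      fun t => ⟨clamp_mem D t, Ioo_subset_Icc_self hr⟩)

theorem law_zero : (Q.law 0 : Measure ℝ) = Measure.dirac 0 := by
  rw [Q.law_eq ⟨le_rfl, D.T_pos.le⟩]
  have h : Q.flowMap 0 =ᵐ[D.labelLaw] fun _ => (0 : ℝ) := by
    filter_upwards [ae_mem_labelLaw D] with r hr
    have := Q.abs_flowMap_sub_le ⟨le_rfl, D.T_pos.le⟩ (Ioo_subset_Icc_self hr)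
    rw [Real.zero_rpow D.α_pos.ne'] at this
    simpa using this
  rw [Measure.map_congr h, Measure.map_const, measure_univ, one_smul]

theorem integral_transport {ψ : ℝ × ℝ → ℝ} (hψ : ContDiff ℝ 1 ψ) (hK : HasCompactSupport ψ)
    (hs : tsupport ψ ⊆ slab D.T) : ∫ t in Ioo 0 D.T, ∫ x,
      Q.eulerDens (t, x) * fderiv ℝ ψ (t, x) (1, Q.eulerVel (t, x)) = 0 := by
  have hD := hψ.continuous_fderiv one_ne_zero
  obtain ⟨k, hk⟩ : ∃ k : ℝ × ℝ → ℝ, ∀ z, k z =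
      fderiv ℝ ψ (z.1, Q.flowMap z.1 z.2) (1, Q.velExt z) := ⟨_, fun _ => rfl⟩
  have hX : ContinuousOn (fun z : ℝ × ℝ => (z.1, Q.flowMap z.1 z.2)) (strip D) :=
    continuousOn_fst.prodMk (Q.continuousOn_flowMap.mono (prod_mono Ioo_subset_Icc_self subset_rfl))
  have hkc : ContinuousOn k (strip D) :=
    ((hD.comp_continuousOn hX).clm_apply (continuousOn_const.prodMk Q.continuousOn_velExt)).congr
      fun z _ => hk z
  have e1 : ∀ t ∈ Ioo 0 D.T, (∫ x, Q.eulerDens (t, x) *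
      fderiv ℝ ψ (t, x) (1, Q.eulerVel (t, x))) = ∫ r, k (t, r) ∂D.labelLaw := fun t ht => by
    rw [Q.integral_eulerDens_mul ht (f := fun x => fderiv ℝ ψ (t, x) (1, Q.eulerVel (t, x)))
      ((hD.comp (by fun_prop : Continuous fun x : ℝ => (t, x))).clm_apply
        (continuous_const.prodMk (Q.continuous_eulerVel_slice ht)))]
    refine integral_congr_ae ?_
    filter_upwards [ae_mem_labelLaw D] with r hr
    rw [hk, Q.eulerVel_flowMap ⟨ht, Ioo_subset_Icc_self hr⟩]
  rw [setIntegral_congr_fun measurableSet_Ioo e1]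
  set K := Prod.fst '' tsupport ψ
  have hKc : IsCompact K := hK.isCompact.image continuous_fst
  have hKs : K ⊆ Ioo 0 D.T := by
    rintro _ ⟨z, hz, rfl⟩
    exact (hs hz).1
  have hk0 : ∀ t ∉ K, ∀ r, k (t, r) = 0 := fun t ht r => by
    rw [hk, fderiv_of_notMem_tsupport ℝ fun h => ht ⟨_, h, rfl⟩]
    simp
  obtain ⟨M, hM⟩ := (hKc.prod (isCompact_Icc (a := -D.R) (b := D.R))).exists_bound_of_continuousOn
    (hkc.mono (prod_mono hKs subset_rfl))
  have hb : ∀ t, ∀ r ∈ Icc (-D.R) D.R, ‖k (t, r)‖ ≤ max M 0 := fun t r hr => by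
    by_cases ht : t ∈ K
    · exact (hM (t, r) ⟨ht, hr⟩).trans (le_max_left _ _)
    · rw [hk0 t ht r, norm_zero]
      exact le_max_right _ _
  have hint : Integrable (Function.uncurry fun t r => k (t, r))
      ((volume.restrict (Ioo 0 D.T)).prod D.labelLaw) := by
    have e : (volume.restrict (Ioo 0 D.T)).prod D.labelLaw = (volume.prod (volume.withDensity
        fun r => ENNReal.ofReal (D.dens r))).restrict (Ioo 0 D.T ×ˢ Ioo (-D.R) D.R) := by
      rw [← Measure.prod_restrict, restrict_withDensity measurableSet_Ioo, Data.labelLaw]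
    refine Integrable.of_bound ?_ (max M 0) ?_
    · rw [e]
      exact (hkc.mono (prod_mono subset_rfl Ioo_subset_Icc_self)).aestronglyMeasurable
        (measurableSet_Ioo.prod measurableSet_Ioo)
    · rw [e]
      filter_upwards [ae_restrict_mem (measurableSet_Ioo.prod measurableSet_Ioo)] with z hz
        using hb z.1 z.2 (Ioo_subset_Icc_self hz.2)
  rw [integral_integral_swap hint]
  have e2 : ∀ᵐ r ∂D.labelLaw, ∫ t in Ioo 0 D.T, k (t, r) = (0 : ℝ) := by
    filter_upwards [ae_mem_labelLaw D] with r hr'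
    have hr := Ioo_subset_Icc_self hr'
    have hd : ∀ t ∈ Ioo 0 D.T, HasDerivAt (fun t => ψ (t, Q.flowMap t r)) (k (t, r)) t :=
      fun t ht => by
        rw [hk]
        exact ((hψ.differentiable one_ne_zero) _).hasFDerivAt.comp_hasDerivAt t
          ((hasDerivAt_id t).prodMk (Q.hasDerivAt_flowMap_time_ext ⟨ht, hr⟩))
    have hz : ∀ t₀ ∉ Ioo 0 D.T, Tendsto (fun t => ψ (t, Q.flowMap t r)) (𝓝 t₀) (𝓝 0) := by
      intro t₀ ht₀
      refine tendsto_const_nhds.congr' ?_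
      filter_upwards [hKc.isClosed.isOpen_compl.mem_nhds fun h => ht₀ (hKs h)] with t ht
      exact (image_eq_zero_of_notMem_tsupport fun h => ht ⟨_, h, rfl⟩).symm
    have hi : IntervalIntegrable (fun t => k (t, r)) volume 0 D.T := by
      rw [intervalIntegrable_iff_integrableOn_Ioo_of_le D.T_pos.le]
      refine Integrable.of_bound ?_ (max M 0) (Eventually.of_forall fun t => hb t r hr)
      exact (hkc.comp (f := fun t : ℝ => (t, r)) (by fun_prop)
        fun t ht => ⟨ht, hr⟩).aestronglyMeasurable measurableSet_Ioo
    have := intervalIntegral.integral_eq_sub_of_hasDerivAt_of_tendsto D.T_pos hd hi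
      ((hz 0 (by simp)).mono_left nhdsWithin_le_nhds)
      ((hz D.T (by simp)).mono_left nhdsWithin_le_nhds)
    rwa [intervalIntegral.integral_of_le D.T_pos.le, integral_Ioc_eq_integral_Ioo, sub_zero] at this
  rw [integral_congr_ae e2, integral_zero]

theorem isPlanningSolution {ρ : ℝ → ℝ}
    (hρ : D.labelLaw.map D.S = volume.withDensity fun x => ENNReal.ofReal (ρ x)) :
    IsPlanningSolution D.θ D.T ρ (fun t x => Q.eulerPot (t, x)) Q.law
      (fun t x => Q.eulerDens (t, x)) := by
  have hx := fun t (ht : t ∈ Ioo 0 D.T) x => (Q.hasDerivAt_eulerPot ht x).deriv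
  refine ⟨contDiffOn_of_partials Q.continuousOn_eulerVel Q.continuousOn_eulerRate
      (fun _ => Q.hasDerivAt_eulerPot) fun _ => Q.hasDerivAt_eulerPot_time,
    Q.continuous_law.continuousOn, Q.continuousOn_eulerDens, fun t ht x => Q.eulerDens_nonneg ht,
    fun t ht => ?_, fun t ht x => ?_, fun ψ hψ hK hs => ?_, Q.law_zero, ?_⟩
  · rw [Q.law_eq (Ioo_subset_Icc_self ht), Q.map_labelLaw ht]
  · rw [hx t ht, (Q.hasDerivAt_eulerPot_time ht x).deriv, eulerRate]
    ring
  · have hψ' : ContDiff ℝ 1 ψ := hψ.of_le (by norm_cast)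
    refine Eq.trans ?_ (Q.integral_transport hψ' hK hs)
    refine setIntegral_congr_fun measurableSet_Ioo fun t ht => ?_
    refine integral_congr_ae (Eventually.of_forall fun x => ?_)
    have hf := ((hψ'.differentiable one_ne_zero) (t, x)).hasFDerivAt
    have d1 : HasDerivAt (fun s => ψ (s, x)) (fderiv ℝ ψ (t, x) (1, 0)) t :=
      hf.comp_hasDerivAt t ((hasDerivAt_id t).prodMk (hasDerivAt_const t x))
    have d2 : HasDerivAt (fun y => ψ (t, y)) (fderiv ℝ ψ (t, x) (0, 1)) x :=
      hf.comp_hasDerivAt x ((hasDerivAt_const x t).prodMk (hasDerivAt_id x))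
    simp only
    rw [hx t ht, d1.deriv, d2.deriv, show ((1 : ℝ), Q.eulerVel (t, x)) =
      (1, 0) + Q.eulerVel (t, x) • ((0 : ℝ), (1 : ℝ)) by simp, map_add, map_smul, smul_eq_mul]
    ring
  · have : ∀ᵐ r ∂D.labelLaw, Q.flowMap D.T r = D.S r := by
      filter_upwards [ae_mem_labelLaw D] with r hr
      exact Q.flowMap_terminal (Ioo_subset_Icc_self hr)
    rw [Q.law_eq ⟨D.T_pos.le, le_rfl⟩, Measure.map_congr this, hρ]

end FlowSeq

namespace FlowSeq

variable {D : Data} (Q : FlowSeq D)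

theorem rpow_mul_abs_label_sub_le {t : ℝ} (ht : t ∈ Ioo 0 D.T) (x : ℝ) :
    t ^ D.α * |Q.label (t, t ^ D.α * x) - max (-D.R) (min x D.R)| ≤ 2 * D.C₀ * t := by
  have hp := Real.rpow_nonneg ht.1.le D.α
  obtain ⟨hr, e⟩ := Q.label_spec (x := t ^ D.α * x) (Ioo_subset_Ioc_self ht)
  have h1 := fun r hr => Q.abs_flowMap_sub_le (r := r) (Ioo_subset_Icc_self ht) hr
  have h2 : |Q.flowMap t (Q.label (t, t ^ D.α * x)) - t ^ D.α * max (-D.R) (min x D.R)| ≤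
      D.C₀ * t := by
    rw [e, clampPos, mul_max_of_nonneg _ _ hp, mul_min_of_nonneg _ _ hp]
    refine (abs_max_sub_max_le_max _ _ _ _).trans (max_le (h1 _ left_mem) ?_)
    refine (abs_min_sub_min_le_max _ _ _ _).trans (max_le ?_ (h1 _ right_mem))
    rw [sub_self, abs_zero]
    exact mul_nonneg D.C₀_nonneg ht.1.le
  have h3 := h1 _ hr
  rw [abs_le] at h2 h3
  rw [← abs_of_nonneg hp, ← abs_mul, abs_of_nonneg hp, mul_sub, abs_le]
  constructor <;> linarith [h2.1, h2.2, h3.1, h3.2]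

theorem tendsto_rpow_one_sub (D : Data) : Tendsto (fun t : ℝ => t ^ (1 - D.α)) (𝓝[>] 0) (𝓝 0) := by
  have h := sub_pos.2 D.α_lt_one
  have := (Real.continuousAt_rpow_const 0 (1 - D.α) (Or.inr h.le)).tendsto
  rw [Real.zero_rpow h.ne'] at this
  exact this.mono_left nhdsWithin_le_nhds

theorem rpow_mul_rpow_one_sub (D : Data) {t : ℝ} (ht : 0 < t) : t ^ D.α * t ^ (1 - D.α) = t := by
  rw [← Real.rpow_add ht, add_sub_cancel, Real.rpow_one]

theorem tendsto_label (x : ℝ) :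
    Tendsto (fun t => Q.label (t, t ^ D.α * x)) (𝓝[>] 0) (𝓝 (max (-D.R) (min x D.R))) := by
  have h0 : Tendsto (fun t : ℝ => 2 * D.C₀ * t ^ (1 - D.α)) (𝓝[>] 0) (𝓝 0) := by
    simpa using (tendsto_rpow_one_sub D).const_mul (2 * D.C₀)
  refine tendsto_iff_dist_tendsto_zero.2
    (squeeze_zero' (Eventually.of_forall fun _ => dist_nonneg) ?_ h0)
  filter_upwards [eventually_Ioo] with t ht
  have hp := Real.rpow_pos_of_pos ht.1 D.α
  rw [Real.dist_eq, ← mul_le_mul_iff_of_pos_left hp, mul_left_comm, rpow_mul_rpow_one_sub D ht.1]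
  exact Q.rpow_mul_abs_label_sub_le ht x

theorem tendsto_rpow_div (D : Data) {f : ℝ → ℝ} {c : ℝ} (hf : ∀ t, f t = t ^ D.α + c * t) :
    Tendsto (fun t => t ^ D.α / f t) (𝓝[>] 0) (𝓝 1) := by
  have h : Tendsto (fun t : ℝ => (1 + c * t ^ (1 - D.α))⁻¹) (𝓝[>] 0) (𝓝 1) := by
    simpa using (((tendsto_rpow_one_sub D).const_mul c).const_add 1).inv₀ (by simp)
  refine h.congr' ?_
  filter_upwards [self_mem_nhdsWithin] with t ht
  have hp := Real.rpow_pos_of_pos ht D.α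
  have e : f t = t ^ D.α * (1 + c * t ^ (1 - D.α)) := by
    rw [hf, mul_add, mul_one, mul_left_comm, rpow_mul_rpow_one_sub D ht]
  rw [e, div_mul_eq_div_div, div_self hp.ne', one_div]

theorem tendsto_rescaled_eulerDens (x : ℝ) :
    Tendsto (fun t => t ^ D.α * Q.eulerDens (t, t ^ D.α * x)) (𝓝[>] 0)
      (𝓝 (D.dens (max (-D.R) (min x D.R)))) := by
  have hd := ((continuous_dens (D := D)).tendsto _).comp (Q.tendsto_label x)
  have hu := (tendsto_rpow_div D (f := D.upper) (c := D.Ap) fun _ => rfl).mul hd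
  have hl := (tendsto_rpow_div D (f := D.lower) (c := -D.Am) fun t => by
    rw [Data.lower]; ring).mul hd
  rw [one_mul] at hu hl
  refine tendsto_of_tendsto_of_tendsto_of_le_of_le' hu hl ?_ ?_ <;>
    filter_upwards [eventually_Ioo] with t ht <;>
    rw [Function.comp_apply, div_mul_eq_mul_div, mul_div_assoc] <;>
    have hp := (Real.rpow_pos_of_pos ht.1 D.α).le
  · exact mul_le_mul_of_nonneg_left (Q.eulerDens_mem ht).1 hp
  · exact mul_le_mul_of_nonneg_left (Q.eulerDens_mem ht).2 hp

theorem tendsto_integral_rescaled {g : ℝ → ℝ} (hg : Integrable g) :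
    Tendsto (fun t => ∫ x, t ^ D.α * Q.eulerDens (t, t ^ D.α * x) * g x) (𝓝[>] 0)
      (𝓝 (∫ x, D.dens (max (-D.R) (min x D.R)) * g x)) := by
  obtain ⟨η, hη, hη'⟩ := D.mul_rpow_le_lower
  obtain ⟨M, hM⟩ := (isCompact_Icc (a := -D.R) (b := D.R)).exists_bound_of_continuousOn
    (continuous_dens (D := D)).continuousOn
  refine tendsto_integral_filter_of_dominated_convergence (fun x => M / η * ‖g x‖) ?_ ?_
    (hg.norm.const_mul _) (Eventually.of_forall fun x =>
      (Q.tendsto_rescaled_eulerDens x).mul_const _)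
  · filter_upwards [eventually_Ioo] with t ht
    exact (continuous_const.mul (Q.continuousOn_eulerDens.comp_continuous
      (f := fun x : ℝ => (t, t ^ D.α * x)) (by fun_prop)
      fun _ => ⟨ht, mem_univ _⟩)).aestronglyMeasurable.mul hg.aestronglyMeasurable
  · filter_upwards [eventually_Ioo] with t ht
    refine Eventually.of_forall fun x => ?_
    have hp := Real.rpow_pos_of_pos ht.1 D.α
    have hr := (Q.label_spec (x := t ^ D.α * x) (Ioo_subset_Ioc_self ht)).1
    rw [norm_mul, norm_mul, Real.norm_of_nonneg hp.le, Real.norm_of_nonneg (Q.eulerDens_nonneg ht)]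
    refine mul_le_mul_of_nonneg_right ?_ (norm_nonneg _)
    rw [le_div_iff₀ hη]
    have h1 := (Q.eulerDens_mem (x := t ^ D.α * x) ht).2
    rw [le_div_iff₀ (D.lower_pos ht.1 ht.2.le)] at h1
    have h2 := mul_le_mul_of_nonneg_left (hη' t ht.1.le ht.2.le)
      (Q.eulerDens_nonneg (x := t ^ D.α * x) ht)
    have h3 := (le_abs_self _).trans (hM _ hr)
    linarith

end FlowSeq

theorem Bump.of_integral_eq_one {γ c C c' C' p q : ℝ} {ψ : ℝ → ℝ} (hpq : p < q)
    (hψ : ContinuousOn ψ (Ioo p q)) (hs : ∀ x, x ∉ Icc p q → ψ x = 0) (hm : ∫ x, ψ x = 1)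
    (hlb : ∀ x ∈ Icc p q, c' * min (x - p) (q - x) ^ γ ≤ ψ x)
    (hub : ∀ x ∈ Icc p q, ψ x ≤ C' * min (x - p) (q - x) ^ γ) (hc : c ≤ c') (hC : C' ≤ C) :
    Bump γ c C p q ψ := by
  have hd : ∀ x ∈ Icc p q, 0 ≤ min (x - p) (q - x) ^ γ := fun x hx =>
    Real.rpow_nonneg (le_min (sub_nonneg.2 hx.1) (sub_nonneg.2 hx.2)) _
  refine ⟨hpq, ?_, hψ, fun x hx => (mul_le_mul_of_nonneg_right hc (hd x hx)).trans (hlb x hx),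
    fun x hx => (hub x hx).trans (mul_le_mul_of_nonneg_right hC (hd x hx)), ?_⟩
  · have : Integrable ψ := by
      by_contra h
      rw [integral_undef h] at hm
      exact zero_ne_one hm
    exact this.intervalIntegrable
  · rw [intervalIntegral.integral_of_le hpq.le, ← integral_Icc_eq_integral_Ioc,
      setIntegral_eq_integral_of_forall_compl_eq_zero hs, hm]

theorem profile_bounds {κ R γ x : ℝ} (hκ : 0 < κ) (hR : 0 < R) (hγ : 0 < γ)
    (hx : x ∈ Icc (-R) R) :
    (1 / 2 * κ * R) ^ γ * min (x - -R) (R - x) ^ γ ≤ (max (1 / 2 * κ * (R ^ 2 - x ^ 2)) 0) ^ γ ∧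
    (max (1 / 2 * κ * (R ^ 2 - x ^ 2)) 0) ^ γ ≤ (κ * R) ^ γ * min (x - -R) (R - x) ^ γ := by
  have hm : 0 ≤ min (x - -R) (R - x) := le_min (by linarith [hx.1]) (by linarith [hx.2])
  have e : R ^ 2 - x ^ 2 = min (x - -R) (R - x) * max (x - -R) (R - x) := by
    rw [min_mul_max]; ring
  have h1 : R ≤ max (x - -R) (R - x) := by
    rcases le_total 0 x with h | h
    · exact le_max_of_le_left (by linarith)
    · exact le_max_of_le_right (by linarith)
  have h2 : max (x - -R) (R - x) ≤ 2 * R := max_le (by linarith [hx.2]) (by linarith [hx.1])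
  have hk : 0 ≤ 1 / 2 * κ := by positivity
  rw [← Real.mul_rpow (by positivity) hm, ← Real.mul_rpow (by positivity) hm, e,
    max_eq_left (mul_nonneg hk (mul_nonneg hm (hR.le.trans h1)))]
  have k1 := mul_le_mul_of_nonneg_left (mul_le_mul_of_nonneg_left h1 hm) hk
  have k2 := mul_le_mul_of_nonneg_left (mul_le_mul_of_nonneg_left h2 hm) hk
  constructor
  · exact Real.rpow_le_rpow (by positivity) (by linarith) hγ.le
  · exact Real.rpow_le_rpow (mul_nonneg hk (mul_nonneg hm (hR.le.trans h1))) (by linarith) hγ.le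

theorem dens_clamp (D : Data) (x : ℝ) : D.dens (max (-D.R) (min x D.R)) =
    (max (1 / 2 * D.κ * (D.R ^ 2 - x ^ 2)) 0) ^ D.γ := by
  have hR := D.R_pos
  have hk := D.κ_pos
  by_cases hx : x ∈ Icc (-D.R) D.R
  · rw [min_eq_left hx.2, max_eq_right hx.1, Data.dens, Data.a₀, max_eq_left]
    · congr 1
      field_simp
    · exact mul_nonneg (by positivity) (by nlinarith [hx.1, hx.2])
  · have h2 : D.R ^ 2 ≤ x ^ 2 ∧ (max (-D.R) (min x D.R) = -D.R ∨ max (-D.R) (min x D.R) = D.R) := by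
      rcases not_and_or.1 hx with h | h <;> rw [not_le] at h
      · exact ⟨by nlinarith, Or.inl (max_eq_left ((min_le_left _ _).trans h.le))⟩
      · exact ⟨by nlinarith, Or.inr (by rw [min_eq_right h.le, max_eq_right (by linarith)])⟩
    rw [FlowSeq.dens_edge h2.2, max_eq_right (mul_nonpos_of_nonneg_of_nonpos (by positivity)
      (sub_nonpos.2 h2.1)), Real.zero_rpow D.γ_pos.ne']

theorem isProbabilityMeasure_labelLaw {D : Data} (h : ∫ x in -D.R..D.R, D.dens x = 1) :
    IsProbabilityMeasure D.labelLaw := by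
  rw [intervalIntegral.integral_of_le (by linarith [D.R_pos]), integral_Ioc_eq_integral_Ioo] at h
  refine ⟨?_⟩
  rw [Data.labelLaw, withDensity_apply _ MeasurableSet.univ, Measure.restrict_univ,
    ← ofReal_integral_eq_lintegral_ofReal, h, ENNReal.ofReal_one]
  · exact FlowSeq.continuous_dens.integrableOn_Icc.mono_set Ioo_subset_Icc_self
  · filter_upwards [ae_restrict_mem measurableSet_Ioo] with r hr
      using FlowSeq.dens_nonneg (Ioo_subset_Icc_self hr)

end MFPlanning

/-- for any θ > 0 and a terminal density m_T of bump type (compatibility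
condition with exponent 1/θ, with (m_T)^θ ∈ C^{1,σ}), there exists a solution of the
planning problem whose rescaled densities x ↦ t^α m(t,t^α x) converge to the
self-similar profile φ in the L^∞ weak-* sense as t → 0⁺. -/
theorem stmt_17 (θ : ℝ) (hθ : 0 < θ)
    (α : ℝ) (hα : α = 2 / (2 + θ))
    (R : ℝ) (hR : 0 < R)
    (φ : ℝ → ℝ)
    (hφ : ∀ r, φ r = (max ((1/2) * α * (1 - α) * (R^2 - r^2)) 0) ^ (1/θ))
    (hφint : (∫ r : ℝ, φ r) = 1)
    (T : ℝ) (hT : 0 < T)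
    (a b : ℝ) (hab : a < b)
    (mT : ℝ → ℝ) (hmT0 : ∀ x, 0 ≤ mT x)
    (hmTsupp : ∀ x, x ∉ Icc a b → mT x = 0)
    (hmTmass : (∫ x : ℝ, mT x) = 1)
    (σ : ℝ) (hσ : σ ∈ Ioc (0:ℝ) 1)
    (hmTC1σ : ∃ D : ℝ → ℝ,
      (∀ x ∈ Ioo a b, HasDerivAt (fun z => (mT z) ^ θ) (D x) x) ∧
      ∃ L, ∀ x ∈ Ioo a b, ∀ y ∈ Ioo a b, |D x - D y| ≤ L * |x - y| ^ σ)
    (C₀ : ℝ) (hC₀ : 1 < C₀)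
    (hmTlb : ∀ x ∈ Icc a b, C₀⁻¹ * (min (x - a) (b - x)) ^ (1/θ) ≤ mT x)
    (hmTub : ∀ x ∈ Icc a b, mT x ≤ C₀ * (min (x - a) (b - x)) ^ (1/θ)) :
    ∃ u : ℝ → ℝ → ℝ, ∃ m : ℝ → ProbabilityMeasure ℝ, ∃ md : ℝ → ℝ → ℝ,
      IsPlanningSolution θ T mT u m md ∧
      ∀ g : ℝ → ℝ, Integrable g →
        Tendsto (fun t : ℝ => ∫ x : ℝ, t ^ α * md t (t ^ α * x) * g x)
          (𝓝[>] (0:ℝ)) (𝓝 (∫ x : ℝ, φ x * g x)) := by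
  have hα0 : 0 < α := by rw [hα]; positivity
  have hα1 : α < 1 := by rw [hα, div_lt_one (by linarith)]; linarith
  have hκ : 0 < α * (1 - α) := mul_pos hα0 (sub_pos.2 hα1)
  have hγ : 0 < 1 / θ := by positivity
  have hφ' : ∀ r, φ r = (max (1 / 2 * (α * (1 - α)) * (R ^ 2 - r ^ 2)) 0) ^ (1 / θ) := fun r => by
    rw [hφ, mul_assoc (1 / 2) α]
  have hφc : Continuous φ := by
    rw [funext hφ']
    exact Continuous.rpow_const (by fun_prop) fun _ => Or.inr hγ.le
  have hφs : ∀ x, x ∉ Icc (-R) R → φ x = 0 := fun x hx => by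
    have : R ^ 2 ≤ x ^ 2 := by
      rcases not_and_or.1 hx with h | h <;> rw [not_le] at h <;> nlinarith
    rw [hφ', max_eq_right (mul_nonpos_of_nonneg_of_nonpos (by positivity) (sub_nonpos.2 this)),
      Real.zero_rpow hγ.ne']
  have hmc : ContinuousOn mT (Ioo a b) := by
    obtain ⟨D, hD, -⟩ := hmTC1σ
    have : ContinuousOn (fun x => (mT x ^ θ) ^ (1 / θ)) (Ioo a b) :=
      ContinuousOn.rpow_const (fun x hx => (hD x hx).continuousAt.continuousWithinAt)
        fun _ _ => Or.inr hγ.le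
    refine this.congr fun x _ => ?_
    change mT x = (mT x ^ θ) ^ (1 / θ)
    rw [← Real.rpow_mul (hmT0 x), mul_one_div_cancel hθ.ne', Real.rpow_one]
  set c := min ((1 / 2 * (α * (1 - α)) * R) ^ (1 / θ)) C₀⁻¹
  set C := max ((α * (1 - α) * R) ^ (1 / θ)) C₀
  have hc : 0 < c := lt_min (by positivity) (by positivity)
  have hC : 0 < C := lt_max_of_lt_right (by positivity)
  have b1 : MFPlanning.Bump (1 / θ) c C (-R) R φ :=
    .of_integral_eq_one (by linarith) hφc.continuousOn hφs hφint
      (fun x hx => hφ' x ▸ (MFPlanning.profile_bounds hκ hR hγ hx).1)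
      (fun x hx => hφ' x ▸ (MFPlanning.profile_bounds hκ hR hγ hx).2) (min_le_left _ _)
      (le_max_left _ _)
  have b2 : MFPlanning.Bump (1 / θ) c C a b mT :=
    .of_integral_eq_one hab hmc hmTsupp hmTmass hmTlb hmTub (min_le_right _ _) (le_max_right _ _)
  obtain ⟨Λ, hΛ, S, hS, hSp, hSq, hSc, hSd⟩ := b1.exists_transport b2 hγ hc hC
  let D : MFPlanning.Data := ⟨θ, α, R, T, Λ, S, hθ, hα, hR, hT, hΛ, hS⟩
  have hdens : ∀ x, D.dens (max (-R) (min x R)) = φ x := fun x =>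
    (MFPlanning.dens_clamp D x).trans (hφ' x).symm
  have hdens' : ∀ x ∈ Icc (-R) R, D.dens x = φ x := fun x hx => by
    rw [← hdens, min_eq_left hx.2, max_eq_right hx.1]
  have hprob : IsProbabilityMeasure D.labelLaw := by
    refine MFPlanning.isProbabilityMeasure_labelLaw (Eq.trans ?_ b1.mass)
    exact intervalIntegral.integral_congr fun x hx =>
      hdens' x (by rwa [uIcc_of_le (by linarith)] at hx)
  have hmap : D.labelLaw.map D.S = volume.withDensity fun x => ENNReal.ofReal (mT x) := by
    refine MFPlanning.map_withDensity_eq (p := -R) (q := R) (h := S) (φ := D.dens)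
      (π := fun r => φ r / mT (S r)) (by linarith) (fun r hr r' hr' h => ?_) hSc
      (fun r hr => (hSd r hr).1) (fun r hr => div_pos (hSd r hr).2.1 (hSd r hr).2.2)
      (fun r hr => ?_) fun x hx => hmTsupp x (by rwa [hSp, hSq] at hx)
    · have := (hS r r' hr.1 h.le hr'.2).1
      have := mul_pos (inv_pos.2 hΛ) (sub_pos.2 h)
      linarith
    · rw [hdens' r (Ioo_subset_Icc_self hr), mul_div_cancel₀ _ (hSd r hr).2.2.ne']
  obtain ⟨Q⟩ := D.exists_flowSeq
  refine ⟨_, _, _, Q.isPlanningSolution hmap, fun g hg => ?_⟩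
  have h := Q.tendsto_integral_rescaled hg
  rwa [integral_congr_ae (Eventually.of_forall fun x => congrArg (· * g x) (hdens x))] at h
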